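/- (Wu–Zhang) Let k be a field and let H be an affine noetherian Hopf algebra over k satisfying a polynomial identity. Then H is Auslander-Gorenstein and Cohen-Macaulay; that is: H has finite (and equal) left and right injective dimension; for every noetherian left or right H-module M, every i ≥ 0, and every submodule N of Ext^i_H(M,H), one has j(N) ≥ i, where j(N) := inf{ j : Ext^j_H(N,H) ≠ 0 }; and for every nonzero noetherian H-module M, j(M) + GKdim(M) = GKdim(H), where GKdim denotes Gelfand–Kirillov dimension. -/

import Mathlib

open CategoryTheory

universe w v u u' u2

/-!
STATEMENT 11 (Wu–Zhang):
An affine noetherian Hopf algebra over a field `k` satisfying a polynomial identity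
is Auslander-Gorenstein and Cohen-Macaulay:
* it has finite (and equal) left and right injective dimension;
* for every noetherian left or right `H`-module `M`, every `i ≥ 0` and every
  submodule `N` of `Ext^i_H (M, H)`, one has `j(N) ≥ i` (the Auslander condition);
* `j(M) + GKdim M = GKdim H` for every nonzero noetherian `H`-module `M`,
where `j(-)` denotes the grade and `GKdim` the Gelfand–Kirillov dimension.
-/

/-! ### Ext groups over an arbitrary ring -/

instance hasExtModuleCat (R : Type u) [Ring R] :
    HasExt.{max u (v + 1)} (ModuleCat.{v} R) :=
  letI := HasDerivedCategory.standard (ModuleCat.{v} R)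
  hasExt_of_hasDerivedCategory _

/-- The canonical map `(X ⟶ Y) → Ext X Y 0` is additive. -/
lemma Ext_mk₀_add {C : Type*} [Category C] [Abelian C] [HasExt.{w} C] {X Y : C}
    (f g : X ⟶ Y) :
    Abelian.Ext.mk₀ (f + g) = Abelian.Ext.mk₀ f + Abelian.Ext.mk₀ g := by
  letI := HasDerivedCategory.standard C
  ext
  rw [Abelian.Ext.add_hom, Abelian.Ext.mk₀_hom, Abelian.Ext.mk₀_hom, Abelian.Ext.mk₀_hom,
    Functor.map_add]
  dsimp [ShiftedHom.mk₀]
  rw [Preadditive.add_comp]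

/-- The Ext-group `Ext_A^i (M, N)` for two left `A`-modules `M` and `N`. -/
noncomputable abbrev ExtGroup (A : Type u) [Ring A]
    (M : Type v) [AddCommGroup M] [Module A M]
    (N : Type w) [AddCommGroup N] [Module A N] (i : ℕ) :=
  Abelian.Ext (C := ModuleCat.{max v w u} A)
    (ModuleCat.of A (ULift.{max w u} M)) (ModuleCat.of A (ULift.{max v u} N)) i

/-! ### The right `A`-module structure on `Ext_A^i (M, A)` -/

/-- Right multiplication by `a : A` on `A`, as an endomorphism of the left module `A`. -/
def rmulLinear (A : Type u) [Ring A] (a : A) :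
    ULift.{w} A →ₗ[A] ULift.{w} A where
  toFun x := ⟨x.down * a⟩
  map_add' x y := by ext; exact add_mul _ _ _
  map_smul' r x := by ext; exact mul_assoc r x.down a

/-- The right action of `A` on `Ext_A^i (M, A)` induced by right multiplication of `A`
on itself (which is an endomorphism of `A` as a left `A`-module). -/
noncomputable def extSmulOp (A : Type u) [Ring A]
    (M : Type v) [AddCommGroup M] [Module A M] (i : ℕ)
    (a : Aᵐᵒᵖ) (e : ExtGroup A M A i) : ExtGroup A M A i :=
  e.comp (Abelian.Ext.mk₀ (ModuleCat.ofHom (rmulLinear A a.unop))) (add_zero i)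

/-- `Ext_A^i (M, A)` is a right `A`-module, i.e. a module over `Aᵐᵒᵖ`, via the right
multiplication action of `A` on itself. -/
noncomputable instance extGroupModuleOp (A : Type u) [Ring A]
    (M : Type v) [AddCommGroup M] [Module A M] (i : ℕ) :
    Module Aᵐᵒᵖ (ExtGroup A M A i) where
  smul a e := extSmulOp A M i a e
  one_smul e := by
    show extSmulOp A M i 1 e = e
    unfold extSmulOp
    have h1 : ModuleCat.ofHom (rmulLinear A ((1 : Aᵐᵒᵖ).unop)) =
        𝟙 (ModuleCat.of A (ULift.{max v u} A)) := by
      ext x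
      exact mul_one x.down
    rw [h1, Abelian.Ext.comp_mk₀_id]
  mul_smul a b e := by
    show extSmulOp A M i (a * b) e = extSmulOp A M i a (extSmulOp A M i b e)
    unfold extSmulOp
    have h1 : ModuleCat.ofHom (rmulLinear A ((a * b).unop)) =
        ModuleCat.ofHom (rmulLinear A b.unop) ≫ ModuleCat.ofHom (rmulLinear A a.unop) := by
      ext x
      exact (mul_assoc x.down b.unop a.unop).symm
    rw [h1, ← Abelian.Ext.mk₀_comp_mk₀,
      ← Abelian.Ext.comp_assoc_of_second_deg_zero]
  smul_zero a := by
    show extSmulOp A M i a 0 = 0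
    unfold extSmulOp
    exact Abelian.Ext.zero_comp _ i
      (Abelian.Ext.mk₀ (ModuleCat.ofHom (rmulLinear A a.unop))) i (add_zero i)
  smul_add a e f := by
    show extSmulOp A M i a (e + f) = extSmulOp A M i a e + extSmulOp A M i a f
    unfold extSmulOp
    exact Abelian.Ext.add_comp _ _ _ _
  add_smul a b e := by
    show extSmulOp A M i (a + b) e = extSmulOp A M i a e + extSmulOp A M i b e
    unfold extSmulOp
    have h1 : ModuleCat.ofHom (rmulLinear A ((a + b).unop)) =
        ModuleCat.ofHom (rmulLinear A a.unop) + ModuleCat.ofHom (rmulLinear A b.unop) := by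
      ext x
      exact mul_add x.down a.unop b.unop
    rw [h1, Ext_mk₀_add, Abelian.Ext.comp_add]
  zero_smul e := by
    show extSmulOp A M i 0 e = 0
    unfold extSmulOp
    have h1 : ModuleCat.ofHom (rmulLinear A ((0 : Aᵐᵒᵖ).unop)) =
        (0 : ModuleCat.of A (ULift.{max v u} A) ⟶ ModuleCat.of A (ULift.{max v u} A)) := by
      ext x
      exact mul_zero x.down
    rw [h1, Abelian.Ext.mk₀_zero, Abelian.Ext.comp_zero]

/-! ### Grade and injective dimension -/

/-- The grade `j(M) = inf { j | Ext_A^j (M, A) ≠ 0 }` of an `A`-module `M`,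
an element of `ℕ∞` (with `inf ∅ = ∞`). -/
noncomputable def moduleGrade (A : Type u) [Ring A]
    (M : Type v) [AddCommGroup M] [Module A M] : ℕ∞ :=
  sInf {j : ℕ∞ | ∃ i : ℕ, j = (i : ℕ∞) ∧ Nontrivial (ExtGroup A M A i)}

/-- The injective dimension of `A` as a left module over itself, an element of `ℕ∞`:
the least `n` such that `Ext_A^i (M, A) = 0` for all modules `M` and all `i > n`. -/
noncomputable def selfInjectiveDimension (A : Type u) [Ring A] : ℕ∞ :=
  sInf {d : ℕ∞ | ∃ n : ℕ, d = (n : ℕ∞) ∧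
    ∀ (M : Type u) [AddCommGroup M] [Module A M],
      ∀ i : ℕ, n < i → Subsingleton (ExtGroup A M A i)}

/-- A ring has finite global dimension if there is a uniform bound above which all
Ext-groups vanish. -/
def HasFiniteGlobalDimension (A : Type u) [Ring A] : Prop :=
  ∃ n : ℕ, ∀ (M N : Type u) [AddCommGroup M] [Module A M] [AddCommGroup N] [Module A N],
    ∀ i : ℕ, n < i → Subsingleton (ExtGroup A M N i)

/-- The Auslander condition: for every noetherian left `A`-module `M`, every `i ≥ 0` and
every (right-) submodule `N` of `Ext_A^i (M, A)`, one has `j(N) ≥ i`. -/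
def AuslanderCondition (A : Type u) [Ring A] : Prop :=
  ∀ (M : Type u) [AddCommGroup M] [Module A M], IsNoetherian A M →
    ∀ (i : ℕ) (N : Submodule Aᵐᵒᵖ (ExtGroup A M A i)), (i : ℕ∞) ≤ moduleGrade Aᵐᵒᵖ ↥N

/-! ### Gelfand–Kirillov dimension -/

open ENNReal in
/-- The Gelfand–Kirillov dimension of a `k`-algebra `A`:
`GKdim A = sup_V limsup_n log_n dim_k ((k + V)^n)`, the supremum being taken over all
finite-dimensional subspaces `V` of `A`. -/
noncomputable def gkDim (k : Type u') (A : Type u) [Field k] [Ring A] [Algebra k A] : ℝ≥0∞ :=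
  ⨆ (V : Submodule k A) (_ : FiniteDimensional k V),
    Filter.limsup (fun n : ℕ =>
      ENNReal.ofReal (Real.logb n (Module.finrank k (((1 ⊔ V) ^ n : Submodule k A)))))
      Filter.atTop

/-- The product `W • F` of a subspace `W` of an algebra `A` and a subspace `F` of an
`A`-module `M`. -/
def subspaceSMul (k : Type u') {A : Type u} {M : Type v} [Field k] [Ring A] [Algebra k A]
    [AddCommGroup M] [Module k M] [Module A M] [IsScalarTower k A M]
    (W : Submodule k A) (F : Submodule k M) : Submodule k M :=
  Submodule.span k {z : M | ∃ a ∈ W, ∃ m ∈ F, z = a • m}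

open ENNReal in
/-- The Gelfand–Kirillov dimension of a module `M` over a `k`-algebra `A`:
`GKdim M = sup_{V, F} limsup_n log_n dim_k ((k + V)^n • F)`, the supremum being taken
over all finite-dimensional subspaces `V` of `A` and `F` of `M`. -/
noncomputable def gkDimModule (k : Type u') (A : Type u) (M : Type v) [Field k] [Ring A]
    [Algebra k A] [AddCommGroup M] [Module k M] [Module A M] [IsScalarTower k A M] : ℝ≥0∞ :=
  ⨆ (V : Submodule k A) (_ : FiniteDimensional k V)
    (F : Submodule k M) (_ : FiniteDimensional k F),
    Filter.limsup (fun n : ℕ =>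
      ENNReal.ofReal (Real.logb n
        (Module.finrank k (subspaceSMul k ((1 ⊔ V) ^ n : Submodule k A) F))))
      Filter.atTop


/-- An algebra `A` over `k` satisfies a polynomial identity if there is a nonzero
polynomial `f` in finitely many noncommuting variables, with coefficients in `k`,
which vanishes identically on `A`. -/
def SatisfiesPolynomialIdentity (k : Type u') (A : Type u) [CommSemiring k] [Ring A]
    [Algebra k A] : Prop :=
  ∃ (n : ℕ) (f : FreeAlgebra k (Fin n)), f ≠ 0 ∧
    ∀ v : Fin n → A, FreeAlgebra.lift k v f = 0

/-- `A` satisfies a multilinear identity of degree `D` whose coefficient at the identity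
permutation does not vanish. -/
def MultilinearPI (k : Type*) (A : Type*) [CommRing k] [Ring A] [Algebra k A] (D : ℕ) : Prop :=
  ∃ a : Equiv.Perm (Fin D) → k, a 1 ≠ 0 ∧
    ∀ h : Fin D → A, ∑ σ, a σ • (List.ofFn fun i => h (σ i)).prod = 0

lemma freeAlgebra_lift_eq_sum {k A : Type*} [CommRing k] [Ring A] [Algebra k A] {n : ℕ}
    (f : FreeAlgebra k (Fin n)) (v : Fin n → A) :
    FreeAlgebra.lift k v f = (FreeAlgebra.equivMonoidAlgebraFreeMonoid f).coeff.sum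
      fun w c => c • (List.ofFn fun p => v (w.toList.get p)).prod := by
  have h1 : FreeAlgebra.lift k v = (MonoidAlgebra.lift k A (FreeMonoid (Fin n))
      (FreeMonoid.lift v)).comp FreeAlgebra.equivMonoidAlgebraFreeMonoid.toAlgHom := by
    ext i
    simp [FreeAlgebra.equivMonoidAlgebraFreeMonoid]
  rw [h1]
  change MonoidAlgebra.lift k A (FreeMonoid (Fin n)) (FreeMonoid.lift v)
    (FreeAlgebra.equivMonoidAlgebraFreeMonoid f) = _
  rw [MonoidAlgebra.lift_apply]
  congr 1
  ext w c
  rw [FreeMonoid.lift_apply]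
  congr 2
  conv_lhs => rw [← List.ofFn_get w.toList]
  rw [List.map_ofFn]
  rfl

open Finset in
lemma sum_sign_prod_restrict {A : Type*} [Ring A] {D n : ℕ} (w : Fin D → Fin n) (h : Fin D → A)
    {l : ℕ} (u : Fin l → Fin n) :
    ∑ C : Finset (Fin D), (-1 : ℤ) ^ (#C) • (List.ofFn fun p =>
        ∑ j, if j ∉ C ∧ w j = u p then h j else 0).prod =
      ∑ φ : Fin l → Fin D, if Function.Surjective φ ∧ (∀ p, w (φ p) = u p) then
        (List.ofFn fun p => h (φ p)).prod else 0 := by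
  classical
  have h1 : ∀ C : Finset (Fin D), (List.ofFn fun p =>
        ∑ j, if j ∉ C ∧ w j = u p then h j else 0).prod =
        ∑ φ : Fin l → Fin D, if (C ⊆ (univ.image φ)ᶜ) ∧ (∀ p, w (φ p) = u p) then
          (List.ofFn fun p => h (φ p)).prod else 0 := by
    intro C
    have := (MultilinearMap.mkPiAlgebraFin ℤ l A).map_sum
      (fun p (j : Fin D) => if j ∉ C ∧ w j = u p then h j else 0)
    simp only [MultilinearMap.mkPiAlgebraFin_apply] at this
    rw [this]
    refine sum_congr rfl fun φ _ => ?_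
    have hC : C ⊆ (univ.image φ)ᶜ ↔ ∀ p, φ p ∉ C := by
      rw [subset_compl_comm]
      constructor
      · intro h p
        have := h (mem_image_of_mem φ (mem_univ p))
        simpa using this
      · intro h x hx
        obtain ⟨p, -, rfl⟩ := mem_image.1 hx
        simpa using h p
    simp only [hC]
    split_ifs with hh
    · congr 2
      ext p
      rw [if_pos ⟨hh.1 p, hh.2 p⟩]
    · have : ∃ p, ¬ (φ p ∉ C ∧ w (φ p) = u p) := by
        by_contra hcon
        push Not at hcon
        exact hh ⟨fun p => (hcon p).1, fun p => (hcon p).2⟩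
      obtain ⟨p, hp⟩ := this
      refine List.prod_eq_zero ?_
      rw [List.mem_ofFn]
      exact ⟨p, by rw [if_neg hp]⟩
  simp_rw [h1, smul_sum]
  rw [sum_comm]
  refine sum_congr rfl fun φ _ => ?_
  by_cases hw : ∀ p, w (φ p) = u p
  · simp only [hw, implies_true, and_true, smul_ite, smul_zero]
    rw [← sum_filter]
    have : (univ.filter fun C : Finset (Fin D) => C ⊆ (univ.image φ)ᶜ) =
      ((univ.image φ)ᶜ).powerset := by ext; simp
    rw [this, ← sum_smul, sum_powerset_neg_one_pow_card]
    have : (univ.image φ)ᶜ = ∅ ↔ Function.Surjective φ := by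
      rw [compl_eq_empty_iff, eq_univ_iff_forall]
      simp [Function.Surjective]
    simp only [this]
    split_ifs <;> simp
  · simp [hw]

open Finset in
theorem SatisfiesPolynomialIdentity.multilinear {k A : Type*} [Field k] [Ring A] [Algebra k A]
    (h : SatisfiesPolynomialIdentity k A) : ∃ D, MultilinearPI k A D := by
  classical
  obtain ⟨n, f, hf, hv⟩ := h
  set F := (FreeAlgebra.equivMonoidAlgebraFreeMonoid f).coeff with hF
  have hF0 : F.support.Nonempty := by
    rw [Finsupp.support_nonempty_iff]
    intro h0
    apply hf
    apply FreeAlgebra.equivMonoidAlgebraFreeMonoid.injective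
    rw [map_zero]
    ext x
    rw [← hF, h0]; simp
  obtain ⟨w, hw, hmax⟩ := exists_max_image F.support (fun w => w.toList.length) hF0
  refine ⟨w.toList.length, fun σ => F (FreeMonoid.ofList (List.ofFn fun i => w.toList.get (σ i))),
    ?_, fun h => ?_⟩
  · simpa using hw
  have key : ∑ C : Finset (Fin w.toList.length), (-1 : ℤ) ^ (#C) •
      FreeAlgebra.lift k (fun i : Fin n => ∑ j, if j ∉ C ∧ w.toList.get j = i then h j else 0) f
      = 0 := by simp [hv]
  simp_rw [freeAlgebra_lift_eq_sum, ← hF, Finsupp.sum, smul_sum] at key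
  rw [sum_comm] at key
  have h2 : ∀ u ∈ F.support, ∑ C : Finset (Fin w.toList.length), (-1 : ℤ) ^ (#C) •
      F u • (List.ofFn fun p => ∑ j, if j ∉ C ∧ w.toList.get j = u.toList.get p
        then h j else 0).prod = ∑ σ : Equiv.Perm (Fin w.toList.length),
        if u = (FreeMonoid.ofList (List.ofFn fun i => w.toList.get (σ i))) then
          F u • (List.ofFn fun i => h (σ i)).prod else 0 := by
    intro u hu
    simp_rw [smul_comm _ (F u)]
    rw [← smul_sum, sum_sign_prod_restrict]
    by_cases hl : u.toList.length = w.toList.length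
    · have hu' : ∃ u' : Fin w.toList.length → Fin n, u = FreeMonoid.ofList (List.ofFn u') := by
        refine ⟨fun i => u.toList.get (Fin.cast hl.symm i), ?_⟩
        apply FreeMonoid.toList.injective
        apply List.ext_get <;> simp [hl]
      obtain ⟨u', rfl⟩ := hu'
      have h3 : ∑ φ : Fin w.toList.length → Fin w.toList.length,
          (if Function.Surjective φ ∧ (∀ p, w.toList.get (φ p) = u' p) then
            (List.ofFn fun p => h (φ p)).prod else 0) = ∑ σ : Equiv.Perm (Fin w.toList.length),
          if u' = (fun i => w.toList.get (σ i)) then (List.ofFn fun i => h (σ i)).prod else 0 := by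
        symm
        refine sum_of_injOn (fun σ i => σ i) ?_ ?_ ?_ ?_
        · intro σ _ τ _ hst
          exact Equiv.ext fun i => congrFun hst i
        · simp
        · intro φ _ hφ
          rw [if_neg]
          rintro ⟨hs, -⟩
          apply hφ
          refine ⟨Equiv.ofBijective φ (Finite.injective_iff_bijective.1
            (Finite.injective_iff_surjective.2 hs)), by simp, rfl⟩
        · intro σ _
          have e1 : Function.Surjective (fun i => σ i) := σ.surjective
          congr 1
          simp only [e1, true_and, eq_iff_iff]
          constructor
          · rintro rfl p; rfl
          · intro hh; exact funext fun p => (hh p).symm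
      have h4 : ∀ (L : List (Fin n)) (hL : L = List.ofFn u'),
          (∑ φ : Fin L.length → Fin w.toList.length,
          (if Function.Surjective φ ∧ (∀ p, w.toList.get (φ p) = L.get p) then
            (List.ofFn fun p => h (φ p)).prod else 0)) =
          ∑ φ : Fin w.toList.length → Fin w.toList.length,
          (if Function.Surjective φ ∧ (∀ p, w.toList.get (φ p) = u' p) then
            (List.ofFn fun p => h (φ p)).prod else 0) := by
        intro L hL
        have hlen : L.length = w.toList.length := by rw [hL]; simp
        have h5 : ∀ p : Fin L.length, L.get p = u' (Fin.cast hlen p) := by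
          subst hL; intro p; simp; rfl
        simp_rw [h5]
        have h6 : ∀ (l : ℕ) (hl : l = w.toList.length), (∑ φ : Fin l → Fin w.toList.length,
          (if Function.Surjective φ ∧ (∀ p, w.toList.get (φ p) = u' (Fin.cast hl p)) then
            (List.ofFn fun p => h (φ p)).prod else 0)) =
          ∑ φ : Fin w.toList.length → Fin w.toList.length,
          (if Function.Surjective φ ∧ (∀ p, w.toList.get (φ p) = u' p) then
            (List.ofFn fun p => h (φ p)).prod else 0) := by
          intro l hl
          subst hl
          rfl
        exact h6 _ hlen
      rw [h4 (FreeMonoid.toList (FreeMonoid.ofList (List.ofFn u'))) rfl, h3, smul_sum]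
      refine sum_congr rfl fun σ _ => ?_
      have : (FreeMonoid.ofList (List.ofFn u') = FreeMonoid.ofList
          (List.ofFn fun i => w.toList.get (σ i))) ↔ u' = fun i => w.toList.get (σ i) := by
        rw [FreeMonoid.ofList.injective.eq_iff, List.ofFn_injective.eq_iff]
      rw [smul_ite, smul_zero]
      simp only [this]
    · rw [sum_eq_zero, smul_zero, sum_eq_zero]
      · intro σ _
        rw [if_neg]
        rintro rfl
        simp at hl
      · intro φ _
        rw [if_neg]
        rintro ⟨hs, -⟩
        have := Fintype.card_le_of_surjective φ hs
        simp only [Fintype.card_fin] at this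
        exact hl (le_antisymm (hmax u hu) this)
  rw [sum_congr rfl h2, sum_comm] at key
  rw [← key]
  refine sum_congr rfl fun σ _ => ?_
  rw [sum_ite_eq']
  split_ifs with hh
  · rfl
  · beta_reduce
    rw [Finsupp.notMem_support_iff.1 hh, zero_smul]

lemma prod_ofFn_smul_path {E V : Type*} [Ring E] [AddCommGroup V] [Module E V] {m : ℕ}
    (U : Fin m → E) (good : Fin m → Prop) (v : Fin (m + 1) → V) [DecidablePred good]
    (h : ∀ j, U j • v j.succ = if good j then v j.castSucc else 0) :
    (List.ofFn U).prod • v (Fin.last m) = if ∀ j, good j then v 0 else 0 := by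
  induction m with
  | zero => simp
  | succ m ih =>
    rw [List.ofFn_succ, List.prod_cons, mul_smul]
    have := ih (fun j => U j.succ) (fun j => good j.succ) (fun j => v j.succ)
      (fun j => by rw [h j.succ]; rfl)
    rw [← Fin.succ_last, this]
    simp only [Fin.forall_fin_succ (P := good)]
    by_cases h1 : ∀ j : Fin m, good j.succ
    · simpa [h1] using h 0
    · simp [h1]

/-- Every simple module is a vector space over a self-centralizing field of operators commuting
with the ring. -/
theorem exists_field_of_isSimpleModule {B S : Type u} [Ring B] [AddCommGroup S] [Module B S]
    [IsSimpleModule B S] :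
    ∃ (L : Type u) (_ : Field L) (_ : Module L S), (∀ (b : B) (l : L) (x : S), b • l • x = l • b • x) ∧
      ∀ f : S →+ S, (∀ (b : B) x, f (b • x) = b • f x) → (∀ (l : L) x, f (l • x) = l • f x) →
        ∃ l : L, ∀ x, f x = l • x := by
  classical
  let D := Module.End B S
  obtain ⟨T, -, hT⟩ := zorn_subset_nonempty {T : Set D | ∀ a ∈ T, ∀ b ∈ T, a * b = b * a}
    (by
      intro c hc hchain _
      refine ⟨⋃₀ c, ?_, fun s hs => Set.subset_sUnion_of_mem hs⟩
      rintro a ⟨s, hs, has⟩ b ⟨t, ht, hbt⟩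
      rcases hchain.total hs ht with h | h
      · exact hc ht a (h has) b hbt
      · exact hc hs a has b (h hbt)) ∅ (by simp)
  have hcomm : ∀ a ∈ T, ∀ b ∈ T, a * b = b * a := hT.prop
  have hmem : ∀ a : D, (∀ b ∈ T, a * b = b * a) → a ∈ T := by
    intro a ha
    have h1 : T ⊆ insert a T := Set.subset_insert a T
    have h2 := hT.le_of_ge (y := insert a T) (by
      rintro x (rfl | hx) y (rfl | hy)
      · rfl
      · exact ha y hy
      · exact (ha x hx).symm
      · exact hcomm x hx y hy) h1
    exact h2 (Set.mem_insert a T)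
  let L : Subring D :=
    { carrier := T
      mul_mem' := fun {a b} ha hb => hmem _ fun c hc => by
        rw [mul_assoc, hcomm b hb c hc, ← mul_assoc, hcomm a ha c hc, mul_assoc]
      one_mem' := hmem _ fun c _ => by simp
      add_mem' := fun {a b} ha hb => hmem _ fun c hc => by
        rw [add_mul, mul_add, hcomm a ha c hc, hcomm b hb c hc]
      zero_mem' := hmem _ fun c _ => by simp
      neg_mem' := fun {a} ha => hmem _ fun c hc => by
        rw [neg_mul, mul_neg, hcomm a ha c hc] }
  let _ : DivisionRing D := Module.End.instDivisionRing
  have hfield : IsField L :=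
    { exists_pair_ne := ⟨0, 1, fun h => zero_ne_one (α := D) (congrArg Subtype.val h)⟩
      mul_comm := fun a b => Subtype.ext (hcomm a a.2 b b.2)
      mul_inv_cancel := fun {a} ha => by
        have ha' : (a : D) ≠ 0 := fun h => ha (Subtype.ext h)
        refine ⟨⟨(a : D)⁻¹, hmem _ fun c hc => ?_⟩, Subtype.ext (mul_inv_cancel₀ ha')⟩
        have := hcomm a a.2 c hc
        calc (a : D)⁻¹ * c = (a : D)⁻¹ * (c * a) * (a : D)⁻¹ := by
              rw [mul_assoc, mul_assoc, mul_inv_cancel₀ ha', mul_one]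
          _ = c * (a : D)⁻¹ := by
              rw [← this, ← mul_assoc (a : D)⁻¹, inv_mul_cancel₀ ha', one_mul] }
  refine ⟨L, hfield.toField, inferInstanceAs (Module L S), ?_, ?_⟩
  · intro b l x
    exact (l.1.map_smul b x).symm
  · intro f hf hl
    let f' : D := { f with map_smul' := hf }
    exact ⟨⟨f', hmem f' fun b hb => LinearMap.ext fun x => hl ⟨b, hb⟩ x⟩, fun x => rfl⟩

lemma MultilinearMap.eq_zero_of_mem_span {ι L V W : Type*} [Fintype ι] [CommRing L]
    [AddCommGroup V] [Module L V] [AddCommGroup W] [Module L W]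
    (μ : MultilinearMap L (fun _ : ι => V) W) (T : Set V) (h0 : ∀ h : ι → V, (∀ i, h i ∈ T) → μ h = 0)
    (h : ι → V) (hh : ∀ i, h i ∈ Submodule.span L T) : μ h = 0 := by
  classical
  have key : ∀ s : Finset ι, ∀ h : ι → V, (∀ i ∈ s, h i ∈ Submodule.span L T) →
      (∀ i ∉ s, h i ∈ T) → μ h = 0 := by
    intro s
    induction s using Finset.induction_on with
    | empty => intro h _ h2; exact h0 h fun i => h2 i (by simp)
    | insert i s his ih =>
      intro h h1 h2
      have hle : Submodule.span L T ≤ LinearMap.ker (μ.toLinearMap h i) := by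
        rw [Submodule.span_le]
        intro q hq
        refine ih _ (fun j hj => ?_) (fun j hj => ?_)
        · have : j ≠ i := by rintro rfl; exact his hj
          rw [Function.update_of_ne this]
          exact h1 j (Finset.mem_insert_of_mem hj)
        · by_cases hji : j = i
          · subst hji; simpa using hq
          · rw [Function.update_of_ne hji]
            exact h2 j (by simp [hji, hj])
      have := hle (h1 i (Finset.mem_insert_self i s))
      simpa using this
  exact key Finset.univ h (fun i _ => hh i) (by simp)

/-- Operators in a dense subspace satisfying a multilinear identity live on a space of dimension
at most the degree. -/
lemma finrank_le_of_dense_of_multilinear {L S : Type*} [Field L] [AddCommGroup S] [Module L S]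
    {D : ℕ} (W : Set (Module.End L S))
    (hW : ∀ (f : Module.End L S) (s : Finset S), ∃ w ∈ W, ∀ m ∈ s, f m = w m)
    (a : Equiv.Perm (Fin D) → L) (ha : a 1 ≠ 0)
    (hPI : ∀ h : Fin D → Module.End L S, (∀ i, h i ∈ W) →
      ∑ σ, a σ • (List.ofFn fun i => h (σ i)).prod = 0) :
    ∀ v : Fin (D + 1) → S, ¬ LinearIndependent L v := by
  classical
  intro v hv
  have h1 : ∀ p : Fin D, ∃ w ∈ W, ∀ j, w (v j) = if j = p.succ then v p.castSucc else 0 := by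
    intro p
    obtain ⟨f, hf⟩ := LinearMap.exists_extend ((Module.Basis.span hv).constr L
      fun j => if j = p.succ then v p.castSucc else 0)
    obtain ⟨w, hw, hfw⟩ := hW f (Finset.univ.image v)
    refine ⟨w, hw, fun j => ?_⟩
    rw [← hfw _ (Finset.mem_image_of_mem v (Finset.mem_univ j))]
    have h3 := congrArg (fun g => g (Module.Basis.span hv j)) hf
    rw [LinearMap.comp_apply, Module.Basis.constr_basis, Submodule.subtype_apply,
      Module.Basis.span_apply] at h3
    exact h3
  choose b hb hbv using h1
  have h2 := congrArg (fun f : Module.End L S => f (v (Fin.last D))) (hPI b hb)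
  simp only [LinearMap.sum_apply, LinearMap.smul_apply, LinearMap.zero_apply] at h2
  rw [Finset.sum_eq_single 1] at h2
  · have := prod_ofFn_smul_path (fun i => b i) (fun _ => True) v
      (fun j => by simp [hbv])
    simp only [Equiv.Perm.coe_one, id, Module.End.smul_def] at this h2
    rw [this] at h2
    simp only [implies_true, if_true, smul_eq_zero, ha, false_or] at h2
    exact hv.ne_zero 0 h2
  · intro σ _ hσ
    have := prod_ofFn_smul_path (fun i => b (σ i)) (fun i => σ i = i) v
      (fun j => by
        by_cases hj : σ j = j
        · simp [hbv, hj]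
        · simp [hbv, hj, Ne.symm hj])
    rw [Module.End.smul_def] at this
    rw [this, if_neg, smul_zero]
    intro h; exact hσ (Equiv.ext h)
  · simp

open Polynomial in
/-- A simple module over `R[X]`, with `R` satisfying a multilinear identity, gives a
representation of `R` by matrices over a field which spans the full matrix ring. -/
theorem exists_matrix_rep_of_isSimpleModule {k : Type*} {R S : Type u} [Field k] [Ring R]
    [Algebra k R] {D : ℕ} (hR : MultilinearPI k R D) [AddCommGroup S] [Module R[X] S]
    [IsSimpleModule R[X] S] :
    ∃ (n : ℕ) (L : Type u) (_ : Field L) (φ : R →+* Matrix (Fin n) (Fin n) L), n ≤ D ∧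
      Submodule.span L (Set.range φ) = ⊤ ∧ ∀ r : R, (∃ x : S, (C r : R[X]) • x ≠ 0) → φ r ≠ 0 := by
  classical
  obtain ⟨L, _, _, hcomm, hL⟩ := exists_field_of_isSimpleModule (B := R[X]) (S := S)
  let ρ : R[X] →+* Module.End L S :=
    { toFun := fun p => { toFun := fun x => p • x, map_add' := fun x y => smul_add p x y,
                          map_smul' := fun l x => hcomm p l x }
      map_one' := LinearMap.ext fun x => one_smul _ x
      map_mul' := fun p q => LinearMap.ext fun x => mul_smul p q x
      map_zero' := LinearMap.ext fun x => zero_smul _ x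
      map_add' := fun p q => LinearMap.ext fun x => add_smul p q x }
  have hρ : ∀ p x, ρ p x = p • x := fun _ _ => rfl
  let T : Set (Module.End L S) := Set.range fun r : R => ρ (C r)
  let W : Submodule L (Module.End L S) := Submodule.span L T
  have hone : (1 : Module.End L S) ∈ W := Submodule.subset_span ⟨1, by simp⟩
  have hmul : ∀ f ∈ W, ∀ g ∈ W, f * g ∈ W := by
    intro f hf g hg
    have : W * W ≤ W := by
      rw [Submodule.span_mul_span]
      refine Submodule.span_mono ?_
      rintro _ ⟨_, ⟨r, rfl⟩, _, ⟨r', rfl⟩, rfl⟩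
      exact ⟨r * r', by simp⟩
    exact this (Submodule.mul_mem_mul hf hg)
  have hscalar : ∀ p : R[X], (∀ q, p * q = q * p) → ∃ l : L, ρ p = l • 1 := by
    intro p hp
    obtain ⟨l, hl⟩ := hL (ρ p).toAddMonoidHom
      (fun b x => by
        change p • b • x = b • p • x
        rw [← mul_smul, ← mul_smul, hp]) (fun l x => (ρ p).map_smul l x)
    exact ⟨l, LinearMap.ext fun x => hl x⟩
  have hW : ∀ p, ρ p ∈ W := by
    intro p
    obtain ⟨l, hl⟩ := hscalar X (fun q => (commute_X q).eq)
    induction p using Polynomial.induction_on' with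
    | add p q hp hq => rw [map_add]; exact W.add_mem hp hq
    | monomial n r =>
      rw [← C_mul_X_pow_eq_monomial, map_mul, map_pow, hl, _root_.smul_pow, one_pow, mul_smul_comm,
        mul_one]
      exact W.smul_mem _ (Submodule.subset_span ⟨r, rfl⟩)
  let B : Subring (Module.End L S) :=
    { carrier := W
      mul_mem' := fun {a b} ha hb => hmul a ha b hb
      one_mem' := hone
      add_mem' := fun {a b} => W.add_mem
      zero_mem' := W.zero_mem
      neg_mem' := fun {a} => W.neg_mem }
  have hsimple : IsSimpleModule B S := by
    have hnt : Nontrivial S := IsSimpleModule.nontrivial R[X] S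
    rw [isSimpleModule_iff_toSpanSingleton_surjective]
    refine ⟨hnt, fun x hx y => ?_⟩
    obtain ⟨p, hp⟩ := IsSimpleModule.toSpanSingleton_surjective R[X] hx y
    exact ⟨⟨ρ p, hW p⟩, hp⟩
  have hdense : ∀ (f : Module.End L S) (s : Finset S), ∃ w ∈ (W : Set (Module.End L S)),
      ∀ m ∈ s, f m = w m := by
    intro f s
    let f' : Module.End (Module.End B S) S :=
      { toFun := f
        map_add' := f.map_add
        map_smul' := fun g x => by
          obtain ⟨l, hl⟩ := hL g.toAddMonoidHom (fun b x => g.map_smul ⟨ρ b, hW b⟩ x)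
            (fun l x => g.map_smul ⟨l • 1, W.smul_mem l hone⟩ x)
          have hl' : ∀ x, g x = l • x := hl
          simp only [Module.End.smul_def, RingHom.id_apply, hl', map_smul] }
    obtain ⟨r, hr⟩ := jacobson_density (R := B) f' s
    exact ⟨r, r.2, hr⟩
  obtain ⟨a, ha, hid⟩ := hR
  have hk : ∀ c : k, ∃ l : L, ρ (C (algebraMap k R c)) = l • 1 := fun c =>
    hscalar _ fun q => by
      ext n
      rw [coeff_C_mul, coeff_mul_C, Algebra.commutes]
  choose lk hlk using hk
  have hnt : Nontrivial S := IsSimpleModule.nontrivial R[X] S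
  have hlk1 : lk (a 1) ≠ 0 := by
    intro h0
    have h1 := hlk (a 1)
    have h2 := hlk (a 1)⁻¹
    have : ρ (C (algebraMap k R (a 1))) * ρ (C (algebraMap k R (a 1)⁻¹)) = 1 := by
      rw [← map_mul, ← C_mul, ← map_mul, mul_inv_cancel₀ ha]; simp
    rw [h1, h0, zero_smul, zero_mul] at this
    obtain ⟨x, hx⟩ := exists_ne (0 : S)
    apply hx
    have := congrArg (fun f : Module.End L S => f x) this
    simpa using this.symm
  let μ : MultilinearMap L (fun _ : Fin D => Module.End L S) (Module.End L S) :=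
    ∑ σ : Equiv.Perm (Fin D), lk (a σ) •
      (MultilinearMap.mkPiAlgebraFin L D (Module.End L S)).domDomCongr σ
  have hμ : ∀ h, μ h = ∑ σ, lk (a σ) • (List.ofFn fun i => h (σ i)).prod := by
    intro h
    simp only [μ, sum_apply, smul_apply,
      MultilinearMap.domDomCongr_apply, MultilinearMap.mkPiAlgebraFin_apply]
  have hμ0 : ∀ h, (∀ i, h i ∈ T) → μ h = 0 := by
    intro h hh
    choose r hr using hh
    rw [hμ]
    have := congrArg (fun x => ρ (C x)) (hid r)
    simp only [map_sum, map_zero] at this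
    rw [← this]
    refine Finset.sum_congr rfl fun σ _ => ?_
    rw [Algebra.smul_def (R := k), C_mul, map_mul, hlk, smul_mul_assoc, one_mul]
    congr 1
    have h5 : h = fun i => (ρ.comp C) (r i) := funext fun i => (hr i).symm
    rw [h5]
    change _ = (ρ.comp C) _
    rw [map_list_prod, List.map_ofFn]
    rfl
  have hrank : ∀ v : Fin (D + 1) → S, ¬ LinearIndependent L v :=
    finrank_le_of_dense_of_multilinear (W : Set (Module.End L S)) hdense (fun σ => lk (a σ)) hlk1
      fun h hh => by rw [← hμ]; exact μ.eq_zero_of_mem_span T hμ0 h hh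
  have hfin : Module.Finite L S ∧ Module.finrank L S ≤ D := by
    have h1 : Module.rank L S ≤ D := by
      by_contra hcon
      push Not at hcon
      have : ((D + 1 : ℕ) : Cardinal) ≤ Module.rank L S := by
        have := Order.succ_le_of_lt hcon
        simpa using this
      obtain ⟨v, hv⟩ := Module.le_rank_iff.1 this
      exact hrank v hv
    have h2 : Module.Finite L S := Module.rank_lt_aleph0_iff.1
      (h1.trans_lt (Cardinal.natCast_lt_aleph0))
    refine ⟨h2, ?_⟩
    exact_mod_cast (Module.finrank_eq_rank L S) ▸ h1
  obtain ⟨_, hfr⟩ := hfin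
  let bs := Module.finBasis L S
  let e := LinearMap.toMatrixAlgEquiv bs
  refine ⟨Module.finrank L S, L, inferInstance, (e.toRingHom.comp ρ).comp C, hfr, ?_, ?_⟩
  · have hWtop : W = ⊤ := by
      rw [eq_top_iff]
      intro f _
      obtain ⟨w, hw, hfw⟩ := hdense f (Finset.univ.image bs)
      have : f = w := bs.ext fun i => hfw _ (Finset.mem_image_of_mem _ (Finset.mem_univ i))
      rw [this]; exact hw
    have : Set.range ((e.toRingHom.comp ρ).comp C) = e.toLinearMap '' T := by
      ext x; simp [T]
    rw [this, ← Submodule.map_span]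
    change Submodule.map _ W = ⊤
    rw [hWtop, Submodule.map_top, LinearMap.range_eq_top]
    exact e.surjective
  · rintro r ⟨x, hx⟩ h0
    apply hx
    have : ρ (C r) = 0 := e.injective (by rw [map_zero]; exact h0)
    rw [← hρ, this]; rfl

/-- A prime ring, elementwise. -/
structure IsPrimeRing' (R : Type*) [Ring R] : Prop where
  nontrivial : Nontrivial R
  eq_zero_or : ∀ a b : R, (∀ x, a * x * b = 0) → a = 0 ∨ b = 0

/-- In a prime left noetherian ring, a nonzero element has a non-nilpotent left multiple. -/
lemma IsPrimeRing'.exists_not_isNilpotent {R : Type*} [Ring R] [IsNoetherianRing R]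
    (hR : IsPrimeRing' R) {a : R} (ha : a ≠ 0) : ∃ r, ¬ IsNilpotent (r * a) := by
  by_contra! hnil
  have hnil' : ∀ r, IsNilpotent (a * r) := by
    intro r
    obtain ⟨m, hm⟩ := hnil r
    refine ⟨m + 1, ?_⟩
    have : ∀ m : ℕ, (a * r) ^ (m + 1) = a * (r * a) ^ m * r := by
      intro m
      induction m with
      | zero => simp
      | succ m ih => rw [pow_succ, ih, pow_succ]; simp only [mul_assoc]
    rw [this, hm]; simp
  let ann : R → Submodule R R := fun c => LinearMap.ker (LinearMap.toSpanSingleton R R c)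
  have hann : ∀ c x, x ∈ ann c ↔ x * c = 0 := fun c x => by simp [ann]
  obtain ⟨I, ⟨c, ⟨⟨x, hx⟩, hc⟩, rfl⟩, hmax⟩ := set_has_maximal_iff_noetherian.2
    (inferInstanceAs (IsNoetherian R R)) (ann '' {c | (∃ x, c = a * x) ∧ c ≠ 0})
    ⟨_, a, ⟨⟨1, by simp⟩, ha⟩, rfl⟩
  have hcc : ∀ r, c * r * c = 0 := by
    intro r
    have hn : IsNilpotent (c * r) := by rw [hx, mul_assoc]; exact hnil' _
    classical
    by_cases h0 : c * r = 0
    · rw [h0, zero_mul]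
    obtain ⟨m, hm, hm'⟩ : ∃ m, (c * r) ^ (m + 1) ≠ 0 ∧ (c * r) ^ (m + 2) = 0 := by
      by_contra! hcon
      obtain ⟨m, hm⟩ := hn
      have : ∀ m, (c * r) ^ (m + 1) ≠ 0 := by
        intro m
        induction m with
        | zero => simpa using h0
        | succ m ih => exact hcon m ih
      rcases m with - | m
      · have := hR.nontrivial; simp at hm
      · exact this m hm
    have h2 : ann c = ann ((c * r) ^ (m + 1)) := by
      by_contra hne
      refine hmax _ ⟨(c * r) ^ (m + 1), ⟨⟨x * (r * (c * r) ^ m), ?_⟩, hm⟩, rfl⟩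
        (lt_of_le_of_ne ?_ hne)
      · rw [pow_succ', hx]; simp only [mul_assoc]
      · intro y hy
        rw [hann] at hy ⊢
        rw [pow_succ', mul_assoc, ← mul_assoc y, hy, zero_mul]
    have h3 : c * r ∈ ann c := by
      rw [h2, hann, ← pow_succ']; exact hm'
    rwa [hann] at h3
  exact hc ((hR.eq_zero_or c c hcc).elim id id)

open Polynomial in
lemma exists_isSimpleModule_smul_ne_zero {R : Type u} [Ring R] {b : R} (hb : ¬ IsNilpotent b) :
    ∃ (S : Type u) (_ : AddCommGroup S) (_ : Module R[X] S), IsSimpleModule R[X] S ∧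
      ∃ x : S, (C b : R[X]) • x ≠ 0 := by
  let I : Submodule R[X] R[X] := Submodule.span R[X] {1 - C b * X}
  have hI : I ≠ ⊤ := by
    intro h
    have h1 : (1 : R[X]) ∈ I := h ▸ Submodule.mem_top
    obtain ⟨p, hp⟩ := Submodule.mem_span_singleton.1 h1
    rw [smul_eq_mul, mul_sub, mul_one, ← mul_assoc] at hp
    have hc : ∀ i, p.coeff i = b ^ i := by
      intro i
      induction i with
      | zero =>
        have := congrArg (fun q => coeff q 0) hp
        simpa using this
      | succ i ih =>
        have := congrArg (fun q => coeff q (i + 1)) hp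
        simp only [coeff_sub, coeff_mul_X, coeff_mul_C, ih, coeff_one] at this
        rw [if_neg (by omega), sub_eq_zero] at this
        rw [this, pow_succ]
    exact hb ⟨p.natDegree + 1, by rw [← hc]; exact coeff_eq_zero_of_natDegree_lt (by omega)⟩
  obtain ⟨m, hm, hIm⟩ := (eq_top_or_exists_le_coatom I).resolve_left hI
  refine ⟨R[X] ⧸ m, inferInstance, inferInstance, isSimpleModule_iff_isCoatom.2 hm,
    Submodule.Quotient.mk X, ?_⟩
  intro h0
  rw [← Submodule.Quotient.mk_smul, Submodule.Quotient.mk_eq_zero] at h0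
  have h1 : (1 - C b * X : R[X]) ∈ m := hIm (Submodule.mem_span_singleton_self _)
  have h2 : (1 : R[X]) ∈ m := by
    have := m.add_mem h1 h0
    simpa using this
  apply hm.1
  exact (Ideal.eq_top_iff_one (I := m)).2 h2

/-- A prime left noetherian PI ring embeds in a product of matrix rings of a fixed size over
fields, spanning each factor. -/
theorem IsPrimeRing'.exists_matrix_reps {k : Type*} {R : Type u} [Field k] [Ring R] [Algebra k R]
    [IsNoetherianRing R] (hR : IsPrimeRing' R) {D : ℕ} (hD : MultilinearPI k R D) :
    ∃ n : ℕ, ∀ a : R, a ≠ 0 → ∃ (L : Type u) (_ : Field L) (φ : R →+* Matrix (Fin n) (Fin n) L),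
      Submodule.span L (Set.range φ) = ⊤ ∧ φ a ≠ 0 := by
  have h1 : ∀ a : R, a ≠ 0 → ∃ n ≤ D, ∃ (L : Type u) (_ : Field L)
      (φ : R →+* Matrix (Fin n) (Fin n) L),
      Submodule.span L (Set.range φ) = ⊤ ∧ φ a ≠ 0 := by
    intro a ha
    obtain ⟨r, hr⟩ := hR.exists_not_isNilpotent ha
    obtain ⟨S, _, _, _, x, hx⟩ := exists_isSimpleModule_smul_ne_zero hr
    obtain ⟨n, L, _, φ, hn, hφ, h⟩ := exists_matrix_rep_of_isSimpleModule hD (S := S)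
    refine ⟨n, hn, L, _, φ, hφ, fun h0 => h (r * a) ⟨x, hx⟩ ?_⟩
    rw [map_mul, h0, mul_zero]
  by_contra! hcon
  choose r hr0 hr using hcon
  have h2 : ∀ m : ℕ, ∃ c : R, c ≠ 0 ∧ ∀ n < m, ∀ (L : Type u) (_ : Field L)
      (φ : R →+* Matrix (Fin n) (Fin n) L), Submodule.span L (Set.range φ) = ⊤ → φ c = 0 := by
    intro m
    induction m with
    | zero => exact ⟨1, fun h => by have := hR.nontrivial; exact one_ne_zero h, by simp⟩
    | succ m ih =>
      obtain ⟨c, hc, hcm⟩ := ih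
      have : ∃ x, c * x * r m ≠ 0 := by
        by_contra! h
        rcases hR.eq_zero_or _ _ h with h | h
        · exact hc h
        · exact hr0 m h
      obtain ⟨x, hx⟩ := this
      refine ⟨_, hx, fun n hn L _ φ hφ => ?_⟩
      rcases Nat.lt_succ_iff_lt_or_eq.1 hn with h | rfl
      · rw [map_mul, map_mul, hcm n h L _ φ hφ, zero_mul, zero_mul]
      · rw [map_mul, hr n L _ φ hφ, mul_zero]
  obtain ⟨c, hc, hcm⟩ := h2 (D + 1)
  obtain ⟨n, hn, L, _, φ, hφ, h⟩ := h1 c hc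
  exact h (hcm n (by omega) L _ φ hφ)

/-- The Capelli expression, alternating in `x`. -/
def capelli {A : Type*} [Ring A] {N : ℕ} (y x : Fin N → A) : A :=
  ∑ σ : Equiv.Perm (Fin N), Equiv.Perm.sign σ • (List.ofFn fun j => y j * x (σ j)).prod

/-- The left coefficient at the zeroth variable in the `σ`-th Capelli monomial. -/
def capelliLeft {A : Type*} [Ring A] {m : ℕ} (y : Fin (m + 1) → A) (c : Fin m → A)
    (σ : Equiv.Perm (Fin (m + 1))) : A :=
  ((List.ofFn fun j => y j * Fin.cons (α := fun _ => A) 0 c (σ j)).take (σ.symm 0)).prod *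
    y (σ.symm 0)

/-- The right coefficient at the zeroth variable in the `σ`-th Capelli monomial. -/
def capelliRight {A : Type*} [Ring A] {m : ℕ} (y : Fin (m + 1) → A) (c : Fin m → A)
    (σ : Equiv.Perm (Fin (m + 1))) : A :=
  ((List.ofFn fun j => y j * Fin.cons (α := fun _ => A) 0 c (σ j)).drop (σ.symm 0 + 1)).prod

/-- The Razmyslov dual of the Capelli expression with respect to its zeroth variable. -/
def capelliDual {A : Type*} [Ring A] {m : ℕ} (y : Fin (m + 1) → A) (c : Fin m → A) (z : A) : A :=
  ∑ σ : Equiv.Perm (Fin (m + 1)), Equiv.Perm.sign σ •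
    (capelliRight y c σ * z * capelliLeft y c σ)

lemma List.prod_ofFn_eq_of_update {A : Type*} [Ring A] {N : ℕ} (f f' : Fin N → A) (p : Fin N)
    (h : ∀ j, j ≠ p → f' j = f j) :
    (List.ofFn f).prod = ((List.ofFn f').take p).prod * f p * ((List.ofFn f').drop (p + 1)).prod := by
  have h1 : (List.ofFn f').take p = (List.ofFn f).take p := by
    apply List.ext_getElem (by simp)
    intro i h1 h2
    simp only [List.getElem_take, List.getElem_ofFn]
    apply h
    simp at h1
    intro h3
    have := congrArg Fin.val h3
    simp at this; omega
  have h2 : (List.ofFn f').drop (p + 1) = (List.ofFn f).drop (p + 1) := by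
    apply List.ext_getElem (by simp)
    intro i h1 h2
    simp only [List.getElem_drop, List.getElem_ofFn]
    apply h
    intro h3
    have := congrArg Fin.val h3
    simp at this; omega
  rw [h1, h2]
  conv_lhs => rw [← List.prod_take_mul_prod_drop (List.ofFn f) p]
  rw [List.drop_eq_getElem_cons (by simp), List.prod_cons, mul_assoc]
  simp

lemma capelliLeft_mul_mul_capelliRight {A : Type*} [Ring A] {m : ℕ} (y : Fin (m + 1) → A)
    (c : Fin m → A) (σ : Equiv.Perm (Fin (m + 1))) (w : A) :
    capelliLeft y c σ * w * capelliRight y c σ =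
      (List.ofFn fun j => y j * Fin.cons (α := fun _ => A) w c (σ j)).prod := by
  rw [List.prod_ofFn_eq_of_update _ (fun j => y j * Fin.cons (α := fun _ => A) 0 c (σ j)) (σ.symm 0)]
  · simp [capelliLeft, capelliRight, mul_assoc]
  · intro j hj
    have : σ j ≠ 0 := fun h => hj (by rw [← h]; simp)
    obtain ⟨i, hi⟩ := Fin.exists_succ_eq.2 this
    simp [← hi]

lemma map_capelli {A B : Type*} [Ring A] [Ring B] (φ : A →+* B) {N : ℕ} (y x : Fin N → A) :
    φ (capelli y x) = capelli (fun i => φ (y i)) (fun i => φ (x i)) := by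
  simp only [capelli, map_sum, Units.smul_def, map_zsmul, map_list_prod, List.map_ofFn]
  refine Finset.sum_congr rfl fun σ _ => ?_
  congr 2
  simp [Function.comp_def]

lemma map_cons' {A B : Type*} (φ : A → B) {m : ℕ} (w : A) (c : Fin m → A) (i : Fin (m + 1)) :
    φ (Fin.cons (α := fun _ => A) w c i) = Fin.cons (α := fun _ => B) (φ w) (fun i => φ (c i)) i := by
  refine Fin.cases ?_ (fun i => ?_) i <;> simp

lemma map_capelliDual {A B : Type*} [Ring A] [Ring B] (φ : A →+* B) {m : ℕ} (y : Fin (m + 1) → A)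
    (c : Fin m → A) (z : A) :
    φ (capelliDual y c z) = capelliDual (fun i => φ (y i)) (fun i => φ (c i)) (φ z) := by
  simp only [capelliDual, map_sum, Units.smul_def, map_zsmul, map_mul]
  have h : ∀ σ : Equiv.Perm (Fin (m + 1)),
    (List.ofFn fun j => φ (y j) * Fin.cons (α := fun _ => B) 0 (fun i => φ (c i)) (σ j)) =
    (List.ofFn fun j => y j * Fin.cons (α := fun _ => A) 0 c (σ j)).map φ := by
    intro σ
    rw [List.map_ofFn]; congr 1; ext j
    rw [Function.comp_apply, map_mul, map_cons' φ, map_zero]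
  refine Finset.sum_congr rfl fun σ _ => ?_
  simp only [capelliLeft, capelliRight, h, map_mul, map_list_prod, List.map_take, List.map_drop]

section Matrix

variable {L : Type*} [Field L] {n : ℕ}

/-- The Capelli expression as an alternating map. -/
noncomputable def capelliAlternating {A : Type*} [Ring A] [Algebra L A] {N : ℕ} (y : Fin N → A) :
    A [⋀^Fin N]→ₗ[L] A :=
  MultilinearMap.alternatization ((MultilinearMap.mkPiAlgebraFin L N A).compLinearMap
    fun j => LinearMap.mulLeft L (y j))

lemma capelliAlternating_apply {A : Type*} [Ring A] [Algebra L A] {N : ℕ} (y x : Fin N → A) :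
    capelliAlternating (L := L) y x = capelli y x := by
  simp [capelliAlternating, MultilinearMap.alternatization_apply, capelli]

/-- The Capelli expression as a multilinear map in the coefficients. -/
noncomputable def capelliMultilinear {A : Type*} [Ring A] [Algebra L A] {N : ℕ} (x : Fin N → A) :
    MultilinearMap L (fun _ : Fin N => A) A :=
  ∑ σ : Equiv.Perm (Fin N), ((Equiv.Perm.sign σ : ℤ) : L) •
    (MultilinearMap.mkPiAlgebraFin L N A).compLinearMap fun j => LinearMap.mulRight L (x (σ j))

lemma capelliMultilinear_apply {A : Type*} [Ring A] [Algebra L A] {N : ℕ} (y x : Fin N → A) :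
    capelliMultilinear (L := L) x y = capelli y x := by
  simp [capelliMultilinear, capelli, sum_apply, Units.smul_def, Int.cast_smul_eq_zsmul]

lemma exists_capelli_ne_zero_of_equiv {N : ℕ} (hN : 0 < n) (e : Fin N ≃ Fin n × Fin n) :
    ∃ y : Fin N → Matrix (Fin n) (Fin n) L,
      capelli y (fun j => Matrix.single (e j).1 (e j).2 (1 : L)) ≠ 0 := by
  classical
  let a : Fin (N + 1) → Fin n := Fin.cons ⟨0, hN⟩ fun j => (e j).2
  let v : Fin (N + 1) → (Fin n → L) := fun j => Pi.single (a j) 1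
  let y : Fin N → Matrix (Fin n) (Fin n) L := fun j => Matrix.single (a j.castSucc) (e j).1 1
  have hact : ∀ j p, Matrix.toLinAlgEquiv' (y j * Matrix.single (e p).1 (e p).2 (1 : L)) • v j.succ =
      if p = j then v j.castSucc else 0 := by
    intro j p
    simp only [Module.End.smul_def, Matrix.toLinAlgEquiv'_apply, v]
    have ha : a j.succ = (e j).2 := by simp [a]
    rw [ha]
    by_cases h1 : (e j).1 = (e p).1
    · have : y j * Matrix.single (e p).1 (e p).2 1 = Matrix.single (a j.castSucc) (e p).2 1 := by
        simp only [y, h1, Matrix.single_mul_single_same, mul_one]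
      rw [this]
      by_cases h2 : (e p).2 = (e j).2
      · have hpj : p = j := e.injective (Prod.ext h1.symm h2)
        subst hpj
        ext i
        simp [Matrix.mulVec_single, Matrix.single_apply, Pi.single_apply, eq_comm]
      · have : p ≠ j := by rintro rfl; exact h2 rfl
        rw [if_neg this]
        ext i
        simp [Matrix.mulVec_single, h2]
    · have hpj : p ≠ j := by rintro rfl; exact h1 rfl
      simp only [y]
      rw [Matrix.single_mul_single_of_ne _ _ _ _ h1, if_neg hpj, Matrix.zero_mulVec]
  refine ⟨y, fun h0 => ?_⟩
  have h1 := congrArg (fun X => Matrix.toLinAlgEquiv' X • v (Fin.last N)) h0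
  simp only [capelli, map_sum, Units.smul_def, map_zsmul, map_list_prod, List.map_ofFn, map_zero,
    zero_smul, Finset.sum_smul] at h1
  rw [Finset.sum_eq_single 1] at h1
  · rw [smul_assoc, prod_ofFn_smul_path _ (fun _ => True) v (fun j => by
      simpa using hact j j)] at h1
    simp [v] at h1
  · intro σ _ hσ
    have := prod_ofFn_smul_path _ (fun j => σ j = j) v (fun j => hact j (σ j))
    rw [smul_assoc]
    change _ • (List.ofFn fun j => Matrix.toLinAlgEquiv' (y j * Matrix.single (e (σ j)).1
      (e (σ j)).2 (1 : L))).prod • v (Fin.last N) = 0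
    rw [this, if_neg, smul_zero]
    intro h; exact hσ (Equiv.ext h)
  · simp

/-- The Capelli expression does not vanish at a basis of the matrix ring. -/
lemma exists_capelli_ne_zero {N : ℕ} (hN : 0 < n)
    (b : Module.Basis (Fin N) L (Matrix (Fin n) (Fin n) L)) :
    ∃ y : Fin N → Matrix (Fin n) (Fin n) L, capelli y b ≠ 0 := by
  have hcard : Fintype.card (Fin N) = Fintype.card (Fin n × Fin n) := by
    have := Module.finrank_eq_card_basis b
    rw [Module.finrank_matrix] at this
    simp at this ⊢
    exact this.symm
  let e := Fintype.equivOfCardEq hcard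
  obtain ⟨y, hy⟩ := exists_capelli_ne_zero_of_equiv (L := L) hN e
  refine ⟨y, fun h0 => hy ?_⟩
  rw [← capelliAlternating_apply (L := L)] at h0 ⊢
  rw [b.ext_alternating (f := capelliAlternating (L := L) y) (g := 0)]
  · rfl
  · intro w hw
    have hw' : Function.Bijective w := Finite.injective_iff_bijective.1 hw
    have := AlternatingMap.map_perm (capelliAlternating (L := L) y) b (Equiv.ofBijective w hw')
    rw [h0, smul_zero] at this
    exact this

open Matrix in
/-- On matrices, with the last variables traceless, the Capelli expression is a multiple of the
trace, and its dual is scalar. -/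
lemma exists_capelli_eq_trace_smul {m : ℕ} (hm : m + 1 = n * n) (hn : 0 < n)
    (y : Fin (m + 1) → Matrix (Fin n) (Fin n) L) (c : Fin m → Matrix (Fin n) (Fin n) L)
    (hc : ∀ i, (c i).trace = 0) :
    ∃ G, (∀ w, capelli y (Fin.cons (α := fun _ => Matrix (Fin n) (Fin n) L) w c) = w.trace • G) ∧
      ∀ z, capelliDual y c z = (z * G).trace • 1 := by
  classical
  let w0 : Matrix (Fin n) (Fin n) L := Matrix.single ⟨0, hn⟩ ⟨0, hn⟩ 1
  have hw0 : w0.trace = 1 := by simp [w0]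
  have hC : ∀ w, capelli y (Fin.cons (α := fun _ => Matrix (Fin n) (Fin n) L) w c) =
      ∑ σ : Equiv.Perm (Fin (m + 1)), Equiv.Perm.sign σ •
        (capelliLeft y c σ * w * capelliRight y c σ) := fun w => by
    simp only [capelli, capelliLeft_mul_mul_capelliRight]
  have h0 : ∀ w : Matrix (Fin n) (Fin n) L, w.trace = 0 →
      capelli y (Fin.cons (α := fun _ => Matrix (Fin n) (Fin n) L) w c) = 0 := by
    intro w hw
    rw [← capelliAlternating_apply (L := L)]
    apply AlternatingMap.map_linearDependent
    intro hli
    let K := LinearMap.ker (Matrix.traceLinearMap (Fin n) L L)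
    have hmem : ∀ i, Fin.cons (α := fun _ => Matrix (Fin n) (Fin n) L) w c i ∈ K := by
      intro i
      refine Fin.cases ?_ (fun i => ?_) i
      · simpa [K] using hw
      · simpa [K] using hc i
    have hspan := hli.span_eq_top_of_card_eq_finrank' (by
      rw [Module.finrank_matrix]; simp [hm])
    have : (⊤ : Submodule L _) ≤ K := by
      rw [← hspan, Submodule.span_le]
      rintro _ ⟨i, rfl⟩; exact hmem i
    have : w0 ∈ K := this trivial
    simp [K, hw0] at this
  refine ⟨capelli y (Fin.cons (α := fun _ => Matrix (Fin n) (Fin n) L) w0 c), ?_, ?_⟩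
  case refine_1 =>
    intro w
    have h1 := h0 (w - w.trace • w0) (by simp [hw0])
    rw [hC] at h1 ⊢
    rw [hC]
    simp only [mul_sub, sub_mul, smul_sub, Finset.sum_sub_distrib, sub_eq_zero] at h1
    rw [h1, Finset.smul_sum]
    refine Finset.sum_congr rfl fun σ _ => ?_
    rw [mul_smul_comm, smul_mul_assoc, smul_comm]
  case refine_2 =>
    intro z
    set G := capelli y (Fin.cons (α := fun _ => Matrix (Fin n) (Fin n) L) w0 c) with hG
    have h2 : ∀ w, capelli y (Fin.cons (α := fun _ => Matrix (Fin n) (Fin n) L) w c) =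
        w.trace • G := by
      intro w
      have h1 := h0 (w - w.trace • w0) (by simp [hw0])
      rw [hC] at h1 ⊢
      rw [hG, hC]
      simp only [mul_sub, sub_mul, smul_sub, Finset.sum_sub_distrib, sub_eq_zero] at h1
      rw [h1, Finset.smul_sum]
      refine Finset.sum_congr rfl fun σ _ => ?_
      rw [mul_smul_comm, smul_mul_assoc, smul_comm]
    apply Matrix.ext_iff_trace_mul_right.2
    intro w
    have h3 : (capelliDual y c z * w).trace = (z * capelli y
        (Fin.cons (α := fun _ => Matrix (Fin n) (Fin n) L) w c)).trace := by
      rw [hC, capelliDual, Finset.sum_mul, Finset.mul_sum, Matrix.trace_sum, Matrix.trace_sum]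
      refine Finset.sum_congr rfl fun σ _ => ?_
      simp only [Units.smul_def, smul_mul_assoc, mul_smul_comm, Matrix.trace_smul]
      congr 1
      rw [mul_assoc, mul_assoc, Matrix.trace_mul_comm]
      simp only [mul_assoc]
    rw [h3, h2]
    simp [mul_comm]

end Matrix

open Matrix in
lemma AlternatingMap.smul_eq_sum_update {L M : Type*} [Field L] [AddCommGroup M] [Module L M]
    {N : ℕ} (b : Module.Basis (Fin N) L M) (ψ : M [⋀^Fin N]→ₗ[L] L) (x : Fin N → M) (r : M) :
    ψ x • r = ∑ j, ψ (Function.update x j r) • x j := by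
  rw [ψ.eq_smul_basis_det b]
  simp only [AlternatingMap.smul_apply, smul_assoc, ← Finset.smul_sum]
  congr 1
  apply b.repr.injective
  ext i
  have h := congrFun (Matrix.mulVec_cramer (b.toMatrix x) (b.repr r)) i
  simp only [Module.Basis.det_apply, Module.Basis.toMatrix_update]
  simp only [Matrix.mulVec, dotProduct, Matrix.cramer_apply, Pi.smul_apply, smul_eq_mul,
    Module.Basis.toMatrix_apply] at h
  simp only [map_smul, map_sum, Finsupp.smul_apply, Finsupp.finsetSum_apply, smul_eq_mul]
  rw [← h]
  exact Finset.sum_congr rfl fun j _ => mul_comm _ _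

section
variable {L : Type*} [Field L] {n : ℕ}

open Matrix in
lemma ker_trace_le_span_commutator {R : Type*} [Ring R] (hn : 0 < n)
    (φ : R →+* Matrix (Fin n) (Fin n) L) (hφ : Submodule.span L (Set.range φ) = ⊤) :
    LinearMap.ker (traceLinearMap (Fin n) L L) ≤
      Submodule.span L (Set.range fun p : R × R => φ (p.1 * p.2 - p.2 * p.1)) := by
  classical
  set W := Submodule.span L (Set.range fun p : R × R => φ (p.1 * p.2 - p.2 * p.1)) with hW
  have hcomm : ∀ a b : Matrix (Fin n) (Fin n) L, a * b - b * a ∈ W := by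
    have h1 : ∀ (r : R) (b : Matrix (Fin n) (Fin n) L), φ r * b - b * φ r ∈ W := by
      intro r b
      have hb : b ∈ Submodule.span L (Set.range φ) := hφ ▸ Submodule.mem_top
      induction hb using Submodule.span_induction with
      | mem b hb =>
        obtain ⟨s, rfl⟩ := hb
        refine Submodule.subset_span ⟨(r, s), ?_⟩
        simp
      | zero => simp
      | add b b' _ _ h h' =>
        have := W.add_mem h h'
        rw [mul_add, add_mul]; convert this using 1; abel
      | smul l b _ h =>
        have := W.smul_mem l h
        rwa [smul_sub, ← mul_smul_comm, ← smul_mul_assoc] at this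
    intro a b
    have ha : a ∈ Submodule.span L (Set.range φ) := hφ ▸ Submodule.mem_top
    induction ha using Submodule.span_induction with
    | mem a ha => obtain ⟨s, rfl⟩ := ha; exact h1 s b
    | zero => simp
    | add a a' _ _ h h' =>
      have := W.add_mem h h'
      rw [mul_add, add_mul]; convert this using 1; abel
    | smul l a _ h =>
      rw [smul_mul_assoc, mul_smul_comm, ← smul_sub]
      exact W.smul_mem l h
  intro a ha
  have ha' : a.trace = 0 := ha
  let o : Fin n := ⟨0, hn⟩
  have h1 : a - a.trace • single o o 1 ∈ W := by
    have h2 : a - a.trace • single o o 1 =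
        ∑ i, ∑ j, a i j • (single i j 1 - if i = j then single o o 1 else 0) := by
      simp only [smul_sub, Finset.sum_sub_distrib, smul_ite, smul_zero]
      congr 1
      · conv_lhs => rw [matrix_eq_sum_single a]
        simp
      · simp [Matrix.trace, Finset.sum_smul]
    rw [h2]
    refine W.sum_mem fun i _ => W.sum_mem fun j _ => W.smul_mem _ ?_
    by_cases hij : i = j
    · subst hij
      have := hcomm (single i o 1) (single o i (1 : L))
      simpa using this
    · have := hcomm (single i i 1) (single i j (1 : L))
      rw [if_neg hij, sub_zero]
      rw [single_mul_single_same, single_mul_single_of_ne _ _ _ _ (Ne.symm hij)] at this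
      simpa using this
  rwa [ha', zero_smul, sub_zero] at h1

open Matrix in
/-- A spanning representation admits a nonvanishing Capelli evaluation with all but the zeroth
variable commutators. -/
lemma exists_capelli_commutator_ne_zero {R : Type*} [Ring R] {m : ℕ} (hm : m + 1 = n * n)
    (hn : 0 < n) (φ : R →+* Matrix (Fin n) (Fin n) L)
    (hφ : Submodule.span L (Set.range φ) = ⊤) :
    ∃ (y : Fin (m + 1) → R) (w : R) (u v : Fin m → R),
      φ (capelli y (Fin.cons (α := fun _ => R) w fun i => u i * v i - v i * u i)) ≠ 0 := by
  classical
  let K := LinearMap.ker (traceLinearMap (Fin n) L L)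
  have htr : (traceLinearMap (Fin n) L L) (single ⟨0, hn⟩ ⟨0, hn⟩ 1) = 1 := by simp
  have hK : Module.finrank L K = m := by
    have h1 := LinearMap.finrank_range_add_finrank_ker (traceLinearMap (Fin n) L L)
    have h2 : LinearMap.range (traceLinearMap (Fin n) L L) = ⊤ := by
      rw [LinearMap.range_eq_top]
      intro c
      exact ⟨c • single ⟨0, hn⟩ ⟨0, hn⟩ 1, by rw [map_smul, htr]; simp⟩
    rw [h2, finrank_top, Module.finrank_self, Module.finrank_matrix] at h1
    simp only [Fintype.card_fin, Module.finrank_self, mul_one] at h1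
    change 1 + Module.finrank L K = _ at h1
    omega
  obtain ⟨b, hbs, hbspan, hbli⟩ := exists_linearIndependent L
    (Set.range fun p : R × R => φ (p.1 * p.2 - p.2 * p.1))
  have hspanK : Submodule.span L (Set.range fun p : R × R => φ (p.1 * p.2 - p.2 * p.1)) = K := by
    refine le_antisymm ?_ (ker_trace_le_span_commutator hn φ hφ)
    rw [Submodule.span_le]
    rintro _ ⟨p, rfl⟩
    simp [K, Matrix.trace_mul_comm (φ p.1)]
  rw [hspanK] at hbspan
  have hbfin : Finite b := hbli.finite
  have hbcard : Nat.card b = m := by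
    have := Fintype.ofFinite b
    have h1 := finrank_span_eq_card hbli
    rw [Subtype.range_coe, hbspan, hK] at h1
    rw [Nat.card_eq_fintype_card, h1]
  let e : Fin m ≃ b := (Finite.equivFinOfCardEq hbcard).symm
  choose p hp using fun i => hbs (e i).2
  have hw : ∃ w : R, (φ w).trace ≠ 0 := by
    by_contra! hcon
    have : Submodule.span L (Set.range φ) ≤ K := by
      rw [Submodule.span_le]; rintro _ ⟨r, rfl⟩; simpa [K] using hcon r
    have := this (hφ ▸ Submodule.mem_top : single ⟨0, hn⟩ ⟨0, hn⟩ (1 : L) ∈ _)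
    simp [K] at this
  obtain ⟨w, hw⟩ := hw
  have hli : LinearIndependent L (Fin.cons (α := fun _ => Matrix (Fin n) (Fin n) L) (φ w)
      fun i => (e i : Matrix (Fin n) (Fin n) L)) := by
    refine LinearIndependent.finCons (hbli.comp e e.injective) ?_
    intro hmem
    have : φ w ∈ Submodule.span L b := Submodule.span_mono (by rintro _ ⟨i, rfl⟩; exact (e i).2) hmem
    rw [hbspan] at this
    exact hw this
  let bs := basisOfLinearIndependentOfCardEqFinrank hli (by rw [Module.finrank_matrix]; simp [hm])
  obtain ⟨y, hy⟩ := exists_capelli_ne_zero hn bs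
  have hy' : ∃ y : Fin (m + 1) → R, capelli (fun i => φ (y i)) bs ≠ 0 := by
    by_contra! hcon
    apply hy
    rw [← capelliMultilinear_apply (L := L)]
    refine MultilinearMap.eq_zero_of_mem_span _ (Set.range φ) (fun h hh => ?_) y
      (fun i => hφ ▸ Submodule.mem_top)
    choose r hr using hh
    obtain rfl : (fun i => φ (r i)) = h := funext hr
    rw [capelliMultilinear_apply]
    exact hcon r
  obtain ⟨y, hy⟩ := hy'
  refine ⟨y, w, fun i => (p i).1, fun i => (p i).2, ?_⟩
  rw [map_capelli]
  convert hy using 2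
  ext1 i
  rw [map_cons' φ]
  simp only [hp]
  simp [bs]

end

/-- A spanning family of representations of a fixed size separating points. -/
def HasMatrixReps (R : Type u) [Ring R] (n : ℕ) : Prop :=
  ∀ a : R, a ≠ 0 → ∃ (L : Type u) (_ : Field L) (φ : R →+* Matrix (Fin n) (Fin n) L),
      Submodule.span L (Set.range φ) = ⊤ ∧ φ a ≠ 0

open Matrix in
lemma exists_trace_mul_ne_zero {L R : Type*} [Field L] [Ring R] {n : ℕ}
    (φ : R →+* Matrix (Fin n) (Fin n) L) (hφ : Submodule.span L (Set.range φ) = ⊤)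
    {A B : Matrix (Fin n) (Fin n) L} (hA : A ≠ 0) (hB : B ≠ 0) :
    ∃ s s' : R, (φ s * A * φ s' * B).trace ≠ 0 := by
  classical
  by_contra! hcon
  have h1 : ∀ (s s' : Matrix (Fin n) (Fin n) L), (s * A * s' * B).trace = 0 := by
    have h2 : ∀ (s : R) (s' : Matrix (Fin n) (Fin n) L), (φ s * A * s' * B).trace = 0 := by
      intro s s'
      have hb : s' ∈ Submodule.span L (Set.range φ) := hφ ▸ Submodule.mem_top
      induction hb using Submodule.span_induction with
      | mem b hb => obtain ⟨t, rfl⟩ := hb; exact hcon s t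
      | zero => simp
      | add b b' _ _ h h' => simp [mul_add, add_mul, h, h']
      | smul l b _ h => simp [h]
    intro s s'
    have hb : s ∈ Submodule.span L (Set.range φ) := hφ ▸ Submodule.mem_top
    induction hb using Submodule.span_induction with
    | mem b hb => obtain ⟨t, rfl⟩ := hb; exact h2 t s'
    | zero => simp
    | add b b' _ _ h h' => simp [add_mul, h, h']
    | smul l b _ h => simp [h]
  obtain ⟨i, j, hij⟩ : ∃ i j, A i j ≠ 0 := by
    by_contra! h; exact hA (Matrix.ext h)
  obtain ⟨p, q, hpq⟩ : ∃ i j, B i j ≠ 0 := by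
    by_contra! h; exact hB (Matrix.ext h)
  have := h1 (single q i 1) (single j p 1)
  rw [Matrix.single_mul_mul_single] at this
  simp [Matrix.trace_single_mul, hij, hpq] at this

open Matrix in
/-- The central element attached to a separating family of matrix representations. -/
lemma capelliDual_mem_center {R : Type u} [Ring R] {n m : ℕ} (hm : m + 1 = n * n) (hn : 0 < n)
    (hR : HasMatrixReps R n) (y : Fin (m + 1) → R) (u v : Fin m → R) (z : R) :
    capelliDual y (fun i => u i * v i - v i * u i) z ∈ Subring.center R := by
  rw [Subring.mem_center_iff]
  intro g
  by_contra hne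
  obtain ⟨L, _, φ, hφ, h⟩ := hR _ (sub_ne_zero.2 hne)
  apply h
  obtain ⟨G, -, hG⟩ := exists_capelli_eq_trace_smul hm hn (fun i => φ (y i))
    (fun i => φ (u i * v i - v i * u i)) (fun i => by
      simp [Matrix.trace_mul_comm (φ (u i))])
  rw [map_sub, map_mul, map_mul, map_capelliDual, hG]
  simp

open Matrix in
/-- Nonzero ideals contain nonzero central elements. -/
theorem HasMatrixReps.exists_central {R : Type u} [Ring R] {n : ℕ} (hR : HasMatrixReps R n)
    {r : R} (hr : r ≠ 0) : ∃ z ∈ Subring.center R, z ≠ 0 ∧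
      ∀ I : Ideal R, I.IsTwoSided → r ∈ I → z ∈ I := by
  obtain ⟨L, _, φ, hφ, hφr⟩ := hR r hr
  have hn : 0 < n := by
    rcases Nat.eq_zero_or_pos n with rfl | h
    · exact absurd (Subsingleton.elim _ _) hφr
    · exact h
  obtain ⟨m, hm⟩ : ∃ m, m + 1 = n * n := ⟨n * n - 1, Nat.sub_add_cancel (Nat.mul_pos hn hn)⟩
  obtain ⟨y, w, u, v, hC⟩ := exists_capelli_commutator_ne_zero hm hn φ hφ
  obtain ⟨G, hG1, hG2⟩ := exists_capelli_eq_trace_smul hm hn (fun i => φ (y i))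
    (fun i => φ (u i * v i - v i * u i)) (fun i => by
      simp [Matrix.trace_mul_comm (φ (u i))])
  have hG : G ≠ 0 := by
    rintro rfl
    apply hC
    rw [map_capelli, funext (map_cons' φ w _), hG1, smul_zero]
  obtain ⟨s, s', hs⟩ := exists_trace_mul_ne_zero φ hφ hφr hG
  refine ⟨_, capelliDual_mem_center hm hn hR y u v (s * r * s'), fun h0 => hs ?_, ?_⟩
  · have := congrArg φ h0
    rw [map_capelliDual, hG2, map_zero, map_mul, map_mul] at this
    have := congrFun (congrFun this ⟨0, hn⟩) ⟨0, hn⟩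
    simpa using this
  · intro I hI hrI
    refine I.sum_mem fun σ _ => ?_
    rw [Units.smul_def]
    refine zsmul_mem (I.mul_mem_right _ (I.mul_mem_left _ ?_)) _
    exact I.mul_mem_right _ (I.mul_mem_left _ hrI)

open Matrix in
/-- Finite rank over the center. -/
theorem HasMatrixReps.exists_finite_rank {R : Type u} [Ring R] [Nontrivial R] {n : ℕ}
    (hR : HasMatrixReps R n) : ∃ (N : ℕ) (x : Fin N → R), ∃ h ∈ Subring.center R, h ≠ 0 ∧
      ∀ r : R, ∃ c : Fin N → Subring.center R, h * r = ∑ j, (c j : R) * x j := by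
  obtain ⟨L, _, φ, hφ, hφr⟩ := hR 1 one_ne_zero
  have hn : 0 < n := by
    rcases Nat.eq_zero_or_pos n with rfl | h
    · exact absurd (Subsingleton.elim _ _) hφr
    · exact h
  obtain ⟨m, hm⟩ : ∃ m, m + 1 = n * n := ⟨n * n - 1, Nat.sub_add_cancel (Nat.mul_pos hn hn)⟩
  obtain ⟨y, w, u, v, hC⟩ := exists_capelli_commutator_ne_zero hm hn φ hφ
  obtain ⟨G, hG1, hG2⟩ := exists_capelli_eq_trace_smul hm hn (fun i => φ (y i))
    (fun i => φ (u i * v i - v i * u i)) (fun i => by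
      simp [Matrix.trace_mul_comm (φ (u i))])
  have hG : G ≠ 0 := by
    rintro rfl
    apply hC
    rw [map_capelli, funext (map_cons' φ w _), hG1, smul_zero]
  obtain ⟨s, s', hs⟩ := exists_trace_mul_ne_zero φ hφ hC hG
  set x : Fin (m + 1) → R := Fin.cons (α := fun _ => R) w fun i => u i * v i - v i * u i with hx
  let τ : (Fin (m + 1) → R) → R := fun x =>
    capelliDual y (fun i => u i * v i - v i * u i) (s * capelli y x * s')
  have hτ : ∀ x, τ x ∈ Subring.center R := fun x => capelliDual_mem_center hm hn hR y u v _
  refine ⟨m + 1, x, τ x, hτ x, fun h0 => hs ?_, fun r =>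
    ⟨fun j => ⟨τ (Function.update x j r), hτ _⟩, ?_⟩⟩
  · have := congrArg φ h0
    rw [map_capelliDual, hG2, map_zero, map_mul, map_mul] at this
    have := congrFun (congrFun this ⟨0, hn⟩) ⟨0, hn⟩
    simpa using this
  · by_contra hne
    obtain ⟨L', _, φ', hφ', h'⟩ := hR _ (sub_ne_zero.2 hne)
    apply h'
    obtain ⟨G', -, hG'⟩ := exists_capelli_eq_trace_smul hm hn (fun i => φ' (y i))
      (fun i => φ' (u i * v i - v i * u i)) (fun i => by
        simp [Matrix.trace_mul_comm (φ' (u i))])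
    let bs : Module.Basis (Fin (m + 1)) L' (Matrix (Fin n) (Fin n) L') :=
      Module.finBasisOfFinrankEq _ _ (by rw [Module.finrank_matrix]; simp [hm])
    let ℓ : Matrix (Fin n) (Fin n) L' →ₗ[L'] L' := (traceLinearMap (Fin n) L' L').comp
      ((LinearMap.mulRight L' G').comp
        ((LinearMap.mulRight L' (φ' s')).comp (LinearMap.mulLeft L' (φ' s))))
    let ψ := ℓ.compAlternatingMap (capelliAlternating (L := L') fun i => φ' (y i))
    have hψ : ∀ x : Fin (m + 1) → R, φ' (τ x) = ψ (fun i => φ' (x i)) • 1 := by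
      intro x
      rw [map_capelliDual, hG', map_mul, map_mul, map_capelli, ← capelliAlternating_apply (L := L')]
      rfl
    have h6 := AlternatingMap.smul_eq_sum_update bs ψ (fun i => φ' (x i)) (φ' r)
    rw [map_sub, map_mul, map_sum, hψ, smul_mul_assoc, one_mul, h6, sub_eq_zero]
    refine Finset.sum_congr rfl fun j _ => ?_
    rw [map_mul, hψ, smul_mul_assoc, one_mul]
    congr 2
    ext1 i
    by_cases hij : i = j
    · subst hij; simp
    · simp [hij]

lemma IsPrimeRing'.eq_zero_or_of_mem_center {R : Type*} [Ring R] (hR : IsPrimeRing' R)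
    {z a : R} (hz : z ∈ Subring.center R) (h : z * a = 0) : z = 0 ∨ a = 0 :=
  hR.eq_zero_or z a fun x => by
    rw [← (Subring.mem_center_iff.1 hz x), mul_assoc, h, mul_zero]

lemma IsPrimeRing'.isDomain_center {k R : Type*} [Field k] [Ring R] [Algebra k R]
    (hR : IsPrimeRing' R) : IsDomain (Subalgebra.center k R) := by
  have := hR.nontrivial
  have : NoZeroDivisors (Subalgebra.center k R) := ⟨by
    rintro ⟨a, ha⟩ ⟨b, hb⟩ h
    have := hR.eq_zero_or_of_mem_center (z := a) (a := b) ha (congrArg Subtype.val h)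
    simpa [Subtype.ext_iff] using this⟩
  exact NoZeroDivisors.to_isDomain _

/-- An affine prime noetherian PI algebra has finite rank over a central polynomial subalgebra. -/
theorem IsPrimeRing'.exists_polynomial_subalgebra {k R : Type u} [Field k] [Ring R] [Algebra k R]
    [IsNoetherianRing R] [Algebra.FiniteType k R] (hR : IsPrimeRing' R) {D : ℕ}
    (hD : MultilinearPI k R D) :
    ∃ (s : ℕ) (φ : MvPolynomial (Fin s) k →ₐ[k] R), Function.Injective φ ∧
      (∀ p, φ p ∈ Subring.center R) ∧
      ∃ (N : ℕ) (e : Fin N → R), ∀ r : R, ∃ q : MvPolynomial (Fin s) k, q ≠ 0 ∧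
        ∃ c : Fin N → MvPolynomial (Fin s) k, φ q * r = ∑ j, φ (c j) * e j := by
  classical
  have := hR.nontrivial
  obtain ⟨n, hn⟩ := hR.exists_matrix_reps hD
  obtain ⟨M, x, h, hh, hh0, hx⟩ := HasMatrixReps.exists_finite_rank hn
  choose c hc using hx
  obtain ⟨G, hG⟩ := Algebra.FiniteType.out (R := k) (A := R)
  let Z := Subalgebra.center k R
  have : IsDomain Z := hR.isDomain_center
  let h' : Z := ⟨h, hh⟩
  let c' : R → Fin M → Z := fun r j => ⟨c r j, (c r j).2⟩
  have hc' : ∀ r, (h' : R) * r = ∑ j, (c' r j : R) * x j := hc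
  let T : Finset Z := insert h' ((Finset.univ.image (c' 1)) ∪
    (G.biUnion fun g => Finset.univ.biUnion fun i => Finset.univ.image (c' (x i * g))))
  let C0 : Subalgebra k Z := Algebra.adjoin k T
  have hC0 : Algebra.FiniteType k C0 := (Subalgebra.fg_iff_finiteType _).1 ⟨T, rfl⟩
  have hT : ∀ z ∈ T, z ∈ C0 := fun z hz => Algebra.subset_adjoin hz
  have hh'0 : h' ∈ C0 := hT _ (by simp [T])
  have hc1 : ∀ j, c' 1 j ∈ C0 := fun j => hT _ (by simp [T])
  have hcg : ∀ g ∈ G, ∀ i j, c' (x i * g) j ∈ C0 := fun g hg i j => hT _ (by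
    simp only [T, Finset.mem_insert, Finset.mem_union, Finset.mem_biUnion, Finset.mem_image,
      Finset.mem_univ, true_and]
    exact Or.inr (Or.inr ⟨g, hg, i, j, rfl⟩))
  have key : ∀ r : R, ∃ (e : ℕ) (d : Fin M → C0),
      (h' : R) ^ e * r = ∑ j, ((d j : Z) : R) * x j := by
    intro r
    have hr : r ∈ Submodule.span k (Submonoid.closure (G : Set R) : Set R) := by
      rw [← Algebra.adjoin_eq_span, hG]; trivial
    induction hr using Submodule.span_induction with
    | mem r hr =>
      induction hr using Submonoid.closure_induction_right with
      | one => exact ⟨1, fun j => ⟨c' 1 j, hc1 j⟩, by rw [pow_one]; exact hc' 1⟩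
      | mul_right r _ g hg ih =>
        obtain ⟨e, d, hd⟩ := ih
        refine ⟨e + 1, fun l => ∑ j, d j * ⟨c' (x j * g) l, hcg g hg j l⟩, ?_⟩
        have h1 : (h' : R) ^ (e + 1) * (r * g) = ∑ j, ((d j : Z) : R) * ((h' : R) * (x j * g)) := by
          rw [pow_succ', mul_assoc, ← mul_assoc (_ ^ e), hd, Finset.sum_mul, Finset.mul_sum]
          refine Finset.sum_congr rfl fun j _ => ?_
          rw [← mul_assoc, ← mul_assoc, ← mul_assoc, ← Subring.mem_center_iff.1 hh, mul_assoc _ (h' : R)]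
          simp only [mul_assoc]
        rw [h1]
        simp only [hc', Finset.mul_sum]
        rw [Finset.sum_comm]
        refine Finset.sum_congr rfl fun l _ => ?_
        push_cast
        rw [Finset.sum_mul]
        exact Finset.sum_congr rfl fun j _ => (mul_assoc _ _ _).symm
    | zero => exact ⟨0, 0, by simp⟩
    | add r r' _ _ hr hr' =>
      obtain ⟨e, d, hd⟩ := hr
      obtain ⟨e', d', hd'⟩ := hr'
      refine ⟨e + e', fun j => ⟨h', hh'0⟩ ^ e' * d j + ⟨h', hh'0⟩ ^ e * d' j, ?_⟩
      rw [mul_add, pow_add, mul_assoc _ _ r', hd', ← pow_add, add_comm e, pow_add, mul_assoc, hd]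
      push_cast
      simp only [add_mul, Finset.sum_add_distrib, Finset.mul_sum, mul_assoc]
    | smul a r _ hr =>
      obtain ⟨e, d, hd⟩ := hr
      refine ⟨e, fun j => a • d j, ?_⟩
      rw [mul_smul_comm, hd, Finset.smul_sum]
      exact Finset.sum_congr rfl fun j _ => by simp
  obtain ⟨s, g, hg, hfin⟩ := exists_finite_inj_algHom_of_fg k C0
  let _ : Algebra (MvPolynomial (Fin s) k) C0 := g.toRingHom.toAlgebra
  have hfin' : Module.Finite (MvPolynomial (Fin s) k) C0 := hfin
  obtain ⟨m, b, hb⟩ := Module.Finite.exists_fin (R := MvPolynomial (Fin s) k) (M := C0)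
  let φ : MvPolynomial (Fin s) k →ₐ[k] R := (Z.val.comp C0.val).comp g
  have hφ : ∀ p, φ p = ((g p : Z) : R) := fun p => rfl
  refine ⟨s, φ, ?_, fun p => (g p : Z).2, m * M, fun i =>
    (((b (finProdFinEquiv.symm i).1 : C0) : Z) : R) * x (finProdFinEquiv.symm i).2, ?_⟩
  · exact Subtype.val_injective.comp (Subtype.val_injective.comp hg)
  · intro r
    obtain ⟨e, d, hd⟩ := key r
    have hz0 : (⟨h', hh'0⟩ : C0) ^ e ≠ 0 := pow_ne_zero _ fun h2 =>
      hh0 (congrArg (fun z : C0 => ((z : Z) : R)) h2)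
    have hne := Ideal.comap_ne_bot_of_integral_mem (R := MvPolynomial (Fin s) k) hz0
      (Ideal.subset_span (s := {(⟨h', hh'0⟩ : C0) ^ e}) rfl)
      (Algebra.IsIntegral.isIntegral _)
    obtain ⟨q, hq, hq0⟩ := Submodule.exists_mem_ne_zero_of_ne_bot hne
    obtain ⟨a, ha⟩ := Ideal.mem_span_singleton'.1 (Ideal.mem_comap.1 hq)
    have hspan : ∀ z : C0, ∃ w : Fin m → MvPolynomial (Fin s) k, z = ∑ i, g (w i) * b i := by
      intro z
      have : z ∈ Submodule.span (MvPolynomial (Fin s) k) (Set.range b) := hb ▸ Submodule.mem_top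
      obtain ⟨w, hw⟩ := (Submodule.mem_span_range_iff_exists_fun _).1 this
      exact ⟨w, hw.symm⟩
    choose w hw using fun j => hspan (a * d j)
    refine ⟨q, hq0, fun i => w (finProdFinEquiv.symm i).2 (finProdFinEquiv.symm i).1, ?_⟩
    have h1 : φ q * r = ((a : Z) : R) * ((h' : R) ^ e * r) := by
      rw [hφ, ← mul_assoc]
      congr 1
      exact (congrArg (fun z : C0 => ((z : Z) : R)) ha).symm
    rw [h1, hd, Finset.mul_sum, ← finProdFinEquiv.sum_comp, Fintype.sum_prod_type,
      Finset.sum_comm]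
    refine Finset.sum_congr rfl fun j _ => ?_
    have := congrArg (fun z : C0 => ((z : Z) : R)) (hw j)
    simp only [MulMemClass.coe_mul, AddSubmonoidClass.coe_finsetSum] at this
    rw [← mul_assoc, this, Finset.sum_mul]
    refine Finset.sum_congr rfl fun i _ => ?_
    simp [hφ, mul_assoc]

section cofinite
variable {k A : Type*} [Field k] [Ring A] [Algebra k A]

lemma finite_quotient_of_ker_le {V W : Type*} [AddCommGroup V] [Module k V] [AddCommGroup W]
    [Module k W] [Module.Finite k W] (f : V →ₗ[k] W) {U : Submodule k V}
    (h : LinearMap.ker f ≤ U) : Module.Finite k (V ⧸ U) := by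
  have h1 : Module.Finite k (V ⧸ LinearMap.ker f) :=
    Module.Finite.of_injective _ (LinearMap.ker_eq_bot.1 (Submodule.ker_liftQ_eq_bot' _ f rfl))
  exact Module.Finite.of_surjective (Submodule.factor h) (Submodule.factor_surjective h)

lemma finite_quotient_annihilator {S : Type*} [AddCommGroup S] [Module A S] [Module k S]
    [IsScalarTower k A S] [Module.Finite k S] {I : Ideal A}
    (hI : ∀ a, (∀ x : S, a • x = 0) → a ∈ I) : Module.Finite k (A ⧸ I) := by
  have := finite_quotient_of_ker_le (Algebra.lsmul k k S : A →ₐ[k] Module.End k S).toLinearMap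
    (U := I.restrictScalars k) (fun a ha => hI a fun x => LinearMap.congr_fun ha x)
  exact Module.Finite.equiv (Submodule.Quotient.restrictScalarsEquiv k I)

lemma finite_of_annihilator {M : Type*} [AddCommGroup M] [Module A M] [Module k M]
    [IsScalarTower k A M] [Module.Finite A M] {I : Ideal A} [Module.Finite k (A ⧸ I)]
    (hI : ∀ a ∈ I, ∀ x : M, a • x = 0) : Module.Finite k M := by
  obtain ⟨n, g, hg⟩ := Module.Finite.exists_fin (R := A) (M := M)
  let f : (Fin n → A ⧸ I) →ₗ[k] M := LinearMap.lsum k (fun _ => A ⧸ I) k fun i =>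
    (Submodule.liftQ I (LinearMap.toSpanSingleton A M (g i))
      (fun a ha => hI a ha _)).restrictScalars k
  refine Module.Finite.of_surjective f fun x => ?_
  have hx : x ∈ Submodule.span A (Set.range g) := hg ▸ Submodule.mem_top
  obtain ⟨c, rfl⟩ := (Submodule.mem_span_range_iff_exists_fun _).1 hx
  exact ⟨fun i => Submodule.Quotient.mk (c i), by
    simp only [f, LinearMap.lsum_apply, LinearMap.sum_apply, LinearMap.comp_apply]
    rfl⟩

/-- A nonzero noetherian module contains a nonzero submodule all of whose nonzero submodules have
the same annihilator, and this annihilator is prime. -/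
lemma exists_prime_submodule {A M : Type*} [Ring A] [AddCommGroup M] [Module A M]
    [IsNoetherianRing A] [Nontrivial M] :
    ∃ N : Submodule A M, N ≠ ⊥ ∧ (∀ N' ≤ N, N' ≠ ⊥ → N'.annihilator = N.annihilator) ∧
      IsPrimeRing' (A ⧸ N.annihilator) := by
  obtain ⟨_, ⟨N, hN0, rfl⟩, hmax⟩ := set_has_maximal_iff_noetherian.2
    (inferInstanceAs (IsNoetherian A A))
    ((fun N : Submodule A M => N.annihilator) '' {N | N ≠ ⊥}) ⟨_, ⊤, top_ne_bot, rfl⟩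
  have hsub : ∀ N' ≤ N, N' ≠ ⊥ → N'.annihilator = N.annihilator := by
    intro N' hN' h0
    have h1 : N.annihilator ≤ N'.annihilator := Submodule.annihilator_mono hN'
    by_contra hne
    exact hmax _ ⟨N', h0, rfl⟩ (lt_of_le_of_ne h1 (Ne.symm hne))
  refine ⟨N, hN0, hsub, ?_, ?_⟩
  · obtain ⟨x, hx, hx0⟩ := Submodule.exists_mem_ne_zero_of_ne_bot hN0
    refine Ideal.Quotient.nontrivial_iff.2 fun h => hx0 ?_
    have : (1 : A) ∈ N.annihilator := h ▸ Submodule.mem_top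
    simpa using Submodule.mem_annihilator.1 this x hx
  · intro a b hab
    obtain ⟨a, rfl⟩ := Ideal.Quotient.mk_surjective a
    obtain ⟨b, rfl⟩ := Ideal.Quotient.mk_surjective b
    rw [Ideal.Quotient.eq_zero_iff_mem, Ideal.Quotient.eq_zero_iff_mem]
    by_contra! hcon
    obtain ⟨ha, hb⟩ := hcon
    rw [Submodule.mem_annihilator] at hb
    push Not at hb
    obtain ⟨n, hn, hbn⟩ := hb
    have h1 : Submodule.span A {b • n} ≤ N := by
      rw [Submodule.span_singleton_le_iff_mem]; exact N.smul_mem _ hn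
    have h2 := hsub _ h1 (by simpa using hbn)
    apply ha
    rw [← h2, Submodule.mem_annihilator]
    intro y hy
    obtain ⟨c, rfl⟩ := Submodule.mem_span_singleton.1 hy
    have := hab (Ideal.Quotient.mk _ c)
    rw [← map_mul, ← map_mul, Ideal.Quotient.eq_zero_iff_mem] at this
    have := Submodule.mem_annihilator.1 this n hn
    simpa [mul_smul] using this

end cofinite

lemma MultilinearPI.of_surjective {k A B : Type*} [CommRing k] [Ring A] [Ring B] [Algebra k A]
    [Algebra k B] {D : ℕ} (h : MultilinearPI k A D) (f : A →ₐ[k] B)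
    (hf : Function.Surjective f) : MultilinearPI k B D := by
  obtain ⟨a, ha, h⟩ := h
  refine ⟨a, ha, fun x => ?_⟩
  choose g hg using hf
  have := congrArg f (h fun i => g (x i))
  simpa [map_list_prod, List.map_ofFn, Function.comp_def, hg] using this

section residual
variable {k : Type*} {A : Type u} [Field k] [Ring A] [Algebra k A] {M : Type*} [AddCommGroup M]
  [Module A M] [Module k M] [IsScalarTower k A M]

lemma finite_quotient_mono {U V : Submodule A M} (h : U ≤ V) [Module.Finite k (M ⧸ U)] :
    Module.Finite k (M ⧸ V) := by
  let f : (M ⧸ U) →ₗ[k] (M ⧸ V) := (Submodule.factor h).restrictScalars k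
  exact Module.Finite.of_surjective f (Submodule.factor_surjective h)

lemma finite_comap_mkQ {S : Submodule A M} [hS : Module.Finite k S] {N : Submodule A (M ⧸ S)}
    [Module.Finite k N] : Module.Finite k (N.comap S.mkQ) := by
  let f : N.comap S.mkQ →ₗ[k] N := ((S.mkQ.comp (Submodule.subtype _)).codRestrict N
    (fun x => x.2)).restrictScalars k
  have hk : Module.Finite k (LinearMap.ker f) := by
    have hno : IsNoetherian k (S.restrictScalars k) := IsNoetherian.iff_fg.2 hS
    let g : LinearMap.ker f →ₗ[k] S.restrictScalars k := LinearMap.codRestrict _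
      (((N.comap S.mkQ).subtype.restrictScalars k).comp (Submodule.subtype _)) (fun x =>
        (Submodule.Quotient.mk_eq_zero _).1 (congrArg Subtype.val x.2))
    refine Module.Finite.of_injective g fun x y h => ?_
    exact Subtype.ext (Subtype.ext (congrArg (fun z : S.restrictScalars k => (z : M)) h))
  have hr : Module.Finite k (N.comap S.mkQ ⧸ LinearMap.ker f) := finite_quotient_of_ker_le f le_rfl
  exact Module.Finite.of_submodule_quotient (LinearMap.ker f)

lemma exists_cofinite_mul_le [IsNoetherianRing A] (P I : Ideal A) [P.IsTwoSided]
    [Module.Finite k (A ⧸ I)] : ∃ J : Submodule k A, Module.Finite k (A ⧸ J) ∧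
      ∀ a ∈ J, ∀ x ∈ P, x * a ∈ Submodule.span A {y | ∃ b ∈ I, ∃ p ∈ P, y = b * p} := by
  set IP : Submodule A A := Submodule.span A {y | ∃ b ∈ I, ∃ p ∈ P, y = b * p} with hIP
  have hIPr : ∀ y ∈ IP, ∀ a, y * a ∈ IP := by
    intro y hy a
    induction hy using Submodule.span_induction with
    | mem y hy =>
      obtain ⟨b, hb, p, hp, rfl⟩ := hy
      rw [mul_assoc]
      exact Submodule.subset_span ⟨b, hb, _, P.mul_mem_right _ hp, rfl⟩
    | zero => simp
    | add x y _ _ hx hy => rw [add_mul]; exact IP.add_mem hx hy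
    | smul c x _ hx => rw [smul_eq_mul, mul_assoc]; exact IP.smul_mem c hx
  have hPfg : Module.Finite A P := Module.Finite.iff_fg.2 (IsNoetherian.noetherian P)
  let PP : Submodule A (A ⧸ IP) := Submodule.map IP.mkQ P
  have hPPfg : Module.Finite A PP := Module.Finite.map _ _
  have hPIP : Module.Finite k PP := finite_of_annihilator (A := A) (I := I) (by
    rintro b hb ⟨_, x, hx, rfl⟩
    exact Subtype.ext ((Submodule.Quotient.mk_eq_zero _).2
      (Submodule.subset_span ⟨b, hb, x, hx, rfl⟩)))
  obtain ⟨t, g, hg⟩ := Module.Finite.exists_fin (R := k) (M := PP)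
  choose p hpP hp using fun i => (g i).2
  have hPspan : ∀ x ∈ P, ∃ c : Fin t → k, x - ∑ i, c i • p i ∈ IP := by
    intro x hxP
    have hx : (⟨IP.mkQ x, x, hxP, rfl⟩ : PP) ∈ Submodule.span k (Set.range g) :=
      hg ▸ Submodule.mem_top
    obtain ⟨c, hc⟩ := (Submodule.mem_span_range_iff_exists_fun _).1 hx
    refine ⟨c, ?_⟩
    rw [← Submodule.Quotient.mk_eq_zero, Submodule.Quotient.mk_sub, sub_eq_zero]
    have h1 : (PP.subtype.restrictScalars k) (∑ i, c i • g i) = IP.mkQ x := congrArg Subtype.val hc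
    change _ = (IP.mkQ.restrictScalars k) (∑ i, c i • p i)
    rw [map_sum] at h1 ⊢
    simp only [map_smul] at h1 ⊢
    rw [← Submodule.mkQ_apply, ← h1]
    exact Finset.sum_congr rfl fun i _ => congrArg _ (hp i).symm
  let m : Fin t → A →ₗ[k] PP := fun i =>
    { toFun := fun a => ⟨IP.mkQ (p i * a), _, P.mul_mem_right _ (hpP i), rfl⟩
      map_add' := fun a b => Subtype.ext (by simp [mul_add])
      map_smul' := fun c a => Subtype.ext ((congrArg IP.mkQ (mul_smul_comm c (p i) a)).trans
        ((IP.mkQ.restrictScalars k).map_smul c _)) }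
  let F : A →ₗ[k] (Fin t → PP) := LinearMap.pi m
  refine ⟨LinearMap.ker F, finite_quotient_of_ker_le F le_rfl, fun a ha x hx => ?_⟩
  obtain ⟨c, hc⟩ := hPspan x hx
  have h1 : ∀ i, p i * a ∈ IP := fun i =>
    (Submodule.Quotient.mk_eq_zero _).1 (congrArg Subtype.val (congrFun ha i))
  have h2 := hIPr _ hc a
  rw [sub_mul, Finset.sum_mul] at h2
  refine (Submodule.sub_mem_iff_left IP (IP.sum_mem fun i _ => ?_)).1 h2
  rw [smul_mul_assoc, ← smul_one_mul]
  exact IP.smul_mem _ (h1 i)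

lemma exists_mem_commutator_mem [IsNoetherianRing A] {D : ℕ} (hD : MultilinearPI k A D)
    (P I : Ideal A) [P.IsTwoSided] [I.IsTwoSided] (hprime : IsPrimeRing' (A ⧸ P)) (h : ¬ I ≤ P) :
    ∃ a ∈ I, (∀ b, a * b - b * a ∈ P) ∧ ∀ m : ℕ, a ^ m ∉ P := by
  obtain ⟨r, hrI, hrP⟩ := SetLike.not_le_iff_exists.1 h
  have hnoeth : IsNoetherianRing (A ⧸ P) :=
    isNoetherianRing_of_surjective A _ (Ideal.Quotient.mk P) Ideal.Quotient.mk_surjective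
  obtain ⟨n, hn⟩ := hprime.exists_matrix_reps
    (hD.of_surjective (Ideal.Quotient.mkₐ k P) Ideal.Quotient.mk_surjective)
  obtain ⟨z, hzc, hz0, hz⟩ := HasMatrixReps.exists_central hn (r := Ideal.Quotient.mk P r)
    (fun h => hrP (Ideal.Quotient.eq_zero_iff_mem.1 h))
  have hsurj : Function.Surjective (Ideal.Quotient.mk P) := Ideal.Quotient.mk_surjective
  have hzI : z ∈ I.map (Ideal.Quotient.mk P) := by
    refine hz _ ⟨fun {x} y hx => ?_⟩ (Ideal.mem_map_of_mem _ hrI)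
    obtain ⟨x, hx', rfl⟩ := (Ideal.mem_map_iff_of_surjective _ hsurj).1 hx
    obtain ⟨y, rfl⟩ := hsurj y
    rw [← map_mul]
    exact Ideal.mem_map_of_mem _ (I.mul_mem_right _ hx')
  obtain ⟨a, haI, rfl⟩ := (Ideal.mem_map_iff_of_surjective _ hsurj).1 hzI
  refine ⟨a, haI, fun b => ?_, fun m => ?_⟩
  · rw [← Ideal.Quotient.eq_zero_iff_mem, map_sub, map_mul, map_mul,
      Subring.mem_center_iff.1 hzc (Ideal.Quotient.mk P b), sub_self]
  · rw [← Ideal.Quotient.eq_zero_iff_mem, map_pow]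
    induction m with
    | zero => have := hprime.nontrivial; simp
    | succ m ih =>
      intro h
      rw [pow_succ'] at h
      rcases hprime.eq_zero_or_of_mem_center hzc h with h | h
      · exact hz0 h
      · exact ih h

lemma exists_pow_smul_eq_zero {A M : Type*} [Ring A] [AddCommGroup M] [Module A M]
    [IsNoetherian A M] {a : A} (ha : ∀ (b : A) (x : M), a • b • x = b • a • x) :
    ∃ (m : ℕ) (g : M →ₗ[A] M), (∀ x, g x = a ^ m • x) ∧ ∀ x, a • g x = 0 → g x = 0 := by
  let f : M →ₗ[A] M :=
    { toFun := fun x => a • x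
      map_add' := fun x y => smul_add _ _ _
      map_smul' := fun b x => ha b x }
  have hf : ∀ (m : ℕ) (x : M), (f ^ m) x = a ^ m • x := by
    intro m
    induction m with
    | zero => simp
    | succ m ih => intro x; rw [pow_succ', pow_succ']; simp [mul_smul, ← ih, f]
  obtain ⟨m, hdisj, hm⟩ := ((Module.End.eventually_disjoint_ker_pow_range_pow f).and
    (Filter.eventually_ge_atTop 1)).exists
  refine ⟨m, f ^ m, hf m, fun x hx => ?_⟩
  rw [hf] at hx
  have h2 : (f ^ m) x ∈ LinearMap.ker (f ^ m) := by
    obtain ⟨l, rfl⟩ : ∃ l, m = l + 1 := ⟨m - 1, by omega⟩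
    rw [LinearMap.mem_ker, hf, hf, pow_succ, mul_smul, ← pow_succ, hx, smul_zero]
  exact Submodule.disjoint_def.1 hdisj _ h2 ⟨x, rfl⟩

lemma finite_of_essential [IsNoetherianRing A] {D : ℕ} (hD : MultilinearPI k A D)
    [Module.Finite A M] (S : Submodule A M) [Module.Finite k S]
    (hS : ∀ N : Submodule A M, N ≠ ⊥ → N ⊓ S ≠ ⊥) : Module.Finite k M := by
  have : IsNoetherian A M := isNoetherian_of_isNoetherianRing_of_finite A M
  obtain ⟨S', ⟨hSS', hS'fin⟩, hmax⟩ := set_has_maximal_iff_noetherian.2 ‹IsNoetherian A M›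
    {S' : Submodule A M | S ≤ S' ∧ Module.Finite k S'} ⟨S, le_rfl, ‹_›⟩
  have hS'fin : Module.Finite k S' := hS'fin
  by_cases htop : S' = ⊤
  · subst htop
    exact Module.Finite.equiv ((Submodule.topEquiv (R := A) (M := M)).restrictScalars k)
  exfalso
  have : Nontrivial (M ⧸ S') := Submodule.Quotient.nontrivial_iff.2 htop
  obtain ⟨N', hN'0, hN'sub, hprime⟩ := exists_prime_submodule (A := A) (M := M ⧸ S')
  set P := N'.annihilator with hP
  let N := N'.comap S'.mkQ
  have hS'N : S' ≤ N := fun x hx => by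
    simp only [N, Submodule.mem_comap, Submodule.mkQ_apply]
    rw [(Submodule.Quotient.mk_eq_zero _).2 hx]; exact N'.zero_mem
  have hmemP : ∀ a, a ∈ P ↔ ∀ n ∈ N, a • n ∈ S' := by
    intro a
    rw [hP, Submodule.mem_annihilator]
    constructor
    · intro h n hn
      rw [← Submodule.Quotient.mk_eq_zero]
      exact h _ hn
    · rintro h n hn
      obtain ⟨n, rfl⟩ := S'.mkQ_surjective n
      exact (Submodule.Quotient.mk_eq_zero _).2 (h n hn)
  have hPinf : ¬ Module.Finite k (A ⧸ P) := by
    intro hfin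
    have h1 : Module.Finite k N' := by
      refine finite_of_annihilator (A := A) (I := P) fun a ha x => ?_
      exact Subtype.ext (Submodule.mem_annihilator.1 ha x x.2)
    have h2 : Module.Finite k N := finite_comap_mkQ
    refine hmax N ⟨hSS'.trans hS'N, h2⟩ (lt_of_le_of_ne hS'N fun h => hN'0 ?_)
    rw [eq_bot_iff]
    intro x hx
    obtain ⟨x, rfl⟩ := S'.mkQ_surjective x
    have : x ∈ S' := h ▸ hx
    exact (Submodule.Quotient.mk_eq_zero _).2 this
  let I := S'.annihilator
  have hIfin : Module.Finite k (A ⧸ I) := finite_quotient_annihilator (S := S') fun a ha =>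
    Submodule.mem_annihilator.2 fun n hn => congrArg Subtype.val (ha ⟨n, hn⟩)
  obtain ⟨J, hJfin, hJ⟩ := exists_cofinite_mul_le (k := k) P I
  have hF : ∀ a ∈ J, ∀ x ∈ P, ∀ n ∈ N, x • a • n = 0 := by
    intro a ha x hx n hn
    have h1 := hJ a ha x hx
    rw [← mul_smul]
    generalize x * a = y at h1
    induction h1 using Submodule.span_induction with
    | mem y hy =>
      obtain ⟨a, ha, p, hp, rfl⟩ := hy
      rw [mul_smul]
      exact Submodule.mem_annihilator.1 ha _ ((hmemP _).1 hp n hn)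
    | zero => simp
    | add x y _ _ hx hy => simp [add_smul, hx, hy]
    | smul c x _ hx => rw [smul_eq_mul, mul_smul, hx, smul_zero]
  let N2 : Submodule A M := Submodule.span A {y | ∃ a ∈ J, ∃ n ∈ N, y = a • n}
  have hPN2 : ∀ x ∈ P, ∀ y ∈ N2, x • y = 0 := by
    intro x hx y hy
    induction hy using Submodule.span_induction generalizing x with
    | mem y hy =>
      obtain ⟨a, ha, n, hn, rfl⟩ := hy
      exact hF a ha x hx n hn
    | zero => simp
    | add y y' _ _ hy hy' => rw [smul_add, hy x hx, hy' x hx, add_zero]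
    | smul c y _ hy => rw [← mul_smul]; exact hy _ (P.mul_mem_right _ hx)
  have hN2N : N2 ≤ N := Submodule.span_le.2 (by rintro _ ⟨a, -, n, hn, rfl⟩; exact N.smul_mem _ hn)
  have hN2S : ¬ N2 ≤ S' := by
    intro h
    apply hPinf
    have := Module.Finite.of_surjective
      (Submodule.factor (show J ≤ P.restrictScalars k from fun a ha =>
        (hmemP a).2 fun n hn => h (Submodule.subset_span ⟨a, ha, n, hn, rfl⟩)))
      (Submodule.factor_surjective _)
    exact Module.Finite.equiv (Submodule.Quotient.restrictScalarsEquiv k P)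
  have hIP : ¬ I ≤ P := fun h => hPinf (finite_quotient_mono h)
  obtain ⟨a, haI, hcomm, hpow⟩ := exists_mem_commutator_mem hD P I hprime hIP
  obtain ⟨m, g, hg, hm⟩ := exists_pow_smul_eq_zero (M := N2) (a := a) (by
    intro b x
    have := hPN2 _ (hcomm b) x x.2
    rw [sub_smul, sub_eq_zero, mul_smul, mul_smul] at this
    exact Subtype.ext this)
  have hzero : ∀ x ∈ N2, a ^ m • x = 0 := by
    intro x hx
    by_contra hne
    have h1 : (LinearMap.range g).map N2.subtype ≠ ⊥ := by
      rw [Submodule.ne_bot_iff]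
      exact ⟨a ^ m • x, ⟨g ⟨x, hx⟩, ⟨_, rfl⟩, congrArg Subtype.val (hg ⟨x, hx⟩)⟩, hne⟩
    obtain ⟨y, ⟨⟨_, ⟨w, rfl⟩, rfl⟩, hyS⟩, hy0⟩ :=
      Submodule.exists_mem_ne_zero_of_ne_bot (hS _ h1)
    exact hy0 (congrArg Subtype.val (hm w
      (Subtype.ext (Submodule.mem_annihilator.1 haI _ (hSS' hyS)))))
  have hap : a ^ m ∈ P := by
    have h1 : N2.map S'.mkQ ≠ ⊥ := by
      intro h
      apply hN2S
      intro x hx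
      rw [← Submodule.Quotient.mk_eq_zero]
      have : S'.mkQ x ∈ N2.map S'.mkQ := ⟨x, hx, rfl⟩
      rw [h] at this
      exact this
    rw [← hN'sub (N2.map S'.mkQ) (Submodule.map_le_iff_le_comap.2 hN2N) h1,
      Submodule.mem_annihilator]
    rintro _ ⟨x, hx, rfl⟩
    rw [← map_smul, hzero x hx, map_zero]
  exact hpow m hap

/-- Residual finiteness relative to a finite-dimensional submodule. -/
theorem exists_cofinite_disjoint [IsNoetherianRing A] {D : ℕ} (hD : MultilinearPI k A D)
    [Module.Finite A M] (S : Submodule A M) [Module.Finite k S] :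
    ∃ Y : Submodule A M, Y ⊓ S = ⊥ ∧ Module.Finite k (M ⧸ Y) := by
  have : IsNoetherian A M := isNoetherian_of_isNoetherianRing_of_finite A M
  obtain ⟨Y, hY, hmax⟩ := set_has_maximal_iff_noetherian.2 ‹IsNoetherian A M›
    {Y : Submodule A M | Y ⊓ S = ⊥} ⟨⊥, by simp⟩
  refine ⟨Y, hY, ?_⟩
  have hSfin : Module.Finite k (S.map Y.mkQ) :=
    Module.Finite.of_surjective ((Y.mkQ.submoduleMap S).restrictScalars k)
      (Y.mkQ.submoduleMap_surjective S)
  refine finite_of_essential hD (S.map Y.mkQ) fun N hN h => ?_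
  have hlt : Y < N.comap Y.mkQ := by
    refine lt_of_le_of_ne (fun x hx => ?_) fun h => hN ?_
    · rw [Submodule.mem_comap, Submodule.mkQ_apply, (Submodule.Quotient.mk_eq_zero _).2 hx]
      exact N.zero_mem
    · rw [← Submodule.map_comap_eq_of_surjective Y.mkQ_surjective N, ← h]
      simp
  refine hmax _ ?_ hlt
  change _ = _
  rw [eq_bot_iff]
  rintro x ⟨hx1, hx2⟩
  have h1 : Y.mkQ x ∈ N ⊓ S.map Y.mkQ := ⟨hx1, x, hx2, rfl⟩
  rw [h] at h1
  have h2 : x ∈ Y := (Submodule.Quotient.mk_eq_zero _).1 h1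
  rw [← hY]
  exact ⟨h2, hx2⟩

end residual

section hilbertBasis
open Polynomial

variable {A : Type*} [Ring A]

/-- The left ideal of `n`-th coefficients of polynomials of degree at most `n` in `I`. -/
noncomputable def topCoeffIdeal (I : Ideal A[X]) (n : ℕ) : Ideal A :=
  Submodule.map (lcoeff A n) (Submodule.restrictScalars A I ⊓ degreeLE A n)

lemma mem_topCoeffIdeal {I : Ideal A[X]} {n : ℕ} {a : A} :
    a ∈ topCoeffIdeal I n ↔ ∃ p ∈ I, p.degree ≤ n ∧ p.coeff n = a := by
  simp [topCoeffIdeal, mem_degreeLE, and_assoc]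

lemma topCoeffIdeal_mono {I J : Ideal A[X]} (h : I ≤ J) {m n : ℕ} (hmn : m ≤ n) :
    topCoeffIdeal I m ≤ topCoeffIdeal J n := by
  intro a ha
  obtain ⟨p, hp, hd, rfl⟩ := mem_topCoeffIdeal.1 ha
  refine mem_topCoeffIdeal.2 ⟨X ^ (n - m) * p, J.mul_mem_left _ (h hp), ?_, ?_⟩
  · refine (degree_mul_le _ _).trans ((add_le_add (degree_X_pow_le _) hd).trans ?_)
    rw [← Nat.cast_add, Nat.sub_add_cancel hmn]
  · have : n = m + (n - m) := by omega
    conv_lhs => rw [this]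
    rw [show m + (n - m) - m = n - m by omega, coeff_X_pow_mul]

lemma le_of_topCoeffIdeal_le {I J : Ideal A[X]} (hIJ : I ≤ J)
    (h : ∀ n, topCoeffIdeal J n ≤ topCoeffIdeal I n) : J ≤ I := by
  have key : ∀ n : ℕ, ∀ p ∈ J, p.degree < n → p ∈ I := by
    intro n
    induction n with
    | zero =>
      intro p _ hd
      rw [Nat.cast_zero, ← not_le, zero_le_degree_iff, not_not] at hd
      rw [hd]; exact I.zero_mem
    | succ n ih =>
      intro p hp hd
      have hd' : p.degree ≤ n := by
        rw [degree_le_iff_coeff_zero]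
        rw [degree_lt_iff_coeff_zero] at hd
        intro m hm
        exact hd m (by exact_mod_cast hm)
      obtain ⟨q, hq, hqd, hqc⟩ := mem_topCoeffIdeal.1 (h n (mem_topCoeffIdeal.2 ⟨p, hp, hd', rfl⟩))
      have : p - q ∈ I := by
        refine ih _ (J.sub_mem hp (hIJ hq)) ?_
        rw [degree_lt_iff_coeff_zero]
        intro m hm
        rcases hm.eq_or_lt with rfl | hm
        · simp [hqc]
        · have hm' : ((n : ℕ) : WithBot ℕ) < m := by exact_mod_cast hm
          rw [coeff_sub, coeff_eq_zero_of_degree_lt (hd'.trans_lt hm'),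
            coeff_eq_zero_of_degree_lt (hqd.trans_lt hm'), sub_zero]
      simpa using I.add_mem this hq
  intro p hp
  refine key (p.natDegree + 1) p hp (lt_of_le_of_lt degree_le_natDegree ?_)
  exact_mod_cast Nat.lt_succ_self _

/-- **Hilbert basis theorem** for left noetherian rings. -/
theorem isNoetherianRing_polynomial [IsNoetherianRing A] : IsNoetherianRing A[X] := by
  rw [isNoetherianRing_iff, ← monotone_stabilizes_iff_noetherian]
  intro f
  obtain ⟨N, hN⟩ := monotone_stabilizes_iff_noetherian.2 (inferInstanceAs (IsNoetherian A A))
    ⟨fun d => topCoeffIdeal (f d) d, fun a b h => topCoeffIdeal_mono (f.monotone h) h⟩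
  choose g hg using fun n => monotone_stabilizes_iff_noetherian.2
    (inferInstanceAs (IsNoetherian A A))
    ⟨fun d => topCoeffIdeal (f d) n, fun a b h => topCoeffIdeal_mono (f.monotone h) le_rfl⟩
  let M := max N ((Finset.range N).sup g)
  refine ⟨M, fun m hm => le_antisymm (f.monotone hm) ?_⟩
  refine le_of_topCoeffIdeal_le (f.monotone hm) fun n => ?_
  have hNM : N ≤ M := le_max_left _ _
  rcases lt_or_ge n N with hn | hn
  · have h1 : g n ≤ M := (Finset.le_sup (f := g) (Finset.mem_range.2 hn)).trans (le_max_right _ _)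
    have h2 := hg n m (h1.trans hm)
    have h3 := hg n M h1
    exact (h2.symm.trans h3).le
  · have h1 : topCoeffIdeal (f N) N = topCoeffIdeal (f (max n m)) (max n m) :=
      hN (max n m) (hn.trans (le_max_left _ _))
    calc topCoeffIdeal (f m) n ≤ topCoeffIdeal (f (max n m)) (max n m) :=
          topCoeffIdeal_mono (f.monotone (le_max_right _ _)) (le_max_left _ _)
      _ = topCoeffIdeal (f N) N := h1.symm
      _ ≤ _ := topCoeffIdeal_mono (f.monotone hNM) hn

end hilbertBasis

lemma isNoetherianRing_closure_insert {B : Type*} [Ring B] {S : Set B}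
    [IsNoetherianRing (Subring.closure S)] {t : B} (ht : ∀ s ∈ S, Commute s t) :
    IsNoetherianRing (Subring.closure (insert t S)) := by
  have : IsNoetherianRing (Polynomial (Subring.closure S)) := isNoetherianRing_polynomial
  have hle : Subring.closure S ≤ Subring.closure (insert t S) :=
    Subring.closure_mono (Set.subset_insert _ _)
  let t' : Subring.closure (insert t S) := ⟨t, Subring.subset_closure (Set.mem_insert _ _)⟩
  have hc : ∀ a : Subring.closure S, Commute (Subring.inclusion hle a) t' := by
    rintro ⟨a, ha⟩
    have : a ∈ Subring.centralizer {t} := by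
      refine Subring.closure_le.2 (fun s hs => ?_) ha
      rw [SetLike.mem_coe, Subring.mem_centralizer_iff]
      rintro _ rfl
      exact (ht s hs).symm
    exact Subtype.ext ((Subring.mem_centralizer_iff.1 this t rfl).symm)
  let g := Polynomial.eval₂RingHom' (Subring.inclusion hle) t' hc
  refine isNoetherianRing_of_surjective _ _ g ?_
  have hr : Subring.closure (insert t S) ≤ g.range.map (Subring.closure (insert t S)).subtype := by
    refine Subring.closure_le.2 ?_
    rintro s (rfl | hs)
    · exact ⟨t', ⟨Polynomial.X, by simp [g]⟩, rfl⟩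
    · exact ⟨⟨s, Subring.subset_closure (Set.mem_insert_of_mem _ hs)⟩,
        ⟨Polynomial.C ⟨s, Subring.subset_closure hs⟩, by simp [g]; rfl⟩, rfl⟩
  rintro ⟨x, hx⟩
  obtain ⟨y, ⟨p, hp⟩, hy⟩ := hr hx
  exact ⟨p, hp.trans (Subtype.ext hy)⟩

/-- Adjoining finitely many commuting elements preserves the left noetherian property. -/
theorem isNoetherianRing_closure_union {A B : Type*} [Ring A] [Ring B] [IsNoetherianRing A]
    (f : A →+* B) {T : Set B} (hT : T.Finite) (h1 : ∀ a, ∀ t ∈ T, Commute (f a) t)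
    (h2 : ∀ s ∈ T, ∀ t ∈ T, Commute s t) :
    IsNoetherianRing (Subring.closure (Set.range f ∪ T)) := by
  induction T, hT using Set.Finite.induction_on with
  | empty =>
    have : Subring.closure (Set.range f ∪ ∅) = f.range := by
      rw [Set.union_empty]; exact Subring.closure_eq f.range
    rw [this]
    exact isNoetherianRing_of_surjective _ _ f.rangeRestrict f.rangeRestrict_surjective
  | insert _ _ ih =>
    have := ih (fun a t ht => h1 a t (Set.mem_insert_of_mem _ ht))
      (fun s hs t ht => h2 s (Set.mem_insert_of_mem _ hs) t (Set.mem_insert_of_mem _ ht))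
    rw [Set.union_insert]
    refine isNoetherianRing_closure_insert ?_
    rintro s (⟨a, rfl⟩ | hs)
    · exact h1 a _ (Set.mem_insert _ _)
    · exact h2 s (Set.mem_insert_of_mem _ hs) _ (Set.mem_insert _ _)

/-- A localization of a left noetherian ring is left noetherian. -/
theorem isNoetherianRing_of_unit_mul_mem_range {C B : Type*} [Ring C] [Ring B]
    [IsNoetherianRing C] (f : C →+* B) (h : ∀ b, ∃ u : B, IsUnit u ∧ ∃ c, f c = u * b) :
    IsNoetherianRing B := by
  have hmono : StrictMono (fun I : Ideal B => I.comap f) := by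
    refine Monotone.strictMono_of_injective (fun I J h => Ideal.comap_mono h) fun I J hIJ => ?_
    have : ∀ I J : Ideal B, I.comap f = J.comap f → I ≤ J := by
      intro I J hIJ b hb
      obtain ⟨u, hu, c, hc⟩ := h b
      have h1 : c ∈ I.comap f := by rw [Ideal.mem_comap, hc]; exact I.mul_mem_left _ hb
      rw [hIJ, Ideal.mem_comap, hc] at h1
      obtain ⟨u, rfl⟩ := hu
      simpa using J.mul_mem_left (↑u⁻¹ : B) h1
    exact le_antisymm (this I J hIJ) (this J I hIJ.symm)
  have : WellFoundedGT (Ideal C) := inferInstanceAs (WellFoundedGT (Submodule C C))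
  have : WellFoundedGT (Ideal B) := hmono.wellFoundedGT
  exact isNoetherianRing_iff.2 (isNoetherian_iff'.2 this)

section KTensor

variable {k K H : Type u} [Field k] [Field K] [Algebra k K] [Ring H] [Algebra k H]

open TensorProduct

theorem MultilinearPI.baseChange {D : ℕ} (hD : MultilinearPI k H D) :
    MultilinearPI K (K ⊗[k] H) D := by
  obtain ⟨a, ha, h⟩ := hD
  refine ⟨fun σ => algebraMap k K (a σ), by simpa using ha, ?_⟩
  let F (σ : Equiv.Perm (Fin D)) : MultilinearMap K (fun _ : Fin D => K ⊗[k] H) (K ⊗[k] H) :=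
    (MultilinearMap.mkPiAlgebraFin K D (K ⊗[k] H)).domDomCongr σ
  let G := ∑ σ, algebraMap k K (a σ) • F σ
  have hG : ∀ x, G x = ∑ σ, algebraMap k K (a σ) • (List.ofFn fun i => x (σ i)).prod := by
    intro x
    simp [G, F]
  suffices G = 0 by
    intro x
    rw [← hG, this]
    rfl
  refine Module.Basis.ext_multilinear
    (fun _ => (Module.Basis.ofVectorSpace k H).baseChange K) fun v => ?_
  rw [hG]
  change _ = (0 : K ⊗[k] H)
  have h2 := congrArg (Algebra.TensorProduct.includeRight : H →ₐ[k] K ⊗[k] H)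
    (h fun i => Module.Basis.ofVectorSpace k H (v i))
  rw [map_zero, map_sum] at h2
  rw [← h2]
  refine Finset.sum_congr rfl fun σ _ => ?_
  rw [map_smul, map_list_prod, List.map_ofFn, algebraMap_smul]
  simp [Function.comp_def]

theorem isNoetherianRing_tensor {Z : Type u} [CommRing Z] [Algebra k Z] [Algebra Z K]
    [IsScalarTower k Z K] [Algebra.FiniteType k Z] [IsFractionRing Z K] [IsNoetherianRing H] :
    IsNoetherianRing (K ⊗[k] H) := by
  obtain ⟨s, hs⟩ := (inferInstance : Algebra.FiniteType k Z).out
  let ι : H →+* K ⊗[k] H := (Algebra.TensorProduct.includeRight : H →ₐ[k] K ⊗[k] H).toRingHom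
  let κ : Z →+* K ⊗[k] H :=
    (algebraMap K (K ⊗[k] H)).comp (algebraMap Z K)
  let C := Subring.closure (Set.range ι ∪ κ '' s)
  have hcomm : ∀ z : K, ∀ b : K ⊗[k] H, Commute b (algebraMap K (K ⊗[k] H) z) :=
    fun z b => (Algebra.commutes z b).symm
  have hC : IsNoetherianRing C := by
    refine isNoetherianRing_closure_union ι (s.finite_toSet.image κ) ?_ ?_
    · rintro a t ⟨z, -, rfl⟩
      exact hcomm _ _
    · rintro _ ⟨z, -, rfl⟩ _ ⟨z', -, rfl⟩
      exact hcomm _ _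
  have hι : ∀ h, ι h ∈ C := fun h => Subring.subset_closure (Or.inl ⟨h, rfl⟩)
  have hZ : ∀ z, κ z ∈ C := by
    intro z
    have hz : z ∈ Algebra.adjoin k (s : Set Z) := by rw [hs]; trivial
    induction hz using Algebra.adjoin_induction with
    | mem x hx => exact Subring.subset_closure (Or.inr ⟨x, hx, rfl⟩)
    | algebraMap r =>
      have : κ (algebraMap k Z r) = ι (algebraMap k H r) := by
        change algebraMap K (K ⊗[k] H) (algebraMap Z K (algebraMap k Z r)) =
          (Algebra.TensorProduct.includeRight : H →ₐ[k] K ⊗[k] H) (algebraMap k H r)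
        rw [← IsScalarTower.algebraMap_apply k Z K, AlgHom.commutes,
          ← IsScalarTower.algebraMap_apply k K (K ⊗[k] H)]
      rw [this]
      exact hι _
    | add x y _ _ hx hy => rw [map_add]; exact add_mem hx hy
    | mul x y _ _ hx hy => rw [map_mul]; exact mul_mem hx hy
  have hu : ∀ z : Z, z ∈ nonZeroDivisors Z → IsUnit (κ z) := fun z hz =>
    (IsLocalization.map_units K (⟨z, hz⟩ : nonZeroDivisors Z)).map (algebraMap K (K ⊗[k] H))
  have key : ∀ b : K ⊗[k] H, ∃ z ∈ nonZeroDivisors Z, κ z * b ∈ C := by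
    intro b
    induction b using TensorProduct.induction_on with
    | zero => exact ⟨1, one_mem _, by simp [C.zero_mem]⟩
    | tmul x h =>
      obtain ⟨⟨a, z⟩, hx⟩ := IsLocalization.surj (nonZeroDivisors Z) x
      refine ⟨z, z.2, ?_⟩
      have : κ z * x ⊗ₜ h = κ a * ι h := by
        simp only [κ, ι, RingHom.comp_apply, Algebra.TensorProduct.algebraMap_apply, ← hx]
        simp [mul_comm]
      rw [this]
      exact mul_mem (hZ _) (hι _)
    | add x y hx hy =>
      obtain ⟨z, hz, h1⟩ := hx
      obtain ⟨w, hw, h2⟩ := hy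
      refine ⟨z * w, mul_mem hz hw, ?_⟩
      have : κ (z * w) * (x + y) = κ w * (κ z * x) + κ z * (κ w * y) := by
        rw [mul_add, map_mul, ← mul_assoc, ← mul_assoc, ← map_mul, ← map_mul, mul_comm w z]
      rw [this]
      exact add_mem (mul_mem (hZ _) h1) (mul_mem (hZ _) h2)
  refine isNoetherianRing_of_unit_mul_mem_range C.subtype fun b => ?_
  obtain ⟨z, hz, h⟩ := key b
  exact ⟨κ z, hu z hz, ⟨_, h⟩, rfl⟩

section Bimodule

variable (W : Type u) [AddCommGroup W] [Module k W] [Module K W] [Module H W]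
  [IsScalarTower k K W] [IsScalarTower k H W] [SMulCommClass K H W]

/-- The `K ⊗ H`-module attached to commuting actions of `K` and `H`. -/
abbrev tensorModule : Module (K ⊗[k] H) W := TensorProduct.Algebra.module

lemma tensorModule_isScalarTower :
    let _ : Module (K ⊗[k] H) W := tensorModule W
    IsScalarTower K (K ⊗[k] H) W := by
  let _ : Module (K ⊗[k] H) W := tensorModule W
  refine ⟨fun a b w => ?_⟩
  induction b using TensorProduct.induction_on with
  | zero => simp
  | tmul x h =>
    rw [TensorProduct.smul_tmul', TensorProduct.Algebra.smul_def, TensorProduct.Algebra.smul_def,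
      smul_assoc]
  | add x y hx hy => rw [smul_add, add_smul, hx, hy, add_smul, smul_add]

end Bimodule

end KTensor

section BaseChange

open TensorProduct

/-- The base change `K ⊗[R] M` of a module `M` with a commuting `H`-action. -/
def BC (R K M : Type u) [CommRing R] [CommRing K] [Algebra R K] [AddCommGroup M] [Module R M] :
    Type u := K ⊗[R] M

variable {R K M M' H k : Type u} [CommRing R] [CommRing K] [Algebra R K] [AddCommGroup M]
  [Module R M] [AddCommGroup M'] [Module R M'] [Ring H] [Module H M] [SMulCommClass H R M]
  [Module H M'] [SMulCommClass H R M']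

noncomputable instance : AddCommGroup (BC R K M) := inferInstanceAs (AddCommGroup (K ⊗[R] M))
noncomputable instance : Module K (BC R K M) := inferInstanceAs (Module K (K ⊗[R] M))

/-- The action of an element of `H` on the base change. -/
noncomputable def BC.act (h : H) : BC R K M →ₗ[K] BC R K M :=
  (DistribSMul.toLinearMap R M h).baseChange K

lemma baseChange_toLinearMap_one :
    (DistribSMul.toLinearMap R M (1 : H)).baseChange K = LinearMap.id := by
  have : DistribSMul.toLinearMap R M (1 : H) = LinearMap.id := by ext; simp
  rw [this, LinearMap.baseChange_id]

lemma baseChange_toLinearMap_mul (a b : H) :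
    (DistribSMul.toLinearMap R M (a * b)).baseChange K =
      (DistribSMul.toLinearMap R M a).baseChange K ∘ₗ
        (DistribSMul.toLinearMap R M b).baseChange K := by
  rw [← LinearMap.baseChange_comp]
  congr 1
  ext; simp [mul_smul]

lemma baseChange_toLinearMap_add (a b : H) :
    (DistribSMul.toLinearMap R M (a + b)).baseChange K =
      (DistribSMul.toLinearMap R M a).baseChange K +
        (DistribSMul.toLinearMap R M b).baseChange K := by
  rw [← LinearMap.baseChange_add]
  congr 1
  ext; simp [add_smul]

lemma baseChange_toLinearMap_zero :
    (DistribSMul.toLinearMap R M (0 : H)).baseChange K = 0 := by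
  have : DistribSMul.toLinearMap R M (0 : H) = 0 := by ext; simp
  rw [this, LinearMap.baseChange_zero]

noncomputable instance : Module H (BC R K M) where
  smul h x := BC.act h x
  one_smul x := LinearMap.congr_fun baseChange_toLinearMap_one x
  mul_smul a b x := LinearMap.congr_fun (baseChange_toLinearMap_mul a b) x
  smul_zero a := map_zero (BC.act a)
  smul_add a := map_add (BC.act a)
  add_smul a b x := LinearMap.congr_fun (baseChange_toLinearMap_add a b) x
  zero_smul x := LinearMap.congr_fun (baseChange_toLinearMap_zero (H := H)) x

instance : SMulCommClass K H (BC R K M) where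
  smul_comm a h x := ((BC.act h).map_smul a x).symm

/-- The pure tensor `a ⊗ m`. -/
def BC.tmul (R : Type u) {K M : Type u} [CommRing R] [CommRing K] [Algebra R K] [AddCommGroup M]
    [Module R M] (a : K) (m : M) : BC R K M := a ⊗ₜ[R] m

lemma BC.smul_tmul' (a b : K) (m : M) : a • BC.tmul R b m = BC.tmul R (a * b) m := rfl

/-- `m ↦ 1 ⊗ m`. -/
noncomputable def BC.mk (R K M H : Type u) [CommRing R] [CommRing K] [Algebra R K]
    [AddCommGroup M] [Module R M] [Ring H] [Module H M] [SMulCommClass H R M] :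
    M →ₗ[H] BC R K M where
  toFun m := BC.tmul R 1 m
  map_add' := TensorProduct.tmul_add 1
  map_smul' _ _ := rfl

lemma BC.mk_apply (m : M) : BC.mk R K M H m = BC.tmul R 1 m := rfl

lemma BC.tmul_eq (a : K) (m : M) : BC.tmul R a m = a • BC.mk R K M H m := by
  rw [BC.mk_apply, BC.smul_tmul', mul_one]

lemma BC.mk_smul (r : R) (m : M) :
    BC.mk R K M H (r • m) = algebraMap R K r • BC.mk R K M H m := by
  rw [← BC.tmul_eq]
  change (1 : K) ⊗ₜ[R] (r • m) = algebraMap R K r ⊗ₜ[R] m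
  rw [← TensorProduct.smul_tmul, Algebra.algebraMap_eq_smul_one]

lemma BC.span_range : Submodule.span K (Set.range (BC.mk R K M H)) = ⊤ := by
  rw [eq_top_iff]
  rintro x -
  induction x using TensorProduct.induction_on with
  | zero => exact zero_mem _
  | tmul a m =>
    change BC.tmul R a m ∈ _
    rw [BC.tmul_eq (H := H)]
    exact Submodule.smul_mem _ _ (Submodule.subset_span ⟨m, rfl⟩)
  | add x y hx hy => exact add_mem hx hy

/-- The induced map on base changes. -/
noncomputable def BC.map (K : Type u) [CommRing K] [Algebra R K] (f : M →ₗ[R] M') :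
    BC R K M →ₗ[K] BC R K M' := f.baseChange K

end BaseChange

section RF

open TensorProduct

variable {k K H Z : Type u} [Field k] [Field K] [Algebra k K] [Ring H] [Algebra k H]

/-- A `K`-subspace stable under `H`, as a `K ⊗ H`-submodule. -/
def tensorSubmodule {W : Type u} [AddCommGroup W] [Module k W] [Module K W] [Module H W]
    [IsScalarTower k K W] [IsScalarTower k H W] [SMulCommClass K H W] (U : Submodule K W)
    (h : ∀ a : H, ∀ x ∈ U, a • x ∈ U) :
    let _ : Module (K ⊗[k] H) W := tensorModule W
    Submodule (K ⊗[k] H) W :=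
  let _ : Module (K ⊗[k] H) W := tensorModule W
  { carrier := U
    add_mem' := U.add_mem
    zero_mem' := U.zero_mem
    smul_mem' := fun b x hx => by
      induction b using TensorProduct.induction_on with
      | zero => rw [zero_smul]; exact U.zero_mem
      | tmul a b => exact U.smul_mem _ (h _ _ hx)
      | add a b ha hb => rw [add_smul]; exact U.add_mem ha hb }

lemma tensorModule_finite {W : Type u} [AddCommGroup W] [Module k W] [Module K W] [Module H W]
    [IsScalarTower k K W] [IsScalarTower k H W] [SMulCommClass K H W]
    {M : Type u} [AddCommGroup M] [Module H M] [Module.Finite H M] (f : M →ₗ[H] W)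
    (hf : Submodule.span K (Set.range f) = ⊤) :
    let _ : Module (K ⊗[k] H) W := tensorModule W
    Module.Finite (K ⊗[k] H) W := by
  let _ : Module (K ⊗[k] H) W := tensorModule W
  obtain ⟨t, ht⟩ := (inferInstance : Module.Finite H M).fg_top
  classical
  refine ⟨⟨t.image f, eq_top_iff.2 ?_⟩⟩
  have h1 : ∀ m, f m ∈ Submodule.span (K ⊗[k] H) ((t.image f : Finset W) : Set W) := by
    intro m
    have hm : m ∈ Submodule.span H (t : Set M) := by rw [ht]; trivial
    induction hm using Submodule.span_induction with
    | mem x hx => exact Submodule.subset_span (Finset.mem_image_of_mem f hx)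
    | zero => rw [map_zero]; exact zero_mem _
    | add x y _ _ hx hy => rw [map_add]; exact add_mem hx hy
    | smul a x _ hx =>
      have : f (a • x) = ((1 : K) ⊗ₜ[k] a) • f x := by
        rw [map_smul, TensorProduct.Algebra.smul_def, one_smul]
      rw [this]
      exact Submodule.smul_mem _ _ hx
  rintro w -
  have hw : w ∈ Submodule.span K (Set.range f) := by rw [hf]; trivial
  induction hw using Submodule.span_induction with
  | mem x hx => obtain ⟨m, rfl⟩ := hx; exact h1 m
  | zero => exact zero_mem _
  | add x y _ _ hx hy => exact add_mem hx hy
  | smul a x _ hx =>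
    have : a • x = (a ⊗ₜ[k] (1 : H)) • x := by
      rw [TensorProduct.Algebra.smul_def, one_smul]
    rw [this]
    exact Submodule.smul_mem _ _ hx

variable [CommRing Z] [Algebra k Z] [Algebra Z K] [IsScalarTower k Z K]
  {N : Type u} [AddCommGroup N] [Module k N] [Module Z N] [IsScalarTower k Z N]
  [Module H N] [IsScalarTower k H N] [SMulCommClass H Z N]

noncomputable instance BC.instModuleBase {R : Type u} [CommRing R] [Algebra R K] [Module R N] :
    Module R (BC R K N) :=
  inferInstanceAs (Module R (K ⊗[R] N))

instance {R : Type u} [CommRing R] [Algebra R K] [Module R N] : IsScalarTower R K (BC R K N) :=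
  inferInstanceAs (IsScalarTower R K (K ⊗[R] N))

instance {R : Type u} [CommRing R] [Algebra R K] [Algebra R H] [Module R N]
    [IsScalarTower R H N] : IsScalarTower R H (BC R K N) where
  smul_assoc c h x := by
    have : DistribSMul.toLinearMap R N (c • h) = c • DistribSMul.toLinearMap R N h := by
      ext; simp
    have h2 : (DistribSMul.toLinearMap R N (c • h)).baseChange K =
      c • (DistribSMul.toLinearMap R N h).baseChange K := by
      rw [this, LinearMap.baseChange_smul]
    exact LinearMap.congr_fun h2 x

/-- The canonical map `K ⊗[k] N → K ⊗[Z] N`. -/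
noncomputable def BC.proj (k K Z H N : Type u) [Field k] [Field K] [Algebra k K] [Ring H]
    [CommRing Z] [Algebra k Z] [Algebra Z K] [IsScalarTower k Z K]
    [AddCommGroup N] [Module k N] [Module Z N] [IsScalarTower k Z N]
    [Module H N] [SMulCommClass H Z N] :
    BC k K N →ₗ[K] BC Z K N :=
  let _ : Module k (BC Z K N) := Module.compHom _ (algebraMap k Z)
  have : IsScalarTower k K (BC Z K N) := ⟨fun a b x => by
    change (a • b) • x = algebraMap k Z a • b • x
    rw [← smul_assoc, algebraMap_smul]⟩
  LinearMap.liftBaseChange K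
    { toFun := BC.mk Z K N H
      map_add' := map_add _
      map_smul' := fun c x => by
        change BC.mk Z K N H (c • x) = algebraMap k Z c • BC.mk Z K N H x
        rw [← algebraMap_smul Z c x, BC.mk_smul, algebraMap_smul] }

omit [Algebra k H] [IsScalarTower k H N] in
lemma BC.proj_mk [SMulCommClass H k N] (x : N) :
    BC.proj k K Z H N (BC.mk k K N H x) = BC.mk Z K N H x := by
  change (1 : K) • BC.mk Z K N H x = _
  rw [one_smul]

lemma BC.linearMap_ext {R W : Type u} [CommRing R] [Algebra R K] [Module R N] [SMulCommClass H R N]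
    [AddCommGroup W] [Module K W] {f g : BC R K N →ₗ[K] W}
    (h : ∀ x, f (BC.mk R K N H x) = g (BC.mk R K N H x)) : f = g := by
  refine LinearMap.ext_on_range (BC.span_range (R := R) (K := K) (M := N) (H := H)) h

lemma BC.proj_smul (a : H) (x : BC k K N) :
    BC.proj k K Z H N (a • x) = a • BC.proj k K Z H N x := by
  have : BC.proj k K Z H N ∘ₗ BC.act a = BC.act a ∘ₗ BC.proj k K Z H N := by
    refine BC.linearMap_ext (H := H) fun x => ?_
    change BC.proj k K Z H N (a • BC.mk k K N H x) = a • BC.proj k K Z H N (BC.mk k K N H x)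
    rw [← map_smul, BC.proj_mk, BC.proj_mk, map_smul]
  exact LinearMap.congr_fun this x

lemma BC.mk_injective {R K N H : Type u} [CommRing R] [IsDomain R] [Field K] [Algebra R K]
    [IsFractionRing R K] [AddCommGroup N] [Module R N] [Ring H] [Module H N] [SMulCommClass H R N]
    (htf : ∀ (z : R) (n : N), z • n = 0 → z = 0 ∨ n = 0) :
    Function.Injective (BC.mk R K N H) := by
  rw [injective_iff_map_eq_zero]
  intro x hx
  have : IsLocalizedModule (nonZeroDivisors R) (TensorProduct.mk R K N 1) := inferInstance
  obtain ⟨c, hc⟩ := (IsLocalizedModule.eq_zero_iff (nonZeroDivisors R)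
    (TensorProduct.mk R K N 1)).1 hx
  exact (htf _ _ hc).resolve_left (nonZeroDivisors.ne_zero c.2)

/-- The `H`-module underlying a `K ⊗ H`-module. -/
abbrev moduleOfTensor (k K H W : Type u) [Field k] [Field K] [Algebra k K] [Ring H] [Algebra k H]
    [AddCommGroup W] [Module (K ⊗[k] H) W] : Module H W :=
  Module.compHom W (Algebra.TensorProduct.includeRight : H →ₐ[k] K ⊗[k] H).toRingHom

lemma moduleOfTensor_smulCommClass {W : Type u} [AddCommGroup W] [Module K W]
    [Module (K ⊗[k] H) W] [IsScalarTower K (K ⊗[k] H) W] :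
    let _ : Module H W := moduleOfTensor k K H W
    SMulCommClass K H W := by
  let _ : Module H W := moduleOfTensor k K H W
  refine ⟨fun a h w => ?_⟩
  have h1 : ∀ w : W, a • w = (algebraMap K (K ⊗[k] H) a) • w := fun w => by rw [algebraMap_smul]
  have h2 : ∀ w : W, h • w = (1 ⊗ₜ h : K ⊗[k] H) • w := fun w => rfl
  rw [h1, h2, h2, h1, smul_smul, smul_smul, Algebra.commutes]

/-- A finitely generated module embeds on a torsion-free submodule of finite rank into a
finite-dimensional `K`-representation. -/
theorem exists_injective_on_finite [IsDomain Z] [Algebra.FiniteType k Z] [IsFractionRing Z K]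
    [IsNoetherianRing H] {D : ℕ} (hD : MultilinearPI k H D)
    {M : Type u} [AddCommGroup M] [Module H M] [Module k M] [IsScalarTower k H M]
    [Module.Finite H M] (N : Submodule H M) [Module Z N] [SMulCommClass H Z N]
    [IsScalarTower k Z N] (htf : ∀ (z : Z) (n : N), z • n = 0 → z = 0 ∨ n = 0)
    [Module.Finite K (BC Z K N)] :
    ∃ (W : Type u) (_ : AddCommGroup W) (_ : Module K W) (_ : Module H W),
      SMulCommClass K H W ∧ (∀ (c : k) (w : W), algebraMap k H c • w = algebraMap k K c • w) ∧
      Module.Finite K W ∧ ∃ f : M →ₗ[H] W, ∀ x ∈ N, f x = 0 → x = 0 := by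
  have : IsNoetherianRing (K ⊗[k] H) := isNoetherianRing_tensor (Z := Z)
  have hD' : MultilinearPI K (K ⊗[k] H) D := hD.baseChange
  let _ : Module (K ⊗[k] H) (BC k K M) := tensorModule _
  have : IsScalarTower K (K ⊗[k] H) (BC k K M) := tensorModule_isScalarTower _
  have : Module.Finite (K ⊗[k] H) (BC k K M) :=
    tensorModule_finite (BC.mk k K M H) BC.span_range
  let π := BC.proj k K Z H N
  let j : BC k K N →ₗ[K] BC k K M := BC.map K (N.subtype.restrictScalars k)
  have hjmk : ∀ x : N, j (BC.mk k K N H x) = BC.mk k K M H x := fun x => rfl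
  have hj : Function.Injective j :=
    Module.Flat.lTensor_preserves_injective_linearMap (M := K) (N.subtype.restrictScalars k)
      N.injective_subtype
  have hjH : ∀ (a : H) x, j (a • x) = a • j x := by
    intro a x
    have : j ∘ₗ BC.act a = BC.act a ∘ₗ j := by
      refine BC.linearMap_ext (H := H) fun x => ?_
      change j (a • BC.mk k K N H x) = a • j (BC.mk k K N H x)
      rw [← map_smul, hjmk, hjmk, ← map_smul]
      rfl
    exact LinearMap.congr_fun this x
  let U : Submodule (K ⊗[k] H) (BC k K M) := tensorSubmodule ((LinearMap.ker π).map j) (by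
    rintro a _ ⟨x, hx, rfl⟩
    refine ⟨a • x, ?_, hjH a x⟩
    have hx' : π x = 0 := hx
    change π (a • x) = 0
    rw [BC.proj_smul, show BC.proj k K Z H N x = 0 from hx', smul_zero])
  let S' : Submodule (K ⊗[k] H) (BC k K M) := tensorSubmodule (LinearMap.range j) (by
    rintro a _ ⟨x, rfl⟩
    exact ⟨a • x, hjH a x⟩)
  let S := S'.map U.mkQ
  have hS : Module.Finite K S := by
    let g : BC k K N →ₗ[K] (BC k K M ⧸ U) := (U.mkQ.restrictScalars K) ∘ₗ j
    have h1 : Module.Finite K (BC k K N ⧸ LinearMap.ker g) := by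
      refine finite_quotient_of_ker_le π fun x hx => ?_
      change U.mkQ (j x) = 0
      rw [Submodule.mkQ_apply, Submodule.Quotient.mk_eq_zero]
      exact ⟨x, hx, rfl⟩
    have h2 : Module.Finite K (LinearMap.range g) :=
      Module.Finite.equiv g.quotKerEquivRange
    let e : LinearMap.range g →ₗ[K] S :=
      { toFun := fun x => ⟨x.1, by
          obtain ⟨y, hy⟩ := x.2
          exact ⟨j y, ⟨y, rfl⟩, hy⟩⟩
        map_add' := fun _ _ => rfl
        map_smul' := fun _ _ => rfl }
    refine Module.Finite.of_surjective e ?_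
    rintro ⟨_, _, ⟨y, rfl⟩, rfl⟩
    exact ⟨⟨_, y, rfl⟩, rfl⟩
  obtain ⟨Y, hY, hfin⟩ := exists_cofinite_disjoint hD' S
  let W := (BC k K M ⧸ U) ⧸ Y
  let iH : Module H W := moduleOfTensor k K H W
  have hcH : ∀ (h : H) (w : W), h • w = (1 ⊗ₜ h : K ⊗[k] H) • w := fun _ _ => rfl
  let f : M →ₗ[H] W :=
    { toFun := fun m => Y.mkQ (U.mkQ (BC.mk k K M H m))
      map_add' := fun x y => by rw [map_add, map_add, map_add]
      map_smul' := fun h x => by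
        have : BC.mk k K M H (h • x) = (1 ⊗ₜ h : K ⊗[k] H) • BC.mk k K M H x := by
          rw [TensorProduct.Algebra.smul_def, one_smul, map_smul]
        rw [this, map_smul, map_smul, RingHom.id_apply, hcH] }
  refine ⟨W, inferInstance, inferInstance, iH, moduleOfTensor_smulCommClass, fun c w => ?_, hfin,
    f, fun x hx h0 => ?_⟩
  · rw [hcH, ← algebraMap_smul (K ⊗[k] H) (algebraMap k K c) w]
    congr 1
    rw [← IsScalarTower.algebraMap_apply k K (K ⊗[k] H)]
    exact AlgHom.commutes (Algebra.TensorProduct.includeRight : H →ₐ[k] K ⊗[k] H) c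
  · have h1 : U.mkQ (BC.mk k K M H x) ∈ Y := by
      have : Y.mkQ (U.mkQ (BC.mk k K M H x)) = 0 := h0
      rwa [Submodule.mkQ_apply, Submodule.Quotient.mk_eq_zero] at this
    have h2 : U.mkQ (BC.mk k K M H x) ∈ S := ⟨j (BC.mk k K N H ⟨x, hx⟩), ⟨_, rfl⟩, rfl⟩
    have h3 : U.mkQ (BC.mk k K M H x) = 0 := by
      have : U.mkQ (BC.mk k K M H x) ∈ Y ⊓ S := ⟨h1, h2⟩
      rwa [hY, Submodule.mem_bot] at this
    rw [Submodule.mkQ_apply, Submodule.Quotient.mk_eq_zero] at h3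
    obtain ⟨y, hy, hyx⟩ := h3
    have h4 : y = BC.mk k K N H ⟨x, hx⟩ := hj hyx
    have h5 : BC.mk Z K N H ⟨x, hx⟩ = 0 := by
      rw [← BC.proj_mk (k := k), ← h4]
      exact hy
    exact congrArg Subtype.val ((BC.mk_injective htf) (h5.trans (map_zero _).symm))

end RF

section Types

open Cardinal

/-- A torsion-free module of finite rank over the commutative domain `Z` acting by
`H`-endomorphisms. -/
structure IsType (k H Z N : Type u) [Field k] [Ring H] [Algebra k H] [CommRing Z] [Algebra k Z]
    [AddCommGroup N] [Module k N] [Module H N] [Module Z N] : Prop where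
  smulComm : SMulCommClass H Z N
  tower : IsScalarTower k Z N
  torsionFree : ∀ (z : Z) (n : N), z • n = 0 → z = 0 ∨ n = 0
  rank_lt : Module.rank Z N < ℵ₀

lemma BC.rank_eq {Z K N : Type u} [CommRing Z] [Field K] [Algebra Z K] [IsFractionRing Z K]
    [AddCommGroup N] [Module Z N] : Module.rank K (BC Z K N) = Module.rank Z N := by
  have h1 : Module.rank K (BC Z K N) = Module.rank Z (BC Z K N) :=
    IsLocalization.rank_eq K (nonZeroDivisors Z) le_rfl
  rw [h1]
  have h2 : Module.rank Z (TensorProduct Z K N) = Module.rank Z N :=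
    IsLocalizedModule.rank_eq (nonZeroDivisors Z) le_rfl (TensorProduct.mk Z K N 1)
  exact h2

lemma BC.finite_iff {Z K N : Type u} [CommRing Z] [Field K] [Algebra Z K] [IsFractionRing Z K]
    [AddCommGroup N] [Module Z N] : Module.Finite K (BC Z K N) ↔ Module.rank Z N < ℵ₀ := by
  rw [← BC.rank_eq (K := K)]
  exact Module.rank_lt_aleph0_iff.symm

variable {k H : Type u} [Field k] [Ring H] [Algebra k H]

theorem exists_central_type [IsNoetherianRing H] [Algebra.FiniteType k H] {D : ℕ}
    (hD : MultilinearPI k H D) (M : Type u) [AddCommGroup M] [Module H M] [Nontrivial M] :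
    ∃ N : Submodule H M, N ≠ ⊥ ∧ ∃ (s : ℕ)
      (φ : MvPolynomial (Fin s) k →ₐ[k] H ⧸ Module.annihilator H N),
      (∀ p, φ p ∈ Subring.center (H ⧸ Module.annihilator H N)) ∧
      (∃ (g : ℕ) (e : Fin g → H ⧸ Module.annihilator H N), ∀ r, ∃ q ≠ 0, ∃ c : Fin g → _,
        φ q * r = ∑ j, φ (c j) * e j) ∧
      ∀ p h (n : N), φ p = Ideal.Quotient.mk _ h → h • n = 0 → p = 0 ∨ n = 0 := by
  obtain ⟨N, hN0, hN, hP⟩ := exists_prime_submodule (A := H) (M := M)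
  have : IsNoetherianRing (H ⧸ Module.annihilator H N) :=
    isNoetherianRing_of_surjective _ _ (Ideal.Quotient.mk _) Ideal.Quotient.mk_surjective
  have : Algebra.FiniteType k (H ⧸ Module.annihilator H N) :=
    Algebra.FiniteType.of_surjective (Ideal.Quotient.mkₐ k (Module.annihilator H N))
      Ideal.Quotient.mk_surjective
  obtain ⟨s, φ, hφ, hc, he⟩ := IsPrimeRing'.exists_polynomial_subalgebra hP
    (hD.of_surjective (Ideal.Quotient.mkₐ k (Module.annihilator H N))
      Ideal.Quotient.mk_surjective)
  refine ⟨N, hN0, s, φ, hc, he, fun p h n hp hn => ?_⟩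
  by_contra! hcon
  obtain ⟨hp0, hn0⟩ := hcon
  let T : Submodule H M :=
    { carrier := {m | m ∈ N ∧ h • m = 0}
      add_mem' := fun {a b} ha hb => ⟨N.add_mem ha.1 hb.1, by rw [smul_add, ha.2, hb.2, add_zero]⟩
      zero_mem' := ⟨N.zero_mem, smul_zero _⟩
      smul_mem' := fun a m hm => ⟨N.smul_mem _ hm.1, by
        have h1 : h * a - a * h ∈ Module.annihilator H N := by
          rw [← Ideal.Quotient.eq, map_mul, map_mul, ← hp]
          exact (Subring.mem_center_iff.1 (hc p) _).symm
        have h2 : (h * a - a * h) • (⟨m, hm.1⟩ : N) = 0 := Module.mem_annihilator.1 h1 _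
        have h3 : (h * a - a * h) • m = 0 := congrArg Subtype.val h2
        rw [sub_smul, mul_smul, mul_smul, hm.2, smul_zero, sub_zero] at h3
        exact h3⟩ }
  have hT : T.annihilator = N.annihilator := by
    refine hN T (fun m hm => hm.1) fun h0 => hn0 ?_
    have : (n : M) ∈ T := ⟨n.2, congrArg Subtype.val hn⟩
    rw [h0, Submodule.mem_bot] at this
    exact Subtype.ext this
  have h4 : h ∈ T.annihilator := by
    rw [Submodule.mem_annihilator]
    exact fun m hm => hm.2
  rw [hT] at h4
  refine hp0 (hφ ?_)
  rw [hp, map_zero]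
  exact Ideal.Quotient.eq_zero_iff_mem.2 h4

/-- Modules over which `Z` acts through a central map to a quotient of `H` over which the quotient
has finite rank. -/
theorem finite_BC_of_central {Z : Type u} [CommRing Z] [IsDomain Z] {K : Type u} [Field K]
    [Algebra Z K]
    [IsFractionRing Z K] {P : Ideal H} [P.IsTwoSided] (φ : Z →+* H ⧸ P)
    {g : ℕ} {e : Fin g → H ⧸ P}
    (he : ∀ r, ∃ q ≠ 0, ∃ c : Fin g → Z, φ q * r = ∑ j, φ (c j) * e j)
    {B : Type u} [AddCommGroup B] [Module H B] [Module.Finite H B] [Module Z B]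
    (hB : ∀ z h (b : B), φ z = Ideal.Quotient.mk _ h → z • b = h • b) :
    Module.Finite K (BC Z K B) := by
  classical
  have hP : ∀ p ∈ P, ∀ b : B, p • b = 0 := by
    intro p hp b
    rw [← hB 0 p b, zero_smul]
    rw [map_zero]
    exact (Ideal.Quotient.eq_zero_iff_mem.2 hp).symm
  obtain ⟨t, ht⟩ := (inferInstance : Module.Finite H B).fg_top
  choose ε hε using fun j => Ideal.Quotient.mk_surjective (e j)
  let S : Finset (BC Z K B) := (Finset.univ ×ˢ t).image fun p => BC.mk Z K B Z (ε p.1 • p.2)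
  refine ⟨⟨S, eq_top_iff.2 ?_⟩⟩
  rw [← BC.span_range (R := Z) (K := K) (M := B) (H := Z), Submodule.span_le]
  rintro _ ⟨b, rfl⟩
  have hb : b ∈ Submodule.span H (t : Set B) := by rw [ht]; trivial
  have key : ∀ b ∈ t, ∀ h : H, BC.mk Z K B Z (h • b) ∈ Submodule.span K (S : Set (BC Z K B)) := by
    intro b hb h
    obtain ⟨q, hq, c, hc⟩ := he (Ideal.Quotient.mk P h)
    obtain ⟨q', hq'⟩ := Ideal.Quotient.mk_surjective (φ q)
    choose c' hc' using fun j => Ideal.Quotient.mk_surjective (φ (c j))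
    have h1 : q • (h • b) = ∑ j, c j • (ε j • b) := by
      rw [hB q q' _ hq'.symm]
      have : ∀ j, c j • (ε j • b) = (c' j * ε j) • b := fun j => by
        rw [hB (c j) (c' j) _ (hc' j).symm, mul_smul]
      rw [Finset.sum_congr rfl fun j _ => this j, ← Finset.sum_smul, ← mul_smul, ← sub_eq_zero,
        ← sub_smul]
      refine hP _ ?_ b
      rw [← Ideal.Quotient.eq, map_mul, map_sum, hq', hc]
      simp only [map_mul, hc', hε]
    have h2 : algebraMap Z K q • BC.mk Z K B Z (h • b) =
        ∑ j, algebraMap Z K (c j) • BC.mk Z K B Z (ε j • b) := by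
      rw [← BC.mk_smul, h1, map_sum]
      simp only [BC.mk_smul]
    have hq0 : algebraMap Z K q ≠ 0 := by
      rwa [Ne, IsFractionRing.to_map_eq_zero_iff]
    rw [← inv_smul_smul₀ hq0 (BC.mk Z K B Z (h • b)), h2]
    refine Submodule.smul_mem _ _ (Submodule.sum_mem _ fun j _ => Submodule.smul_mem _ _
      (Submodule.subset_span ?_))
    exact Finset.mem_image.2 ⟨(j, b), by simp [hb], rfl⟩
  have key2 : ∀ h : H, BC.mk Z K B Z (h • b) ∈ Submodule.span K (S : Set (BC Z K B)) := by
    induction hb using Submodule.span_induction with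
    | mem x hx => exact key x hx
    | zero => intro h; rw [smul_zero, map_zero]; exact zero_mem _
    | add x y _ _ hx hy => intro h; rw [smul_add, map_add]; exact add_mem (hx h) (hy h)
    | smul a x _ hx => intro h; rw [← mul_smul]; exact hx _
  simpa using key2 1

/-- The action of `Z` through a central map to a quotient of `H`. -/
abbrev centralModule {Z : Type u} [CommRing Z] {P : Ideal H} [P.IsTwoSided] (φ : Z →+* H ⧸ P)
    (B : Type u) [AddCommGroup B] [Module H B] (hB : P ≤ Module.annihilator H B) : Module Z B :=
  have h : Module.IsTorsionBySet H B P := fun b p => Module.mem_annihilator.1 (hB p.2) b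
  let _ : Module (H ⧸ P) B := h.module
  Module.compHom B φ

lemma centralModule_smul {Z : Type u} [CommRing Z] {P : Ideal H} [P.IsTwoSided] (φ : Z →+* H ⧸ P)
    (B : Type u) [AddCommGroup B] [Module H B] (hB : P ≤ Module.annihilator H B)
    (z : Z) (h : H) (b : B) (hz : φ z = Ideal.Quotient.mk _ h) :
    let _ : Module Z B := centralModule φ B hB
    z • b = h • b := by
  have h' : Module.IsTorsionBySet H B P := fun b p => Module.mem_annihilator.1 (hB p.2) b
  let _ : Module (H ⧸ P) B := h'.module
  change φ z • b = h • b
  rw [hz]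
  rfl

lemma smulCommClass_of_central {Z : Type u} [CommRing Z] {P : Ideal H} [P.IsTwoSided]
    (φ : Z →+* H ⧸ P) (hc : ∀ z, φ z ∈ Subring.center (H ⧸ P))
    {B : Type u} [AddCommGroup B] [Module H B] [Module Z B]
    (hB : ∀ z h (b : B), φ z = Ideal.Quotient.mk _ h → z • b = h • b) :
    SMulCommClass H Z B where
  smul_comm h z b := by
    obtain ⟨z', hz'⟩ := Ideal.Quotient.mk_surjective (φ z)
    rw [hB z z' _ hz'.symm, hB z z' _ hz'.symm, ← mul_smul, ← mul_smul, ← sub_eq_zero, ← sub_smul,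
      ← hB 0 (h * z' - z' * h) b, zero_smul]
    rw [map_zero, map_sub, map_mul, map_mul, hz', sub_eq_zero.2 (Subring.mem_center_iff.1 (hc z) _)]

theorem exists_type [IsNoetherianRing H] [Algebra.FiniteType k H] {D : ℕ}
    (hD : MultilinearPI k H D) (M : Type u) [AddCommGroup M] [Module H M] [Module k M]
    [IsScalarTower k H M] [Module.Finite H M] [Nontrivial M] :
    ∃ N : Submodule H M, N ≠ ⊥ ∧ ∃ (s : ℕ) (_ : Module (MvPolynomial (Fin s) k) N),
      IsType k H (MvPolynomial (Fin s) k) N := by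
  obtain ⟨N, hN, s, φ, hc, ⟨g, e, he⟩, htf⟩ := exists_central_type hD M
  let _ : Module (MvPolynomial (Fin s) k) N := centralModule φ.toRingHom N le_rfl
  have hB : ∀ z h (b : N), φ.toRingHom z = Ideal.Quotient.mk _ h → z • b = h • b :=
    fun z h b hz => centralModule_smul φ.toRingHom N le_rfl z h b hz
  have : Module.Finite H N := Module.Finite.of_fg (IsNoetherian.noetherian N)
  refine ⟨N, hN, s, inferInstance, smulCommClass_of_central φ.toRingHom hc hB, ⟨?_⟩, ?_, ?_⟩
  · intro c z n
    obtain ⟨h, hh⟩ := Ideal.Quotient.mk_surjective (φ z)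
    rw [hB z h _ hh.symm, hB (c • z) (c • h), smul_assoc]
    change φ (c • z) = Ideal.Quotient.mkₐ k _ (c • h)
    rw [map_smul, map_smul, ← hh]
    rfl
  · intro z n hzn
    obtain ⟨h, hh⟩ := Ideal.Quotient.mk_surjective (φ z)
    rw [hB z h _ hh.symm] at hzn
    exact htf z h n hh.symm hzn
  · exact (BC.finite_iff (K := FractionRing (MvPolynomial (Fin s) k))).1
      (finite_BC_of_central φ.toRingHom he hB)

end Types

section Lattice

open Cardinal

/-- A maximal independent family: every element has a nonzero multiple in its span. -/
lemma exists_fin_independent {Z N : Type*} [CommRing Z] [IsDomain Z] [AddCommGroup N] [Module Z N]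
    (h : Module.rank Z N < ℵ₀) :
    ∃ m : Fin (Module.finrank Z N) → N, LinearIndependent Z m ∧
      ∀ x, ∃ q : Z, q ≠ 0 ∧ q • x ∈ Submodule.span Z (Set.range m) := by
  have hr : (Module.finrank Z N : Cardinal) = Module.rank Z N := Cardinal.cast_toNat_of_lt_aleph0 h
  obtain ⟨m, hm⟩ := Module.le_rank_iff.1 hr.le
  refine ⟨m, hm, fun x => ?_⟩
  by_contra! hcon
  have h2 : LinearIndependent Z (Fin.cons x m : Fin (Module.finrank Z N + 1) → N) := by
    rw [Fintype.linearIndependent_iff]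
    intro g hg
    rw [Fin.sum_univ_succ] at hg
    simp only [Fin.cons_zero, Fin.cons_succ] at hg
    have h0 : g 0 = 0 := by
      by_contra h0
      refine hcon _ h0 ?_
      rw [eq_neg_of_add_eq_zero_left hg]
      exact neg_mem (Submodule.sum_mem _ fun i _ => Submodule.smul_mem _ _
        (Submodule.subset_span ⟨i, rfl⟩))
    rw [h0, zero_smul, zero_add] at hg
    intro i
    refine Fin.cases h0 (fun i => ?_) i
    exact Fintype.linearIndependent_iff.1 hm (fun i => g i.succ) hg i
  have h3 := Module.le_rank_iff.2 ⟨_, h2⟩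
  rw [← hr] at h3
  exact absurd (Nat.cast_le.1 h3) (by omega)

lemma exists_common_multiple {Z N : Type*} [CommRing Z] [IsDomain Z] [AddCommGroup N] [Module Z N]
    (L : Submodule Z N) (h : ∀ x, ∃ q : Z, q ≠ 0 ∧ q • x ∈ L) (X : Finset N) :
    ∃ q : Z, q ≠ 0 ∧ ∀ x ∈ X, q • x ∈ L := by
  classical
  induction X using Finset.induction_on with
  | empty => exact ⟨1, one_ne_zero, by simp⟩
  | insert a X _ ih =>
    obtain ⟨q, hq, hX⟩ := ih
    obtain ⟨p, hp, ha⟩ := h a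
    refine ⟨p * q, mul_ne_zero hp hq, fun x hx => ?_⟩
    obtain rfl | hx := Finset.mem_insert.1 hx
    · rw [mul_comm, mul_smul]; exact L.smul_mem _ ha
    · rw [mul_smul]; exact L.smul_mem _ (hX x hx)

/-- The elements carried into `L` by a power of `q`. -/
def powColon {Z N : Type*} [CommRing Z] [AddCommGroup N] [Module Z N] (q : Z) (L : Submodule Z N) :
    Submodule Z N where
  carrier := {x | ∃ n : ℕ, q ^ n • x ∈ L}
  zero_mem' := ⟨0, by simp⟩
  add_mem' := by
    rintro x y ⟨n, hn⟩ ⟨m, hm⟩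
    refine ⟨n + m, ?_⟩
    rw [smul_add]
    refine add_mem ?_ ?_
    · rw [pow_add, mul_comm, mul_smul]; exact L.smul_mem _ hn
    · rw [pow_add, mul_smul]; exact L.smul_mem _ hm
  smul_mem' := by
    rintro z x ⟨n, hn⟩
    exact ⟨n, by rw [smul_comm]; exact L.smul_mem _ hn⟩

/-- A finitely generated `H`-module mapping to a module of finite `Z`-rank lands in a localized
lattice. -/
theorem exists_lattice_of_map {k H Z N W : Type*} [Field k] [Ring H] [Algebra k H]
    [Algebra.FiniteType k H]
    [CommRing Z] [IsDomain Z] [Algebra k Z] [AddCommGroup N] [Module H N] [Module.Finite H N]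
    [AddCommGroup W] [Module k W] [Module H W] [IsScalarTower k H W] [Module Z W]
    [SMulCommClass H Z W] [IsScalarTower k Z W] (g : N →ₗ[H] W) {r : ℕ} (m : Fin r → W)
    (hx : ∀ x, ∃ q : Z, q ≠ 0 ∧ q • x ∈ Submodule.span Z (Set.range m)) :
    ∃ q : Z, q ≠ 0 ∧ ∀ x, ∃ n : ℕ, q ^ n • g x ∈ Submodule.span Z (Set.range m) := by
  classical
  obtain ⟨t, ht⟩ := (inferInstance : Module.Finite H N).fg_top
  obtain ⟨A, hA⟩ := Algebra.FiniteType.out (R := k) (A := H)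
  set L := Submodule.span Z (Set.range m) with hL
  obtain ⟨q, hq, hqX⟩ := exists_common_multiple L hx
    (t.image g ∪ (A ×ˢ Finset.univ).image fun p => p.1 • m p.2)
  have hT : ∀ x ∈ t, g x ∈ powColon q L := fun x hx =>
    ⟨1, by
      rw [pow_one]
      exact hqX _ (Finset.mem_union_left _ (Finset.mem_image_of_mem g hx))⟩
  have hAL : ∀ a ∈ A, ∀ x ∈ L, q • a • x ∈ L := by
    intro a ha x hx
    induction hx using Submodule.span_induction with
    | mem x hx =>
      obtain ⟨l, rfl⟩ := hx
      exact hqX _ (Finset.mem_union_right _ (Finset.mem_image.2 ⟨(a, l), by simp [ha], rfl⟩))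
    | zero => simp
    | add x y _ _ hx hy => rw [smul_add, smul_add]; exact add_mem hx hy
    | smul z x _ hx => rw [smul_comm a z, smul_comm q z]; exact L.smul_mem _ hx
  have hH : ∀ a : H, ∀ x ∈ powColon q L, a • x ∈ powColon q L := by
    intro a
    have ha : a ∈ Algebra.adjoin k (A : Set H) := by rw [hA]; trivial
    induction ha using Algebra.adjoin_induction with
    | mem a ha =>
      rintro x ⟨n, hn⟩
      refine ⟨n + 1, ?_⟩
      rw [pow_succ', mul_smul, ← smul_comm a]
      exact hAL a ha _ hn
    | algebraMap c =>
      intro x hx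
      rw [algebraMap_smul, ← algebraMap_smul Z]
      exact Submodule.smul_mem _ _ hx
    | add a b _ _ ha hb => intro x hx; rw [add_smul]; exact add_mem (ha x hx) (hb x hx)
    | mul a b _ _ ha hb => intro x hx; rw [mul_smul]; exact ha _ (hb x hx)
  refine ⟨q, hq, fun x => ?_⟩
  have hx : x ∈ Submodule.span H (t : Set N) := by rw [ht]; trivial
  change g x ∈ powColon q L
  induction hx using Submodule.span_induction with
  | mem x hx => exact hT x hx
  | zero => rw [map_zero]; exact zero_mem _
  | add x y _ _ hx hy => rw [map_add]; exact add_mem hx hy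
  | smul a x _ hx => rw [map_smul]; exact hH a _ hx

/-- A finitely generated `H`-module of finite `Z`-rank is contained in a localized lattice. -/
theorem exists_lattice {k H Z N : Type*} [Field k] [Ring H] [Algebra k H] [Algebra.FiniteType k H]
    [CommRing Z] [IsDomain Z] [Algebra k Z] [AddCommGroup N] [Module k N] [Module H N]
    [IsScalarTower k H N] [Module.Finite H N] [Module Z N] [SMulCommClass H Z N]
    [IsScalarTower k Z N] (h : Module.rank Z N < ℵ₀) :
    ∃ (m : Fin (Module.finrank Z N) → N) (q : Z), LinearIndependent Z m ∧ q ≠ 0 ∧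
      ∀ x, ∃ n : ℕ, q ^ n • x ∈ Submodule.span Z (Set.range m) := by
  obtain ⟨m, hm, hx⟩ := exists_fin_independent h
  obtain ⟨q, hq, h⟩ := exists_lattice_of_map (k := k) (LinearMap.id : N →ₗ[H] N) m hx
  exact ⟨m, q, hm, hq, h⟩

lemma IsType.finite_of_zero {k H N : Type u} [Field k] [Ring H] [Algebra k H]
    [Algebra.FiniteType k H] [AddCommGroup N] [Module k N] [Module H N]
    [IsScalarTower k H N] [Module.Finite H N] [Module (MvPolynomial (Fin 0) k) N]
    (h : IsType k H (MvPolynomial (Fin 0) k) N) : Module.Finite k N := by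
  have := h.smulComm
  have := h.tower
  obtain ⟨m, q, -, hq, hx⟩ := exists_lattice (k := k) (H := H) h.rank_lt
  obtain ⟨c, rfl⟩ := MvPolynomial.C_surjective (Fin 0) q
  have hc : c ≠ 0 := by rintro rfl; simp at hq
  have h1 : Module.Finite (MvPolynomial (Fin 0) k) N := by
    classical
    refine ⟨⟨Finset.univ.image m, eq_top_iff.2 fun x _ => ?_⟩⟩
    rw [Finset.coe_image, Finset.coe_univ, Set.image_univ]
    obtain ⟨n, hn⟩ := hx x
    have : x = (MvPolynomial.C (c⁻¹ ^ n) : MvPolynomial (Fin 0) k) •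
        (MvPolynomial.C c : MvPolynomial (Fin 0) k) ^ n • x := by
      rw [← map_pow, smul_smul, ← map_mul, ← mul_pow, inv_mul_cancel₀ hc, one_pow, map_one,
        one_smul]
    rw [this]
    exact Submodule.smul_mem _ _ hn
  have h2 : Module.Finite k (MvPolynomial (Fin 0) k) :=
    Module.Finite.equiv (MvPolynomial.isEmptyAlgEquiv k (Fin 0)).symm.toLinearEquiv
  exact Module.Finite.trans (MvPolynomial (Fin 0) k) N

lemma MvPolynomial.X_mul_ne_C {k : Type*} [Field k] {σ : Type*} (i : σ)
    {q : MvPolynomial σ k} (hq : q ≠ 0) (c : k) : MvPolynomial.X i * q ≠ MvPolynomial.C c := by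
  intro h
  have h2 := congrArg MvPolynomial.totalDegree h
  rw [MvPolynomial.totalDegree_C, MvPolynomial.totalDegree_mul_of_isDomain
    (MvPolynomial.X_ne_zero i) hq, MvPolynomial.totalDegree_X] at h2
  omega

lemma MvPolynomial.not_isUnit_one_add_X_mul {k : Type*} [Field k] {σ : Type*} (i : σ)
    {q : MvPolynomial σ k} (hq : q ≠ 0) : ¬ IsUnit (1 + MvPolynomial.X i * q) := by
  intro hu
  obtain ⟨c, hc, h⟩ := MvPolynomial.isUnit_iff_eq_C_of_isReduced.1 hu
  refine MvPolynomial.X_mul_ne_C i hq (c - 1) ?_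
  rw [map_sub, ← h, map_one]; ring

lemma IsType.finite_of_isSimple {k H N : Type u} {s : ℕ} [Field k] [Ring H] [Algebra k H]
    [Algebra.FiniteType k H] [AddCommGroup N] [Module k N] [Module H N]
    [IsScalarTower k H N] [IsSimpleModule H N] [Module (MvPolynomial (Fin s) k) N]
    (h : IsType k H (MvPolynomial (Fin s) k) N) : Module.Finite k N := by
  have := h.smulComm
  have := h.tower
  have hfin : Module.Finite H N := inferInstance
  obtain _ | s := s
  · exact h.finite_of_zero
  exfalso
  obtain ⟨m, q, hm, hq, hx⟩ := exists_lattice (k := k) (H := H) h.rank_lt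
  have hne : Nontrivial N := IsSimpleModule.nontrivial H N
  have hr : 0 < Module.finrank (MvPolynomial (Fin (s + 1)) k) N := by
    by_contra h0
    obtain ⟨x, hx0⟩ := exists_ne (0 : N)
    obtain ⟨n, hn⟩ := hx x
    have : IsEmpty (Fin (Module.finrank (MvPolynomial (Fin (s + 1)) k) N)) := by
      rw [Nat.eq_zero_of_not_pos h0]; infer_instance
    rw [Set.range_eq_empty, Submodule.span_empty, Submodule.mem_bot] at hn
    exact (h.torsionFree _ _ hn).elim (pow_ne_zero _ hq) hx0
  set f := 1 + MvPolynomial.X 0 * q with hf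
  have hu : ¬ IsUnit f := MvPolynomial.not_isUnit_one_add_X_mul 0 hq
  have hcomm : SMulCommClass (MvPolynomial (Fin (s + 1)) k) H N := SMulCommClass.symm _ _ _
  have hsurj : Function.Surjective (DistribSMul.toLinearMap H N f) := by
    refine (LinearMap.bijective_of_ne_zero (f := DistribSMul.toLinearMap H N f) fun h0 => ?_).2
    obtain ⟨x, hx0⟩ := exists_ne (0 : N)
    refine (h.torsionFree f x (LinearMap.congr_fun h0 x)).elim (fun hf0 => ?_) hx0
    refine MvPolynomial.X_mul_ne_C 0 hq (-1) ?_
    rw [map_neg, map_one]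
    linear_combination hf0
  obtain ⟨y, hy⟩ := hsurj (m ⟨0, hr⟩)
  replace hy : f • y = m ⟨0, hr⟩ := hy
  obtain ⟨n, hn⟩ := hx y
  rw [Submodule.mem_span_range_iff_exists_fun] at hn
  obtain ⟨c, hc⟩ := hn
  have h1 : ∑ l, (f * c l - if l = ⟨0, hr⟩ then q ^ n else 0) • m l = 0 := by
    simp only [sub_smul, Finset.sum_sub_distrib, mul_smul, ← Finset.smul_sum, hc, ite_smul,
      zero_smul, Finset.sum_ite_eq', Finset.mem_univ, if_true]
    rw [smul_comm, hy, sub_self]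
  have h2 := Fintype.linearIndependent_iff.1 hm _ h1 ⟨0, hr⟩
  rw [if_pos rfl, sub_eq_zero] at h2
  have hcop : IsCoprime f q := ⟨1, -MvPolynomial.X 0, by rw [hf]; ring⟩
  exact hu ((hcop.pow_right (n := n)).isUnit_of_dvd ⟨_, h2.symm⟩)

/-- A nonzero finitely generated module over an affine noetherian PI algebra has a nonzero
finite-dimensional quotient. -/
theorem exists_finite_quotient {k H : Type u} [Field k] [Ring H] [Algebra k H] [IsNoetherianRing H]
    [Algebra.FiniteType k H] {D : ℕ} (hD : MultilinearPI k H D) (M : Type u) [AddCommGroup M]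
    [Module H M] [Module k M] [IsScalarTower k H M] [Module.Finite H M] [Nontrivial M] :
    ∃ Y : Submodule H M, Y ≠ ⊤ ∧ Module.Finite k (M ⧸ Y) := by
  obtain ⟨Y, hY, -⟩ := (eq_top_or_exists_le_coatom (⊥ : Submodule H M)).resolve_left bot_ne_top
  have : IsSimpleModule H (M ⧸ Y) := isSimpleModule_iff_isCoatom.2 hY
  have : Nontrivial (M ⧸ Y) := IsSimpleModule.nontrivial H _
  obtain ⟨N, hN, s, _, hs⟩ := exists_type hD (M ⧸ Y)
  have hN' : N = ⊤ := (eq_bot_or_eq_top N).resolve_left hN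
  have : IsSimpleModule H N := by
    rw [hN']; exact IsSimpleModule.congr Submodule.topEquiv
  have h1 := hs.finite_of_isSimple
  refine ⟨Y, hY.1, ?_⟩
  subst hN'
  let e : (⊤ : Submodule H (M ⧸ Y)) ≃ₗ[k] (M ⧸ Y) :=
    (Submodule.topEquiv (R := H) (M := M ⧸ Y)).restrictScalars k
  exact Module.Finite.equiv e

end Lattice

section Specialization

open Cardinal TensorProduct

theorem exists_large_quotient {k H : Type u} [Field k] [Ring H] [Algebra k H] [IsNoetherianRing H]
    [Algebra.FiniteType k H] {D : ℕ} (hD : MultilinearPI k H D) (M : Type u) [AddCommGroup M]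
    [Module H M] [Module k M] [IsScalarTower k H M] [Module.Finite H M]
    (hM : ¬ Module.Finite k M) (n : ℕ) :
    ∃ Y : Submodule H M, Module.Finite k (M ⧸ Y) ∧ n ≤ Module.finrank k (M ⧸ Y) := by
  have : IsNoetherian H M := isNoetherian_of_isNoetherianRing_of_finite H M
  induction n with
  | zero => 
    refine ⟨⊤, ?_, Nat.zero_le _⟩
    have : Subsingleton (M ⧸ (⊤ : Submodule H M)) := Submodule.Quotient.subsingleton_iff.2 rfl
    infer_instance
  | succ n ih =>
    obtain ⟨Y, hY, hn⟩ := ih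
    have hY0 : Y ≠ ⊥ := by
      rintro rfl
      exact hM (Module.Finite.equiv
        ((Submodule.quotEquivOfEqBot (⊥ : Submodule H M) rfl).restrictScalars k))
    have : Nontrivial Y := Submodule.nontrivial_iff_ne_bot.2 hY0
    have : Module.Finite H Y := Module.Finite.of_fg (IsNoetherian.noetherian Y)
    obtain ⟨T, hT, hTf⟩ := exists_finite_quotient hD Y
    let T' := T.map Y.subtype
    have hle : T' ≤ Y := Submodule.map_subtype_le _ _
    let p : (M ⧸ T') →ₗ[k] (M ⧸ Y) := (Submodule.factor hle).restrictScalars k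
    have hp : Function.Surjective p := Submodule.factor_surjective hle
    let j : (Y ⧸ T) →ₗ[k] (M ⧸ T') :=
      (T.mapQ T' Y.subtype (fun x hx => ⟨x, hx, rfl⟩)).restrictScalars k
    have hker : LinearMap.ker p ≤ LinearMap.range j := by
      intro x hx
      obtain ⟨x, rfl⟩ := T'.mkQ_surjective x
      have hx' : Submodule.Quotient.mk (p := Y) x = 0 := hx
      rw [Submodule.Quotient.mk_eq_zero] at hx'
      exact ⟨T.mkQ ⟨x, hx'⟩, rfl⟩
    have h1 : Module.Finite k (LinearMap.ker p) := Submodule.finiteDimensional_of_le hker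
    have h2 : Module.Finite k (M ⧸ T') := by
      have : Module.Finite k ((M ⧸ T') ⧸ LinearMap.ker p) :=
        Module.Finite.equiv (p.quotKerEquivOfSurjective hp).symm
      exact Module.Finite.of_submodule_quotient (LinearMap.ker p)
    refine ⟨T', h2, ?_⟩
    have h3 := LinearMap.finrank_range_add_finrank_ker p
    rw [LinearMap.range_eq_top.2 hp, finrank_top] at h3
    have h4 : 0 < Module.finrank k (LinearMap.ker p) := by
      rw [Module.finrank_pos_iff, Submodule.nontrivial_iff_ne_bot]
      intro h0
      refine hT (eq_top_iff.2 fun y _ => ?_)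
      have : Submodule.Quotient.mk (p := T') (y : M) ∈ LinearMap.ker p := by
        change Submodule.Quotient.mk (p := Y) (y : M) = 0
        rw [Submodule.Quotient.mk_eq_zero]
        exact y.2
      rw [h0, Submodule.mem_bot, Submodule.Quotient.mk_eq_zero] at this
      obtain ⟨y', hy', h⟩ := this
      rwa [← Subtype.ext h]
    omega

theorem finiteType_tensor {k K H : Type*} [Field k] [CommRing K] [Algebra k K] [Ring H]
    [Algebra k H] [h : Algebra.FiniteType k H] : Algebra.FiniteType K (K ⊗[k] H) := by
  classical
  obtain ⟨s, hs⟩ := h.out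
  refine ⟨s.image fun x => (1 : K) ⊗ₜ[k] x, ?_⟩
  rw [eq_top_iff]
  rintro x -
  have h1 : ∀ y : H, (1 : K) ⊗ₜ[k] y ∈
      Algebra.adjoin K ((s.image fun x => (1 : K) ⊗ₜ[k] x : Finset (K ⊗[k] H)) : Set (K ⊗[k] H)) := by
    intro y
    have hy : y ∈ Algebra.adjoin k (s : Set H) := by rw [hs]; trivial
    induction hy using Algebra.adjoin_induction with
    | mem x hx => exact Algebra.subset_adjoin (Finset.mem_coe.2 (Finset.mem_image_of_mem _ hx))
    | algebraMap r =>
      have : (1 : K) ⊗ₜ[k] algebraMap k H r = algebraMap K (K ⊗[k] H) (algebraMap k K r) := by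
        rw [Algebra.algebraMap_eq_smul_one r, TensorProduct.tmul_smul,
          Algebra.TensorProduct.algebraMap_apply, Algebra.algebraMap_self, RingHom.id_apply,
          Algebra.algebraMap_eq_smul_one r, TensorProduct.smul_tmul']
      rw [this]
      exact Subalgebra.algebraMap_mem _ _
    | add x y _ _ hx hy => rw [TensorProduct.tmul_add]; exact add_mem hx hy
    | mul x y _ _ hx hy =>
      have : (1 : K) ⊗ₜ[k] (x * y) = (1 ⊗ₜ x) * (1 ⊗ₜ y) := by
        rw [Algebra.TensorProduct.tmul_mul_tmul, mul_one]
      rw [this]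
      exact mul_mem hx hy
  induction x with
  | zero => exact zero_mem _
  | tmul a y =>
    have : a ⊗ₜ[k] y = a • ((1 : K) ⊗ₜ[k] y) := by
      rw [TensorProduct.smul_tmul', smul_eq_mul, mul_one]
    rw [this]
    exact Subalgebra.smul_mem _ (h1 y) a
  | add x y hx hy => exact add_mem hx hy

/-- The rank does not drop under specialization at a general prime. -/
theorem exists_le_rank_specialization {k H Z : Type u} [Field k] [Ring H] [Algebra k H]
    [IsNoetherianRing H]
    [Algebra.FiniteType k H] {D : ℕ} (hD : MultilinearPI k H D) [CommRing Z] [IsDomain Z]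
    [Algebra k Z] [Algebra.FiniteType k Z] (X : Type u) [AddCommGroup X] [Module k X] [Module H X]
    [IsScalarTower k H X] [Module.Finite H X] [Module Z X] [SMulCommClass H Z X]
    [IsScalarTower k Z X] (n : ℕ) (hn : n ≤ Module.rank Z X) :
    ∃ q : Z, q ≠ 0 ∧ ∀ (κ Y : Type u) [CommRing κ] [IsDomain κ] [AddCommGroup Y] [Module κ Y]
      (π : Z →+* κ) (f : Z), Function.Surjective π → (∀ z, π z = 0 ↔ f ∣ z) → π q ≠ 0 → f ≠ 0 →
      ∀ φ : X →+ Y, (∀ z x, φ (z • x) = π z • φ x) → (∀ x, φ x = 0 → ∃ y, x = f • y) →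
        (n : Cardinal) ≤ Module.rank κ Y := by
  classical
  let K := FractionRing Z
  have : IsNoetherianRing (K ⊗[k] H) := isNoetherianRing_tensor (Z := Z)
  have : Algebra.FiniteType K (K ⊗[k] H) := finiteType_tensor
  have hD' : MultilinearPI K (K ⊗[k] H) D := hD.baseChange
  let _ : Module k (BC Z K X) := Module.compHom _ (algebraMap k K)
  have : IsScalarTower k K (BC Z K X) := ⟨fun a b x => by
    rw [Algebra.smul_def, mul_smul]; rfl⟩
  have hmkk : ∀ (c : k) (x : X), BC.mk Z K X H (c • x) = c • BC.mk Z K X H x := fun c x => by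
    rw [← algebraMap_smul Z c x, BC.mk_smul, ← IsScalarTower.algebraMap_apply k Z K]
    rfl
  have hkH : ∀ (c : k) (x : BC Z K X), algebraMap k H c • x = c • x := by
    intro c x
    have : BC.act (algebraMap k H c) = algebraMap k K c • LinearMap.id (M := BC Z K X) := by
      refine BC.linearMap_ext (H := H) fun x => ?_
      change algebraMap k H c • BC.mk Z K X H x = c • BC.mk Z K X H x
      rw [← map_smul, algebraMap_smul, hmkk]
    exact LinearMap.congr_fun this x
  have : IsScalarTower k H (BC Z K X) := ⟨fun a b x => by
    rw [Algebra.smul_def, mul_smul, hkH]⟩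
  let _ : Module (K ⊗[k] H) (BC Z K X) := tensorModule _
  have : IsScalarTower K (K ⊗[k] H) (BC Z K X) := tensorModule_isScalarTower _
  have : Module.Finite (K ⊗[k] H) (BC Z K X) :=
    tensorModule_finite (BC.mk Z K X H) BC.span_range
  obtain ⟨Y, hY, hnY⟩ : ∃ Y : Submodule (K ⊗[k] H) (BC Z K X),
      Module.Finite K (BC Z K X ⧸ Y) ∧ n ≤ Module.finrank K (BC Z K X ⧸ Y) := by
    by_cases hfin : Module.Finite K (BC Z K X)
    · let e : (BC Z K X ⧸ (⊥ : Submodule (K ⊗[k] H) (BC Z K X))) ≃ₗ[K] BC Z K X :=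
        (Submodule.quotEquivOfEqBot _ rfl).restrictScalars K
      refine ⟨⊥, Module.Finite.equiv e.symm, ?_⟩
      rw [e.finrank_eq]
      rwa [← BC.rank_eq (K := K), ← Module.finrank_eq_rank, Nat.cast_le] at hn
    · exact exists_large_quotient hD' _ hfin n
  let W := BC Z K X ⧸ Y
  let iH : Module H W := moduleOfTensor k K H W
  have hKH : SMulCommClass K H W := moduleOfTensor_smulCommClass
  have hcH : ∀ (h : H) (w : W), h • w = (1 ⊗ₜ h : K ⊗[k] H) • w := fun _ _ => rfl
  let _ : Module Z W := Module.compHom W (algebraMap Z K)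
  have hZW : ∀ (z : Z) (w : W), z • w = algebraMap Z K z • w := fun _ _ => rfl
  have : IsScalarTower Z K W := ⟨fun a b x => by rw [Algebra.smul_def, mul_smul]; rfl⟩
  have : SMulCommClass H Z W := ⟨fun h z w => (smul_comm (algebraMap Z K z) h w).symm⟩
  let _ : Module k W := Module.compHom W (algebraMap k Z)
  have hkW : ∀ (c : k) (w : W), c • w = algebraMap k K c • w := fun c w => by
    change algebraMap Z K (algebraMap k Z c) • w = _
    rw [← IsScalarTower.algebraMap_apply]
  have : IsScalarTower k Z W := ⟨fun a b x => by rw [Algebra.smul_def, mul_smul]; rfl⟩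
  have : IsScalarTower k H W := ⟨fun a b x => by
    rw [Algebra.smul_def, mul_smul, hkW, ← algebraMap_smul (K ⊗[k] H) (algebraMap k K a), hcH]
    congr 1
    rw [← IsScalarTower.algebraMap_apply k K (K ⊗[k] H)]
    exact AlgHom.commutes (Algebra.TensorProduct.includeRight : H →ₐ[k] K ⊗[k] H) a⟩
  let g : X →ₗ[H] W :=
    { toFun := fun m => Y.mkQ (BC.mk Z K X H m)
      map_add' := fun x y => by rw [map_add, map_add]
      map_smul' := fun h x => by
        have : BC.mk Z K X H (h • x) = (1 ⊗ₜ h : K ⊗[k] H) • BC.mk Z K X H x := by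
          rw [TensorProduct.Algebra.smul_def, one_smul, map_smul]
        rw [this, map_smul, RingHom.id_apply, hcH] }
  have hgZ : ∀ (z : Z) x, g (z • x) = z • g x := fun z x => by
    change Y.mkQ (BC.mk Z K X H (z • x)) = algebraMap Z K z • Y.mkQ (BC.mk Z K X H x)
    rw [BC.mk_smul]
    rfl
  have hspan : Submodule.span K (Set.range g) = ⊤ := by
    have h1 : Set.range g = (Y.mkQ.restrictScalars K) '' Set.range (BC.mk Z K X H) := by
      rw [← Set.range_comp]; rfl
    rw [h1, ← Submodule.map_span, BC.span_range, Submodule.map_top, LinearMap.range_eq_top]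
    exact Y.mkQ_surjective
  obtain ⟨w, hw1, hw2, hw3⟩ := Submodule.exists_fun_fin_finrank_span_eq K (Set.range g)
  replace hw2 := hw2.trans hspan
  choose x hx using hw1
  have hmul : ∀ v : W, ∃ q : Z, q ≠ 0 ∧ q • v ∈ Submodule.span Z (Set.range w) := by
    intro v
    have hv : v ∈ Submodule.span K (Set.range w) := by rw [hw2]; trivial
    obtain ⟨c, rfl⟩ := (Submodule.mem_span_range_iff_exists_fun K).1 hv
    obtain ⟨q, hq⟩ := IsLocalization.exist_integer_multiples_of_finite (nonZeroDivisors Z) c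
    refine ⟨q, nonZeroDivisors.ne_zero q.2, ?_⟩
    rw [Finset.smul_sum]
    refine Submodule.sum_mem _ fun i _ => ?_
    obtain ⟨z, hz⟩ := hq i
    rw [← smul_assoc]
    change ((q : Z) • c i) • w i ∈ _
    rw [← hz, ← hZW]
    exact Submodule.smul_mem _ _ (Submodule.subset_span ⟨i, rfl⟩)
  obtain ⟨q, hq, hqx⟩ := exists_lattice_of_map (k := k) g w hmul
  have hwZ : LinearIndependent Z w := hw3.restrict_scalars' Z
  refine ⟨q, hq, fun κ V _ _ _ _ π f hπ hf hπq hf0 φ hφ hker => ?_⟩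
  have hn' : n ≤ Module.finrank K (Submodule.span K (Set.range g)) := by
    rw [hspan, finrank_top]; exact hnY
  refine le_trans (Nat.cast_le.2 hn') (Module.le_rank_iff.2 ⟨fun i => φ (x i), ?_⟩)
  rw [Fintype.linearIndependent_iff]
  intro c hc i
  choose d hd using fun i => hπ (c i)
  have h1 : φ (∑ i, d i • x i) = 0 := by
    rw [map_sum, ← hc]
    exact Finset.sum_congr rfl fun i _ => by rw [hφ, hd]
  obtain ⟨y, hy⟩ := hker _ h1
  obtain ⟨a, ha⟩ := hqx y
  obtain ⟨e, he⟩ := (Submodule.mem_span_range_iff_exists_fun Z).1 ha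
  have h2 : ∑ i, (q ^ a * d i - f * e i) • w i = 0 := by
    have h3 : g (∑ i, d i • x i) = f • g y := by rw [hy, hgZ]
    rw [map_sum] at h3
    simp only [sub_smul, mul_smul, Finset.sum_sub_distrib, ← Finset.smul_sum, he]
    rw [smul_comm f, ← smul_sub, ← h3]
    simp only [hgZ, hx, sub_self, smul_zero]
  have h4 := Fintype.linearIndependent_iff.1 hwZ _ h2 i
  have h5 : π (q ^ a * d i) = 0 := (hf _).2 ⟨e i, sub_eq_zero.1 h4⟩
  rw [map_mul, map_pow, hd] at h5
  exact (mul_eq_zero.1 h5).resolve_left (pow_ne_zero _ hπq)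

/-- The rank does not grow under specialization at a general prime. -/
theorem rank_specialization_le {Z X κ Y : Type u} [CommRing Z] [IsDomain Z] [WfDvdMonoid Z]
    [AddCommGroup X] [Module Z X] [CommRing κ] [IsDomain κ] [AddCommGroup Y] [Module κ Y]
    (π : Z →+* κ) (f : Z) (hf : ∀ z, π z = 0 ↔ f ∣ z) (hf0 : f ≠ 0)
    (h : Z) (hh : π h ≠ 0) (htors : ∀ (z : Z) (x : X), z ≠ 0 → z • x = 0 → h • x = 0)
    (h' : κ) (hh' : h' ≠ 0) (φ : X →+ Y) (hφ : ∀ z x, φ (z • x) = π z • φ x)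
    (hcoker : ∀ y, ∃ x, φ x = h' • y) (n : ℕ) (hn : n ≤ Module.rank κ Y) :
    (n : Cardinal) ≤ Module.rank Z X := by
  classical
  obtain ⟨v, hv⟩ := Module.le_rank_iff.1 hn
  choose x hx using fun i => hcoker (v i)
  refine Module.le_rank_iff.2 ⟨x, ?_⟩
  have hfu : ¬ IsUnit f := fun hu =>
    hh ((hf h).2 (hu.dvd))
  rw [Fintype.linearIndependent_iff]
  have key : ∀ c : Fin n → Z, ∑ i, c i • x i = 0 → ∀ a : ℕ, ∀ i, f ^ a ∣ c i := by
    intro c hc a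
    induction a with
    | zero => simp
    | succ a ih =>
      choose d hd using ih
      have h1 : (f ^ a : Z) • ∑ i, d i • x i = 0 := by
        rw [Finset.smul_sum, ← hc]
        exact Finset.sum_congr rfl fun i _ => by rw [smul_smul, ← hd]
      have h2 := htors (f ^ a) _ (pow_ne_zero a hf0) h1
      have h3 : ∑ i, (π h * π (d i) * h') • v i = 0 := by
        have := congrArg φ h2
        rw [map_zero, hφ, map_sum, Finset.smul_sum] at this
        rw [← this]
        exact Finset.sum_congr rfl fun i _ => by rw [hφ, hx, smul_smul, smul_smul, mul_assoc]
      intro i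
      have h4 := Fintype.linearIndependent_iff.1 hv _ h3 i
      have h5 : π (d i) = 0 := by
        simpa [hh, hh'] using h4
      obtain ⟨e, he⟩ := (hf _).1 h5
      exact ⟨e, by rw [hd, he, pow_succ, mul_assoc]⟩
  intro c hc i
  by_contra h0
  exact (FiniteMultiplicity.of_not_isUnit hfu h0).elim fun a ha => ha (key c hc _ i)

end Specialization

section Growth

open Cardinal

variable {k H M M' : Type u} [Field k] [Ring H] [Algebra k H] [AddCommGroup M] [Module H M]
  [Module k M] [IsScalarTower k H M] [AddCommGroup M'] [Module H M'] [Module k M']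
  [IsScalarTower k H M']

lemma smul_mem_subspaceSMul {U : Submodule k H} {F : Submodule k M} {a : H} {x : M} (ha : a ∈ U)
    (hx : x ∈ F) : a • x ∈ subspaceSMul k U F :=
  Submodule.subset_span ⟨a, ha, x, hx, rfl⟩

lemma subspaceSMul_le {U : Submodule k H} {F G : Submodule k M} :
    subspaceSMul k U F ≤ G ↔ ∀ a ∈ U, ∀ x ∈ F, a • x ∈ G := by
  refine ⟨fun h a ha x hx => h (smul_mem_subspaceSMul ha hx), fun h => Submodule.span_le.2 ?_⟩
  rintro _ ⟨a, ha, x, hx, rfl⟩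
  exact h a ha x hx

lemma subspaceSMul_eq_map₂ (U : Submodule k H) (F : Submodule k M) :
    subspaceSMul k U F = Submodule.map₂ (Algebra.lsmul k k M).toLinearMap U F := by
  refine le_antisymm (subspaceSMul_le.2 fun a ha x hx => ?_) (Submodule.map₂_le.2 fun a ha x hx => ?_)
  · exact Submodule.apply_mem_map₂ _ ha hx
  · exact smul_mem_subspaceSMul ha hx

instance finite_subspaceSMul (U : Submodule k H) (F : Submodule k M) [Module.Finite k U]
    [Module.Finite k F] : Module.Finite k (subspaceSMul k U F) := by
  rw [subspaceSMul_eq_map₂]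
  exact Module.Finite.of_fg ((Module.Finite.iff_fg.1 inferInstance).map₂ _
    (Module.Finite.iff_fg.1 inferInstance))

instance finite_submodule_pow (U : Submodule k H) [Module.Finite k U] (m : ℕ) :
    Module.Finite k (U ^ m : Submodule k H) :=
  Module.Finite.of_fg ((Module.Finite.iff_fg.1 inferInstance).pow m)

instance finite_one_submodule : Module.Finite k (1 : Submodule k H) := by
  rw [Submodule.one_eq_span]
  infer_instance

lemma subspaceSMul_mono {U U' : Submodule k H} {F F' : Submodule k M} (h : U ≤ U') (h' : F ≤ F') :
    subspaceSMul k U F ≤ subspaceSMul k U' F' :=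
  subspaceSMul_le.2 fun _ ha _ hx => smul_mem_subspaceSMul (h ha) (h' hx)

lemma subspaceSMul_mul (U U' : Submodule k H) (F : Submodule k M) :
    subspaceSMul k (U * U') F = subspaceSMul k U (subspaceSMul k U' F) := by
  apply le_antisymm
  · refine subspaceSMul_le.2 fun a ha x hx => ?_
    refine Submodule.mul_induction_on (C := fun a => a • x ∈ _) ha (fun a ha b hb => ?_)
      (fun a b ha hb => ?_)
    · rw [mul_smul]
      exact smul_mem_subspaceSMul ha (smul_mem_subspaceSMul hb hx)
    · rw [add_smul]; exact add_mem ha hb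
  · refine subspaceSMul_le.2 fun a ha x hx => ?_
    induction hx using Submodule.span_induction with
    | mem x hx =>
      obtain ⟨b, hb, y, hy, rfl⟩ := hx
      rw [← mul_smul]
      exact smul_mem_subspaceSMul (Submodule.mul_mem_mul ha hb) hy
    | zero => rw [smul_zero]; exact zero_mem _
    | add x y _ _ hx hy => rw [smul_add]; exact add_mem hx hy
    | smul c x _ hx => rw [smul_algebra_smul_comm]; exact Submodule.smul_mem _ _ hx

lemma subspaceSMul_one (F : Submodule k M) : subspaceSMul k (1 : Submodule k H) F = F := by
  apply le_antisymm
  · refine subspaceSMul_le.2 fun a ha x hx => ?_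
    obtain ⟨c, rfl⟩ := Submodule.mem_one.1 ha
    rw [algebraMap_smul]
    exact F.smul_mem c hx
  · intro x hx
    rw [← one_smul H x]
    exact smul_mem_subspaceSMul (Submodule.one_le.1 le_rfl) hx

lemma subspaceSMul_map (U : Submodule k H) (F : Submodule k M) (f : M →ₗ[H] M') :
    (subspaceSMul k U F).map (f.restrictScalars k) =
      subspaceSMul k U (F.map (f.restrictScalars k)) := by
  apply le_antisymm
  · rw [Submodule.map_le_iff_le_comap, subspaceSMul_le]
    intro a ha x hx
    change f (a • x) ∈ subspaceSMul k U (F.map (f.restrictScalars k))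
    rw [map_smul]
    exact smul_mem_subspaceSMul ha ⟨x, hx, rfl⟩
  · refine subspaceSMul_le.2 ?_
    rintro a ha _ ⟨x, hx, rfl⟩
    exact ⟨a • x, smul_mem_subspaceSMul ha hx, map_smul f a x⟩

/-- The dimension of `(1 ⊔ V) ^ m • F`. -/
noncomputable def growthDim (V : Submodule k H) (F : Submodule k M) (m : ℕ) : ℕ :=
  Module.finrank k (subspaceSMul k ((1 ⊔ V) ^ m) F)

lemma one_sup_pow_mono {V V' : Submodule k H} (hV : V ≤ V') {m m' : ℕ} (hm : m ≤ m') :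
    (1 ⊔ V) ^ m ≤ (1 ⊔ V') ^ m' :=
  (pow_le_pow_left' (sup_le_sup_left hV 1)  m).trans
    (pow_le_pow_right' le_sup_left hm)

lemma growthDim_mono {V V' : Submodule k H} {F F' : Submodule k M} [Module.Finite k V']
    [Module.Finite k F'] (hV : V ≤ V') (hF : F ≤ F') {m m' : ℕ} (hm : m ≤ m') :
    growthDim V F m ≤ growthDim V' F' m' :=
  Submodule.finrank_mono (subspaceSMul_mono (one_sup_pow_mono hV hm) hF)

lemma growthDim_map_le (V : Submodule k H) (F : Submodule k M) [Module.Finite k V]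
    [Module.Finite k F] (f : M →ₗ[H] M') (m : ℕ) :
    growthDim V (F.map (f.restrictScalars k)) m ≤ growthDim V F m := by
  rw [growthDim, ← subspaceSMul_map]
  exact Submodule.finrank_map_le _ _

lemma growthDim_map_eq (V : Submodule k H) (F : Submodule k M) 
    (f : M →ₗ[H] M') (hf : Function.Injective f) (m : ℕ) :
    growthDim V (F.map (f.restrictScalars k)) m = growthDim V F m := by
  rw [growthDim, ← subspaceSMul_map]
  exact (Submodule.equivMapOfInjective (f.restrictScalars k) hf _).finrank_eq.symm

variable (k H M) in
/-- Growth of degree less than `n`. -/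
def GrowthLT (n : ℕ) : Prop :=
  ∀ (V : Submodule k H) (F : Submodule k M) [Module.Finite k V] [Module.Finite k F],
    ∃ C : ℕ, ∀ m, 1 ≤ m → m * growthDim V F m ≤ C * m ^ n

variable (k H M) in
/-- Growth of degree at least `s`. -/
def GrowthGE (s : ℕ) : Prop :=
  ∃ (V : Submodule k H) (F : Submodule k M), Module.Finite k V ∧ Module.Finite k F ∧
    ∃ C : ℕ, ∀ m, m ^ s ≤ C * growthDim V F m

lemma GrowthLT.mono {n n' : ℕ} (h : GrowthLT k H M n) (hn : n ≤ n') : GrowthLT k H M n' := by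
  intro V F _ _
  obtain ⟨C, hC⟩ := h V F
  exact ⟨C, fun m hm => (hC m hm).trans (Nat.mul_le_mul_left _ (Nat.pow_le_pow_right hm hn))⟩

lemma GrowthLT.of_injective {n : ℕ} (h : GrowthLT k H M' n) (f : M →ₗ[H] M')
    (hf : Function.Injective f) : GrowthLT k H M n := by
  intro V F _ _
  obtain ⟨C, hC⟩ := h V (F.map (f.restrictScalars k))
  refine ⟨C, fun m hm => ?_⟩
  rw [← growthDim_map_eq V F f hf]
  exact hC m hm

lemma exists_finite_lift (f : M →ₗ[H] M') (hf : Function.Surjective f) (F : Submodule k M')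
    [Module.Finite k F] : ∃ F' : Submodule k M, Module.Finite k F' ∧
      F'.map (f.restrictScalars k) = F := by
  classical
  obtain ⟨t, ht⟩ := (Module.Finite.iff_fg.1 (inferInstance : Module.Finite k F))
  choose g hg using hf
  refine ⟨Submodule.span k (t.image g : Finset M), inferInstance, ?_⟩
  rw [Submodule.map_span, ← ht, Finset.coe_image, ← Set.image_comp]
  congr 1
  convert Set.image_id _
  ext x
  exact hg x

lemma GrowthLT.of_surjective {n : ℕ} (h : GrowthLT k H M n) (f : M →ₗ[H] M')
    (hf : Function.Surjective f) : GrowthLT k H M' n := by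
  intro V F _ _
  obtain ⟨F', _, rfl⟩ := exists_finite_lift f hf F
  obtain ⟨C, hC⟩ := h V F'
  exact ⟨C, fun m hm => (Nat.mul_le_mul_left _ (growthDim_map_le V F' f m)).trans (hC m hm)⟩

lemma GrowthGE.of_injective {n : ℕ} (h : GrowthGE k H M n) (f : M →ₗ[H] M')
    (hf : Function.Injective f) : GrowthGE k H M' n := by
  obtain ⟨V, F, _, _, C, hC⟩ := h
  refine ⟨V, F.map (f.restrictScalars k), inferInstance, inferInstance, C, fun m => ?_⟩
  rw [growthDim_map_eq V F f hf]
  exact hC m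

lemma GrowthGE.of_surjective {n : ℕ} (h : GrowthGE k H M' n) (f : M →ₗ[H] M')
    (hf : Function.Surjective f) : GrowthGE k H M n := by
  obtain ⟨V, F, _, _, C, hC⟩ := h
  obtain ⟨F', _, rfl⟩ := exists_finite_lift f hf F
  exact ⟨V, F', inferInstance, inferInstance, C, fun m =>
    (hC m).trans (Nat.mul_le_mul_left _ (growthDim_map_le V F' f m))⟩

lemma GrowthLT.prod {n : ℕ} (h : GrowthLT k H M n) (h' : GrowthLT k H M' n) :
    GrowthLT k H (M × M') n := by
  intro V F _ _
  obtain ⟨C, hC⟩ := h V (F.map ((LinearMap.fst H M M').restrictScalars k))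
  obtain ⟨C', hC'⟩ := h' V (F.map ((LinearMap.snd H M M').restrictScalars k))
  refine ⟨C + C', fun m hm => ?_⟩
  have : growthDim V F m ≤ growthDim V (F.map ((LinearMap.fst H M M').restrictScalars k)) m +
      growthDim V (F.map ((LinearMap.snd H M M').restrictScalars k)) m := by
    unfold growthDim
    rw [← subspaceSMul_map, ← subspaceSMul_map]
    set G := subspaceSMul k ((1 ⊔ V) ^ m) F
    have h1 := (LinearMap.finrank_range_add_finrank_ker
      (((LinearMap.fst H M M').restrictScalars k).comp G.subtype)).symm
    rw [h1, LinearMap.range_comp, Submodule.range_subtype]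
    refine Nat.add_le_add_left ?_ _
    let p : LinearMap.ker (((LinearMap.fst H M M').restrictScalars k).comp G.subtype) →ₗ[k]
        G.map ((LinearMap.snd H M M').restrictScalars k) :=
      { toFun := fun x => ⟨(x : G).1.2, ⟨_, x.1.2, rfl⟩⟩
        map_add' := fun _ _ => rfl
        map_smul' := fun _ _ => rfl }
    refine LinearMap.finrank_le_finrank_of_injective (f := p) ?_
    intro x y hxy
    have h2 : (x : G).1.2 = (y : G).1.2 := congrArg Subtype.val hxy
    have hx : (x : G).1.1 = 0 := x.2
    have hy : (y : G).1.1 = 0 := y.2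
    exact Subtype.ext (Subtype.ext (Prod.ext (hx.trans hy.symm) h2))
  nlinarith [hC m hm, hC' m hm, Nat.mul_le_mul_left m this]

lemma growthDim_pos (V : Submodule k H) (F : Submodule k M) [Module.Finite k V]
    [Module.Finite k F] (hF : F ≠ ⊥) (m : ℕ) : 0 < growthDim V F m := by
  have h1 : F ≤ subspaceSMul k ((1 ⊔ V) ^ m) F := by
    have := subspaceSMul_mono (M := M) (one_sup_pow_mono (le_refl V) (Nat.zero_le m)) (le_refl F)
    rwa [pow_zero, subspaceSMul_one] at this
  have h2 : 0 < Module.finrank k F := by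
    rw [Module.finrank_pos_iff]; exact Submodule.nontrivial_iff_ne_bot.2 hF
  exact h2.trans_le (Submodule.finrank_mono h1)

lemma GrowthLT.subsingleton (h : GrowthLT k H M 0) : Subsingleton M := by
  by_contra hM
  rw [not_subsingleton_iff_nontrivial] at hM
  obtain ⟨x, hx⟩ := exists_ne (0 : M)
  obtain ⟨C, hC⟩ := h ⊥ (Submodule.span k {x})
  have h1 := hC (C + 1) (by omega)
  have h2 := growthDim_pos (⊥ : Submodule k H) (Submodule.span k {x}) (by simpa using hx) (C + 1)
  nlinarith

lemma growthLT_of_subsingleton [Subsingleton M] (n : ℕ) : GrowthLT k H M n := by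
  intro V F _ _
  refine ⟨0, fun m _ => ?_⟩
  have : growthDim V F m = 0 := Module.finrank_zero_of_subsingleton
  rw [this]; simp

lemma GrowthGE.le {n s : ℕ} (h : GrowthLT k H M n) (h' : GrowthGE k H M s) : s < n := by
  obtain ⟨V, F, _, _, C', hC'⟩ := h'
  obtain ⟨C, hC⟩ := h V F
  by_contra hs
  rw [not_lt] at hs
  have h1 := hC (C' * C + 1) (by omega)
  have h2 := hC' (C' * C + 1)
  have h3 : (C' * C + 1) ^ n ≤ (C' * C + 1) ^ s := Nat.pow_le_pow_right (by omega) hs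
  have h4 : 0 < (C' * C + 1) ^ n := by positivity
  set m := C' * C + 1 with hm
  have h5 : m * m ^ n ≤ C' * C * m ^ n :=
    calc m * m ^ n ≤ m * (C' * growthDim V F m) := Nat.mul_le_mul_left _ (h3.trans h2)
      _ = C' * (m * growthDim V F m) := by ring
      _ ≤ C' * (C * m ^ n) := Nat.mul_le_mul_left _ h1
      _ = C' * C * m ^ n := by ring
  have := Nat.le_of_mul_le_mul_right h5 h4
  omega

/-- The quotient by an injective endomorphism has smaller growth. -/
lemma GrowthLT.quotient_range [Module.Finite H M] {n : ℕ} (h : GrowthLT k H M (n + 1))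
    (f : M →ₗ[H] M) (hf : Function.Injective f) :
    GrowthLT k H (M ⧸ LinearMap.range f) n := by
  classical
  intro V F _ _
  obtain ⟨F', _, rfl⟩ := exists_finite_lift (LinearMap.range f).mkQ (Submodule.mkQ_surjective _) F
  obtain ⟨t, ht⟩ := (inferInstance : Module.Finite H M).fg_top
  set G := F' ⊔ Submodule.span k (t : Set M) with hG
  have hGF : ∀ x : M, ∃ V' : Submodule k H, Module.Finite k V' ∧ x ∈ subspaceSMul k V' G := by
    intro x
    have hx : x ∈ Submodule.span H (t : Set M) := by rw [ht]; trivial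
    induction hx using Submodule.span_induction with
    | mem x hx =>
      refine ⟨1, inferInstance, ?_⟩
      rw [subspaceSMul_one]
      exact (le_sup_right : _ ≤ G) (Submodule.subset_span hx)
    | zero => exact ⟨⊥, inferInstance, zero_mem _⟩
    | add x y _ _ hx hy =>
      obtain ⟨V1, _, h1⟩ := hx
      obtain ⟨V2, _, h2⟩ := hy
      exact ⟨V1 ⊔ V2, inferInstance, add_mem (subspaceSMul_mono le_sup_left le_rfl h1)
        (subspaceSMul_mono le_sup_right le_rfl h2)⟩
    | smul a x _ hx =>
      obtain ⟨V1, _, h1⟩ := hx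
      refine ⟨Submodule.span k {a} * V1, Module.Finite.of_fg (Submodule.FG.mul
        (Submodule.fg_span_singleton a) (Module.Finite.iff_fg.1 inferInstance)), ?_⟩
      rw [subspaceSMul_mul]
      exact smul_mem_subspaceSMul (Submodule.mem_span_singleton_self a) h1
  have hVex : ∃ V' : Submodule k H, Module.Finite k V' ∧
      G.map (f.restrictScalars k) ≤ subspaceSMul k V' G := by
    obtain ⟨t', ht'⟩ : (G.map (f.restrictScalars k)).FG := Module.Finite.iff_fg.1 inferInstance
    rw [← ht']
    clear ht'
    induction t' using Finset.induction_on with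
    | empty => exact ⟨⊥, inferInstance, by simp⟩
    | insert a t' _ ih =>
      obtain ⟨V1, _, h1⟩ := ih
      obtain ⟨V2, _, h2⟩ := hGF a
      refine ⟨V1 ⊔ V2, inferInstance, ?_⟩
      rw [Submodule.span_le, Finset.coe_insert, Set.insert_subset_iff]
      exact ⟨subspaceSMul_mono le_sup_right le_rfl h2, (Submodule.span_le.1 h1).trans
        (subspaceSMul_mono le_sup_left le_rfl)⟩
  obtain ⟨V', _, hV'⟩ := hVex
  set U : Submodule k H := 1 ⊔ (V ⊔ V') with hU
  let X : ℕ → Submodule k M := fun m => subspaceSMul k (U ^ m) G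
  have hXf : ∀ m, (X m).map (f.restrictScalars k) ≤ X (m + 1) := by
    intro m
    change (subspaceSMul k (U ^ m) G).map _ ≤ subspaceSMul k (U ^ (m + 1)) G
    rw [subspaceSMul_map, pow_succ, subspaceSMul_mul]
    refine subspaceSMul_mono le_rfl (hV'.trans (subspaceSMul_mono ?_ le_rfl))
    exact le_sup_right.trans le_sup_right
  have hXmono : ∀ {m m'}, m ≤ m' → X m ≤ X m' := fun hm =>
    subspaceSMul_mono (pow_le_pow_right' le_sup_left hm) le_rfl
  obtain ⟨C, hC⟩ := h (V ⊔ V') G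
  have hXdim : ∀ m, 1 ≤ m → m * Module.finrank k (X m) ≤ C * m ^ (n + 1) := hC
  refine ⟨C * 2 ^ n, fun m hm => ?_⟩
  set p := (LinearMap.range f).mkQ.restrictScalars k with hp
  have key : ∀ i, ∃ Y : Submodule k M, Module.Finite k Y ∧ Y ≤ X (m + i) ∧
      i * Module.finrank k ((X m).map p) ≤ Module.finrank k Y := by
    intro i
    induction i with
    | zero => exact ⟨⊥, inferInstance, bot_le, by simp⟩
    | succ i ih =>
      obtain ⟨Y, _, hY, hYd⟩ := ih
      let Y' := X m ⊔ Y.map (f.restrictScalars k)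
      refine ⟨Y', inferInstance, sup_le (hXmono (by omega))
        ((Submodule.map_mono hY).trans (hXf _)), ?_⟩
      have h1 := LinearMap.finrank_range_add_finrank_ker (p.comp Y'.subtype)
      rw [← h1, LinearMap.range_comp, Submodule.range_subtype, add_mul, one_mul, add_comm]
      refine add_le_add (Submodule.finrank_mono (Submodule.map_mono le_sup_left)) (hYd.trans ?_)
      let g : Y →ₗ[k] LinearMap.ker (p.comp Y'.subtype) :=
        { toFun := fun y => ⟨⟨f y, (le_sup_right : _ ≤ Y') ⟨y, y.2, rfl⟩⟩, by
            rw [LinearMap.mem_ker]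
            exact (Submodule.Quotient.mk_eq_zero _).2 ⟨y, rfl⟩⟩
          map_add' := fun x y => Subtype.ext (Subtype.ext (map_add f _ _))
          map_smul' := fun c x => Subtype.ext (Subtype.ext
            (map_smul (f.restrictScalars k) c (x : M))) }
      refine LinearMap.finrank_le_finrank_of_injective (f := g) fun x y hxy => ?_
      exact Subtype.ext (hf (congrArg (fun z : LinearMap.ker (p.comp Y'.subtype) => z.1.1) hxy))
  obtain ⟨Y, _, hY, hYd⟩ := key m
  have h1 : growthDim V (F'.map p) m ≤ Module.finrank k ((X m).map p) := by
    rw [growthDim, ← subspaceSMul_map]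
    exact Submodule.finrank_mono (Submodule.map_mono (subspaceSMul_mono
      (pow_le_pow_left' (sup_le_sup_left le_sup_left 1) m) le_sup_left))
  have h2 := (Submodule.finrank_mono hY)
  have h3 := hXdim (m + m) (by omega)
  have h4 : m * growthDim V (F'.map p) m ≤ Module.finrank k (X (m + m)) :=
    (Nat.mul_le_mul_left _ h1).trans (hYd.trans h2)
  have h5 : Module.finrank k (X (m + m)) ≤ C * (m + m) ^ n := by
    rw [pow_succ, ← mul_assoc, mul_comm] at h3
    exact Nat.le_of_mul_le_mul_right h3 (by omega)
  calc _ ≤ C * (m + m) ^ n := h4.trans h5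
    _ = C * 2 ^ n * m ^ n := by rw [← two_mul, mul_pow, mul_assoc]

end Growth

section TypeGrowth

open Cardinal MvPolynomial

lemma mem_restrictDegree_iff_degreeOf {σ R : Type*} [CommSemiring R] (p : MvPolynomial σ R) (n : ℕ) :
    p ∈ restrictDegree σ R n ↔ ∀ i, degreeOf i p ≤ n := by
  simp only [mem_restrictDegree, degreeOf_le_iff]
  exact ⟨fun h i m hm => h m hm i, fun h m hm i => h i m hm⟩

lemma mul_mem_restrictDegree {σ R : Type*} [CommSemiring R] {p q : MvPolynomial σ R} {m n : ℕ}
    (hp : p ∈ restrictDegree σ R m) (hq : q ∈ restrictDegree σ R n) :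
    p * q ∈ restrictDegree σ R (m + n) := by
  rw [mem_restrictDegree_iff_degreeOf] at *
  exact fun i => (degreeOf_mul_le i p q).trans (add_le_add (hp i) (hq i))

lemma restrictDegree_mono (σ R : Type*) [CommSemiring R] {m n : ℕ} (h : m ≤ n) :
    restrictDegree σ R m ≤ restrictDegree σ R n := by
  intro p hp
  rw [mem_restrictDegree_iff_degreeOf] at *
  exact fun i => (hp i).trans h

lemma mem_restrictDegree_totalDegree {σ R : Type*} [CommSemiring R] (p : MvPolynomial σ R) :
    p ∈ restrictDegree σ R p.totalDegree := by
  rw [mem_restrictDegree_iff_degreeOf]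
  exact fun i => degreeOf_le_totalDegree p i

lemma exists_mem_restrictDegree {σ R ι : Type*} [CommSemiring R] [Fintype ι]
    (c : ι → MvPolynomial σ R) : ∃ d, ∀ i, c i ∈ restrictDegree σ R d :=
  ⟨Finset.univ.sup fun i => (c i).totalDegree, fun i =>
    restrictDegree_mono _ _ (Finset.le_sup (f := fun i => (c i).totalDegree)
      (Finset.mem_univ i)) (mem_restrictDegree_totalDegree _)⟩

lemma exists_uniform_index {W Y α : Type*} [SetLike α W] (P : ℕ → α)
    (hP : ∀ d d', d ≤ d' → ∀ ⦃x⦄, x ∈ P d → x ∈ P d') (t : Finset Y) (g : Y → W)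
    (h : ∀ x ∈ t, ∃ d, g x ∈ P d) : ∃ D, ∀ x ∈ t, g x ∈ P D := by
  choose! d hd using h
  exact ⟨t.sup d, fun x hx => hP _ _ (Finset.le_sup hx) (hd x hx)⟩

lemma finrank_restrictDegree (R : Type*) [Field R] (s n : ℕ) :
    Module.finrank R (restrictDegree (Fin s) R n) = (n + 1) ^ s := by
  let e : {f : Fin s →₀ ℕ | ∀ a, f a ≤ n} ≃ (Fin s → Fin (n + 1)) :=
    { toFun := fun f a => ⟨f.1 a, Nat.lt_succ_of_le (f.2 a)⟩
      invFun := fun g => ⟨Finsupp.equivFunOnFinite.symm fun a => (g a : ℕ), fun a =>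
        Nat.le_of_lt_succ (g a).2⟩
      left_inv := fun f => Subtype.ext (Finsupp.ext fun a => rfl)
      right_inv := fun g => rfl }
  have h := Module.finrank_eq_card_basis ((basisRestrictSupport R _).reindex e)
  rw [Fintype.card_fun, Fintype.card_fin, Fintype.card_fin] at h
  exact h

variable {k H W : Type u} [Field k] [Ring H] [Algebra k H] [AddCommGroup W] [Module H W]
  [Module k W] [IsScalarTower k H W] {s : ℕ} [Module (MvPolynomial (Fin s) k) W]

/-- A module of type `s` has growth of degree at most `s`. -/
theorem IsType.growthLT (h : IsType k H (MvPolynomial (Fin s) k) W) : GrowthLT k H W (s + 1) := by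
  classical
  intro V F _ _
  have := h.smulComm
  have := h.tower
  let Z := MvPolynomial (Fin s) k
  obtain ⟨r, m, hx⟩ : ∃ (r : ℕ) (m : Fin r → W), ∀ x, ∃ q : Z, q ≠ 0 ∧
      q • x ∈ Submodule.span Z (Set.range m) := by
    obtain ⟨m, -, hx⟩ := exists_fin_independent h.rank_lt
    exact ⟨_, m, hx⟩
  set L := Submodule.span Z (Set.range m) with hL
  obtain ⟨A, hA⟩ : (1 ⊔ V).FG := Module.Finite.iff_fg.1 inferInstance
  obtain ⟨T, hT⟩ : F.FG := Module.Finite.iff_fg.1 inferInstance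
  obtain ⟨q, hq, hqX⟩ := exists_common_multiple L hx
    (T ∪ (A ×ˢ Finset.univ).image fun p => p.1 • m p.2)
  let ψ : (Fin r → Z) →ₗ[k] W := (Fintype.linearCombination Z m).restrictScalars k
  let Q : ℕ → Submodule k (Fin r → Z) := fun d => Submodule.pi Set.univ
    fun _ => restrictDegree (Fin s) k d
  let P : ℕ → Submodule k W := fun d => (Q d).map ψ
  have hPm : ∀ d x, x ∈ P d ↔ ∃ c : Fin r → MvPolynomial (Fin s) k,
      (∀ i, c i ∈ restrictDegree (Fin s) k d) ∧ ∑ i, c i • m i = x := by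
    intro d x
    constructor
    · rintro ⟨c, hc, rfl⟩
      exact ⟨c, fun i => hc i trivial, (Fintype.linearCombination_apply _ _ _).symm⟩
    · rintro ⟨c, hc, rfl⟩
      exact ⟨c, fun i _ => hc i, Fintype.linearCombination_apply _ _ _⟩
  have hPmono : ∀ {d d'}, d ≤ d' → P d ≤ P d' := fun hd =>
    Submodule.map_mono fun c hc i hi => restrictDegree_mono _ _ hd (hc i hi)
  have hPex : ∀ x ∈ L, ∃ d, x ∈ P d := by
    intro x hx
    obtain ⟨c, rfl⟩ := (Submodule.mem_span_range_iff_exists_fun Z).1 hx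
    obtain ⟨d, hd⟩ := exists_mem_restrictDegree c
    exact ⟨d, (hPm _ _).2 ⟨c, hd, rfl⟩⟩
  have hD : ∃ D, ∀ x ∈ T ∪ (A ×ˢ Finset.univ).image fun p => p.1 • m p.2, q • x ∈ P D := by
    exact exists_uniform_index P (fun _ _ h => @hPmono _ _ h) _ _ fun x hx => hPex _ (hqX x hx)
  obtain ⟨D, hD⟩ := hD
  have hmulP : ∀ {d d'} (z : Z) (x : W), z ∈ restrictDegree (Fin s) k d → x ∈ P d' →
      z • x ∈ P (d + d') := by
    intro d d' z x hz hx
    obtain ⟨c, hc, rfl⟩ := (hPm _ _).1 hx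
    refine (hPm _ _).2 ⟨fun i => z * c i, fun i => mul_mem_restrictDegree hz (hc i), ?_⟩
    rw [Finset.smul_sum]
    exact Finset.sum_congr rfl fun i _ => mul_smul _ _ _
  have hAP : ∀ (d : ℕ), ∀ a ∈ 1 ⊔ V, ∀ x ∈ P d, q • a • x ∈ P (d + D) := by
    intro d a ha
    rw [← hA] at ha
    induction ha using Submodule.span_induction with
    | mem a ha =>
      intro x hx
      obtain ⟨c, hc, rfl⟩ := (hPm _ _).1 hx
      rw [Finset.smul_sum, Finset.smul_sum]
      refine Submodule.sum_mem _ fun i _ => ?_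
      rw [smul_comm a (c i), smul_comm q (c i)]
      refine hmulP _ _ (hc i) (hD _ (Finset.mem_union_right _ (Finset.mem_image.2
        ⟨(a, i), Finset.mem_product.2 ⟨ha, Finset.mem_univ _⟩, rfl⟩)))
    | zero => intro x _; rw [zero_smul, smul_zero]; exact zero_mem _
    | add a b _ _ ha hb =>
      intro x hx; rw [add_smul, smul_add]; exact add_mem (ha x hx) (hb x hx)
    | smul c a _ ha =>
      intro x hx
      rw [smul_assoc, smul_comm q c]
      exact Submodule.smul_mem _ _ (ha x hx)
  let μ : ℕ → W →ₗ[k] W := fun n => ((LinearMap.lsmul Z W) (q ^ n)).restrictScalars k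
  have hmain : ∀ n, subspaceSMul k ((1 ⊔ V) ^ n) F ≤ (P ((n + 1) * D)).comap (μ (n + 1)) := by
    intro n
    induction n with
    | zero =>
      rw [pow_zero, subspaceSMul_one, ← hT, Submodule.span_le]
      intro x hx
      change q ^ (0 + 1) • x ∈ P ((0 + 1) * D)
      rw [zero_add, pow_one, one_mul]
      exact hD x (Finset.mem_union_left _ hx)
    | succ n ih =>
      rw [pow_succ', subspaceSMul_mul, subspaceSMul_le]
      intro a ha x hx
      have h1 : q ^ (n + 1) • x ∈ P ((n + 1) * D) := ih hx
      have h2 := hAP _ a ha _ h1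
      change q ^ (n + 1 + 1) • a • x ∈ P ((n + 1 + 1) * D)
      rw [pow_succ', mul_smul, ← smul_comm a, Nat.succ_mul]
      exact h2
  have hQdim : ∀ d, Module.Finite k (Q d) ∧ Module.finrank k (Q d) ≤ r * (d + 1) ^ s := by
    intro d
    let e : Q d →ₗ[k] (Fin r → restrictDegree (Fin s) k d) :=
      { toFun := fun c i => ⟨c.1 i, c.2 i trivial⟩
        map_add' := fun _ _ => rfl
        map_smul' := fun _ _ => rfl }
    have he : Function.Injective e := by
      intro x y hxy
      exact Subtype.ext (funext fun i => congrArg Subtype.val (congrFun hxy i))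
    refine ⟨Module.Finite.of_injective e he, ?_⟩
    refine (LinearMap.finrank_le_finrank_of_injective he).trans ?_
    rw [Module.finrank_pi_fintype]
    simp [finrank_restrictDegree]
  have hdim : ∀ n, growthDim V F n ≤ r * ((n + 1) * D + 1) ^ s := by
    intro n
    have := (hQdim ((n + 1) * D)).1
    have hinj : Function.Injective (μ (n + 1)) := by
      rw [← LinearMap.ker_eq_bot, LinearMap.ker_eq_bot']
      intro x hx
      exact (h.torsionFree _ _ hx).resolve_left (pow_ne_zero _ hq)
    rw [growthDim, (Submodule.equivMapOfInjective (μ (n + 1)) hinj _).finrank_eq]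
    refine (Submodule.finrank_mono (Submodule.map_le_iff_le_comap.2 (hmain n))).trans ?_
    exact (Submodule.finrank_map_le _ _).trans (hQdim _).2
  refine ⟨r * (2 * D + 1) ^ s, fun n hn => ?_⟩
  have h1 : (n + 1) * D + 1 ≤ (2 * D + 1) * n := by nlinarith
  calc n * growthDim V F n ≤ n * (r * ((2 * D + 1) * n) ^ s) :=
        Nat.mul_le_mul_left _ ((hdim n).trans (Nat.mul_le_mul_left _ (Nat.pow_le_pow_left h1 s)))
    _ = r * (2 * D + 1) ^ s * n ^ (s + 1) := by rw [mul_pow, pow_succ]; ring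

lemma exists_finite_smul [Module.Finite H W] (F : Submodule k W) [Module.Finite k F] :
    ∃ G : Submodule k W, Module.Finite k G ∧ F ≤ G ∧ ∀ Y : Finset W,
      ∃ V : Submodule k H, Module.Finite k V ∧ (Y : Set W) ⊆ subspaceSMul k V G := by
  classical
  obtain ⟨t, ht⟩ := (inferInstance : Module.Finite H W).fg_top
  set G := F ⊔ Submodule.span k (t : Set W) with hG
  have hGF : ∀ x : W, ∃ V' : Submodule k H, Module.Finite k V' ∧ x ∈ subspaceSMul k V' G := by
    intro x
    have hx : x ∈ Submodule.span H (t : Set W) := by rw [ht]; trivial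
    induction hx using Submodule.span_induction with
    | mem x hx =>
      refine ⟨1, inferInstance, ?_⟩
      rw [subspaceSMul_one]
      exact (le_sup_right : _ ≤ G) (Submodule.subset_span hx)
    | zero => exact ⟨⊥, inferInstance, zero_mem _⟩
    | add x y _ _ hx hy =>
      obtain ⟨V1, _, h1⟩ := hx
      obtain ⟨V2, _, h2⟩ := hy
      exact ⟨V1 ⊔ V2, inferInstance, add_mem (subspaceSMul_mono le_sup_left le_rfl h1)
        (subspaceSMul_mono le_sup_right le_rfl h2)⟩
    | smul a x _ hx =>
      obtain ⟨V1, _, h1⟩ := hx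
      refine ⟨Submodule.span k {a} * V1, Module.Finite.of_fg (Submodule.FG.mul
        (Submodule.fg_span_singleton a) (Module.Finite.iff_fg.1 inferInstance)), ?_⟩
      rw [subspaceSMul_mul]
      exact smul_mem_subspaceSMul (Submodule.mem_span_singleton_self a) h1
  refine ⟨G, inferInstance, le_sup_left, fun t' => ?_⟩
  induction t' using Finset.induction_on with
  | empty => exact ⟨⊥, inferInstance, by simp⟩
  | insert a t' _ ih =>
    obtain ⟨V1, _, h1⟩ := ih
    obtain ⟨V2, _, h2⟩ := hGF a
    refine ⟨V1 ⊔ V2, inferInstance, ?_⟩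
    rw [Finset.coe_insert, Set.insert_subset_iff]
    exact ⟨subspaceSMul_mono le_sup_right le_rfl h2, h1.trans
      (subspaceSMul_mono le_sup_left le_rfl)⟩

/-- A nonzero module of type `s` has growth of degree at least `s`. -/
theorem IsType.growthGE [Module.Finite H W] [Nontrivial W]
    (h : IsType k H (MvPolynomial (Fin s) k) W) : GrowthGE k H W s := by
  classical
  have := h.smulComm
  have := h.tower
  obtain ⟨n0, hn0⟩ := exists_ne (0 : W)
  obtain ⟨G, _, hG, hV⟩ := exists_finite_smul (H := H) (Submodule.span k {n0})
  have hn0G : n0 ∈ G := hG (Submodule.mem_span_singleton_self _)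
  obtain ⟨B, hB⟩ : G.FG := Module.Finite.iff_fg.1 inferInstance
  obtain ⟨V, _, hV⟩ := hV ((Finset.univ ×ˢ B).image fun p => (X p.1 : MvPolynomial (Fin s) k) • p.2)
  have hX : ∀ i : Fin s, ∀ x ∈ G, (X i : MvPolynomial (Fin s) k) • x ∈ subspaceSMul k (1 ⊔ V) G := by
    intro i x hx
    rw [← hB] at hx
    induction hx using Submodule.span_induction with
    | mem x hx =>
      refine subspaceSMul_mono le_sup_right le_rfl (hV ?_)
      exact Finset.mem_coe.2 (Finset.mem_image.2 ⟨(i, x), Finset.mem_product.2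
        ⟨Finset.mem_univ _, hx⟩, rfl⟩)
    | zero => rw [smul_zero]; exact zero_mem _
    | add x y _ _ hx hy => rw [smul_add]; exact add_mem hx hy
    | smul c x _ hx => rw [smul_comm]; exact Submodule.smul_mem _ _ hx
  have hX' : ∀ (i : Fin s) (j n : ℕ), ∀ x ∈ subspaceSMul k ((1 ⊔ V) ^ n) G,
      (X i ^ j : MvPolynomial (Fin s) k) • x ∈ subspaceSMul k ((1 ⊔ V) ^ (n + j)) G := by
    intro i j
    induction j with
    | zero => intro n x hx; simpa using hx
    | succ j ih =>
      intro n x hx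
      rw [pow_succ, mul_smul, ← add_assoc, add_right_comm]
      refine ih (n + 1) _ ?_
      induction hx using Submodule.span_induction with
      | mem x hx =>
        obtain ⟨a, ha, y, hy, rfl⟩ := hx
        rw [← smul_comm a, pow_succ, subspaceSMul_mul]
        exact smul_mem_subspaceSMul ha (hX i y hy)
      | zero => rw [smul_zero]; exact zero_mem _
      | add x y _ _ hx hy => rw [smul_add]; exact add_mem hx hy
      | smul c x _ hx => rw [smul_comm]; exact Submodule.smul_mem _ _ hx
  have hprod : ∀ (S : Finset (Fin s)) (f : Fin s →₀ ℕ),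
      (∏ i ∈ S, X i ^ f i : MvPolynomial (Fin s) k) • n0 ∈
        subspaceSMul k ((1 ⊔ V) ^ (∑ i ∈ S, f i)) G := by
    intro S f
    induction S using Finset.induction_on with
    | empty => simpa [subspaceSMul_one] using hn0G
    | insert i S hi ih =>
      rw [Finset.prod_insert hi, Finset.sum_insert hi, mul_smul, add_comm]
      exact hX' i (f i) _ _ ih
  have hmem : ∀ j, ∀ p ∈ restrictDegree (Fin s) k j, p • n0 ∈ subspaceSMul k ((1 ⊔ V) ^ (s * j)) G := by
    intro j p hp
    rw [p.as_sum, Finset.sum_smul]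
    refine Submodule.sum_mem _ fun f hf => ?_
    have hf' := (mem_restrictDegree _ _ _).1 hp f hf
    have h1 : monomial f (coeff f p) = coeff f p • ∏ i, X i ^ f i := by
      rw [monomial_eq, Finsupp.prod_fintype _ _ (fun i => pow_zero _), C_mul']
    rw [h1, smul_assoc]
    refine Submodule.smul_mem _ _ ?_
    refine subspaceSMul_mono (one_sup_pow_mono le_rfl ?_) le_rfl (hprod Finset.univ f)
    refine (Finset.sum_le_card_nsmul _ _ _ fun i _ => hf' i).trans ?_
    simp
  have hdim : ∀ j, (j + 1) ^ s ≤ growthDim V G (s * j) := by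
    intro j
    rw [← finrank_restrictDegree k, growthDim]
    let g : restrictDegree (Fin s) k j →ₗ[k] subspaceSMul k ((1 ⊔ V) ^ (s * j)) G :=
      { toFun := fun p => ⟨(p : MvPolynomial (Fin s) k) • n0, hmem j p p.2⟩
        map_add' := fun p q => Subtype.ext (add_smul _ _ _)
        map_smul' := fun c p => Subtype.ext (smul_assoc c (p : MvPolynomial (Fin s) k) n0) }
    refine LinearMap.finrank_le_finrank_of_injective (f := g) ?_
    rw [← LinearMap.ker_eq_bot, LinearMap.ker_eq_bot']
    intro p hp
    have : (p : MvPolynomial (Fin s) k) • n0 = 0 := congrArg Subtype.val hp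
    exact Subtype.ext ((h.torsionFree _ _ this).resolve_right hn0)
  refine ⟨V, G, inferInstance, inferInstance, s ^ s, fun m => ?_⟩
  obtain rfl | hs := Nat.eq_zero_or_pos s
  · have := growthDim_pos V G (by rintro rfl; exact hn0 hn0G) m
    rw [pow_zero, pow_zero, one_mul]
    exact this
  · calc m ^ s ≤ (s * (m / s + 1)) ^ s := Nat.pow_le_pow_left (by
          have := Nat.div_add_mod m s
          have := Nat.mod_lt m hs
          rw [mul_add]; omega) s
      _ = s ^ s * (m / s + 1) ^ s := mul_pow _ _ _
      _ ≤ s ^ s * growthDim V G m := Nat.mul_le_mul_left _ ((hdim _).trans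
          (growthDim_mono le_rfl le_rfl (Nat.mul_div_le m s)))

end TypeGrowth

section GrowthExtension

open Cardinal MvPolynomial

variable {k H M : Type u} [Field k] [Ring H] [Algebra k H] [AddCommGroup M] [Module H M]
  [Module k M] [IsScalarTower k H M]

lemma GrowthLT.of_isType [IsNoetherianRing H] {D : ℕ} (hD : MultilinearPI k H D)
    [Module.Finite H M] {n s : ℕ} (N : Submodule H M) [Module (MvPolynomial (Fin s) k) N]
    (hN : IsType k H (MvPolynomial (Fin s) k) N) (hs : s < n) (hQ : GrowthLT k H (M ⧸ N) n) :
    GrowthLT k H M n := by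
  have := hN.smulComm
  have := hN.tower
  let Z := MvPolynomial (Fin s) k
  let K := FractionRing Z
  have : Module.Finite K (BC Z K N) := BC.finite_iff.2 hN.rank_lt
  obtain ⟨W, _, _, _, hKH, hc, hfin, f, hf⟩ := exists_injective_on_finite (k := k) (K := K) (Z := Z)
    hD N hN.torsionFree
  let _ : Module Z W := Module.compHom W (algebraMap Z K)
  have hZW : ∀ (z : Z) (w : W), z • w = algebraMap Z K z • w := fun _ _ => rfl
  have : IsScalarTower Z K W := ⟨fun a b x => by rw [Algebra.smul_def, mul_smul]; rfl⟩
  have : SMulCommClass H Z W := ⟨fun h z w => (smul_comm (algebraMap Z K z) h w).symm⟩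
  let _ : Module k W := Module.compHom W (algebraMap k Z)
  have hkW : ∀ (c : k) (w : W), c • w = algebraMap k K c • w := fun c w => by
    change algebraMap Z K (algebraMap k Z c) • w = _
    rw [← IsScalarTower.algebraMap_apply]
  have : IsScalarTower k Z W := ⟨fun a b x => by rw [Algebra.smul_def, mul_smul]; rfl⟩
  have : IsScalarTower k H W := ⟨fun a b x => by rw [Algebra.smul_def, mul_smul, hc, hkW]⟩
  have hW : IsType k H Z W :=
    { smulComm := inferInstance
      tower := inferInstance
      torsionFree := fun z w hzw => by
        rw [hZW] at hzw
        refine (smul_eq_zero.1 hzw).imp_left fun h => ?_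
        exact (FaithfulSMul.algebraMap_eq_zero_iff Z K).1 h
      rank_lt := by
        rw [← IsLocalization.rank_eq K (nonZeroDivisors Z) le_rfl]
        exact Module.rank_lt_aleph0 K W }
  refine ((hW.growthLT.mono hs).prod hQ).of_injective (f.prod N.mkQ) ?_
  rw [← LinearMap.ker_eq_bot, LinearMap.ker_eq_bot']
  intro x hx
  have h1 : f x = 0 := congrArg Prod.fst hx
  have h2 : N.mkQ x = 0 := congrArg Prod.snd hx
  exact hf x ((Submodule.Quotient.mk_eq_zero _).1 h2) h1

lemma IsType.transfer {Z N N' : Type u} [CommRing Z] [Algebra k Z] [AddCommGroup N] [Module k N]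
    [Module H N] [IsScalarTower k H N] [Module Z N] [AddCommGroup N'] [Module k N'] [Module H N']
    [IsScalarTower k H N'] (h : IsType k H Z N) (e : N ≃ₗ[H] N') :
    ∃ _ : Module Z N', IsType k H Z N' := by
  let _ : SMul Z N' := ⟨fun z x => e (z • e.symm x)⟩
  have hz : ∀ (z : Z) (x : N'), z • x = e (z • e.symm x) := fun _ _ => rfl
  have hz' : ∀ (z : Z) (x : N'), e.symm (z • x) = z • e.symm x := fun z x => by
    rw [hz, e.symm_apply_apply]
  let _ : Module Z N' := Function.Injective.module Z (e.symm : N' →ₗ[H] N).toAddMonoidHom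
    e.symm.injective hz'
  have := h.smulComm
  have := h.tower
  refine ⟨inferInstance, ⟨⟨fun a z x => ?_⟩, ⟨fun c z x => ?_⟩, fun z x hx => ?_, ?_⟩⟩
  · rw [hz, hz, LinearEquiv.map_smul, ← smul_comm a z (e.symm x), LinearEquiv.map_smul]
  · rw [hz, hz, smul_assoc, ← algebraMap_smul H c (z • e.symm x), map_smul, algebraMap_smul]
  · rw [hz, LinearEquiv.map_eq_zero_iff] at hx
    exact (h.torsionFree z _ hx).imp_right fun h => by simpa using h
  · let e' : N' ≃ₗ[Z] N := { e.symm.toAddEquiv with map_smul' := hz' }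
    rw [e'.rank_eq]
    exact h.rank_lt

/-- Induction principle for finitely generated modules: every such module is an iterated extension
of torsion-free modules of finite rank over polynomial rings. -/
theorem devissage [IsNoetherianRing H] [Algebra.FiniteType k H] {D : ℕ} (hD : MultilinearPI k H D)
    (P : ∀ (M : Type u) [AddCommGroup M] [Module H M] [Module k M] [IsScalarTower k H M], Prop)
    (zero : ∀ (M : Type u) [AddCommGroup M] [Module H M] [Module k M] [IsScalarTower k H M]
      [Subsingleton M], P M)
    (type : ∀ (M : Type u) [AddCommGroup M] [Module H M] [Module k M] [IsScalarTower k H M]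
      [Module.Finite H M] [Nontrivial M] (s : ℕ) [Module (MvPolynomial (Fin s) k) M],
      IsType k H (MvPolynomial (Fin s) k) M → P M)
    (ext : ∀ (M' M M'' : Type u) [AddCommGroup M'] [Module H M'] [Module k M']
      [IsScalarTower k H M'] [AddCommGroup M] [Module H M] [Module k M] [IsScalarTower k H M]
      [AddCommGroup M''] [Module H M''] [Module k M''] [IsScalarTower k H M'']
      [Module.Finite H M'] [Module.Finite H M] [Module.Finite H M'']
      (f : M' →ₗ[H] M) (g : M →ₗ[H] M''), Function.Injective f → Function.Surjective g →
      Function.Exact f g → P M' → P M'' → P M)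
    (M : Type u) [AddCommGroup M] [Module H M] [Module k M] [IsScalarTower k H M]
    [Module.Finite H M] : P M := by
  have hM : IsNoetherian H M := isNoetherian_of_isNoetherianRing_of_finite H M
  obtain ⟨T, hT, hmax⟩ := set_has_maximal_iff_noetherian.2 hM {T | P T} ⟨⊥, zero _⟩
  have fin : ∀ U : Submodule H M, Module.Finite H U := fun U =>
    Module.Finite.of_fg (IsNoetherian.noetherian U)
  have hT' : T = ⊤ := by
    by_contra hne
    have : Nontrivial (M ⧸ T) := Submodule.Quotient.nontrivial_iff.2 hne
    obtain ⟨N, hN0, s, _, hN⟩ := exists_type hD (M ⧸ T)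
    have : Nontrivial N := Submodule.nontrivial_iff_ne_bot.2 hN0
    have : Module.Finite H N := Module.Finite.of_fg (IsNoetherian.noetherian _)
    have hle : T ≤ N.comap T.mkQ := Submodule.le_comap_mkQ T N
    refine hmax (N.comap T.mkQ) ?_ (lt_of_le_of_ne hle fun h => hN0 ?_)
    · let g : N.comap T.mkQ →ₗ[H] N := T.mkQ.submoduleComap N
      refine ext T (N.comap T.mkQ) N (Submodule.inclusion hle) g
        (Submodule.inclusion_injective hle) ?_ ?_ hT (type N s hN)
      · rintro ⟨x, hx⟩
        obtain ⟨y, rfl⟩ := T.mkQ_surjective x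
        exact ⟨⟨y, hx⟩, rfl⟩
      · rintro ⟨x, hx⟩
        rw [Set.mem_range, Subtype.ext_iff]
        change (T.mkQ x = 0) ↔ _
        rw [Submodule.mkQ_apply, Submodule.Quotient.mk_eq_zero]
        exact ⟨fun h => ⟨⟨x, h⟩, rfl⟩, fun ⟨y, hy⟩ => by
          have h1 : (y : M) = x := Subtype.ext_iff.1 hy
          exact h1 ▸ y.2⟩
    · rw [← Submodule.map_comap_eq_of_surjective T.mkQ_surjective N, ← h]
      exact Submodule.mkQ_map_self T
  have e : (⊥ : Submodule H M) = ⊥ := rfl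
  subst hT'
  refine ext _ M (M ⧸ (⊤ : Submodule H M)) (⊤ : Submodule H M).subtype (⊤ : Submodule H M).mkQ
    (Submodule.injective_subtype _) (Submodule.mkQ_surjective _) ?_ hT ?_
  · exact LinearMap.exact_subtype_mkQ _
  · have : Subsingleton (M ⧸ (⊤ : Submodule H M)) := Submodule.Quotient.subsingleton_iff.2 rfl
    exact zero _

theorem GrowthLT.of_extension [IsNoetherianRing H] [Algebra.FiniteType k H] {D : ℕ}
    (hD : MultilinearPI k H D) [Module.Finite H M] {n : ℕ} {M' M'' : Type u} [AddCommGroup M']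
    [Module H M'] [Module k M'] [IsScalarTower k H M'] [AddCommGroup M''] [Module H M'']
    [Module k M''] [IsScalarTower k H M''] (f : M' →ₗ[H] M) (g : M →ₗ[H] M'')
    (hf : Function.Injective f) (hg : Function.Surjective g) (hfg : Function.Exact f g)
    (hS : GrowthLT k H M' n) (hQ : GrowthLT k H M'' n) : GrowthLT k H M n := by
  have : IsNoetherian H M := isNoetherian_of_isNoetherianRing_of_finite H M
  have : Module.Finite H M' := Module.Finite.of_injective f hf
  have key := devissage hD (fun M' [AddCommGroup M'] [Module H M'] [Module k M']
    [IsScalarTower k H M'] => GrowthLT k H M' n → ∀ (M : Type u) [AddCommGroup M] [Module H M]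
      [Module k M] [IsScalarTower k H M] [Module.Finite H M] (N : Submodule H M) (e : M' ≃ₗ[H] N),
      GrowthLT k H (M ⧸ N) n → GrowthLT k H M n) ?_ ?_ ?_ M' hS M (LinearMap.range f)
    (LinearEquiv.ofInjective f hf) ?_
  · exact key
  · intro M' _ _ _ _ _ _ M _ _ _ _ _ N e hQ
    have : Subsingleton N := e.symm.injective.subsingleton
    have hN : N = ⊥ := (Submodule.subsingleton_iff_eq_bot).1 this
    exact hQ.of_injective N.mkQ (by rw [← LinearMap.ker_eq_bot, Submodule.ker_mkQ, hN])
  · intro M' _ _ _ _ _ _ s _ hs hS M _ _ _ _ _ N e hQ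
    obtain ⟨_, hN⟩ := hs.transfer e
    exact GrowthLT.of_isType hD N hN (GrowthGE.le hS hs.growthGE) hQ
  · intro A M' B _ _ _ _ _ _ _ _ _ _ _ _ _ _ _ i p hi hp hip hA hB hM' M _ _ _ _ _ N e hQ
    let j : A →ₗ[H] M := N.subtype ∘ₗ e.toLinearMap ∘ₗ i
    have hj : Function.Injective j :=
      N.injective_subtype.comp (e.injective.comp hi)
    have hjN : LinearMap.range j ≤ N := by
      rintro _ ⟨x, rfl⟩
      exact (e (i x)).2
    refine hA (hM'.of_injective i hi) M (LinearMap.range j) (LinearEquiv.ofInjective j hj) ?_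
    let N' := N.map (LinearMap.range j).mkQ
    let q : M' →ₗ[H] N' := ((LinearMap.range j).mkQ.submoduleMap N) ∘ₗ e.toLinearMap
    have hq : Function.Surjective q :=
      (LinearMap.submoduleMap_surjective _ _).comp e.surjective
    have hker : LinearMap.ker p = LinearMap.ker q := by
      ext x
      rw [LinearMap.mem_ker, LinearMap.mem_ker, hip x, Subtype.ext_iff]
      change _ ↔ (LinearMap.range j).mkQ (e x) = 0
      rw [Submodule.mkQ_apply, Submodule.Quotient.mk_eq_zero]
      constructor
      · rintro ⟨y, rfl⟩; exact ⟨y, rfl⟩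
      · rintro ⟨y, hy⟩; exact ⟨y, e.injective (Subtype.ext hy)⟩
    let e' : B ≃ₗ[H] N' := (LinearMap.quotKerEquivOfSurjective p hp).symm.trans
      ((Submodule.quotEquivOfEq _ _ hker).trans (LinearMap.quotKerEquivOfSurjective q hq))
    refine hB (hM'.of_surjective p hp) (M ⧸ LinearMap.range j) N' e' ?_
    exact hQ.of_surjective (Submodule.quotientQuotientEquivQuotient _ _ hjN).symm.toLinearMap
      (LinearEquiv.surjective _)
  · rw [← LinearMap.exact_iff.1 hfg]
    exact hQ.of_surjective (LinearMap.quotKerEquivOfSurjective g hg).symm.toLinearMap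
      (LinearEquiv.surjective _)

/-- The growth of a nonzero finitely generated module is governed by an integer. -/
theorem exists_growth [IsNoetherianRing H] [Algebra.FiniteType k H] {D : ℕ}
    (hD : MultilinearPI k H D) (M : Type u) [AddCommGroup M] [Module H M] [Module k M]
    [IsScalarTower k H M] [Module.Finite H M] [Nontrivial M] :
    ∃ s, GrowthLT k H M (s + 1) ∧ GrowthGE k H M s := by
  have key := devissage hD (fun M [AddCommGroup M] [Module H M] [Module k M]
    [IsScalarTower k H M] => Nontrivial M → ∃ s, GrowthLT k H M (s + 1) ∧ GrowthGE k H M s)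
    ?_ ?_ ?_ M inferInstance
  · exact key
  · intro M _ _ _ _ _ h
    exact absurd h (not_nontrivial M)
  · intro M _ _ _ _ _ _ s _ hs _
    exact ⟨s, hs.growthLT, hs.growthGE⟩
  · intro A M B _ _ _ _ _ _ _ _ _ _ _ _ _ _ _ i p hi hp hip hA hB hM
    rcases subsingleton_or_nontrivial A with h0 | h0
    · rcases subsingleton_or_nontrivial B with h1 | h1
      · refine absurd hM (not_nontrivial_iff_subsingleton.2 ⟨fun x y => ?_⟩)
        have : ∀ x : M, x = 0 := fun x => by
          obtain ⟨a, rfl⟩ := (hip x).1 (Subsingleton.elim _ _)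
          rw [Subsingleton.elim a 0, map_zero]
        rw [this x, this y]
      · obtain ⟨s, h2, h3⟩ := hB h1
        exact ⟨s, .of_extension hD i p hi hp hip (growthLT_of_subsingleton (s + 1)) h2,
          h3.of_surjective p hp⟩
    · obtain ⟨s, h2, h3⟩ := hA h0
      rcases subsingleton_or_nontrivial B with h1 | h1
      · exact ⟨s, .of_extension hD i p hi hp hip h2 (growthLT_of_subsingleton (s + 1)),
          h3.of_injective i hi⟩
      · obtain ⟨t, h4, h5⟩ := hB h1
        rcases le_total s t with h | h
        · exact ⟨t, .of_extension hD i p hi hp hip (h2.mono (by lia)) h4, h5.of_surjective p hp⟩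
        · exact ⟨s, .of_extension hD i p hi hp hip h2 (h4.mono (by lia)), h3.of_injective i hi⟩

end GrowthExtension

section GKDim

open Filter Topology ENNReal

lemma tendsto_ofReal_logb_mul_pow (C s : ℕ) (hC : C ≠ 0) :
    Tendsto (fun m : ℕ => ENNReal.ofReal (Real.logb m ((C : ℝ) * (m : ℝ) ^ s))) atTop (𝓝 (s : ℝ≥0∞)) := by
  rw [← ENNReal.ofReal_natCast s]
  refine ENNReal.tendsto_ofReal ?_
  have h1 : Tendsto (fun m : ℕ => Real.log C / Real.log m + s) atTop (𝓝 (0 + s)) :=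
    (Tendsto.const_div_atTop (Real.tendsto_log_atTop.comp tendsto_natCast_atTop_atTop) _).add_const _
  rw [zero_add] at h1
  refine h1.congr' ?_
  filter_upwards [eventually_ge_atTop 2] with m hm
  have hm' : (1 : ℝ) < m := by exact_mod_cast hm
  have hl : Real.log m ≠ 0 := (Real.log_pos hm').ne'
  rw [Real.logb, Real.log_mul (by exact_mod_cast hC) (by positivity), Real.log_pow]
  field_simp

lemma limsup_logb_le (f : ℕ → ℕ) (C s : ℕ) (h : ∀ m, 1 ≤ m → f m ≤ C * m ^ s) :
    limsup (fun m : ℕ => ENNReal.ofReal (Real.logb m (f m))) atTop ≤ (s : ℝ≥0∞) := by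
  rw [← (tendsto_ofReal_logb_mul_pow (C + 1) s (by lia)).limsup_eq]
  refine limsup_le_limsup ?_
  filter_upwards [eventually_ge_atTop 2] with m hm
  refine ENNReal.ofReal_le_ofReal ?_
  have hm' : (1 : ℝ) < m := by exact_mod_cast hm
  rcases Nat.eq_zero_or_pos (f m) with h0 | h0
  · rw [h0, Nat.cast_zero, Real.logb_zero]
    refine Real.logb_nonneg hm' ?_
    have h1 : 1 ≤ (C + 1) * m ^ s := Nat.mul_pos (by lia) (by positivity)
    exact_mod_cast h1
  · refine Real.logb_le_logb_of_le hm' (by exact_mod_cast h0) ?_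
    have h1 : f m ≤ (C + 1) * m ^ s := (h m (by lia)).trans (Nat.mul_le_mul_right _ (by lia))
    exact_mod_cast h1

lemma le_limsup_logb (f : ℕ → ℕ) (C s : ℕ) (h : ∀ m, 2 ≤ m → m ^ s ≤ C * f m) :
    (s : ℝ≥0∞) ≤ limsup (fun m : ℕ => ENNReal.ofReal (Real.logb m (f m))) atTop := by
  have hs : Tendsto (fun m : ℕ => ENNReal.ofReal (s - Real.logb m C)) atTop (𝓝 (s : ℝ≥0∞)) := by
    rw [← ENNReal.ofReal_natCast s]
    refine ENNReal.tendsto_ofReal ?_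
    have h1 : Tendsto (fun m : ℕ => (s : ℝ) - Real.log C / Real.log m) atTop (𝓝 (s - 0)) :=
      (Tendsto.const_div_atTop (Real.tendsto_log_atTop.comp tendsto_natCast_atTop_atTop) _).const_sub _
    rw [sub_zero] at h1
    exact h1
  rw [← hs.limsup_eq]
  refine limsup_le_limsup ?_
  filter_upwards [eventually_ge_atTop 2] with m hm
  refine ENNReal.ofReal_le_ofReal ?_
  have hm' : (1 : ℝ) < m := by exact_mod_cast hm
  have h1 := h m hm
  have h2 : 0 < C * f m := lt_of_lt_of_le (by positivity) h1
  have hC : (C : ℝ) ≠ 0 := by exact_mod_cast (Nat.pos_of_mul_pos_right h2).ne'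
  have hf : (f m : ℝ) ≠ 0 := by exact_mod_cast (Nat.pos_of_mul_pos_left h2).ne'
  rw [sub_le_iff_le_add, add_comm, ← Real.logb_mul hC hf]
  have h3 : ((m : ℝ) ^ s) ≤ C * f m := by exact_mod_cast h1
  have := Real.logb_le_logb_of_le hm' (by positivity) h3
  rwa [Real.logb_pow, Real.logb_self_eq_one hm', mul_one] at this

variable {k H M : Type u} [Field k] [Ring H] [Algebra k H] [AddCommGroup M] [Module H M]
  [Module k M] [IsScalarTower k H M]

lemma GrowthLT.bound {s : ℕ} (h : GrowthLT k H M (s + 1)) (V : Submodule k H) (F : Submodule k M)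
    [Module.Finite k V] [Module.Finite k F] :
    ∃ C : ℕ, ∀ m, 1 ≤ m → growthDim V F m ≤ C * m ^ s := by
  obtain ⟨C, hC⟩ := h V F
  refine ⟨C, fun m hm => ?_⟩
  have := hC m hm
  rw [pow_succ, ← mul_assoc, mul_comm] at this
  exact Nat.le_of_mul_le_mul_right this hm

theorem gkDimModule_eq {s : ℕ} (h : GrowthLT k H M (s + 1)) (h' : GrowthGE k H M s) :
    gkDimModule k H M = s := by
  apply le_antisymm
  · refine iSup_le fun V => iSup_le fun _ => iSup_le fun F => iSup_le fun _ => ?_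
    obtain ⟨C, hC⟩ := h.bound V F
    exact limsup_logb_le _ C s hC
  · obtain ⟨V, F, hV, hF, C, hC⟩ := h'
    exact (le_limsup_logb _ C s fun m _ => hC m).trans
      (le_iSup_of_le V (le_iSup_of_le hV (le_iSup_of_le F (le_iSup_of_le hF le_rfl))))

theorem gkDim_eq {s : ℕ} (h : GrowthLT k H H (s + 1)) (h' : GrowthGE k H H s) :
    gkDim k H = s := by
  apply le_antisymm
  · refine iSup_le fun V => iSup_le fun _ => ?_
    obtain ⟨C, hC⟩ := h.bound V 1
    refine limsup_logb_le _ C s fun m hm => ?_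
    refine le_trans (Submodule.finrank_mono fun x hx => ?_) (hC m hm)
    rw [← mul_one x]
    exact smul_mem_subspaceSMul hx (Submodule.mem_one.2 ⟨1, map_one _⟩)
  · obtain ⟨V, F, hV, hF, C, hC⟩ := h'
    have : Module.Finite k (V ⊔ F : Submodule k H) := Submodule.finite_sup V F
    refine (le_limsup_logb _ (C * 2 ^ s) s fun m hm => ?_).trans
      (le_iSup_of_le (V ⊔ F) (le_iSup_of_le this le_rfl))
    obtain ⟨m, rfl⟩ : ∃ m', m = m' + 1 := ⟨m - 1, by lia⟩
    have h1 : growthDim V F m ≤ Module.finrank k ((1 ⊔ (V ⊔ F)) ^ (m + 1) : Submodule k H) := by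
      have : Module.Finite k (1 ⊔ (V ⊔ F) : Submodule k H) := Submodule.finite_sup _ _
      refine Submodule.finrank_mono (subspaceSMul_le.2 fun a ha x hx => ?_)
      rw [pow_succ]
      have h2 : ((1 ⊔ V) ^ m : Submodule k H) ≤ (1 ⊔ (V ⊔ F)) ^ m :=
        pow_le_pow_left' (sup_le_sup le_rfl le_sup_left) m
      refine Submodule.mul_mem_mul (h2 ha) ?_
      exact Submodule.mem_sup_right (Submodule.mem_sup_right hx)
    calc (m + 1) ^ s ≤ (2 * m) ^ s := Nat.pow_le_pow_left (by lia) s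
      _ = 2 ^ s * m ^ s := mul_pow ..
      _ ≤ 2 ^ s * (C * growthDim V F m) := Nat.mul_le_mul_left _ (hC m)
      _ ≤ 2 ^ s * (C * Module.finrank k ((1 ⊔ (V ⊔ F)) ^ (m + 1) : Submodule k H)) := by gcongr
      _ = _ := by ring

end GKDim

section RawExt

open Abelian

variable {C : Type u'} [Category.{v} C] [Abelian C] [HasExt.{w} C] {X Y Z T : C}

/-- Precomposition of an extension class with a morphism, as an additive map. -/
noncomputable def extPre (f : X ⟶ Y) (i : ℕ) : Ext.{w} Y Z i →+ Ext.{w} X Z i where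
  toFun e := (Ext.mk₀ f).comp e (zero_add i)
  map_zero' := Ext.comp_zero ..
  map_add' _ _ := Ext.comp_add ..

/-- Postcomposition of an extension class with a morphism, as an additive map. -/
noncomputable def extPost (f : Y ⟶ Z) (i : ℕ) : Ext.{w} X Y i →+ Ext.{w} X Z i where
  toFun e := e.comp (Ext.mk₀ f) (add_zero i)
  map_zero' := Ext.zero_comp ..
  map_add' _ _ := Ext.add_comp ..

lemma extPre_id (i : ℕ) (e : Ext.{w} X Z i) : extPre (𝟙 X) i e = e := Ext.mk₀_id_comp e

lemma extPre_comp (f : X ⟶ Y) (g : Y ⟶ T) (i : ℕ) (e : Ext.{w} T Z i) :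
    extPre (f ≫ g) i e = extPre f i (extPre g i e) :=
  (Ext.mk₀_comp_mk₀_assoc f g e).symm

lemma extPre_add (f g : X ⟶ Y) (i : ℕ) (e : Ext.{w} Y Z i) :
    extPre (f + g) i e = extPre f i e + extPre g i e := by
  change (Ext.mk₀ (f + g)).comp e (zero_add i) = (Ext.mk₀ f).comp e (zero_add i) + (Ext.mk₀ g).comp e (zero_add i)
  rw [Ext.mk₀_add, Ext.add_comp]

lemma extPre_zero (i : ℕ) (e : Ext.{w} Y Z i) : extPre (0 : X ⟶ Y) i e = 0 := by
  change (Ext.mk₀ (0 : X ⟶ Y)).comp e (zero_add i) = 0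
  rw [Ext.mk₀_zero, Ext.zero_comp]

lemma extPost_id (i : ℕ) (e : Ext.{w} X Z i) : extPost (𝟙 Z) i e = e := Ext.comp_mk₀_id e

lemma extPost_comp (f : Y ⟶ Z) (g : Z ⟶ T) (i : ℕ) (e : Ext.{w} X Y i) :
    extPost (f ≫ g) i e = extPost g i (extPost f i e) := by
  change e.comp (Ext.mk₀ (f ≫ g)) (add_zero i) = (e.comp (Ext.mk₀ f) (add_zero i)).comp (Ext.mk₀ g) (add_zero i)
  rw [← Ext.mk₀_comp_mk₀, ← Ext.comp_assoc_of_second_deg_zero]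

lemma extPost_add (f g : Y ⟶ Z) (i : ℕ) (e : Ext.{w} X Y i) :
    extPost (f + g) i e = extPost f i e + extPost g i e := by
  change e.comp (Ext.mk₀ (f + g)) (add_zero i) = e.comp (Ext.mk₀ f) (add_zero i) + e.comp (Ext.mk₀ g) (add_zero i)
  rw [Ext.mk₀_add, Ext.comp_add]

lemma extPost_zero (i : ℕ) (e : Ext.{w} X Y i) : extPost (0 : Y ⟶ Z) i e = 0 := by
  change e.comp (Ext.mk₀ (0 : Y ⟶ Z)) (add_zero i) = 0
  rw [Ext.mk₀_zero, Ext.comp_zero]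

lemma extPre_extPost (f : X ⟶ Y) (g : Z ⟶ T) (i : ℕ) (e : Ext.{w} Y Z i) :
    extPre f i (extPost g i e) = extPost g i (extPre f i e) :=
  (Ext.comp_assoc _ _ _ (zero_add i) (add_zero i) (by lia)).symm

lemma extPre_mk₀ (f : X ⟶ Y) (g : Y ⟶ Z) :
    extPre f 0 (Ext.mk₀ g : Ext.{w} Y Z 0) = Ext.mk₀ (f ≫ g) := Ext.mk₀_comp_mk₀ f g

lemma extPost_mk₀ (f : X ⟶ Y) (g : Y ⟶ Z) :
    extPost g 0 (Ext.mk₀ f : Ext.{w} X Y 0) = Ext.mk₀ (f ≫ g) := Ext.mk₀_comp_mk₀ f g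

variable {S S' : ShortComplex C}

/-- The connecting map of the long exact sequence in the first variable. -/
noncomputable def extDelta (hS : S.ShortExact) (i : ℕ) : Ext.{w} S.X₁ Z i →+ Ext.{w} S.X₃ Z (i + 1) where
  toFun e := hS.extClass.comp e (add_comm 1 i)
  map_zero' := Ext.comp_zero ..
  map_add' _ _ := Ext.comp_add ..

lemma extDelta_extPost (hS : S.ShortExact) (g : Z ⟶ T) (i : ℕ) (e : Ext.{w} S.X₁ Z i) :
    extDelta hS i (extPost g i e) = extPost g (i + 1) (extDelta hS i e) :=
  (Ext.comp_assoc _ _ _ (add_comm 1 i) (add_zero i) (by lia)).symm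

lemma extDelta_extPre (hS : S.ShortExact) (hS' : S'.ShortExact) (φ : S ⟶ S') (i : ℕ)
    (x : Ext.{w} S'.X₁ Z i) :
    extDelta hS i (extPre φ.τ₁ i x) = extPre φ.τ₃ (i + 1) (extDelta hS' i x) := by
  change hS.extClass.comp ((Ext.mk₀ φ.τ₁).comp x (zero_add i)) (add_comm 1 i) =
    (Ext.mk₀ φ.τ₃).comp (hS'.extClass.comp x (add_comm 1 i)) (zero_add (i + 1))
  rw [← Ext.comp_assoc _ _ _ (add_zero 1) (zero_add i) (by lia),
    ShortComplex.ShortExact.extClass_naturality hS hS' φ,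
    Ext.comp_assoc _ _ _ (zero_add 1) (add_comm 1 i) (by lia)]

lemma extPre_exact (hS : S.ShortExact) (i : ℕ) :
    Function.Exact (extPre (Z := Z) S.g i : Ext.{w} S.X₃ Z i →+ _) (extPre S.f i) := by
  intro x
  refine ⟨fun hx => Ext.contravariant_sequence_exact₂ hS Z x hx, ?_⟩
  rintro ⟨y, rfl⟩
  rw [← extPre_comp, S.zero, extPre_zero]

lemma extDelta_exact (hS : S.ShortExact) (i : ℕ) :
    Function.Exact (extPre (Z := Z) S.f i : Ext.{w} S.X₂ Z i →+ _) (extDelta hS i) := by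
  intro x
  refine ⟨fun hx => Ext.contravariant_sequence_exact₁ hS Z x (add_comm 1 i) hx, ?_⟩
  rintro ⟨y, rfl⟩
  exact ShortComplex.ShortExact.extClass_comp_assoc hS y (h := add_comm 1 i)

lemma extDelta_exact' (hS : S.ShortExact) (i : ℕ) :
    Function.Exact (extDelta (Z := Z) hS i : Ext.{w} S.X₁ Z i →+ _) (extPre S.g (i + 1)) := by
  intro x
  refine ⟨fun hx => Ext.contravariant_sequence_exact₃ hS Z x hx (add_comm 1 i), ?_⟩
  rintro ⟨y, rfl⟩
  exact ShortComplex.ShortExact.comp_extClass_assoc hS y (add_comm 1 i)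

lemma extPre_zero_injective (hS : S.ShortExact) :
    Function.Injective (extPre (Z := Z) S.g 0 : Ext.{w} S.X₃ Z 0 →+ _) := by
  have := hS.epi_g
  exact Ext.precomp_mk₀_injective_of_epi Z S.g

end RawExt

section ExtFunctor

open Abelian

/-- Right multiplication by an element of a ring, as an endomorphism of the left regular module. -/
def rmulEnd (A : Type u) [Ring A] (a : Aᵐᵒᵖ) : A →ₗ[A] A where
  toFun x := x * a.unop
  map_add' _ _ := add_mul _ _ _
  map_smul' r x := mul_assoc r x a.unop

/-- The group `Ext^i (M, A)`, in the universe of the module. -/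
def ExtA (A : Type u) [Ring A] (M : Type u) [AddCommGroup M] [Module A M] (i : ℕ) : Type u :=
  Ext.{u} (ModuleCat.of A M) (ModuleCat.of A A) i

variable {A : Type u} [Ring A] {M N P : Type u} [AddCommGroup M] [Module A M]
  [AddCommGroup N] [Module A N] [AddCommGroup P] [Module A P]

noncomputable instance (i : ℕ) : AddCommGroup (ExtA A M i) :=
  inferInstanceAs (AddCommGroup (Ext.{u} (ModuleCat.of A M) (ModuleCat.of A A) i))

lemma ofHom_rmulEnd_mul (a b : Aᵐᵒᵖ) : ModuleCat.ofHom (rmulEnd A (a * b)) =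
    ModuleCat.ofHom (rmulEnd A b) ≫ ModuleCat.ofHom (rmulEnd A a) :=
  ModuleCat.hom_ext (LinearMap.ext fun x => (mul_assoc x b.unop a.unop).symm)

lemma ofHom_rmulEnd_one : ModuleCat.ofHom (rmulEnd A 1) = 𝟙 (ModuleCat.of A A) :=
  ModuleCat.hom_ext (LinearMap.ext fun x => mul_one x)

lemma ofHom_rmulEnd_add (a b : Aᵐᵒᵖ) : ModuleCat.ofHom (rmulEnd A (a + b)) =
    ModuleCat.ofHom (rmulEnd A a) + ModuleCat.ofHom (rmulEnd A b) :=
  ModuleCat.hom_ext (LinearMap.ext fun x => mul_add x a.unop b.unop)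

lemma ofHom_rmulEnd_zero : ModuleCat.ofHom (rmulEnd A 0) = 0 :=
  ModuleCat.hom_ext (LinearMap.ext fun x => mul_zero x)

/-- The right module structure on `Ext^i (M, A)`. -/
noncomputable instance instModuleExtA (i : ℕ) : Module Aᵐᵒᵖ (ExtA A M i) where
  smul a := extPost.{u, u, u + 1} (X := ModuleCat.of A M) (ModuleCat.ofHom (rmulEnd A a)) i
  one_smul e := (DFunLike.congr_fun (congrArg (extPost.{u, u, u + 1} · i) ofHom_rmulEnd_one) _).trans
    (extPost_id.{u, u, u + 1} i _)
  mul_smul a b e := (DFunLike.congr_fun (congrArg (extPost.{u, u, u + 1} · i) (ofHom_rmulEnd_mul a b)) _).trans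
    (extPost_comp.{u, u, u + 1} _ _ i _)
  smul_zero a := map_zero (extPost.{u, u, u + 1} (X := ModuleCat.of A M) (ModuleCat.ofHom (rmulEnd A a)) i)
  smul_add a := map_add (extPost.{u, u, u + 1} (X := ModuleCat.of A M) (ModuleCat.ofHom (rmulEnd A a)) i)
  add_smul a b e := (DFunLike.congr_fun (congrArg (extPost.{u, u, u + 1} · i) (ofHom_rmulEnd_add a b)) _).trans
    (extPost_add.{u, u, u + 1} _ _ i _)
  zero_smul e := (DFunLike.congr_fun (congrArg (extPost.{u, u, u + 1} · i) ofHom_rmulEnd_zero) _).trans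
    (extPost_zero.{u, u, u + 1} i _)

/-- The map `Ext^i (N, A) → Ext^i (M, A)` induced by a linear map `M → N`. -/
noncomputable def ExtA.map (f : M →ₗ[A] N) (i : ℕ) : ExtA A N i →ₗ[Aᵐᵒᵖ] ExtA A M i where
  __ := (extPre.{u, u, u + 1} (ModuleCat.ofHom f) i :
    Ext.{u} (ModuleCat.of A N) (ModuleCat.of A A) i →+
      Ext.{u} (ModuleCat.of A M) (ModuleCat.of A A) i)
  map_smul' a x := extPre_extPost.{u, u, u + 1} (ModuleCat.ofHom f) (ModuleCat.ofHom (rmulEnd A a)) i _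

lemma ExtA.map_id (i : ℕ) (e : ExtA A M i) : ExtA.map (LinearMap.id : M →ₗ[A] M) i e = e :=
  extPre_id.{u, u, u + 1} (X := ModuleCat.of A M) i _

lemma ExtA.map_comp (f : M →ₗ[A] N) (g : N →ₗ[A] P) (i : ℕ) (e : ExtA A P i) :
    ExtA.map (g ∘ₗ f) i e = ExtA.map f i (ExtA.map g i e) :=
  extPre_comp.{u, u, u + 1} (ModuleCat.ofHom f) (ModuleCat.ofHom g) i _

lemma ExtA.map_add' (f g : M →ₗ[A] N) (i : ℕ) (e : ExtA A N i) :
    ExtA.map (f + g) i e = ExtA.map f i e + ExtA.map g i e :=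
  extPre_add.{u, u, u + 1} (ModuleCat.ofHom f) (ModuleCat.ofHom g) i _

lemma ExtA.map_zero' (i : ℕ) (e : ExtA A N i) : ExtA.map (0 : M →ₗ[A] N) i e = 0 :=
  extPre_zero.{u, u, u + 1} (X := ModuleCat.of A M) (Y := ModuleCat.of A N) i _

/-- A linear equivalence induces an equivalence on `Ext`. -/
noncomputable def ExtA.mapEquiv (f : M ≃ₗ[A] N) (i : ℕ) : ExtA A N i ≃ₗ[Aᵐᵒᵖ] ExtA A M i :=
  { ExtA.map f.toLinearMap i with
    invFun := ExtA.map f.symm.toLinearMap i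
    left_inv := fun e => by
      change ExtA.map _ i (ExtA.map _ i e) = e
      rw [← ExtA.map_comp, LinearEquiv.comp_coe, LinearEquiv.symm_trans_self]
      exact ExtA.map_id i e
    right_inv := fun e => by
      change ExtA.map _ i (ExtA.map _ i e) = e
      rw [← ExtA.map_comp, LinearEquiv.comp_coe, LinearEquiv.self_trans_symm]
      exact ExtA.map_id i e }

/-- `Ext^0` is `Hom`. -/
noncomputable def ExtA.zeroEquiv : ExtA A M 0 ≃ₗ[Aᵐᵒᵖ] (M →ₗ[A] A) :=
  LinearEquiv.symm
  { toFun := fun f => (Ext.mk₀.{u, u, u + 1} (ModuleCat.ofHom f) :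
      Ext.{u} (ModuleCat.of A M) (ModuleCat.of A A) 0)
    invFun := fun e => ((Ext.addEquiv₀ :
      Ext.{u} (ModuleCat.of A M) (ModuleCat.of A A) 0 ≃+ _) e).hom
    map_add' := fun f g => Ext.mk₀_add.{u, u, u + 1} (X := ModuleCat.of A M) (Y := ModuleCat.of A A) _ _
    map_smul' := fun a f =>
      (extPost_mk₀.{u, u, u + 1} (ModuleCat.ofHom f) (ModuleCat.ofHom (rmulEnd A a))).symm
    left_inv := fun f => congrArg ModuleCat.Hom.hom ((Ext.addEquiv₀ :
      Ext.{u} (ModuleCat.of A M) (ModuleCat.of A A) 0 ≃+ _).apply_symm_apply (ModuleCat.ofHom f))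
    right_inv := fun e => (Ext.addEquiv₀ :
      Ext.{u} (ModuleCat.of A M) (ModuleCat.of A A) 0 ≃+ _).symm_apply_apply e }

lemma ExtA.map_zeroEquiv_symm (f : M →ₗ[A] N) (φ : N →ₗ[A] A) :
    ExtA.map f 0 (ExtA.zeroEquiv.symm φ) = ExtA.zeroEquiv.symm (φ ∘ₗ f) :=
  extPre_mk₀.{u, u, u + 1} (ModuleCat.ofHom f) (ModuleCat.ofHom φ)

lemma ExtA.zeroEquiv_map (f : M →ₗ[A] N) (e : ExtA A N 0) :
    ExtA.zeroEquiv (ExtA.map f 0 e) = ExtA.zeroEquiv e ∘ₗ f := by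
  obtain ⟨φ, rfl⟩ := ExtA.zeroEquiv.symm.surjective e
  rw [ExtA.map_zeroEquiv_symm, LinearEquiv.apply_symm_apply, LinearEquiv.apply_symm_apply]

/-- Short exact sequences of modules. -/
structure IsSES (f : M →ₗ[A] N) (g : N →ₗ[A] P) : Prop where
  inj : Function.Injective f
  surj : Function.Surjective g
  exact : Function.Exact f g

namespace IsSES

variable {f : M →ₗ[A] N} {g : N →ₗ[A] P}

lemma comp (h : IsSES f g) : g ∘ₗ f = 0 := by
  ext x; exact h.exact.apply_apply_eq_zero x

/-- The short complex attached to a short exact sequence. -/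
def sc (h : IsSES f g) : ShortComplex (ModuleCat.{u} A) :=
  ShortComplex.mk (ModuleCat.ofHom f) (ModuleCat.ofHom g) (by
    rw [← ModuleCat.ofHom_comp, h.comp, ModuleCat.ofHom_zero])

lemma shortExact (h : IsSES f g) : h.sc.ShortExact where
  exact := (ShortComplex.moduleCat_exact_iff _).2 fun x hx => (h.exact x).1 hx
  mono_f := (ModuleCat.mono_iff_injective _).2 h.inj
  epi_g := (ModuleCat.epi_iff_surjective _).2 h.surj

/-- The connecting map. -/
noncomputable def δ (h : IsSES f g) (i : ℕ) : ExtA A M i →ₗ[Aᵐᵒᵖ] ExtA A P (i + 1) where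
  __ := (extDelta.{u, u, u + 1} h.shortExact i :
    Ext.{u} (ModuleCat.of A M) (ModuleCat.of A A) i →+
      Ext.{u} (ModuleCat.of A P) (ModuleCat.of A A) (i + 1))
  map_smul' a x := extDelta_extPost.{u, u, u + 1} h.shortExact (ModuleCat.ofHom (rmulEnd A a)) i _

variable (h : IsSES f g) (i : ℕ)

lemma exact₂ (h : IsSES f g) (i : ℕ) : Function.Exact (ExtA.map g i) (ExtA.map f i) :=
  extPre_exact.{u, u, u + 1} (Z := ModuleCat.of A A) h.shortExact i

lemma exact₁ : Function.Exact (ExtA.map f i) (h.δ i) :=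
  extDelta_exact.{u, u, u + 1} (Z := ModuleCat.of A A) h.shortExact i

lemma exact₃ : Function.Exact (h.δ i) (ExtA.map g (i + 1)) :=
  extDelta_exact'.{u, u, u + 1} (Z := ModuleCat.of A A) h.shortExact i

lemma map_zero_injective (h : IsSES f g) : Function.Injective (ExtA.map g 0) :=
  extPre_zero_injective.{u, u, u + 1} (Z := ModuleCat.of A A) h.shortExact

lemma δ_naturality {M' N' P' : Type u} [AddCommGroup M'] [Module A M'] [AddCommGroup N']
    [Module A N'] [AddCommGroup P'] [Module A P'] {f' : M' →ₗ[A] N'} {g' : N' →ₗ[A] P'}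
    (h' : IsSES f' g') (a : M →ₗ[A] M') (b : N →ₗ[A] N') (c : P →ₗ[A] P')
    (hab : b ∘ₗ f = f' ∘ₗ a) (hbc : c ∘ₗ g = g' ∘ₗ b) (x : ExtA A M' i) :
    h.δ i (ExtA.map a i x) = ExtA.map c (i + 1) (h'.δ i x) := by
  let φ : h.sc ⟶ h'.sc := ShortComplex.homMk (ModuleCat.ofHom a) (ModuleCat.ofHom b)
    (ModuleCat.ofHom c) (by
      change ModuleCat.ofHom a ≫ ModuleCat.ofHom f' = ModuleCat.ofHom f ≫ ModuleCat.ofHom b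
      rw [← ModuleCat.ofHom_comp, ← ModuleCat.ofHom_comp, hab]) (by
      change ModuleCat.ofHom b ≫ ModuleCat.ofHom g' = ModuleCat.ofHom g ≫ ModuleCat.ofHom c
      rw [← ModuleCat.ofHom_comp, ← ModuleCat.ofHom_comp, hbc])
  exact extDelta_extPre.{u, u, u + 1} h.shortExact h'.shortExact φ i _

end IsSES

lemma ExtA.subsingleton_of_projective [Module.Projective A M] (i : ℕ) :
    Subsingleton (ExtA A M (i + 1)) := by
  have : Projective (ModuleCat.of A M) := (IsProjective.iff_projective (R := A) M).1 ‹_›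
  exact ⟨fun x y => (Ext.eq_zero_of_projective (Y := ModuleCat.of A A) x).trans
    (Ext.eq_zero_of_projective (Y := ModuleCat.of A A) y).symm⟩

lemma ExtA.subsingleton [Subsingleton M] (i : ℕ) : Subsingleton (ExtA A M i) := by
  have h : ∀ x : ExtA A M i, x = 0 := fun x => by
    rw [← ExtA.map_id i x, show (LinearMap.id : M →ₗ[A] M) = 0 from Subsingleton.elim _ _,
      ExtA.map_zero']
  exact ⟨fun x y => (h x).trans (h y).symm⟩

lemma IsSES.of_ker {f : M →ₗ[A] N} (hf : Function.Surjective f) :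
    IsSES (LinearMap.ker f).subtype f :=
  ⟨Submodule.injective_subtype _, hf, LinearMap.exact_subtype_ker_map f⟩

lemma IsSES.of_quotient (S : Submodule A M) : IsSES S.subtype S.mkQ :=
  ⟨Submodule.injective_subtype _, S.mkQ_surjective, LinearMap.exact_subtype_mkQ S⟩

lemma IsSES.of_range {f : M →ₗ[A] N} (hf : Function.Injective f) :
    IsSES f (LinearMap.range f).mkQ :=
  ⟨hf, Submodule.mkQ_surjective _, LinearMap.exact_map_mkQ_range f⟩

/-- Over a noetherian ring a finitely generated module has a finitely generated syzygy. -/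
lemma exists_syzygy [IsNoetherianRing A] (M : Type u) [AddCommGroup M] [Module A M]
    [Module.Finite A M] : ∃ (n : ℕ) (f : (Fin n → A) →ₗ[A] M), Function.Surjective f ∧
      Module.Finite A (LinearMap.ker f) := by
  obtain ⟨n, f, hf⟩ := Module.Finite.exists_fin' A M
  exact ⟨n, f, hf, Module.Finite.of_fg (IsNoetherian.noetherian _)⟩

theorem ExtA.finite [IsNoetherianRing A] [IsNoetherianRing Aᵐᵒᵖ] (M : Type u) [AddCommGroup M]
    [Module A M] [Module.Finite A M] (i : ℕ) : Module.Finite Aᵐᵒᵖ (ExtA A M i) := by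
  induction i generalizing M with
  | zero =>
    obtain ⟨n, f, hf⟩ := Module.Finite.exists_fin' A M
    let ev : ((Fin n → A) →ₗ[A] A) →ₗ[Aᵐᵒᵖ] (Fin n → A) :=
      { toFun := fun φ j => φ (Pi.single j 1)
        map_add' := fun _ _ => rfl
        map_smul' := fun _ _ => rfl }
    have hev : Function.Injective ev := by
      intro φ ψ h
      refine LinearMap.pi_ext' fun j => LinearMap.ext_ring ?_
      exact congrFun h j
    let e1 : A →ₗ[Aᵐᵒᵖ] Aᵐᵒᵖ := 
      { toFun := MulOpposite.op
        map_add' := fun _ _ => rfl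
        map_smul' := fun _ _ => rfl }
    let e2 : (Fin n → A) →ₗ[Aᵐᵒᵖ] (Fin n → Aᵐᵒᵖ) := LinearMap.pi fun j => e1 ∘ₗ LinearMap.proj j
    have he2 : Function.Injective e2 := by
      intro x y h
      funext j
      exact MulOpposite.op_injective (congrFun h j)
    let pre : (M →ₗ[A] A) →ₗ[Aᵐᵒᵖ] ((Fin n → A) →ₗ[A] A) :=
      { toFun := fun φ => φ ∘ₗ f
        map_add' := fun _ _ => rfl
        map_smul' := fun _ _ => rfl }
    have hpre : Function.Injective pre := fun φ ψ h => (LinearMap.cancel_right hf).1 h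
    exact Module.Finite.of_injective (e2 ∘ₗ ev ∘ₗ pre ∘ₗ (ExtA.zeroEquiv (M := M)).toLinearMap)
      (he2.comp (hev.comp (hpre.comp (LinearEquiv.injective _))))
  | succ i ih =>
    obtain ⟨n, f, hf, hfin⟩ := exists_syzygy (A := A) M
    have := ih (LinearMap.ker f)
    refine Module.Finite.of_surjective ((IsSES.of_ker hf).δ i) fun x => ?_
    have := ExtA.subsingleton_of_projective (A := A) (M := Fin n → A) i
    exact ((IsSES.of_ker hf).exact₃ i x).1 (Subsingleton.elim _ _)

end ExtFunctor

section Sweedler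

open Coalgebra HopfAlgebra TensorProduct

variable {k : Type u'} [Field k] {H : Type u} [Ring H] [HopfAlgebra k H]
  {X : Type w} [AddCommGroup X] [Module k X]

/-- `sw B h = ∑ B h₁ h₂` in Sweedler notation. -/
noncomputable def sw (B : H →ₗ[k] H →ₗ[k] X) : H →ₗ[k] X := TensorProduct.lift B ∘ₗ comul

lemma sw_eq (B : H →ₗ[k] H →ₗ[k] X) {h : H} {ι : Type*} (r : Repr k h ι) :
    sw B h = ∑ i ∈ r.index, B (r.left i) (r.right i) := by
  change TensorProduct.lift B (comul h) = _
  rw [← r.eq, map_sum]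
  rfl

lemma sw_mul (B : H →ₗ[k] H →ₗ[k] X) (a b : H) :
    sw B (a * b) = ∑ i ∈ (ℛ k a).index, ∑ j ∈ (ℛ k b).index,
      B ((ℛ k a).left i * (ℛ k b).left j) ((ℛ k a).right i * (ℛ k b).right j) := by
  rw [sw_eq B ((ℛ k a).mul (ℛ k b))]
  exact Finset.sum_product ..

lemma sw_coassoc (T : H →ₗ[k] H →ₗ[k] H →ₗ[k] X) (h : H) :
    ∑ i ∈ (ℛ k h).index, ∑ j ∈ (ℛ k ((ℛ k h).left i)).index,
      T ((ℛ k ((ℛ k h).left i)).left j) ((ℛ k ((ℛ k h).left i)).right j) ((ℛ k h).right i) =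
    ∑ i ∈ (ℛ k h).index, ∑ j ∈ (ℛ k ((ℛ k h).right i)).index,
      T ((ℛ k h).left i) ((ℛ k ((ℛ k h).right i)).left j) ((ℛ k ((ℛ k h).right i)).right j) := by
  have := congrArg (TensorProduct.lift ((TensorProduct.uncurry (.id k) H H X).comp T))
    (sum_tmul_tmul_eq (ℛ k h) (fun i => ℛ k ((ℛ k h).left i)) (fun i => ℛ k ((ℛ k h).right i)))
  simp only [map_sum] at this
  exact this

/-- The hit action of a functional: `x ↦ ∑ α(x₂) x₁`. -/
noncomputable def hit (α : H →ₗ[k] k) : H →ₗ[k] H :=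
  sw ((LinearMap.lsmul k H).flip.compr₂ (LinearMap.id) |>.compl₂ α)

lemma hit_eq (α : H →ₗ[k] k) {h : H} {ι : Type*} (r : Repr k h ι) :
    hit α h = ∑ i ∈ r.index, α (r.right i) • r.left i := sw_eq _ r

lemma hit_mul (α : H →ₗ[k] k) (a b : H) :
    hit α (a * b) = ∑ i ∈ (ℛ k a).index, ∑ j ∈ (ℛ k b).index,
      α ((ℛ k a).right i * (ℛ k b).right j) • ((ℛ k a).left i * (ℛ k b).left j) := sw_mul _ _ _

lemma hit_hit (α β : H →ₗ[k] k) (x : H) : hit α (hit β x) =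
    ∑ i ∈ (ℛ k x).index, (∑ j ∈ (ℛ k ((ℛ k x).right i)).index,
      α ((ℛ k ((ℛ k x).right i)).left j) * β ((ℛ k ((ℛ k x).right i)).right j)) •
      (ℛ k x).left i := by
  let T : H →ₗ[k] H →ₗ[k] H →ₗ[k] H :=
    LinearMap.mk₂ k (fun a b => LinearMap.toSpanSingleton k H (α b • a) ∘ₗ β)
      (fun a a' b => by ext c; simp) (fun r a b => by ext c; simp; module)
      (fun a b b' => by ext c; simp; module) (fun r a b => by ext c; simp; module)
  have hT : ∀ a b c, T a b c = β c • α b • a := fun a b c => rfl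
  have h := sw_coassoc T x
  simp only [hT] at h
  have h1 : hit α (hit β x) = ∑ i ∈ (ℛ k x).index, β ((ℛ k x).right i) •
      hit α ((ℛ k x).left i) := by
    rw [hit_eq β (ℛ k x), map_sum]
    simp only [map_smul]
  rw [h1]
  have h2 : ∀ i, hit α ((ℛ k x).left i) = _ := fun i => hit_eq α (ℛ k ((ℛ k x).left i))
  simp only [h2, Finset.smul_sum, Finset.sum_smul]
  refine h.trans (Finset.sum_congr rfl fun i _ => Finset.sum_congr rfl fun j _ => ?_)
  rw [smul_smul, mul_comm]

lemma sum_counit_right_smul (x : H) :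
    ∑ i ∈ (ℛ k x).index, counit (R := k) ((ℛ k x).right i) • (ℛ k x).left i = x := by
  have := congrArg (TensorProduct.rid k H) (sum_tmul_counit_eq (R := k) (ℛ k x))
  simpa only [map_sum, TensorProduct.rid_tmul, one_smul] using this

lemma sum_hit_hit {ι : Type*} (s : Finset ι) (α β : ι → H →ₗ[k] k) (c : k)
    (h : ∀ x, ∑ l ∈ s, ∑ j ∈ (ℛ k x).index, α l ((ℛ k x).left j) * β l ((ℛ k x).right j) =
      counit (R := k) x * c) (x : H) : ∑ l ∈ s, hit (α l) (hit (β l) x) = c • x := by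
  simp only [hit_hit]
  rw [Finset.sum_comm]
  simp only [← Finset.sum_smul, h]
  conv_rhs => rw [← sum_counit_right_smul (k := k) x]
  rw [Finset.smul_sum]
  refine Finset.sum_congr rfl fun i _ => ?_
  rw [smul_smul, mul_comm]

end Sweedler

section Balanced

open Coalgebra HopfAlgebra TensorProduct

variable {k : Type u'} [Field k] {H : Type u} [Ring H] [HopfAlgebra k H]
  {X : Type w} [AddCommGroup X] [Module k X]
  {M : Type v} [AddCommGroup M] [Module k M] [Module H M] [IsScalarTower k H M]

lemma eq_zero_of_twist (G : H →ₗ[k] M →ₗ[k] X)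
    (hG : ∀ h m, ∑ i ∈ (ℛ k h).index, G ((ℛ k h).left i) ((ℛ k h).right i • m) = 0) : G = 0 := by
  ext h m
  let T : H →ₗ[k] H →ₗ[k] H →ₗ[k] X :=
    LinearMap.mk₂ k (fun a b => G a ∘ₗ (LinearMap.toSpanSingleton H M m).restrictScalars k ∘ₗ
        LinearMap.mulLeft k b ∘ₗ antipode k)
      (fun a a' b => by ext c; simp) (fun r a b => by ext c; simp)
      (fun a b b' => by ext c; simp [add_mul, add_smul])
      (fun r a b => by ext c; simp)
  have hT : ∀ a b c, T a b c = G a ((b * antipode k c) • m) := fun a b c => rfl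
  have h3 := sw_coassoc T h
  simp only [hT] at h3
  rw [Finset.sum_eq_zero fun i _ => ?_] at h3
  · simp only [← map_sum, ← Finset.sum_smul, sum_mul_antipode_eq_smul] at h3
    conv_lhs => rw [← sum_counit_right_smul (k := k) h]
    rw [map_sum, LinearMap.sum_apply]
    rw [LinearMap.zero_apply, LinearMap.zero_apply, h3]
    refine Finset.sum_congr rfl fun i _ => ?_
    rw [map_smul, LinearMap.smul_apply, smul_assoc, one_smul, map_smul]
  · simpa only [mul_smul] using hG ((ℛ k h).left i) (antipode k ((ℛ k h).right i) • m)

variable {N : Type w} [AddCommGroup N] [Module k N] [Module H N] [IsScalarTower k H N]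

/-- `h g(n)(m) = ∑ g(h₁ n)(h₂ m)`. -/
def IsBalanced (g : N →ₗ[k] M →ₗ[k] H) : Prop := ∀ (h : H) (n : N) (m : M),
  h * g n m = ∑ i ∈ (ℛ k h).index, g ((ℛ k h).left i • n) ((ℛ k h).right i • m)

lemma IsBalanced.factor {F : Type v} [AddCommGroup F] [Module k F] [Module H F]
    [IsScalarTower k H F] {Λ : F →ₗ[k] M →ₗ[k] H} (hΛ : IsBalanced Λ)
    (hb : Function.Bijective Λ) {g : N →ₗ[k] M →ₗ[k] H} (hg : IsBalanced g) :
    ∃ ψ : N →ₗ[H] F, ∀ n, Λ (ψ n) = g n := by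
  let e := LinearEquiv.ofBijective Λ hb
  have he : ∀ y, Λ (e.symm y) = y := fun y => e.apply_symm_apply y
  refine ⟨{ toFun := fun n => e.symm (g n), map_add' := fun a b => by simp, map_smul' := ?_ }, ?_⟩
  · intro h n
    apply hb.1
    have := eq_zero_of_twist (M := M) (X := H) ((g ∘ₗ
      (LinearMap.toSpanSingleton H N n).restrictScalars k) - (Λ ∘ₗ
      (LinearMap.toSpanSingleton H F (e.symm (g n))).restrictScalars k)) fun h m => by
        simp only [LinearMap.sub_apply, LinearMap.comp_apply, LinearMap.restrictScalars_apply,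
          LinearMap.toSpanSingleton_apply, Finset.sum_sub_distrib]
        rw [← hg, ← hΛ, he, sub_self]
    have := LinearMap.congr_fun this h
    simp only [LinearMap.sub_apply, LinearMap.comp_apply, LinearMap.restrictScalars_apply,
          LinearMap.toSpanSingleton_apply, LinearMap.zero_apply] at this
    rw [RingHom.id_apply, he]
    exact sub_eq_zero.1 this
  · intro n
    exact he _

/-- `h ↦ α (S(h) m)`. -/
noncomputable def coeffS (α : M →ₗ[k] k) (m : M) : H →ₗ[k] k :=
  α ∘ₗ (LinearMap.toSpanSingleton H M m).restrictScalars k ∘ₗ antipode k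

lemma coeffS_apply (α : M →ₗ[k] k) (m : M) (h : H) :
    coeffS α m h = α (antipode k h • m) := rfl

/-- `(x, m) ↦ ∑ α (S(x₂) m) x₁`. -/
noncomputable def hitS (α : M →ₗ[k] k) : H →ₗ[k] M →ₗ[k] H :=
  LinearMap.mk₂ k (fun h m => hit (coeffS α m) h)
    (fun a b m => map_add _ _ _) (fun c a m => map_smul _ _ _)
    (fun a m m' => by
      simp only [hit_eq _ (ℛ k a), coeffS_apply, smul_add, map_add, add_smul,
        Finset.sum_add_distrib])
    (fun c a m => by
      simp only [hit_eq _ (ℛ k a), coeffS_apply, smul_comm _ c, map_smul, Finset.smul_sum,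
        smul_assoc])

lemma hitS_apply (α : M →ₗ[k] k) (h : H) (m : M) : hitS α h m = hit (coeffS α m) h := rfl

lemma isBalanced_hitS (α : M →ₗ[k] k) : IsBalanced (N := H) (hitS α) := by
  intro h x m
  simp only [hitS_apply, smul_eq_mul, hit_mul, coeffS_apply]
  let T : H →ₗ[k] H →ₗ[k] H →ₗ[k] H :=
    LinearMap.mk₂ k (fun a b => ∑ j ∈ (ℛ k x).index,
        LinearMap.toSpanSingleton k H (a * (ℛ k x).left j) ∘ₗ α ∘ₗ
        (LinearMap.toSpanSingleton H M m).restrictScalars k ∘ₗ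
        LinearMap.mulLeft k (antipode k (b * (ℛ k x).right j)))
      (fun a a' b => by ext c; simp [add_mul, Finset.sum_add_distrib])
      (fun r a b => by
        ext c
        simp only [LinearMap.sum_apply, LinearMap.smul_apply, LinearMap.comp_apply,
          LinearMap.toSpanSingleton_apply, smul_mul_assoc, Finset.smul_sum]
        exact Finset.sum_congr rfl fun _ _ => smul_comm _ _ _)
      (fun a b b' => by ext c; simp [add_mul, add_smul, Finset.sum_add_distrib])
      (fun r a b => by ext c; simp [Finset.smul_sum, mul_smul])
  have hT : ∀ a b c, T a b c = ∑ j ∈ (ℛ k x).index,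
      α ((antipode k (b * (ℛ k x).right j) * c) • m) • (a * (ℛ k x).left j) := fun a b c => by
    simp [T]
  have h3 := sw_coassoc T h
  simp only [hT] at h3
  have h4 : ∀ i ∈ (ℛ k h).index, ∑ j ∈ (ℛ k ((ℛ k h).right i)).index,
      ∑ l ∈ (ℛ k x).index, α ((antipode k ((ℛ k ((ℛ k h).right i)).left j * (ℛ k x).right l) *
        (ℛ k ((ℛ k h).right i)).right j) • m) • ((ℛ k h).left i * (ℛ k x).left l) =
      (counit (R := k) ((ℛ k h).right i) • (ℛ k h).left i) *
        ∑ l ∈ (ℛ k x).index, α (antipode k ((ℛ k x).right l) • m) • (ℛ k x).left l := by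
    intro i _
    rw [Finset.sum_comm, Finset.mul_sum]
    refine Finset.sum_congr rfl fun l _ => ?_
    rw [← Finset.sum_smul, ← map_sum, ← Finset.sum_smul]
    simp only [antipode_mul_antidistrib, mul_assoc]
    rw [← Finset.mul_sum, sum_antipode_mul_eq_smul, mul_smul_comm, mul_one, smul_assoc, map_smul,
      smul_mul_assoc, mul_smul_comm, smul_eq_mul, mul_smul]
  rw [Finset.sum_congr rfl h4, ← Finset.sum_mul, sum_counit_right_smul] at h3
  rw [hit_eq _ (ℛ k x)]
  simp only [coeffS_apply]
  rw [← h3]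
  simp only [mul_smul]

variable {r : ℕ} (b : Module.Basis (Fin r) k M)

/-- The balanced isomorphism `Hʳ ≃ Hom(M, H)` as a bilinear map. -/
noncomputable def coordS : (Fin r → H) →ₗ[k] M →ₗ[k] H :=
  ∑ j, (hitS (b.coord j)) ∘ₗ (LinearMap.proj j)

lemma coordS_apply (x : Fin r → H) (m : M) :
    coordS b x m = ∑ j, hit (coeffS (b.coord j) m) (x j) := by
  simp [coordS, hitS_apply]

lemma isBalanced_coordS : IsBalanced (coordS (H := H) b) := by
  intro h x m
  simp only [coordS, LinearMap.sum_apply, LinearMap.comp_apply, LinearMap.proj_apply,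
    Finset.mul_sum]
  rw [Finset.sum_comm]
  exact Finset.sum_congr rfl fun j _ => isBalanced_hitS _ _ _ _

lemma sum_coord_antipode_left (x : H) (i m : Fin r) :
    ∑ j, ∑ l ∈ (ℛ k x).index, coeffS (H := H) (b.coord j) (b m) ((ℛ k x).left l) *
      coeffS (b.coord i) (b j) (antipode k ((ℛ k x).right l)) =
    counit (R := k) x * if i = m then 1 else 0 := by
  rw [Finset.sum_comm]
  have h1 : ∀ l ∈ (ℛ k x).index, ∑ j, coeffS (H := H) (b.coord j) (b m) ((ℛ k x).left l) *
      coeffS (b.coord i) (b j) (antipode k ((ℛ k x).right l)) =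
      b.coord i (antipode k ((ℛ k x).left l * antipode k ((ℛ k x).right l)) • b m) := by
    intro l _
    simp only [coeffS_apply]
    rw [antipode_mul_antidistrib, mul_smul]
    conv_rhs => rw [← b.sum_repr (antipode k ((ℛ k x).left l) • b m), Finset.smul_sum, map_sum]
    refine Finset.sum_congr rfl fun j _ => ?_
    rw [smul_comm, LinearMap.map_smul _ (b.repr _ j), smul_eq_mul, b.coord_apply]
  rw [Finset.sum_congr rfl h1, ← map_sum, ← Finset.sum_smul, ← map_sum, sum_mul_antipode_eq_smul,
    LinearMap.map_smul (antipode k), antipode_one, smul_assoc, one_smul, LinearMap.map_smul,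
    smul_eq_mul, b.coord_apply,
    b.repr_self, Finsupp.single_apply]
  simp only [eq_comm]

lemma sum_coord_antipode_right (x : H) (j m : Fin r) :
    ∑ i, ∑ l ∈ (ℛ k x).index, coeffS (H := H) (b.coord i) (b j) (antipode k ((ℛ k x).left l)) *
      coeffS (b.coord m) (b i) ((ℛ k x).right l) =
    counit (R := k) x * if j = m then 1 else 0 := by
  rw [Finset.sum_comm]
  have h1 : ∀ l ∈ (ℛ k x).index, ∑ i,
      coeffS (H := H) (b.coord i) (b j) (antipode k ((ℛ k x).left l)) *
      coeffS (b.coord m) (b i) ((ℛ k x).right l) =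
      b.coord m (antipode k (antipode k ((ℛ k x).left l) * (ℛ k x).right l) • b j) := by
    intro l _
    simp only [coeffS_apply]
    rw [antipode_mul_antidistrib, mul_smul]
    conv_rhs => rw [← b.sum_repr (antipode k (antipode k ((ℛ k x).left l)) • b j),
      Finset.smul_sum, map_sum]
    refine Finset.sum_congr rfl fun j _ => ?_
    rw [smul_comm, LinearMap.map_smul _ (b.repr _ j), smul_eq_mul, b.coord_apply]
  rw [Finset.sum_congr rfl h1, ← map_sum, ← Finset.sum_smul, ← map_sum, sum_antipode_mul_eq_smul,
    LinearMap.map_smul (antipode k), antipode_one, smul_assoc, one_smul, LinearMap.map_smul,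
    smul_eq_mul, b.coord_apply,
    b.repr_self, Finsupp.single_apply]

lemma coordS_bijective : Function.Bijective (coordS (H := H) b) := by
  let D : Fin r → Fin r → H →ₗ[k] k := fun i j => coeffS (b.coord i) (b j) ∘ₗ antipode k
  refine Function.bijective_iff_has_inverse.2
    ⟨fun f j => ∑ i, hit (D i j) (f (b i)), fun x => ?_, fun f => ?_⟩
  · ext m
    simp only [coordS_apply, map_sum]
    rw [Finset.sum_comm]
    have := fun j => sum_hit_hit (k := k) (H := H) Finset.univ (fun i => D i m)
      (fun i => coeffS (b.coord j) (b i)) (if m = j then 1 else 0)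
      (fun x => sum_coord_antipode_right b x m j) (x j)
    simp [this]
  · refine b.ext fun m => ?_
    simp only [coordS_apply, map_sum]
    rw [Finset.sum_comm]
    have := fun i => sum_hit_hit (k := k) (H := H) Finset.univ
      (fun j => coeffS (b.coord j) (b m)) (fun j => D i j) (if i = m then 1 else 0)
      (fun x => sum_coord_antipode_left b x i m) (f (b i))
    simp [this]

end Balanced

section LinearExt

open Abelian

lemma extPre_smul_id {k : Type u'} [Field k] {C : Type u2} [Category.{v} C] [Abelian C]
    [Linear k C] [HasExt.{w} C] {X Z : C} (c : k) (i : ℕ) (e : Ext.{w} X Z i) :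
    extPre (c • 𝟙 X) i e = extPost (c • 𝟙 Z) i e := by
  change (Ext.mk₀.{w} (c • 𝟙 X)).comp e (zero_add i) = e.comp (Ext.mk₀.{w} (c • 𝟙 Z)) (add_zero i)
  rw [Ext.mk₀_smul, Ext.mk₀_smul, Ext.smul_comp, Ext.comp_smul, Ext.mk₀_id_comp, Ext.comp_mk₀_id]

end LinearExt

section ScalarExt

open Abelian

variable {k : Type u'} [Field k] {A : Type u} [Ring A] [Algebra k A]
  {M N P : Type u} [AddCommGroup M] [Module A M] [AddCommGroup N] [Module A N]
  [AddCommGroup P] [Module A P]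

noncomputable instance ExtA.instModuleField (i : ℕ) : Module k (ExtA A M i) :=
  Module.compHom _ (algebraMap k Aᵐᵒᵖ)

instance ExtA.isScalarTower_field (i : ℕ) : IsScalarTower k Aᵐᵒᵖ (ExtA A M i) :=
  ⟨fun c a e => by
    rw [Algebra.smul_def, mul_smul]
    rfl⟩

lemma ExtA.map_eq_smul (c : k) (f : M →ₗ[A] M) (hf : ∀ x, f x = algebraMap k A c • x) (i : ℕ)
    (e : ExtA A M i) : ExtA.map f i e = c • e := by
  have h1 : ModuleCat.ofHom f = c • 𝟙 (ModuleCat.of A M) :=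
    ModuleCat.hom_ext (LinearMap.ext fun x => hf x)
  have h3 := extPre_smul_id.{u, u, u', u + 1} (X := ModuleCat.of A M) (Z := ModuleCat.of A A) c i e
  rw [← h1] at h3
  refine h3.trans (DFunLike.congr_fun (congrArg (extPost.{u, u, u + 1} · i) (?_ : _ =
    ModuleCat.ofHom (rmulEnd A (algebraMap k Aᵐᵒᵖ c)))) _)
  refine ModuleCat.hom_ext (LinearMap.ext fun x => ?_)
  change algebraMap k A c * x = x * algebraMap k A c
  exact Algebra.commutes c x

end ScalarExt

section Diag

open Coalgebra HopfAlgebra TensorProduct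

variable (k : Type u) [Field k] (H : Type u) [Ring H] [HopfAlgebra k H]
  (N : Type u) [AddCommGroup N] [Module k N] [Module H N] [IsScalarTower k H N]
  (M : Type u) [AddCommGroup M] [Module k M] [Module H M] [IsScalarTower k H M]

/-- The tensor product with the diagonal action of a Hopf algebra. -/
def Diag (_H : Type u) (N M : Type u) [AddCommGroup N] [Module k N] [AddCommGroup M] [Module k M] :
  Type u := N ⊗[k] M

noncomputable instance : AddCommGroup (Diag k H N M) := inferInstanceAs (AddCommGroup (N ⊗[k] M))

noncomputable instance : Module k (Diag k H N M) := inferInstanceAs (Module k (N ⊗[k] M))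

/-- The diagonal action. -/
noncomputable def diagHom : H →ₐ[k] Module.End k (N ⊗[k] M) :=
  ((Module.endTensorEndAlgHom (R := k) (A := k)).comp
    (Algebra.TensorProduct.map (Algebra.lsmul k k N) (Algebra.lsmul k k M) :
      H ⊗[k] H →ₐ[k] Module.End k N ⊗[k] Module.End k M)).comp (Bialgebra.comulAlgHom k H)

noncomputable instance : Module H (Diag k H N M) :=
  Module.compHom (N ⊗[k] M) (diagHom k H N M).toRingHom

instance : IsScalarTower k H (Diag k H N M) := ⟨fun c h x => by
  change diagHom k H N M (c • h) x = c • diagHom k H N M h x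
  rw [map_smul]
  rfl⟩

variable {N M}

/-- Pure tensors. -/
noncomputable def Diag.tmul (n : N) (m : M) : Diag k H N M := (n ⊗ₜ[k] m : N ⊗[k] M)

lemma Diag.smul_tmul (h : H) (n : N) (m : M) : h • Diag.tmul k H n m =
    ∑ i ∈ (ℛ k h).index, Diag.tmul k H ((ℛ k h).left i • n) ((ℛ k h).right i • m) := by
  change diagHom k H N M h (n ⊗ₜ[k] m) = _
  change Module.endTensorEndAlgHom (R := k) (A := k)
    (Algebra.TensorProduct.map (Algebra.lsmul k k N) (Algebra.lsmul k k M) (comul (R := k) h))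
    (n ⊗ₜ[k] m) = _
  rw [← (ℛ k h).eq, map_sum, map_sum, LinearMap.sum_apply]
  rfl

variable {k H}

/-- A balanced map gives an `H`-linear map on the diagonal tensor product. -/
noncomputable def Diag.lift (X : Type u) [AddCommGroup X] [Module k X] [Module H X]
    (g : N →ₗ[k] M →ₗ[k] X) (hg : ∀ (h : H) (n : N) (m : M),
      h • g n m = ∑ i ∈ (ℛ k h).index, g ((ℛ k h).left i • n) ((ℛ k h).right i • m)) 
    [IsScalarTower k H X] : Diag k H N M →ₗ[H] X where
  __ := (TensorProduct.lift g).toAddMonoidHom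
  map_smul' h x := by
    change TensorProduct.lift g (h • x : Diag k H N M) = h • TensorProduct.lift g x
    induction x using TensorProduct.induction_on with
    | zero =>
      rw [map_zero, smul_zero]
      exact (congrArg (TensorProduct.lift g) (smul_zero (A := Diag k H N M) h)).trans (map_zero _)
    | tmul n m =>
      refine (congrArg (TensorProduct.lift g) (Diag.smul_tmul k H h n m)).trans ?_
      refine (map_sum (TensorProduct.lift g) _ _).trans ?_
      exact (hg h n m).symm
    | add x y hx hy =>
      rw [map_add, smul_add, ← hx, ← hy]
      exact (congrArg (TensorProduct.lift g) (smul_add (A := Diag k H N M) h x y)).trans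
        (map_add _ _ _)

lemma Diag.lift_tmul (X : Type u) [AddCommGroup X] [Module k X] [Module H X]
    (g : N →ₗ[k] M →ₗ[k] X) (hg : ∀ (h : H) (n : N) (m : M),
      h • g n m = ∑ i ∈ (ℛ k h).index, g ((ℛ k h).left i • n) ((ℛ k h).right i • m)) 
    [IsScalarTower k H X] (n : N) (m : M) : Diag.lift X g hg (Diag.tmul k H n m) = g n m := 
  TensorProduct.lift.tmul _ _

lemma Diag.hom_ext {X : Type u} [AddCommGroup X] [Module H X] {f g : Diag k H N M →ₗ[H] X}
    (h : ∀ n m, f (Diag.tmul k H n m) = g (Diag.tmul k H n m)) : f = g := by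
  ext x
  induction x using TensorProduct.induction_on with
  | zero => exact (map_zero f).trans (map_zero g).symm
  | tmul n m => exact h n m
  | add x y hx hy => exact (map_add f _ _).trans ((congrArg₂ _ hx hy).trans (map_add g _ _).symm)

variable (k H) in
/-- The pure tensors as a bilinear map. -/
noncomputable def Diag.mk (N M : Type u) [AddCommGroup N] [Module k N] [AddCommGroup M]
    [Module k M] : N →ₗ[k] M →ₗ[k] Diag k H N M :=
  TensorProduct.mk k N M

variable {N' M' : Type u} [AddCommGroup N'] [Module k N'] [Module H N'] [IsScalarTower k H N']
  [AddCommGroup M'] [Module k M'] [Module H M'] [IsScalarTower k H M']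

/-- Functoriality. -/
noncomputable def Diag.map (f : N →ₗ[H] N') (g : M →ₗ[H] M') : Diag k H N M →ₗ[H] Diag k H N' M' :=
  Diag.lift _ ((Diag.mk k H N' M').compl₁₂ (f.restrictScalars k) (g.restrictScalars k))
    fun h n m => by
      simp only [LinearMap.compl₁₂_apply, LinearMap.restrictScalars_apply, map_smul]
      exact Diag.smul_tmul k H h (f n) (g m)

lemma Diag.map_tmul (f : N →ₗ[H] N') (g : M →ₗ[H] M') (n : N) (m : M) :
    Diag.map f g (Diag.tmul k H n m) = Diag.tmul k H (f n) (g m) := Diag.lift_tmul _ _ _ _ _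

lemma Diag.map_eq (f : N →ₗ[H] N') (x : Diag k H N M) :
    Diag.map (k := k) f (LinearMap.id : M →ₗ[H] M) x =
      LinearMap.rTensor M (f.restrictScalars k) (x : N ⊗[k] M) := by
  refine congrArg (fun T : N ⊗[k] M →ₗ[k] N' ⊗[k] M => T x) (?_ :
    ((Diag.map (k := k) f (LinearMap.id : M →ₗ[H] M)).restrictScalars k :
      N ⊗[k] M →ₗ[k] N' ⊗[k] M) = LinearMap.rTensor M (f.restrictScalars k))
  refine TensorProduct.ext' fun n m => ?_
  exact Diag.map_tmul f _ n m

lemma IsSES.diag {P : Type u} [AddCommGroup P] [Module k P] [Module H P] [IsScalarTower k H P]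
    {f : N →ₗ[H] N'} {g : N' →ₗ[H] P} (h : IsSES f g) (M : Type u) [AddCommGroup M] [Module k M]
    [Module H M] [IsScalarTower k H M] :
    IsSES (Diag.map (k := k) f (LinearMap.id : M →ₗ[H] M))
      (Diag.map (k := k) g (LinearMap.id : M →ₗ[H] M)) where
  inj := by
    have : Function.Injective (LinearMap.rTensor M (f.restrictScalars k)) :=
      Module.Flat.rTensor_preserves_injective_linearMap _ h.inj
    intro x y hxy
    rw [Diag.map_eq, Diag.map_eq] at hxy
    exact this hxy
  surj := fun y => by
    obtain ⟨x, hx⟩ := LinearMap.rTensor_surjective M (g := g.restrictScalars k) h.surj y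
    exact ⟨x, (Diag.map_eq g x).trans hx⟩
  exact := fun y => by
    have := rTensor_exact M (f := f.restrictScalars k) (g := g.restrictScalars k) h.exact h.surj y
    rw [Diag.map_eq]
    refine this.trans (exists_congr fun x => ?_)
    exact Eq.congr_left (Diag.map_eq f x).symm

end Diag

section HopfStep

open Coalgebra HopfAlgebra TensorProduct

variable {k : Type u} [Field k] {H : Type u} [Ring H] [HopfAlgebra k H]
  {N : Type u} [AddCommGroup N] [Module k N] [Module H N] [IsScalarTower k H N]
  {M : Type u} [AddCommGroup M] [Module k M] [Module H M] [IsScalarTower k H M]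
  {N' : Type u} [AddCommGroup N'] [Module k N'] [Module H N'] [IsScalarTower k H N']
  {M' : Type u} [AddCommGroup M'] [Module k M'] [Module H M'] [IsScalarTower k H M']
  {r r' : ℕ}

lemma Diag.sum_twist (h : H) (n : N) (m : M) : ∑ i ∈ (ℛ k h).index,
    (ℛ k h).left i • Diag.tmul k H n (antipode k ((ℛ k h).right i) • m) =
      Diag.tmul k H (h • n) m := by
  let T : H →ₗ[k] H →ₗ[k] H →ₗ[k] Diag k H N M :=
    LinearMap.mk₂ k (fun a b => (Diag.mk k H N M (a • n)) ∘ₗ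
        (LinearMap.toSpanSingleton H M m).restrictScalars k ∘ₗ
        LinearMap.mulLeft k b ∘ₗ antipode k)
      (fun a a' b => by ext c; simp [add_smul])
      (fun r a b => by ext c; simp)
      (fun a b b' => by ext c; simp [add_mul, add_smul])
      (fun r a b => by ext c; simp)
  have hT : ∀ a b c, T a b c = Diag.mk k H N M (a • n) ((b * antipode k c) • m) :=
    fun a b c => rfl
  have h3 := sw_coassoc T h
  simp only [hT] at h3
  have h4 : ∀ i, (ℛ k h).left i • Diag.tmul k H n (antipode k ((ℛ k h).right i) • m) = _ :=
    fun i => Diag.smul_tmul k H ((ℛ k h).left i) n (antipode k ((ℛ k h).right i) • m)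
  simp only [h4, ← mul_smul]
  refine h3.trans ?_
  simp only [← map_sum, ← Finset.sum_smul, sum_mul_antipode_eq_smul]
  change _ = Diag.mk k H N M (h • n) m
  conv_rhs => rw [← sum_counit_right_smul (k := k) h]
  rw [Finset.sum_smul, map_sum, LinearMap.sum_apply]
  refine Finset.sum_congr rfl fun i _ => ?_
  rw [smul_assoc, one_smul, smul_assoc, LinearMap.map_smul, LinearMap.map_smul,
    LinearMap.smul_apply]

lemma Diag.projective (b : Module.Basis (Fin r) k M) (n : ℕ) :
    Module.Projective H (Diag k H (Fin n → H) M) := by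
  let g : (Fin n → H) →ₗ[k] M →ₗ[k] (Fin n × Fin r → H) :=
    LinearMap.mk₂ k (fun p m ij => hitS (b.coord ij.2) (p ij.1) m)
      (fun p p' m => by ext ij; simp) (fun c p m => by ext ij; simp)
      (fun p m m' => by ext ij; simp) (fun c p m => by ext ij; simp)
  let σ : Diag k H (Fin n → H) M →ₗ[H] (Fin n × Fin r → H) := Diag.lift _ g fun h p m => by
    ext ij
    rw [Finset.sum_apply]
    exact isBalanced_hitS (b.coord ij.2) h (p ij.1) m
  let θ : (Fin n × Fin r → H) →ₗ[H] Diag k H (Fin n → H) M :=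
    ∑ ij, (LinearMap.toSpanSingleton H _ (Diag.tmul k H (Pi.single ij.1 (1 : H) : Fin n → H) (b ij.2))) ∘ₗ
      LinearMap.proj ij
  refine Module.Projective.of_split σ θ (Diag.hom_ext fun p m => ?_)
  have h1 : θ (σ (Diag.tmul k H p m)) = θ (g p m) := congrArg θ (Diag.lift_tmul _ _ _ _ _)
  rw [LinearMap.comp_apply, h1]
  simp only [θ, LinearMap.sum_apply, LinearMap.comp_apply, LinearMap.proj_apply,
    LinearMap.toSpanSingleton_apply, LinearMap.id_apply, Fintype.sum_prod_type]
  have h2 : ∀ i, ∑ j, g p m (i, j) • Diag.tmul k H (Pi.single i (1 : H) : Fin n → H) (b j) =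
      Diag.tmul k H (Pi.single i (p i) : Fin n → H) m := by
    intro i
    have h3 : ∀ j, g p m (i, j) = hit (coeffS (b.coord j) m) (p i) := fun j => rfl
    have h5 : (Pi.single i (p i) : Fin n → H) = p i • (Pi.single i 1 : Fin n → H) := by
      rw [← Pi.single_smul, smul_eq_mul, mul_one]
    rw [h5, ← Diag.sum_twist]
    simp only [h3, hit_eq _ (ℛ k (p i)), Finset.sum_smul, coeffS_apply]
    rw [Finset.sum_comm]
    refine Finset.sum_congr rfl fun l _ => ?_
    have h6 : Diag.tmul k H (Pi.single i (1 : H) : Fin n → H) (antipode k ((ℛ k (p i)).right l) • m) =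
        ∑ j, (b.coord j (antipode k ((ℛ k (p i)).right l) • m)) •
          Diag.tmul k H (Pi.single i (1 : H) : Fin n → H) (b j) := by
      conv_lhs => rw [← b.sum_repr (antipode k ((ℛ k (p i)).right l) • m)]
      exact (map_sum (Diag.mk k H (Fin n → H) M (Pi.single i 1)) _ _).trans
        (Finset.sum_congr rfl fun j _ => LinearMap.map_smul _ _ _)
    rw [h6, Finset.smul_sum]
    refine Finset.sum_congr rfl fun j _ => ?_
    rw [smul_assoc, smul_comm]
  simp only [h2]
  conv_rhs => rw [← Finset.univ_sum_single p]
  change ∑ i, Diag.mk k H (Fin n → H) M (Pi.single i (p i)) m = Diag.mk k H (Fin n → H) M _ m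
  rw [map_sum, LinearMap.sum_apply]

/-- The homomorphism on the diagonal tensor product attached to a tuple of homomorphisms. -/
noncomputable def Diag.homOf (b : Module.Basis (Fin r) k M) (ψ : N →ₗ[H] (Fin r → H)) :
    Diag k H N M →ₗ[H] H :=
  Diag.lift H (coordS b ∘ₗ ψ.restrictScalars k) fun h n m => by
    simp only [LinearMap.comp_apply, LinearMap.restrictScalars_apply, map_smul, smul_eq_mul]
    exact isBalanced_coordS b h (ψ n) m

lemma Diag.homOf_tmul (b : Module.Basis (Fin r) k M) (ψ : N →ₗ[H] (Fin r → H)) (n : N) (m : M) :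
    Diag.homOf b ψ (Diag.tmul k H n m) = coordS b (ψ n) m := Diag.lift_tmul _ _ _ _ _

lemma Diag.homOf_bijective (b : Module.Basis (Fin r) k M) :
    Function.Bijective (Diag.homOf (N := N) (H := H) b) := by
  constructor
  · intro ψ ψ' h
    ext1 n
    apply (coordS_bijective b).1
    ext m
    rw [← Diag.homOf_tmul, h, Diag.homOf_tmul]
  · intro φ
    obtain ⟨ψ, hψ⟩ := (isBalanced_coordS b).factor (coordS_bijective (H := H) b)
      (g := (Diag.mk k H N M).compr₂ (φ.restrictScalars k)) fun h n m => by
        change h • φ (Diag.tmul k H n m) = ∑ i ∈ _, φ (Diag.tmul k H _ _)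
        rw [← map_smul, Diag.smul_tmul, map_sum]
    refine ⟨ψ, Diag.hom_ext fun n m => ?_⟩
    rw [Diag.homOf_tmul, hψ]
    rfl

lemma Diag.homOf_comp (b : Module.Basis (Fin r) k M) (ψ : N' →ₗ[H] (Fin r → H)) (f : N →ₗ[H] N') :
    Diag.homOf b (ψ ∘ₗ f) = Diag.homOf b ψ ∘ₗ Diag.map f LinearMap.id :=
  Diag.hom_ext fun n m => by
    rw [LinearMap.comp_apply, Diag.map_tmul, Diag.homOf_tmul, Diag.homOf_tmul]
    rfl

lemma ExtA.zeroEquiv_smul_apply {N : Type u} [AddCommGroup N] [Module H N] (c : k)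
    (x : ExtA H N 0) (n : N) :
    ExtA.zeroEquiv (c • x) n = c • ExtA.zeroEquiv x n := by
  have : c • x = algebraMap k Hᵐᵒᵖ c • x := rfl
  rw [this, map_smul, Algebra.smul_def, Algebra.commutes]
  rfl

/-- The comparison isomorphism in degree zero. -/
noncomputable def Diag.extZero (b : Module.Basis (Fin r) k M) :
    (Fin r → ExtA H N 0) ≃ₗ[k] ExtA H (Diag k H N M) 0 :=
  LinearEquiv.ofBijective (M := Fin r → ExtA H N 0)
    { toFun := fun x => ExtA.zeroEquiv.symm
        (Diag.homOf b (LinearMap.pi fun j => ExtA.zeroEquiv (x j)))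
      map_add' := fun x y => by
        rw [← map_add]
        congr 1
        refine Diag.hom_ext fun n m => ?_
        rw [LinearMap.add_apply, Diag.homOf_tmul, Diag.homOf_tmul, Diag.homOf_tmul,
          ← LinearMap.add_apply, ← map_add]
        congr 2
        ext j
        simp
      map_smul' := fun c x => by
        rw [RingHom.id_apply]
        apply ExtA.zeroEquiv.injective
        refine Diag.hom_ext fun n m => ?_
        rw [ExtA.zeroEquiv_smul_apply, LinearEquiv.apply_symm_apply, LinearEquiv.apply_symm_apply,
          Diag.homOf_tmul, Diag.homOf_tmul, ← LinearMap.smul_apply, ← map_smul]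
        congr 2
        ext j
        exact ExtA.zeroEquiv_smul_apply c (x j) n }
    (by
      refine ExtA.zeroEquiv.symm.bijective.comp ((Diag.homOf_bijective (H := H) (N := N) b).comp ⟨?_, ?_⟩)
      · intro x y h
        ext j
        apply ExtA.zeroEquiv.injective
        ext n
        exact congrFun (LinearMap.congr_fun h n) j
      · intro ψ
        refine ⟨fun j => ExtA.zeroEquiv.symm (LinearMap.proj j ∘ₗ ψ), ?_⟩
        ext n j
        simp)

lemma Diag.extZero_map (b : Module.Basis (Fin r) k M) (f : N →ₗ[H] N')
    (x : Fin r → ExtA H N' 0) :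
    Diag.extZero b (fun j => ExtA.map f 0 (x j)) =
      ExtA.map (Diag.map f LinearMap.id) 0 (Diag.extZero b x) := by
  change ExtA.zeroEquiv.symm _ = ExtA.map _ 0 (ExtA.zeroEquiv.symm _)
  rw [ExtA.map_zeroEquiv_symm, ← Diag.homOf_comp]
  congr 2
  ext n j
  change ExtA.zeroEquiv (ExtA.map f 0 (x j)) n = ExtA.zeroEquiv (x j) (f n)
  rw [ExtA.zeroEquiv_map]
  rfl

/-- Extending homomorphisms along an inclusion of finite-dimensional modules. -/
lemma Diag.map_zero_surjective (b : Module.Basis (Fin r) k M) (b' : Module.Basis (Fin r') k M')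
    (g : M →ₗ[H] M') (hg : Function.Injective g) :
    Function.Surjective (ExtA.map (Diag.map (k := k) (LinearMap.id : N →ₗ[H] N) g) 0) := by
  obtain ⟨p, hp⟩ := (g.restrictScalars k).exists_leftInverse_of_injective (LinearMap.ker_eq_bot.2 hg)
  have hp' : ∀ m, p (g m) = m := fun m => LinearMap.congr_fun hp m
  let R : (Fin r' → H) →ₗ[k] M →ₗ[k] H := (coordS b').compl₂ (g.restrictScalars k)
  have hR : ∀ x m, R x m = coordS b' x (g m) := fun x m => rfl
  obtain ⟨ρ, hρ⟩ := (isBalanced_coordS b).factor (coordS_bijective (H := H) b) (g := R) fun h x m => by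
    simp only [hR, map_smul]
    exact isBalanced_coordS b' h x (g m)
  have hsurj : Function.Surjective ρ := by
    intro y
    obtain ⟨x, hx⟩ := (coordS_bijective (H := H) b').2 (coordS b y ∘ₗ p)
    refine ⟨x, (coordS_bijective (H := H) b).1 ?_⟩
    rw [hρ]
    ext m
    rw [hR, hx, LinearMap.comp_apply, hp']
  obtain ⟨τ, hτ⟩ := Module.projective_lifting_property ρ LinearMap.id hsurj
  intro y
  obtain ⟨φ, rfl⟩ := ExtA.zeroEquiv.symm.surjective y
  obtain ⟨ψ, rfl⟩ := (Diag.homOf_bijective (H := H) (N := N) b).2 φ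
  refine ⟨ExtA.zeroEquiv.symm (Diag.homOf b' (τ ∘ₗ ψ)), ?_⟩
  rw [ExtA.map_zeroEquiv_symm]
  congr 1
  refine Diag.hom_ext fun n m => ?_
  rw [LinearMap.comp_apply, Diag.map_tmul, Diag.homOf_tmul, Diag.homOf_tmul, LinearMap.id_apply,
    LinearMap.comp_apply, ← hR, ← hρ]
  exact congrArg (fun z => coordS b z m) (LinearMap.congr_fun hτ (ψ n))

/-- Restriction of scalars to the base field for finitely generated modules. -/
lemma Diag.map_surjective [IsNoetherianRing H] (b : Module.Basis (Fin r) k M)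
    (b' : Module.Basis (Fin r') k M') (g : M →ₗ[H] M') (hg : Function.Injective g) (j : ℕ)
    (N : Type u) [AddCommGroup N] [Module k N] [Module H N] [IsScalarTower k H N]
    [Module.Finite H N] :
    Function.Surjective (ExtA.map (Diag.map (k := k) (LinearMap.id : N →ₗ[H] N) g) j) := by
  induction j generalizing N with
  | zero => exact Diag.map_zero_surjective b b' g hg
  | succ j ih =>
    obtain ⟨n, f, hf, hfin⟩ := exists_syzygy (A := H) N
    have hs := IsSES.of_ker hf
    have h1 := hs.diag (k := k) M
    have h2 := hs.diag (k := k) M'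
    have := Diag.projective (H := H) b n
    have := ExtA.subsingleton_of_projective (A := H) (M := Diag k H (Fin n → H) M) j
    intro y
    obtain ⟨x, rfl⟩ := (h1.exact₃ j y).1 (Subsingleton.elim _ _)
    obtain ⟨z, rfl⟩ := ih (LinearMap.ker f) x
    refine ⟨h2.δ j z, ?_⟩
    refine (h1.δ_naturality j h2 (Diag.map LinearMap.id g) (Diag.map LinearMap.id g)
      (Diag.map LinearMap.id g) ?_ ?_ z).symm
    · exact Diag.hom_ext fun n m => by simp only [LinearMap.comp_apply, Diag.map_tmul]; rfl
    · exact Diag.hom_ext fun n m => by simp only [LinearMap.comp_apply, Diag.map_tmul]; rfl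

lemma exists_equiv_cokernel {B C B' C' A A' : Type*} [AddCommGroup A] [AddCommGroup A']
    [AddCommGroup B] [AddCommGroup C] [AddCommGroup B'] [AddCommGroup C'] [Module k B] [Module k C]
    [Module k B'] [Module k C'] [Module k A] [Module k A'] (e : B ≃ₗ[k] B') (v : B →ₗ[k] C)
    (v' : B' →ₗ[k] C') (u : A →ₗ[k] B) (u' : A' →ₗ[k] B') (hv : Function.Surjective v)
    (hv' : Function.Surjective v') (hu : Function.Exact u v) (hu' : Function.Exact u' v')
    (h : ∀ a, ∃ a', u' a' = e (u a)) (h' : ∀ a', ∃ a, u' a' = e (u a)) :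
    Nonempty (C ≃ₗ[k] C') := by
  have hk : LinearMap.ker v = LinearMap.ker (v' ∘ₗ e.toLinearMap) := by
    ext x
    rw [LinearMap.mem_ker, LinearMap.mem_ker]
    constructor
    · intro hx
      obtain ⟨a, rfl⟩ := (hu x).1 hx
      obtain ⟨a', ha'⟩ := h a
      exact (hu' _).2 ⟨a', ha'⟩
    · intro hx
      obtain ⟨a', ha'⟩ := (hu' _).1 hx
      obtain ⟨a, ha⟩ := h' a'
      exact (hu x).2 ⟨a, e.injective (ha.symm.trans ha')⟩
  exact ⟨(v.quotKerEquivOfSurjective hv).symm ≪≫ₗ Submodule.quotEquivOfEq _ _ hk ≪≫ₗ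
    (v' ∘ₗ e.toLinearMap).quotKerEquivOfSurjective (hv'.comp e.surjective)⟩

lemma Diag.exists_ext_equiv [IsNoetherianRing H] (b : Module.Basis (Fin r) k M) (j : ℕ)
    (N : Type u) [AddCommGroup N] [Module k N] [Module H N] [IsScalarTower k H N]
    [Module.Finite H N] :
    Nonempty ((Fin r → ExtA H N j) ≃ₗ[k] ExtA H (Diag k H N M) j) := by
  induction j generalizing N with
  | zero => exact ⟨Diag.extZero b⟩
  | succ j ih =>
    obtain ⟨n, f, hf, hfin⟩ := exists_syzygy (A := H) N
    have hs := IsSES.of_ker hf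
    have h1 := hs.diag (k := k) M
    have := Diag.projective (H := H) b n
    have h3 := ExtA.subsingleton_of_projective (A := H) (M := Diag k H (Fin n → H) M)
    have h4 := ExtA.subsingleton_of_projective (A := H) (M := Fin n → H)
    have hδ : Function.Surjective (h1.δ j) := fun y => (h1.exact₃ j y).1 (Subsingleton.elim _ _)
    have hδ' : Function.Surjective (hs.δ j) := fun y => (hs.exact₃ j y).1 (Subsingleton.elim _ _)
    have key : ∃ e : (Fin r → ExtA H (LinearMap.ker f) j) ≃ₗ[k]
        ExtA H (Diag k H (LinearMap.ker f) M) j,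
        (∀ a : Fin r → ExtA H (Fin n → H) j, ∃ a',
          ExtA.map (Diag.map (k := k) (LinearMap.ker f).subtype LinearMap.id) j a' =
            e fun i => ExtA.map (LinearMap.ker f).subtype j (a i)) ∧
        (∀ a', ∃ a : Fin r → ExtA H (Fin n → H) j,
          ExtA.map (Diag.map (k := k) (LinearMap.ker f).subtype LinearMap.id) j a' =
            e fun i => ExtA.map (LinearMap.ker f).subtype j (a i)) := by
      cases j with
      | zero =>
        refine ⟨Diag.extZero b, fun a => ⟨_, (Diag.extZero_map b _ a).symm⟩, fun a' => ?_⟩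
        refine ⟨(Diag.extZero b).symm a', ?_⟩
        rw [Diag.extZero_map, LinearEquiv.apply_symm_apply]
      | succ j =>
        obtain ⟨e⟩ := ih (LinearMap.ker f)
        have z : ∀ a : Fin r → ExtA H (Fin n → H) (j + 1),
            (e fun i => ExtA.map (LinearMap.ker f).subtype (j + 1) (a i)) = 0 := fun a => by
          rw [← map_zero e]
          congr 1
          ext i
          rw [Subsingleton.elim (a i) 0, map_zero]
          rfl
        refine ⟨e, fun a => ⟨0, ?_⟩, fun a' => ⟨0, ?_⟩⟩
        · rw [z, map_zero]
        · rw [z, Subsingleton.elim a' 0, map_zero]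
    obtain ⟨e, he, he'⟩ := key
    refine exists_equiv_cokernel e
      (LinearMap.pi fun i => ((hs.δ j).restrictScalars k) ∘ₗ LinearMap.proj i)
      ((h1.δ j).restrictScalars k)
      (LinearMap.pi fun i => ((ExtA.map (LinearMap.ker f).subtype j).restrictScalars k) ∘ₗ
        LinearMap.proj i)
      ((ExtA.map (Diag.map (k := k) (LinearMap.ker f).subtype LinearMap.id) j).restrictScalars k)
      ?_ hδ ?_ (h1.exact₁ j) he he'
    · intro y
      choose x hx using fun i => hδ' (y i)
      exact ⟨x, funext hx⟩
    · intro x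
      constructor
      · intro hx
        choose y hy using fun i => (hs.exact₁ j (x i)).1 (congrFun hx i)
        exact ⟨y, funext hy⟩
      · rintro ⟨y, rfl⟩
        exact funext fun i => (hs.exact₁ j _).2 ⟨y i, rfl⟩

/-- The trivial module of a Hopf algebra. -/
def Triv (k : Type u) (_H : Type u) : Type u := k

noncomputable instance : AddCommGroup (Triv k H) := inferInstanceAs (AddCommGroup k)

noncomputable instance : Module k (Triv k H) := inferInstanceAs (Module k k)

noncomputable instance : Module H (Triv k H) :=
  Module.compHom k (Bialgebra.counitAlgHom k H).toRingHom

lemma Triv.smul_def (h : H) (x : Triv k H) : h • x = counit (R := k) h • x := rfl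

instance : IsScalarTower k H (Triv k H) := ⟨fun c h x => by
  rw [Triv.smul_def, Triv.smul_def, map_smul, smul_assoc]⟩

instance : Module.Finite k (Triv k H) := inferInstanceAs (Module.Finite k k)

instance : Module.Finite H (Triv k H) := Module.Finite.of_restrictScalars_finite k H _

/-- Scalar multiplication by the trivial module. -/
noncomputable def Triv.act (k H M : Type u) [Field k] [AddCommGroup M] [Module k M] :
    Triv k H →ₗ[k] M →ₗ[k] M := LinearMap.lsmul k M

lemma Triv.act_balanced (M : Type u) [AddCommGroup M] [Module k M] [Module H M]
    [IsScalarTower k H M] (h : H) (n : Triv k H) (m : M) :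
    h • Triv.act k H M n m =
      ∑ i ∈ (ℛ k h).index, Triv.act k H M ((ℛ k h).left i • n) ((ℛ k h).right i • m) := by
  change h • ((show k from n) • m) = ∑ i ∈ _,
    (counit (R := k) ((ℛ k h).left i) * (show k from n)) • _ • m
  conv_lhs => rw [← sum_counit_smul (R := k) (ℛ k h), Finset.sum_smul]
  refine Finset.sum_congr rfl fun i _ => ?_
  rw [smul_assoc, smul_comm _ (show k from n), smul_smul]

/-- The identification `k ⊗ M ≃ M`. -/
noncomputable def Diag.trivEquiv (M : Type u) [AddCommGroup M] [Module k M] [Module H M]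
    [IsScalarTower k H M] : Diag k H (Triv k H) M ≃ₗ[H] M :=
  LinearEquiv.ofBijective (Diag.lift M (Triv.act k H M) (Triv.act_balanced M)) (by
    have : Function.Bijective (TensorProduct.lid k M) := LinearEquiv.bijective _
    exact this)

lemma Diag.trivEquiv_tmul (n : Triv k H) (m : M) :
    Diag.trivEquiv M (Diag.tmul k H n m) = (show k from n) • m :=
  Diag.lift_tmul M (Triv.act k H M) (Triv.act_balanced M) n m

/-- For finite-dimensional modules, `Ext(M, H)` is a sum of copies of `Ext(k, H)`. -/
theorem exists_ext_equiv [IsNoetherianRing H] (M : Type u) [AddCommGroup M] [Module k M]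
    [Module H M] [IsScalarTower k H M] [Module.Finite k M] (j : ℕ) :
    Nonempty ((Fin (Module.finrank k M) → ExtA H (Triv k H) j) ≃ₗ[k] ExtA H M j) := by
  obtain ⟨e⟩ := Diag.exists_ext_equiv (H := H) (Module.finBasis k M) j (Triv k H)
  exact ⟨e ≪≫ₗ ((ExtA.mapEquiv (Diag.trivEquiv (k := k) (H := H) M) j).restrictScalars k).symm⟩

/-- `Ext(-, H)` turns inclusions of finite-dimensional modules into surjections. -/
theorem ExtA.map_surjective_of_finite [IsNoetherianRing H] [Module.Finite k M]
    [Module.Finite k M'] (g : M →ₗ[H] M') (hg : Function.Injective g) (j : ℕ) :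
    Function.Surjective (ExtA.map g j) := by
  have h := Diag.map_surjective (H := H) (Module.finBasis k M) (Module.finBasis k M') g hg j
    (Triv k H)
  have h1 : g ∘ₗ (Diag.trivEquiv (k := k) M).toLinearMap =
      (Diag.trivEquiv (k := k) M').toLinearMap ∘ₗ Diag.map LinearMap.id g :=
    Diag.hom_ext fun n m => by
      simp only [LinearMap.comp_apply, Diag.map_tmul, LinearEquiv.coe_coe, Diag.trivEquiv_tmul,
        LinearMap.id_apply]
      exact LinearMap.map_smul (g.restrictScalars k) (show k from n) m
  intro y
  obtain ⟨x, hx⟩ := h (ExtA.mapEquiv (Diag.trivEquiv (k := k) M) j y)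
  obtain ⟨z, rfl⟩ := (ExtA.mapEquiv (Diag.trivEquiv (k := k) M') j).surjective x
  refine ⟨z, (ExtA.mapEquiv (Diag.trivEquiv (k := k) M) j).injective ?_⟩
  rw [← hx]
  change ExtA.map _ j (ExtA.map g j z) = ExtA.map _ j (ExtA.map _ j z)
  rw [← ExtA.map_comp, ← ExtA.map_comp, h1]

end HopfStep

section Commuting

variable {A : Type u} [Ring A] {Z : Type u} [CommRing Z] {N : Type u} [AddCommGroup N] [Module A N]
  [Module Z N] [SMulCommClass A Z N]

/-- A scalar commuting with `A`, as an `A`-linear map. -/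
def zEnd (A N : Type u) [Ring A] [AddCommGroup N] [Module A N] [Module Z N] [SMulCommClass A Z N]
    (z : Z) : N →ₗ[A] N where
  toFun n := z • n
  map_add' := smul_add z
  map_smul' a n := (smul_comm a z n).symm

lemma zEnd_apply (z : Z) (n : N) : zEnd A N z n = z • n := rfl

/-- Scalars commuting with `A` act on `Ext^i (N, A)`. -/
noncomputable instance (priority := 50) ExtA.instModuleEnd (i : ℕ) : Module Z (ExtA A N i) where
  smul z e := ExtA.map (zEnd A N z) i e
  one_smul e := by
    change ExtA.map (zEnd A N 1) i e = e
    rw [show zEnd A N (1 : Z) = LinearMap.id from LinearMap.ext fun n => one_smul Z n, ExtA.map_id]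
  mul_smul a b e := by
    change ExtA.map (zEnd A N (a * b)) i e = ExtA.map (zEnd A N a) i (ExtA.map (zEnd A N b) i e)
    rw [← ExtA.map_comp]
    congr 2
    ext n
    exact (congrArg (· • n) (mul_comm a b)).trans (mul_smul b a n)
  smul_zero z := map_zero (ExtA.map (zEnd A N z) i)
  smul_add z := map_add (ExtA.map (zEnd A N z) i)
  add_smul a b e := by
    change ExtA.map (zEnd A N (a + b)) i e =
      ExtA.map (zEnd A N a) i e + ExtA.map (zEnd A N b) i e
    rw [← ExtA.map_add']
    congr 2
    exact LinearMap.ext fun n => add_smul a b n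
  zero_smul e := by
    change ExtA.map (zEnd A N 0) i e = 0
    rw [show zEnd A N (0 : Z) = 0 from LinearMap.ext fun n => zero_smul Z n, ExtA.map_zero']

lemma ExtA.smul_eq_map {i : ℕ} (z : Z) (e : ExtA A N i) : z • e = ExtA.map (zEnd A N z) i e := rfl

instance ExtA.smulCommClass_end (i : ℕ) : SMulCommClass Aᵐᵒᵖ Z (ExtA A N i) :=
  ⟨fun a z e => (map_smul (ExtA.map (zEnd A N z) i) a e).symm⟩

instance ExtA.isScalarTower_end {k : Type u} [Field k] [Algebra k A] [Algebra k Z] [Module k N]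
    [IsScalarTower k A N] [IsScalarTower k Z N] (i : ℕ) : IsScalarTower k Z (ExtA A N i) :=
  ⟨fun c z e => by
    rw [Algebra.smul_def, mul_smul]
    exact ExtA.map_eq_smul c _ (fun n => by
      rw [zEnd_apply, algebraMap_smul, algebraMap_smul]) i _⟩

/-- Maps compatible with the actions of commuting scalars induce compatible maps. -/
lemma ExtA.map_smul_comm {κ P : Type u} [CommRing κ] [AddCommGroup P] [Module A P] [Module κ P]
    [SMulCommClass A κ P] (z : Z) (c : κ) (g : N →ₗ[A] P) (hg : ∀ n, g (z • n) = c • g n) (i : ℕ)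
    (e : ExtA A P i) : ExtA.map g i (c • e) = z • ExtA.map g i e := by
  rw [ExtA.smul_eq_map, ExtA.smul_eq_map, ← ExtA.map_comp, ← ExtA.map_comp]
  congr 2
  exact LinearMap.ext fun n => (hg n).symm

/-- The action on a quotient by a stable submodule. -/
abbrev quotModule (T : Submodule A N) (hT : ∀ (z : Z) (n : N), n ∈ T → z • n ∈ T) :
    Module Z (N ⧸ T) where
  smul z := T.mapQ T (zEnd A N z) (hT z)
  one_smul := by
    rintro ⟨n⟩
    exact congrArg (Submodule.Quotient.mk (p := T)) (one_smul Z n)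
  mul_smul a b := by
    rintro ⟨n⟩
    exact congrArg (Submodule.Quotient.mk (p := T)) (mul_smul a b n)
  smul_zero z := map_zero _
  smul_add z := map_add _
  add_smul a b := by
    rintro ⟨n⟩
    exact congrArg (Submodule.Quotient.mk (p := T)) (add_smul a b n)
  zero_smul := by
    rintro ⟨n⟩
    exact congrArg (Submodule.Quotient.mk (p := T)) (zero_smul Z n)

/-- The action on a stable submodule. -/
abbrev subModule (T : Submodule A N) (hT : ∀ (z : Z) (n : N), n ∈ T → z • n ∈ T) :
    Module Z T where
  smul z t := ⟨z • (t : N), hT z t t.2⟩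
  one_smul t := Subtype.ext (one_smul Z (t : N))
  mul_smul a b t := Subtype.ext (mul_smul a b (t : N))
  smul_zero z := Subtype.ext (smul_zero z)
  smul_add z s t := Subtype.ext (smul_add z (s : N) t)
  add_smul a b t := Subtype.ext (add_smul a b (t : N))
  zero_smul t := Subtype.ext (zero_smul Z (t : N))

theorem exists_quotient_module (T : Submodule A N) {κ : Type u} [CommRing κ] (π : Z →+* κ)
    (hπ : Function.Surjective π) (hT : ∀ (z : Z) (n : N), n ∈ T → z • n ∈ T)
    (hk : ∀ z, π z = 0 → ∀ n : N, z • n ∈ T) :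
    ∃ (_ : Module κ (N ⧸ T)) (_ : SMulCommClass A κ (N ⧸ T)),
      ∀ (z : Z) (n : N), T.mkQ (z • n) = π z • T.mkQ n := by
  let _ : Module Z (N ⧸ T) := quotModule T hT
  let _ : SMul κ (N ⧸ T) := ⟨fun c y => Function.surjInv hπ c • y⟩
  have h : ∀ (z : Z) (y : N ⧸ T), π z • y = z • y := by
    rintro z ⟨n⟩
    refine (Submodule.Quotient.eq T).2 ?_
    rw [zEnd_apply, zEnd_apply, ← sub_smul]
    refine hk _ ?_ n
    rw [map_sub, Function.surjInv_eq hπ, sub_self]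
  refine ⟨Function.Surjective.moduleLeft π hπ h, ⟨?_⟩, ?_⟩
  · rintro a c ⟨n⟩
    exact congrArg (Submodule.Quotient.mk (p := T)) (smul_comm a (Function.surjInv hπ c) n)
  · intro z n
    exact (h z (T.mkQ n)).symm

end Commuting

section Rank

open Cardinal

variable {Z : Type u} [CommRing Z]

lemma rank_eq_zero_of_killed {X : Type u} [AddCommGroup X] [Module Z X] (h : Z) (h0 : h ≠ 0)
    (hX : ∀ x : X, h • x = 0) : Module.rank Z X = 0 :=
  rank_eq_zero_iff.2 fun x => ⟨h, h0, hX x⟩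

variable [IsDomain Z]

lemma rank_eq_of_killed {X Y : Type u} [AddCommGroup X] [Module Z X] [AddCommGroup Y] [Module Z Y]
    (φ : X →ₗ[Z] Y) (h : Z) (h0 : h ≠ 0) (hk : ∀ x, φ x = 0 → h • x = 0)
    (hc : ∀ y, ∃ x, φ x = h • y) : Module.rank Z X = Module.rank Z Y := by
  have h1 := rank_quotient_add_rank_of_isDomain (LinearMap.ker φ)
  rw [rank_eq_zero_of_killed (X := LinearMap.ker φ) h h0 fun x => Subtype.ext (hk x x.2), add_zero,
    φ.quotKerEquivRange.rank_eq] at h1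
  have h2 := rank_quotient_add_rank_of_isDomain (LinearMap.range φ)
  rw [rank_eq_zero_of_killed (X := Y ⧸ LinearMap.range φ) h h0, zero_add] at h2
  · rw [← h1, h2]
  · rintro ⟨y⟩
    exact (Submodule.Quotient.mk_eq_zero _).2 (LinearMap.mem_range.2 (hc y))

/-- The torsion of a finitely generated module with commuting scalars. -/
theorem exists_torsion {A : Type u} [Ring A] (X : Type u) [AddCommGroup X] [Module A X]
    [IsNoetherian A X] [Module Z X] [SMulCommClass A Z X] :
    ∃ T : Submodule A X, ∃ h : Z, h ≠ 0 ∧ (∀ x ∈ T, h • x = 0) ∧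
      ∀ (z : Z) (x : X), z ≠ 0 → z • x ∈ T → x ∈ T := by
  classical
  let T : Submodule A X :=
    { carrier := {x | ∃ z : Z, z ≠ 0 ∧ z • x = 0}
      zero_mem' := ⟨1, one_ne_zero, smul_zero _⟩
      add_mem' := by
        rintro x y ⟨a, ha, hx⟩ ⟨b, hb, hy⟩
        refine ⟨a * b, mul_ne_zero ha hb, ?_⟩
        rw [smul_add, mul_smul a b y, hy, mul_comm, mul_smul, hx, smul_zero, smul_zero, add_zero]
      smul_mem' := by
        rintro r x ⟨a, ha, hx⟩
        exact ⟨a, ha, by rw [← smul_comm r a x, hx, smul_zero]⟩ }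
  obtain ⟨S, hS⟩ := IsNoetherian.noetherian T
  have hST : ∀ x ∈ S, ∃ z : Z, z ≠ 0 ∧ z • x = 0 := fun x hx => by
    have : x ∈ T := hS ▸ Submodule.subset_span hx
    exact this
  choose! z hz0 hz using hST
  refine ⟨T, ∏ x ∈ S, z x, Finset.prod_ne_zero_iff.2 hz0, fun x hx => ?_, ?_⟩
  · rw [← hS] at hx
    induction hx using Submodule.span_induction with
    | mem x hx =>
      rw [← Finset.prod_erase_mul S z hx, mul_smul, hz x hx, smul_zero]
    | zero => exact smul_zero _
    | add x y _ _ hx hy => rw [smul_add, hx, hy, add_zero]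
    | smul r x _ hx => rw [← smul_comm r _ x, hx, smul_zero]
  · rintro a x ha ⟨b, hb, hx⟩
    exact ⟨b * a, mul_ne_zero hb ha, by rw [mul_smul, hx]⟩

end Rank

section RankFormula

open Cardinal

/-- The ranks of `Ext^i (N, A)` over commuting scalars are given by a shifted sequence. -/
def RankFormula (k A Z : Type u) [Field k] [Ring A] [Algebra k A] [CommRing Z] [Algebra k Z]
    (e : ℕ → ℕ∞) (s : ℕ) : Prop :=
  ∀ (N : Type u) [AddCommGroup N] [Module k N] [Module A N] [IsScalarTower k A N]
    [Module.Finite A N] [Module Z N] [SMulCommClass A Z N] [IsScalarTower k Z N],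
    Module.rank Z N < ℵ₀ →
      (∀ i, toENat (Module.rank Z (ExtA A N i)) = toENat (Module.rank Z N) * e (i + s)) ∧
      ∀ j < s, toENat (Module.rank Z N) * e j = 0

variable {k A : Type u} [Field k] [Ring A] [Algebra k A] [IsNoetherianRing A]
  [Algebra.FiniteType k A]

theorem exists_specialization {Z : Type u} [CommRing Z] [IsDomain Z] [Algebra k Z]
    [Algebra.FiniteType k Z] {D : ℕ} (hD : MultilinearPI k A D) (Q : (κ : Type u) → [CommRing κ] →
      [Algebra k κ] → Prop)
    (hspec : ∀ h : Z, h ≠ 0 → ∃ (κ : Type u) (_ : CommRing κ) (_ : IsDomain κ) (_ : Algebra k κ)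
      (π : Z →ₐ[k] κ) (f : Z), Function.Surjective π ∧ f ≠ 0 ∧ (∀ z, π z = 0 ↔ f ∣ z) ∧ π h ≠ 0 ∧
        Q κ)
    (N : Type u) [AddCommGroup N] [Module k N] [Module A N] [IsScalarTower k A N]
    [Module.Finite A N] [Module Z N] [SMulCommClass A Z N] [IsScalarTower k Z N]
    (hN : Module.rank Z N < ℵ₀) (htf : ∀ (z : Z) (n : N), z • n = 0 → z = 0 ∨ n = 0)
    (h : Z) (h0 : h ≠ 0) :
    ∃ (κ : Type u) (_ : CommRing κ) (_ : IsDomain κ) (_ : Algebra k κ)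
      (π : Z →ₐ[k] κ) (f : Z) (P : Type u) (_ : AddCommGroup P) (_ : Module k P) (_ : Module A P)
      (_ : IsScalarTower k A P) (_ : Module.Finite A P) (_ : Module κ P) (_ : SMulCommClass A κ P)
      (_ : IsScalarTower k κ P) (g : N →ₗ[A] P), IsSES (zEnd A N f) g ∧
      (∀ (z : Z) n, g (z • n) = π z • g n) ∧ Module.rank κ P = Module.rank Z N ∧
      Function.Surjective π ∧ f ≠ 0 ∧ (∀ z, π z = 0 ↔ f ∣ z) ∧ π h ≠ 0 ∧ Q κ := by
  have : IsNoetherianRing Z := Algebra.FiniteType.isNoetherianRing k Z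
  obtain ⟨n, hn⟩ := Cardinal.lt_aleph0.1 hN
  obtain ⟨q, hq0, hq⟩ := exists_le_rank_specialization hD N n hn.ge
  obtain ⟨κ, _, _, _, π, f, hπ, hf0, hf, hπh, hQ⟩ := hspec (h * q) (mul_ne_zero h0 hq0)
  rw [map_mul] at hπh
  have hT : ∀ (z : Z) (n : N), n ∈ LinearMap.range (zEnd A N f) →
      z • n ∈ LinearMap.range (zEnd A N f) := by
    rintro z _ ⟨n, rfl⟩
    exact ⟨z • n, smul_comm f z n⟩
  obtain ⟨_, _, hg⟩ := exists_quotient_module (LinearMap.range (zEnd A N f)) π.toRingHom hπ hT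
    (fun z hz n => by
      obtain ⟨y, rfl⟩ := (hf z).1 hz
      exact ⟨y • n, (mul_smul f y n).symm⟩)
  have htower : IsScalarTower k κ (N ⧸ LinearMap.range (zEnd A N f)) := ⟨by
    intro c x p
    obtain ⟨z, rfl⟩ := hπ x
    obtain ⟨n, rfl⟩ := Submodule.mkQ_surjective _ p
    rw [← map_smul π c z]
    refine (hg (c • z) n).symm.trans ?_
    rw [smul_assoc]
    exact congrArg (c • ·) (hg z n)⟩
  have hs : IsSES (zEnd A N f) (LinearMap.range (zEnd A N f)).mkQ :=
    ⟨fun x y hxy => by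
      have h1 : f • (x - y) = 0 := (smul_sub f x y).trans (sub_eq_zero.2 hxy)
      exact sub_eq_zero.1 ((htf f _ h1).resolve_left hf0),
      Submodule.mkQ_surjective _, LinearMap.exact_map_mkQ_range _⟩
  refine ⟨κ, inferInstance, inferInstance, inferInstance, π, f, _, inferInstance, inferInstance,
    inferInstance, inferInstance, inferInstance, inferInstance, inferInstance, htower,
    (LinearMap.range (zEnd A N f)).mkQ, hs, hg, ?_, hπ, hf0, hf, left_ne_zero_of_mul hπh, hQ⟩
  refine le_antisymm ?_ ?_
  · by_contra! hlt
    have h1 : ((n + 1 : ℕ) : Cardinal) ≤ Module.rank κ (N ⧸ LinearMap.range (zEnd A N f)) := by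
      rw [hn] at hlt
      rw [Nat.cast_succ]
      exact Cardinal.add_one_le_of_lt hlt
    have h2 := rank_specialization_le π.toRingHom f hf hf0 1
      (by rw [map_one]; exact one_ne_zero)
      (fun z x hz hx => by rw [(htf z x hx).resolve_left hz, smul_zero]) 1 one_ne_zero
      (LinearMap.range (zEnd A N f)).mkQ.toAddMonoidHom hg
      (fun y => by
        rw [one_smul]
        exact Submodule.mkQ_surjective _ y) (n + 1) h1
    rw [hn, Nat.cast_le] at h2
    lia
  · rw [hn]
    refine hq κ _ π.toRingHom f hπ hf (right_ne_zero_of_mul hπh) hf0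
      (LinearMap.range (zEnd A N f)).mkQ.toAddMonoidHom hg fun x hx => ?_
    obtain ⟨y, hy⟩ := (hs.exact x).1 hx
    exact ⟨y, hy.symm⟩

theorem RankFormula.step_of_torsionFree [IsNoetherianRing Aᵐᵒᵖ] [Algebra.FiniteType k Aᵐᵒᵖ]
    {D D' : ℕ} (hD : MultilinearPI k A D) (hD' : MultilinearPI k Aᵐᵒᵖ D')
    {Z : Type u} [CommRing Z] [IsDomain Z] [Algebra k Z]
    [Algebra.FiniteType k Z] {e : ℕ → ℕ∞} {s : ℕ}
    (hspec : ∀ h : Z, h ≠ 0 → ∃ (κ : Type u) (_ : CommRing κ) (_ : IsDomain κ) (_ : Algebra k κ)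
      (π : Z →ₐ[k] κ) (f : Z), Function.Surjective π ∧ f ≠ 0 ∧ (∀ z, π z = 0 ↔ f ∣ z) ∧ π h ≠ 0 ∧
        RankFormula k A κ e s)
    (N : Type u) [AddCommGroup N] [Module k N] [Module A N] [IsScalarTower k A N]
    [Module.Finite A N] [Module Z N] [SMulCommClass A Z N] [IsScalarTower k Z N]
    (hN : Module.rank Z N < ℵ₀) (htf : ∀ (z : Z) (n : N), z • n = 0 → z = 0 ∨ n = 0) :
    (∀ i, toENat (Module.rank Z (ExtA A N i)) = toENat (Module.rank Z N) * e (i + (s + 1))) ∧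
      ∀ j < s + 1, toENat (Module.rank Z N) * e j = 0 := by
  have : IsNoetherianRing Z := Algebra.FiniteType.isNoetherianRing k Z
  have hfin : ∀ i, Module.Finite Aᵐᵒᵖ (ExtA A N i) := fun i => ExtA.finite N i
  have hnoe : ∀ i, IsNoetherian Aᵐᵒᵖ (ExtA A N i) := fun i =>
    isNoetherian_of_isNoetherianRing_of_finite _ _
  have htors : ∀ i, ∃ h : Z, h ≠ 0 ∧ ∀ (z : Z) (x : ExtA A N i), z ≠ 0 → z • x = 0 → h • x = 0 := by
    intro i
    obtain ⟨T, h, h0, hT, hT'⟩ := exists_torsion (Z := Z) (A := Aᵐᵒᵖ) (ExtA A N i)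
    exact ⟨h, h0, fun z x hz hx => hT x (hT' z x hz (hx ▸ T.zero_mem))⟩
  choose t ht0 ht using htors
  have key := exists_specialization hD (fun κ _ _ => RankFormula k A κ e s) hspec N hN htf
  constructor
  · intro i
    refine le_antisymm (ENat.forall_natCast_le_iff_le.1 fun n hn => ?_)
      (ENat.forall_natCast_le_iff_le.1 fun n hn => ?_)
    · obtain ⟨q, hq0, hq⟩ := exists_le_rank_specialization hD' (ExtA A N i) n
        (Cardinal.natCast_le_toENat.1 hn)
      obtain ⟨κ, _, _, _, π, f, P, _, _, _, _, _, _, _, _, g, hs, hg, hr, hπ, hf0, hf, hπh, hQ⟩ :=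
        key q hq0
      have h1 := hq κ (ExtA A P (i + 1)) π.toRingHom f hπ hf hπh hf0 (hs.δ i).toAddMonoidHom
        (fun z x => hs.δ_naturality i hs (zEnd A N z) (zEnd A N z) (zEnd A P (π z))
          (LinearMap.ext fun n => smul_comm z f n) (LinearMap.ext fun n => (hg z n).symm) x)
        (fun x hx => by
          obtain ⟨y, hy⟩ := (hs.exact₁ i x).1 hx
          exact ⟨y, hy.symm⟩)
      rw [← Cardinal.natCast_le_toENat, (hQ P (hr ▸ hN)).1, hr] at h1
      rwa [show i + (s + 1) = i + 1 + s by ring]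
    · obtain ⟨κ, _, _, _, π, f, P, _, _, _, _, _, _, _, _, g, hs, hg, hr, hπ, hf0, hf, hπh, hQ⟩ :=
        key (t i * t (i + 1)) (mul_ne_zero (ht0 _) (ht0 _))
      rw [map_mul] at hπh
      rw [show i + (s + 1) = i + 1 + s by ring, ← hr, ← (hQ P (hr ▸ hN)).1,
        Cardinal.natCast_le_toENat] at hn
      refine Cardinal.natCast_le_toENat.2 ?_
      refine rank_specialization_le π.toRingHom f hf hf0 (t i) (left_ne_zero_of_mul hπh) (ht i)
        (π (t (i + 1))) (right_ne_zero_of_mul hπh) (hs.δ i).toAddMonoidHom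
        (fun z x => hs.δ_naturality i hs (zEnd A N z) (zEnd A N z) (zEnd A P (π z))
          (LinearMap.ext fun n => smul_comm z f n) (LinearMap.ext fun n => (hg z n).symm) x)
        (fun y => (hs.exact₃ i _).1 ?_) n hn
      rw [ExtA.map_smul_comm (t (i + 1)) (π (t (i + 1))) g (hg _)]
      exact ht (i + 1) f _ hf0 ((hs.exact₂ (i + 1) _).2 ⟨y, rfl⟩)
  · intro j hj
    obtain ⟨κ, _, _, _, π, f, P, _, _, _, _, _, _, _, _, g, hs, hg, hr, hπ, hf0, hf, hπh, hQ⟩ :=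
      key (t 0) (ht0 0)
    have h1 := hQ P (hr ▸ hN)
    rw [hr] at h1
    rcases Nat.lt_succ_iff_lt_or_eq.1 hj with hj | rfl
    · exact h1.2 j hj
    · have h2 := h1.1 0
      rw [zero_add] at h2
      rw [← h2, Cardinal.toENat_eq_zero]
      refine rank_eq_zero_of_killed (π (t 0)) hπh fun x => hs.map_zero_injective ?_
      rw [ExtA.map_smul_comm (t 0) (π (t 0)) g (hg _), map_zero]
      exact ht 0 f _ hf0 ((hs.exact₂ 0 _).2 ⟨x, rfl⟩)

theorem RankFormula.step [IsNoetherianRing Aᵐᵒᵖ] [Algebra.FiniteType k Aᵐᵒᵖ]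
    {D D' : ℕ} (hD : MultilinearPI k A D) (hD' : MultilinearPI k Aᵐᵒᵖ D')
    {Z : Type u} [CommRing Z] [IsDomain Z] [Algebra k Z]
    [Algebra.FiniteType k Z] {e : ℕ → ℕ∞} {s : ℕ}
    (hspec : ∀ h : Z, h ≠ 0 → ∃ (κ : Type u) (_ : CommRing κ) (_ : IsDomain κ) (_ : Algebra k κ)
      (π : Z →ₐ[k] κ) (f : Z), Function.Surjective π ∧ f ≠ 0 ∧ (∀ z, π z = 0 ↔ f ∣ z) ∧ π h ≠ 0 ∧
        RankFormula k A κ e s) : RankFormula k A Z e (s + 1) := by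
  intro N _ _ _ _ _ _ _ _ hN
  have : IsNoetherian A N := isNoetherian_of_isNoetherianRing_of_finite A N
  obtain ⟨T, h, h0, hT, hT'⟩ := exists_torsion (Z := Z) (A := A) N
  have hst : ∀ (z : Z) (n : N), n ∈ T → z • n ∈ T := fun z n hn =>
    hT' h _ h0 (by rw [smul_comm h z n, hT n hn, smul_zero]; exact T.zero_mem)
  have hst' : ∀ (z : Z), z = 0 → ∀ (n : N), z • n ∈ T := by
    rintro _ rfl n
    rw [zero_smul]
    exact T.zero_mem
  obtain ⟨_, _, hg⟩ := exists_quotient_module T (RingHom.id Z) Function.surjective_id hst hst'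
  have hg' : ∀ (z : Z) (n : N), T.mkQ (z • n) = z • T.mkQ n := hg
  let _ : Module Z T := subModule T hst
  have : SMulCommClass A Z T := ⟨fun a z t => Subtype.ext (smul_comm a z (t : N))⟩
  have htower : IsScalarTower k Z (N ⧸ T) := ⟨by
    intro c z p
    obtain ⟨n, rfl⟩ := T.mkQ_surjective p
    rw [← hg', smul_assoc, ← hg']
    rfl⟩
  have hs : IsSES T.subtype T.mkQ := ⟨T.injective_subtype, T.mkQ_surjective,
    LinearMap.exact_subtype_mkQ T⟩
  have hTE : ∀ i (x : ExtA A T i), h • x = 0 := fun i x => by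
    rw [ExtA.smul_eq_map, show zEnd A T h = 0 from LinearMap.ext fun t => Subtype.ext (hT t t.2),
      ExtA.map_zero']
  have hrN : Module.rank Z N = Module.rank Z (N ⧸ T) :=
    rank_eq_of_killed { T.mkQ.toAddMonoidHom with map_smul' := hg' } h h0
      (fun x hx => hT x ((Submodule.Quotient.mk_eq_zero T).1 hx))
      (fun y => T.mkQ_surjective (h • y))
  have hrE : ∀ i, Module.rank Z (ExtA A (N ⧸ T) i) = Module.rank Z (ExtA A N i) := by
    intro i
    have hsm : ∀ (z : Z) (x : ExtA A (N ⧸ T) i),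
        ExtA.map T.mkQ i (z • x) = z • ExtA.map T.mkQ i x :=
      fun z x => ExtA.map_smul_comm z z T.mkQ (hg' z) i x
    refine rank_eq_of_killed { (ExtA.map T.mkQ i).toAddMonoidHom with map_smul' := hsm } h h0
      (fun x hx => ?_) (fun y => ?_)
    · cases i with
      | zero =>
        have : x = 0 := hs.map_zero_injective (hx.trans (map_zero _).symm)
        rw [this, smul_zero]
      | succ i =>
        obtain ⟨y, rfl⟩ := (hs.exact₃ i x).1 hx
        have h1 := hs.δ_naturality i hs (zEnd A T h) (zEnd A N h) (zEnd A (N ⧸ T) h)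
          rfl (LinearMap.ext fun n => (hg' h n).symm) y
        change hs.δ i (h • y) = h • hs.δ i y at h1
        rw [← h1, hTE, map_zero]
    · refine (hs.exact₂ i (h • y)).1 ?_
      have h1 : ExtA.map T.subtype i (h • y) = h • ExtA.map T.subtype i y :=
        ExtA.map_smul_comm h h T.subtype (fun _ => rfl) i y
      rw [h1, hTE]
  have htf : ∀ (z : Z) (n : N ⧸ T), z • n = 0 → z = 0 ∨ n = 0 := by
    intro z n hz
    obtain ⟨n, rfl⟩ := T.mkQ_surjective n
    rw [← hg'] at hz
    by_cases hz0 : z = 0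
    · exact Or.inl hz0
    · exact Or.inr ((Submodule.Quotient.mk_eq_zero T).2
        (hT' z n hz0 ((Submodule.Quotient.mk_eq_zero T).1 hz)))
  have h3 := RankFormula.step_of_torsionFree hD hD' hspec (N ⧸ T) (hrN ▸ hN) htf
  rw [← hrN] at h3
  refine ⟨fun i => ?_, h3.2⟩
  rw [← hrE]
  exact h3.1 i

end RankFormula

section HopfRank

open Cardinal

variable (k : Type u) [Field k] (H : Type u) [Ring H] [HopfAlgebra k H]

/-- The dimension of `Ext^j (k, H)` for the trivial module `k`. -/
noncomputable def trivExtRank (j : ℕ) : ℕ∞ := toENat (Module.rank k (ExtA H (Triv k H) j))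

variable {k H}

lemma ENat.eq_of_natCast_mul {a : ℕ} (ha : a ≠ 0) {b c : ℕ∞} (h : (a : ℕ∞) * b = a * c) : b = c :=
  (ENat.mul_right_strictMono (by exact_mod_cast ha) (ENat.natCast_ne_top a)).injective h

theorem toENat_rank_ext [IsNoetherianRing H] (M : Type u) [AddCommGroup M] [Module k M]
    [Module H M] [IsScalarTower k H M] [Module.Finite k M] (j : ℕ) :
    toENat (Module.rank k (ExtA H M j)) = toENat (Module.rank k M) * trivExtRank k H j := by
  obtain ⟨e⟩ := exists_ext_equiv (k := k) (H := H) M j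
  rw [← e.rank_eq, rank_fun_eq_lift_mul, map_mul, Cardinal.toENat_lift, Fintype.card_fin,
    Module.finrank_eq_rank]
  rfl

theorem RankFormula.of_finite [IsNoetherianRing H] (κ : Type u) [CommRing κ] [IsDomain κ]
    [Algebra k κ] [Module.Finite k κ] : RankFormula k H κ (trivExtRank k H) 0 := by
  intro N _ _ _ _ _ _ _ _ hN
  refine ⟨fun i => ?_, fun j hj => absurd hj (Nat.not_lt_zero j)⟩
  let _ : Field κ := fieldOfFiniteDimensional k κ
  have : Module.Finite κ N := Module.rank_lt_aleph0_iff.1 hN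
  have : Module.Finite k N := Module.Finite.trans κ N
  have h1 := toENat_rank_ext (k := k) (H := H) N i
  rw [← rank_mul_rank k κ N, ← rank_mul_rank k κ (ExtA H N i), map_mul, map_mul, mul_assoc,
    ← Module.finrank_eq_rank k κ, map_natCast] at h1
  exact ENat.eq_of_natCast_mul Module.finrank_pos.ne' h1

theorem rankFormula_mvPolynomial [IsNoetherianRing H] [IsNoetherianRing Hᵐᵒᵖ]
    [Algebra.FiniteType k H] [Algebra.FiniteType k Hᵐᵒᵖ]
    {D D' : ℕ} (hD : MultilinearPI k H D) (hD' : MultilinearPI k Hᵐᵒᵖ D') (s : ℕ) :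
    RankFormula k H (MvPolynomial (Fin s) k) (trivExtRank k H) s := by
  induction s with
  | zero =>
    have : Module.Finite k (MvPolynomial (Fin 0) k) :=
      Module.Finite.equiv (MvPolynomial.isEmptyAlgEquiv k (Fin 0)).symm.toLinearEquiv
    exact RankFormula.of_finite _
  | succ s ih =>
    refine RankFormula.step hD hD' fun h h0 => ?_
    cases s with
    | zero =>
      let E := MvPolynomial.uniqueAlgEquiv k (Fin 1)
      have hp : E h ≠ 0 := (map_ne_zero_iff E E.injective).2 h0
      have hu : ¬ IsUnit (1 + Polynomial.X * E h) := by
        intro hu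
        have h1 := Polynomial.natDegree_eq_zero_of_isUnit hu
        have h2 : (Polynomial.X * E h).natDegree = (E h).natDegree + 1 :=
          Polynomial.natDegree_X_mul hp
        have h3 : (1 + Polynomial.X * E h).natDegree = (Polynomial.X * E h).natDegree :=
          Polynomial.natDegree_add_eq_right_of_natDegree_lt (by
            rw [Polynomial.natDegree_one, h2]
            exact Nat.succ_pos _)
        lia
      have hne : 1 + Polynomial.X * E h ≠ 0 := by
        intro h1
        have h2 := congrArg (Polynomial.eval 0) h1
        simp at h2
      obtain ⟨g, hg, hgd⟩ := WfDvdMonoid.exists_irreducible_factor hu hne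
      have hgh : ¬ g ∣ E h := fun hd => hg.not_isUnit (isUnit_of_dvd_one
        ((dvd_add_left (hd.mul_left _)).1 hgd))
      have : IsDomain (AdjoinRoot g) := AdjoinRoot.isDomain_of_prime hg.prime
      have : Module.Finite k (AdjoinRoot g) := (AdjoinRoot.powerBasis hg.ne_zero).finite
      refine ⟨AdjoinRoot g, inferInstance, inferInstance, inferInstance,
        (AdjoinRoot.mkₐ g).comp E.toAlgHom, E.symm g,
        (AdjoinRoot.mk_surjective (g := g)).comp E.surjective,
        (map_ne_zero_iff _ E.symm.injective).2 hg.ne_zero, fun z => ?_, fun hz => ?_,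
        RankFormula.of_finite _⟩
      · refine (AdjoinRoot.mk_eq_zero (f := g) (g := E z)).trans ⟨fun hd => ?_, fun hd => ?_⟩
        · simpa using map_dvd E.symm hd
        · simpa using map_dvd E hd
      · exact hgh (AdjoinRoot.mk_eq_zero.1 hz)
    | succ s =>
      let E := MvPolynomial.finSuccEquiv k (s + 1)
      have hp : E h ≠ 0 := (map_ne_zero_iff E E.injective).2 h0
      obtain ⟨a, ha⟩ : ∃ a, ¬ (E h).IsRoot a := by
        by_contra! hc
        exact hp (Polynomial.eq_zero_of_infinite_isRoot _
          ((Set.eq_univ_of_forall hc : {x | (E h).IsRoot x} = _) ▸ Set.infinite_univ))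
      refine ⟨MvPolynomial (Fin (s + 1)) k, inferInstance, inferInstance, inferInstance,
        ((Polynomial.aeval (R := MvPolynomial (Fin (s + 1)) k) a).restrictScalars k).comp
          E.toAlgHom, E.symm (Polynomial.X - Polynomial.C a), fun x => ?_,
        (map_ne_zero_iff _ E.symm.injective).2 (Polynomial.X_sub_C_ne_zero a), fun z => ?_,
        fun hz => ha ?_, ih⟩
      · refine ⟨E.symm (Polynomial.C x), ?_⟩
        change Polynomial.aeval a (E (E.symm (Polynomial.C x))) = x
        rw [AlgEquiv.apply_symm_apply, Polynomial.aeval_C]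
        rfl
      · change Polynomial.aeval a (E z) = 0 ↔ _
        rw [Polynomial.coe_aeval_eq_eval]
        refine (Polynomial.dvd_iff_isRoot (p := E z) (a := a)).symm.trans
          ⟨fun hd => ?_, fun hd => ?_⟩
        · simpa using map_dvd E.symm hd
        · simpa using map_dvd E hd
      · change Polynomial.aeval a (E h) = 0 at hz
        rwa [Polynomial.coe_aeval_eq_eval] at hz

end HopfRank

section Dimension

open Cardinal

variable {k H : Type u} [Field k] [Ring H] [Algebra k H]

theorem exists_type_hom [IsNoetherianRing H] [Algebra.FiniteType k H] [Nontrivial H] {D : ℕ}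
    (hD : MultilinearPI k H D) :
    ∃ N : Submodule H H, N ≠ ⊥ ∧ ∃ (s : ℕ) (_ : Module (MvPolynomial (Fin s) k) N)
      (_ : IsType k H (MvPolynomial (Fin s) k) N) (_ : SMulCommClass H (MvPolynomial (Fin s) k) N),
      Module.rank (MvPolynomial (Fin s) k) (ExtA H N 0) < ℵ₀ ∧
      Module.rank (MvPolynomial (Fin s) k) (ExtA H N 0) ≠ 0 := by
  obtain ⟨N, hN, s, φ, hc, ⟨g, e, he⟩, htf⟩ := exists_central_type hD H
  let _ : Module (MvPolynomial (Fin s) k) N := centralModule φ.toRingHom N le_rfl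
  have hB : ∀ z h (b : N), φ.toRingHom z = Ideal.Quotient.mk _ h → z • b = h • b :=
    fun z h b hz => centralModule_smul φ.toRingHom N le_rfl z h b hz
  have : Module.Finite H N := Module.Finite.of_fg (IsNoetherian.noetherian N)
  have hsc := smulCommClass_of_central φ.toRingHom hc hB
  have htf' : ∀ (z : MvPolynomial (Fin s) k) (n : N), z • n = 0 → z = 0 ∨ n = 0 := by
    intro z n hzn
    obtain ⟨h, hh⟩ := Ideal.Quotient.mk_surjective (φ z)
    rw [hB z h _ hh.symm] at hzn
    exact htf z h n hh.symm hzn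
  refine ⟨N, hN, s, inferInstance, ⟨hsc, ⟨?_⟩, htf', ?_⟩, hsc, ?_, ?_⟩
  · intro c z n
    obtain ⟨h, hh⟩ := Ideal.Quotient.mk_surjective (φ z)
    rw [hB z h _ hh.symm, hB (c • z) (c • h), smul_assoc]
    change φ (c • z) = Ideal.Quotient.mkₐ k _ (c • h)
    rw [map_smul, map_smul, ← hh]
    rfl
  · exact (BC.finite_iff (K := FractionRing (MvPolynomial (Fin s) k))).1
      (finite_BC_of_central φ.toRingHom he hB)
  · obtain ⟨r, n, hn⟩ := Module.Finite.exists_fin (R := H) (M := N)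
    let P := Module.annihilator H N
    let B : Submodule H H :=
      { carrier := {b | ∀ p ∈ P, p * b = 0}
        add_mem' := fun ha hb p hp => by rw [mul_add, ha p hp, hb p hp, add_zero]
        zero_mem' := fun p _ => mul_zero p
        smul_mem' := fun h b hb p hp => by
          rw [smul_eq_mul, ← mul_assoc]
          exact hb _ (Ideal.mul_mem_right _ _ hp) }
    have hPB : P ≤ Module.annihilator H B := fun p hp => Module.mem_annihilator.2 fun b =>
      Subtype.ext (b.2 p hp)
    let _ : Module (MvPolynomial (Fin s) k) B := centralModule φ.toRingHom B hPB
    have hB' : ∀ z h (b : B), φ.toRingHom z = Ideal.Quotient.mk _ h → z • b = h • b :=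
      fun z h b hz => centralModule_smul φ.toRingHom B hPB z h b hz
    have : Module.Finite H B := Module.Finite.of_fg (IsNoetherian.noetherian B)
    have hfin := (BC.finite_iff (K := FractionRing (MvPolynomial (Fin s) k))).1
      (finite_BC_of_central (B := Fin r → B) φ.toRingHom he
        (fun z h b hz => funext fun i => hB' z h (b i) hz))
    have hmem : ∀ (f : N →ₗ[H] H) x, f x ∈ B := fun f x p hp => by
      have h1 := congrArg f (Module.mem_annihilator.1 hp x)
      rwa [map_smul, map_zero] at h1
    let F : ExtA H N 0 →ₗ[MvPolynomial (Fin s) k] (Fin r → B) :=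
      { toFun := fun e i => ⟨ExtA.zeroEquiv e (n i), hmem _ _⟩
        map_add' := fun a b => by
          funext i
          apply Subtype.ext
          change ExtA.zeroEquiv (a + b) (n i) = _
          rw [map_add]
          rfl
        map_smul' := fun z a => by
          funext i
          obtain ⟨h, hh⟩ := Ideal.Quotient.mk_surjective (φ z)
          rw [RingHom.id_apply, Pi.smul_apply, hB' z h _ hh.symm]
          apply Subtype.ext
          change ExtA.zeroEquiv (z • a) (n i) = h • ExtA.zeroEquiv a (n i)
          rw [ExtA.smul_eq_map, ExtA.zeroEquiv_map, LinearMap.comp_apply, zEnd_apply,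
            hB z h _ hh.symm, LinearMap.map_smul] }
    refine (LinearMap.rank_le_of_injective F fun a b hab => ?_).trans_lt hfin
    apply ExtA.zeroEquiv.injective
    refine LinearMap.ext_on_range hn fun i => ?_
    exact congrArg Subtype.val (congrFun hab i)
  · intro h0
    obtain ⟨z, hz, hz'⟩ := rank_eq_zero_iff.1 h0 (ExtA.zeroEquiv.symm N.subtype)
    rw [ExtA.smul_eq_map, ExtA.map_zeroEquiv_symm, LinearEquiv.map_eq_zero_iff] at hz'
    refine hN (eq_bot_iff.2 fun x hx => ?_)
    have h1 := LinearMap.congr_fun hz' ⟨x, hx⟩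
    have h2 : z • (⟨x, hx⟩ : N) = 0 := Subtype.ext h1
    exact congrArg Subtype.val ((htf' _ _ h2).resolve_left hz)

lemma IsType.rank_ne_zero {Z N : Type u} [CommRing Z] [Algebra k Z] [Nontrivial Z]
    [AddCommGroup N] [Module k N] [Module H N] [Module Z N] [Nontrivial N]
    (h : IsType k H Z N) : Module.rank Z N ≠ 0 := by
  intro h0
  obtain ⟨n, hn⟩ := exists_ne (0 : N)
  obtain ⟨z, hz, hz'⟩ := rank_eq_zero_iff.1 h0 n
  exact (h.torsionFree z n hz').elim hz hn

/-- The homological data of an algebra of dual dimension `d`. -/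
structure HasDualDim (k A : Type u) [Field k] [Ring A] [Algebra k A] (e : ℕ → ℕ∞) (d : ℕ) : Prop where
  rankFormula : ∀ s, RankFormula k A (MvPolynomial (Fin s) k) e s
  ne_zero : e d ≠ 0
  ne_top : e d ≠ ⊤
  growthLT : ∀ (M : Type u) [AddCommGroup M] [Module A M] [Module k M] [IsScalarTower k A M]
    [Module.Finite A M], GrowthLT k A M (d + 1)
  growthGE : GrowthGE k A A d

lemma HasDualDim.unique {e e' : ℕ → ℕ∞} {d d' : ℕ} (h : HasDualDim k H e d)
    (h' : HasDualDim k H e' d') : d = d' :=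
  le_antisymm (Nat.lt_succ_iff.1 (h.growthGE.le (h'.growthLT H)))
    (Nat.lt_succ_iff.1 (h'.growthGE.le (h.growthLT H)))

theorem exists_hasDualDim [IsNoetherianRing H] [Algebra.FiniteType k H] [Nontrivial H] {D : ℕ}
    (hD : MultilinearPI k H D) (e : ℕ → ℕ∞)
    (he : ∀ s, RankFormula k H (MvPolynomial (Fin s) k) e s) :
    ∃ d, HasDualDim k H e d ∧ ∀ j < d, e j = 0 := by
  obtain ⟨N, hN, s, _, hT, _, h1, h2⟩ := exists_type_hom hD
  have : Module.Finite H N := Module.Finite.of_fg (IsNoetherian.noetherian N)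
  have : Nontrivial N := Submodule.nontrivial_iff_ne_bot.2 hN
  have := hT.tower
  obtain ⟨h3, h4⟩ := he s N hT.rank_lt
  have h5 : toENat (Module.rank (MvPolynomial (Fin s) k) N) ≠ 0 :=
    fun h => hT.rank_ne_zero (toENat_eq_zero.1 h)
  have h6 := h3 0
  rw [zero_add] at h6
  have hs0 : e s ≠ 0 := fun h => by
    rw [h, mul_zero, toENat_eq_zero] at h6
    exact h2 h6
  have hst : e s ≠ ⊤ := fun h => by
    rw [h, ENat.mul_top h5] at h6
    exact (toENat_lt_top.2 h1).ne h6
  refine ⟨s, ⟨he, hs0, hst, fun M _ _ _ _ _ => ?_, ?_⟩, fun j hj => ?_⟩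
  · refine devissage hD (fun M [AddCommGroup M] [Module H M] [Module k M] [IsScalarTower k H M] =>
      GrowthLT k H M (s + 1)) (fun M _ _ _ _ _ => growthLT_of_subsingleton _)
      (fun M _ _ _ _ _ _ t _ ht => ?_)
      (fun M' M M'' _ _ _ _ _ _ _ _ _ _ _ _ _ _ _ f g hf hg hfg h h' =>
        GrowthLT.of_extension hD f g hf hg hfg h h') M
    refine ht.growthLT.mono ?_
    by_contra! hlt
    have := ht.smulComm
    have := ht.tower
    have h7 := (he t M ht.rank_lt).2 s (by lia)
    exact (mul_eq_zero.1 h7).elim (fun h => ht.rank_ne_zero (toENat_eq_zero.1 h)) hs0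
  · exact hT.growthGE.of_injective N.subtype N.injective_subtype
  · exact (mul_eq_zero.1 (h4 j hj)).resolve_left h5

end Dimension

section Embedding

/-- Vanishing of `Ext (M, A)` in degrees `≥ p`. -/
def ExtVanish (A : Type u) [Ring A] (M : Type u) [AddCommGroup M] [Module A M] (p : ℕ) : Prop :=
  ∀ i, p ≤ i → Subsingleton (ExtA A M i)

lemma ExtVanish.cokernel {A : Type u} [Ring A] {G P X : Type u} [AddCommGroup G] [Module A G]
    [AddCommGroup P] [Module A P] [AddCommGroup X] [Module A X] [Module.Projective A P]
    {f : G →ₗ[A] P} {g : P →ₗ[A] X} (h : IsSES f g) {p : ℕ} (hG : ExtVanish A G p) :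
    ExtVanish A X (p + 1) := by
  rintro (_ | i) hi
  · lia
  · have := hG i (by lia)
    have := ExtA.subsingleton_of_projective (A := A) (M := P) i
    refine subsingleton_of_forall_eq 0 fun x => ?_
    obtain ⟨y, rfl⟩ := (h.exact₃ i x).1 (Subsingleton.elim _ _)
    rw [Subsingleton.elim y 0, map_zero]

variable {A : Type u} [Ring A]

/-- The dual of a finite free module. -/
noncomputable def dualFree (n : ℕ) : ExtA A (Fin n → A) 0 ≃ₗ[Aᵐᵒᵖ] (Fin n → Aᵐᵒᵖ) :=
  ExtA.zeroEquiv.trans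
    { toFun := fun f i => MulOpposite.op (f (Pi.single i 1))
      map_add' := fun _ _ => rfl
      map_smul' := fun _ _ => rfl
      invFun := fun c =>
        { toFun := fun x => ∑ i, x i * (c i).unop
          map_add' := fun x y => by simp only [Pi.add_apply, add_mul, Finset.sum_add_distrib]
          map_smul' := fun a x => by
            simp only [Pi.smul_apply, smul_eq_mul, mul_assoc, Finset.mul_sum, RingHom.id_apply] }
      left_inv := fun f => by
        refine LinearMap.pi_ext' fun i => LinearMap.ext_ring ?_
        simp [Pi.single_apply, ite_mul]
      right_inv := fun c => by
        funext i
        simp [Pi.single_apply, ite_mul] }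

instance projective_dualFree (n : ℕ) : Module.Projective Aᵐᵒᵖ (ExtA A (Fin n → A) 0) :=
  Module.Projective.of_equiv (dualFree n).symm

instance finite_dualFree (n : ℕ) : Module.Finite Aᵐᵒᵖ (ExtA A (Fin n → A) 0) :=
  Module.Finite.equiv (dualFree n).symm

variable [IsNoetherianRing A] 

theorem exists_embedding_of_quotient {Ω G X : Type u} [AddCommGroup Ω] [Module A Ω]
    [Module.Finite A Ω] [AddCommGroup G] [Module Aᵐᵒᵖ G] [AddCommGroup X] [Module Aᵐᵒᵖ X]
    {ι : G →ₗ[Aᵐᵒᵖ] ExtA A Ω 0} {q : ExtA A Ω 0 →ₗ[Aᵐᵒᵖ] X} (h : IsSES ι q) {p : ℕ}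
    (hG : ExtVanish Aᵐᵒᵖ G p) :
    ∃ (C : Type u) (_ : AddCommGroup C) (_ : Module Aᵐᵒᵖ C) (f : X →ₗ[Aᵐᵒᵖ] C),
      Module.Finite Aᵐᵒᵖ C ∧ Function.Injective f ∧ ExtVanish Aᵐᵒᵖ C (p + 1) := by
  obtain ⟨n, π, hπ, -⟩ := exists_syzygy (A := A) Ω
  have hj : Function.Injective (ExtA.map π 0) := (IsSES.of_ker hπ).map_zero_injective
  let ι' := ExtA.map π 0 ∘ₗ ι
  have hι' : Function.Injective ι' := hj.comp h.inj
  have hker : LinearMap.ker q = LinearMap.range ι := LinearMap.exact_iff.1 h.exact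
  have hle : LinearMap.ker q ≤ LinearMap.ker ((LinearMap.range ι').mkQ ∘ₗ ExtA.map π 0) := by
    rw [hker]
    rintro _ ⟨g, rfl⟩
    rw [LinearMap.mem_ker, LinearMap.comp_apply, Submodule.mkQ_apply, Submodule.Quotient.mk_eq_zero]
    exact ⟨g, rfl⟩
  refine ⟨_ ⧸ LinearMap.range ι', inferInstance, inferInstance,
    (LinearMap.ker q).liftQ ((LinearMap.range ι').mkQ ∘ₗ ExtA.map π 0) hle ∘ₗ
      (q.quotKerEquivOfSurjective h.surj).symm.toLinearMap, inferInstance, ?_,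
      ExtVanish.cokernel (IsSES.of_range hι') hG⟩
  rw [LinearMap.coe_comp, LinearEquiv.coe_coe]
  refine Function.Injective.comp ?_ (LinearEquiv.injective _)
  rw [← LinearMap.ker_eq_bot, Submodule.ker_liftQ_eq_bot _ _ _ ?_]
  intro x hx
  rw [LinearMap.mem_ker, LinearMap.comp_apply, Submodule.mkQ_apply,
    Submodule.Quotient.mk_eq_zero] at hx
  obtain ⟨g, hg⟩ := hx
  rw [hker]
  exact ⟨g, hj hg⟩

theorem exists_embedding_succ (n : ℕ) : ∀ {Ω : Type u} [AddCommGroup Ω] [Module A Ω]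
    [Module.Finite A Ω] {p : ℕ} (_ : ∀ m, 1 ≤ m → m ≤ n → Subsingleton (ExtA A Ω m))
    (_ : ExtVanish Aᵐᵒᵖ (ExtA A Ω 0) p),
    ∃ (C : Type u) (_ : AddCommGroup C) (_ : Module Aᵐᵒᵖ C) (f : ExtA A Ω (n + 1) →ₗ[Aᵐᵒᵖ] C),
      Module.Finite Aᵐᵒᵖ C ∧ Function.Injective f ∧ ExtVanish Aᵐᵒᵖ C (p + n + 2) := by
  induction n with
  | zero =>
    intro Ω _ _ _ p _ h0
    obtain ⟨r, π, hπ, hfin⟩ := exists_syzygy (A := A) Ω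
    have hS := IsSES.of_ker hπ
    let R := LinearMap.range (ExtA.map (LinearMap.ker π).subtype 0)
    have h1 : IsSES (ExtA.map π 0) (ExtA.map (LinearMap.ker π).subtype 0).rangeRestrict :=
      ⟨hS.map_zero_injective, LinearMap.surjective_rangeRestrict _, fun x => by
        rw [← hS.exact₂ 0 x]
        exact Subtype.ext_iff⟩
    have h2 : IsSES R.subtype (hS.δ 0) :=
      ⟨R.injective_subtype, fun x => (hS.exact₃ 0 x).1
          (@Subsingleton.elim _ (ExtA.subsingleton_of_projective (A := A) (M := Fin r → A) 0) _ _),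
        fun x => by
          rw [hS.exact₁ 0 x]
          simp [R]⟩
    exact exists_embedding_of_quotient h2 (ExtVanish.cokernel h1 h0)
  | succ n ih =>
    intro Ω _ _ _ p hm h0
    obtain ⟨r, π, hπ, hfin⟩ := exists_syzygy (A := A) Ω
    have hS := IsSES.of_ker hπ
    have hP := fun i => ExtA.subsingleton_of_projective (A := A) (M := Fin r → A) i
    have h1 : IsSES (ExtA.map π 0) (ExtA.map (LinearMap.ker π).subtype 0) :=
      ⟨hS.map_zero_injective, fun x => (hS.exact₁ 0 x).1
        (@Subsingleton.elim _ (hm 1 le_rfl (by lia)) _ _), hS.exact₂ 0⟩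
    have h2 : ∀ i, Function.Injective (hS.δ (i + 1)) := fun i => by
      rw [injective_iff_map_eq_zero]
      intro x hx
      obtain ⟨y, rfl⟩ := (hS.exact₁ (i + 1) x).1 hx
      rw [@Subsingleton.elim _ (hP i) y 0, map_zero]
    have h3 : Function.Surjective (hS.δ (n + 1)) := fun x =>
      (hS.exact₃ (n + 1) x).1 (@Subsingleton.elim _ (hP (n + 1)) _ _)
    obtain ⟨C, _, _, f, hC, hf, hv⟩ := ih (Ω := LinearMap.ker π) (p := p + 1)
      (fun m h1 h2' => by
        obtain ⟨m, rfl⟩ := Nat.exists_eq_add_of_le' h1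
        have := hm (m + 2) (by lia) (by lia)
        exact (h2 m).subsingleton) (ExtVanish.cokernel h1 h0)
    refine ⟨C, inferInstance, inferInstance,
      f ∘ₗ (LinearEquiv.ofBijective (hS.δ (n + 1)) ⟨h2 n, h3⟩).symm.toLinearMap, hC, ?_, ?_⟩
    · exact hf.comp (LinearEquiv.injective _)
    · rwa [show p + (n + 1) + 2 = p + 1 + n + 2 by lia]

theorem exists_embedding {Ω : Type u} [AddCommGroup Ω] [Module A Ω] [Module.Finite A Ω] (d : ℕ)
    (hd : ∀ j < d, Subsingleton (ExtA A Ω j)) :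
    ∃ (C : Type u) (_ : AddCommGroup C) (_ : Module Aᵐᵒᵖ C) (f : ExtA A Ω d →ₗ[Aᵐᵒᵖ] C),
      Module.Finite Aᵐᵒᵖ C ∧ Function.Injective f ∧ ExtVanish Aᵐᵒᵖ C (d + 1) := by
  cases d with
  | zero =>
    exact exists_embedding_of_quotient (ι := (⊥ : Submodule Aᵐᵒᵖ (ExtA A Ω 0)).subtype)
      (q := LinearMap.id) (X := ExtA A Ω 0)
      ⟨Submodule.injective_subtype _, Function.surjective_id, fun x => by simp⟩
      (fun i _ => ExtA.subsingleton i)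
  | succ n =>
    have h0 := hd 0 n.succ_pos
    obtain h := exists_embedding_succ n (Ω := Ω) (p := 0) (fun m _ h => hd m (by lia))
      (fun i _ => ExtA.subsingleton i)
    rwa [Nat.zero_add] at h

end Embedding

section OpHopf

open Coalgebra TensorProduct MulOpposite

variable {k H : Type u} [Field k] [Ring H] [HopfAlgebra k H]

/-- The antipode as an isomorphism onto the opposite algebra. -/
noncomputable def antipodeEquiv (hS : Function.Bijective (HopfAlgebra.antipode k : H →ₗ[k] H)) :
    H ≃ₐ[k] Hᵐᵒᵖ :=
  AlgEquiv.ofLinearEquiv ((LinearEquiv.ofBijective _ hS).trans (opLinearEquiv k))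
    (by simp) (fun a b => by
      simp [HopfAlgebra.antipode_mul_antidistrib])

lemma tensor_op_mul (x y : H ⊗[k] H) :
    TensorProduct.map (opLinearEquiv k : H ≃ₗ[k] Hᵐᵒᵖ).toLinearMap
      (opLinearEquiv k : H ≃ₗ[k] Hᵐᵒᵖ).toLinearMap (x * y) =
    TensorProduct.map (opLinearEquiv k : H ≃ₗ[k] Hᵐᵒᵖ).toLinearMap
      (opLinearEquiv k : H ≃ₗ[k] Hᵐᵒᵖ).toLinearMap y *
    TensorProduct.map (opLinearEquiv k : H ≃ₗ[k] Hᵐᵒᵖ).toLinearMap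
      (opLinearEquiv k : H ≃ₗ[k] Hᵐᵒᵖ).toLinearMap x := by
  induction x with
  | zero => simp
  | add x x' hx hx' => rw [add_mul, map_add, hx, hx', map_add, mul_add]
  | tmul a b =>
    induction y with
    | zero => simp
    | add x x' hx hx' => rw [mul_add, map_add, hx, hx', map_add, add_mul]
    | tmul c d => simp [Algebra.TensorProduct.tmul_mul_tmul]

/-- The opposite bialgebra. -/
noncomputable abbrev opBialgebra : Bialgebra k Hᵐᵒᵖ :=
  Bialgebra.mk' k Hᵐᵒᵖ (by simp [MulOpposite.counit_def])
    (fun {a b} => by simp [MulOpposite.counit_def, mul_comm])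
    (by simp [MulOpposite.comul_def, Algebra.TensorProduct.one_def])
    (fun {a b} => by
      change TensorProduct.map _ _ (comul (R := k) (b.unop * a.unop)) = _
      rw [Bialgebra.comul_mul, tensor_op_mul]
      rfl)

/-- The antipode of the opposite Hopf algebra. -/
noncomputable def opAntipode (hS : Function.Bijective (HopfAlgebra.antipode k : H →ₗ[k] H)) :
    Hᵐᵒᵖ →ₗ[k] Hᵐᵒᵖ :=
  (opLinearEquiv k).toLinearMap ∘ₗ
    (LinearEquiv.ofBijective _ hS).symm.toLinearMap ∘ₗ (opLinearEquiv k).symm.toLinearMap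

lemma antipode_opAntipode (hS : Function.Bijective (HopfAlgebra.antipode k : H →ₗ[k] H))
    (a : Hᵐᵒᵖ) : HopfAlgebra.antipode k (opAntipode hS a).unop = a.unop :=
  LinearEquiv.apply_symm_apply (LinearEquiv.ofBijective _ hS) a.unop

lemma opAntipode_bijective (hS : Function.Bijective (HopfAlgebra.antipode k : H →ₗ[k] H)) :
    Function.Bijective (opAntipode hS) :=
  (((opLinearEquiv k).symm.trans (LinearEquiv.ofBijective _ hS).symm).trans
    (opLinearEquiv k)).bijective

/-- The opposite Hopf algebra of a Hopf algebra with bijective antipode. -/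
noncomputable abbrev opHopf (hS : Function.Bijective (HopfAlgebra.antipode k : H →ₗ[k] H)) :
    HopfAlgebra k Hᵐᵒᵖ :=
  { opBialgebra with
    antipode := opAntipode hS
    mul_antipode_rTensor_comul := by
      refine LinearMap.ext fun a => unop_injective (hS.1 ?_)
      have key : ∀ t : H ⊗[k] H, HopfAlgebra.antipode k (LinearMap.mul' k Hᵐᵒᵖ
          ((opAntipode hS).rTensor Hᵐᵒᵖ (TensorProduct.map (opLinearEquiv k).toLinearMap
            (opLinearEquiv k).toLinearMap t))).unop =
          LinearMap.mul' k H ((HopfAlgebra.antipode k).lTensor H t) := by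
        intro t
        induction t with
        | zero => simp
        | add x y hx hy => simp only [map_add, MulOpposite.unop_add, hx, hy]
        | tmul x y => simp [HopfAlgebra.antipode_mul_antidistrib, antipode_opAntipode]
      refine (key (comul a.unop)).trans ((LinearMap.congr_fun
        (HopfAlgebra.mul_antipode_lTensor_comul (R := k) (A := H)) a.unop).trans ?_)
      simp [MulOpposite.counit_def, Algebra.algebraMap_eq_smul_one]
    mul_antipode_lTensor_comul := by
      refine LinearMap.ext fun a => unop_injective (hS.1 ?_)
      have key : ∀ t : H ⊗[k] H, HopfAlgebra.antipode k (LinearMap.mul' k Hᵐᵒᵖ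
          ((opAntipode hS).lTensor Hᵐᵒᵖ (TensorProduct.map (opLinearEquiv k).toLinearMap
            (opLinearEquiv k).toLinearMap t))).unop =
          LinearMap.mul' k H ((HopfAlgebra.antipode k).rTensor H t) := by
        intro t
        induction t with
        | zero => simp
        | add x y hx hy => simp only [map_add, MulOpposite.unop_add, hx, hy]
        | tmul x y => simp [HopfAlgebra.antipode_mul_antidistrib, antipode_opAntipode]
      refine (key (comul a.unop)).trans ((LinearMap.congr_fun
        (HopfAlgebra.mul_antipode_rTensor_comul (R := k) (A := H)) a.unop).trans ?_)
      simp [MulOpposite.counit_def, Algebra.algebraMap_eq_smul_one] }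

end OpHopf

section OpVanish

open Cardinal

variable {k H : Type u} [Field k] [Ring H] [HopfAlgebra k H]

lemma trivExtRank_eq_zero {j : ℕ} :
    trivExtRank k H j = 0 ↔ Subsingleton (ExtA H (Triv k H) j) := by
  rw [trivExtRank, toENat_eq_zero, rank_zero_iff]

theorem trivExtRank_op_eq_zero [IsNoetherianRing H] [IsNoetherianRing Hᵐᵒᵖ]
    (hS : Function.Bijective (HopfAlgebra.antipode k : H →ₗ[k] H)) {D : ℕ}
    (hD : MultilinearPI k Hᵐᵒᵖ D) {d : ℕ} (hd : ∀ j < d, trivExtRank k H j = 0)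
    (h0 : trivExtRank k H d ≠ 0) (ht : trivExtRank k H d ≠ ⊤) :
    let _ : HopfAlgebra k Hᵐᵒᵖ := opHopf hS
    ∀ j, d < j → trivExtRank k Hᵐᵒᵖ j = 0 := by
  intro _ j hj
  obtain ⟨C, _, _, f, hC, hf, hv⟩ := exists_embedding (Ω := Triv k H) d
    fun j hj => trivExtRank_eq_zero.1 (hd j hj)
  let _ : Module k C := Module.compHom C (algebraMap k Hᵐᵒᵖ)
  have : IsScalarTower k Hᵐᵒᵖ C := ⟨fun c a x => by
    rw [Algebra.smul_def, mul_smul]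
    rfl⟩
  let X := ExtA H (Triv k H) d
  have hfin : Module.Finite k X := by
    rw [← Module.rank_lt_aleph0_iff, ← toENat_lt_top]
    exact lt_top_iff_ne_top.2 ht
  have hnt : Nontrivial X := not_subsingleton_iff_nontrivial.1 fun h => h0 (trivExtRank_eq_zero.2 h)
  have : Module.Finite k (LinearMap.range f) :=
    Module.Finite.of_surjective (f.restrictScalars k).rangeRestrict
      (LinearMap.surjective_rangeRestrict _)
  obtain ⟨Y, hY, hYf⟩ := exists_cofinite_disjoint (k := k) hD (LinearMap.range f)
  have hg : Function.Injective (Y.mkQ ∘ₗ f) := by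
    rw [injective_iff_map_eq_zero]
    intro x hx
    rw [LinearMap.comp_apply, Submodule.mkQ_apply, Submodule.Quotient.mk_eq_zero] at hx
    have : f x ∈ Y ⊓ LinearMap.range f := ⟨hx, x, rfl⟩
    rw [hY, Submodule.mem_bot] at this
    exact (injective_iff_map_eq_zero f).1 hf x this
  have hs := ExtA.map_surjective_of_finite (k := k) (Y.mkQ ∘ₗ f) hg j
  have hz : Subsingleton (ExtA Hᵐᵒᵖ X j) := by
    refine subsingleton_of_forall_eq 0 fun x => ?_
    obtain ⟨y, rfl⟩ := hs x
    have := hv j hj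
    rw [ExtA.map_comp, Subsingleton.elim (ExtA.map Y.mkQ j y) 0, map_zero]
  obtain ⟨E⟩ := exists_ext_equiv (k := k) (H := Hᵐᵒᵖ) X j
  have := E.toEquiv.subsingleton
  rw [trivExtRank_eq_zero]
  have hp : 0 < Module.finrank k X := Module.finrank_pos
  exact ⟨fun a b => congrFun (Subsingleton.elim
    (fun _ : Fin (Module.finrank k X) => a) fun _ => b) ⟨0, hp⟩⟩

end OpVanish

section ExtTransfer

open Abelian

lemma subsingleton_ext_congr {C : Type u'} [Category.{v} C] [Abelian C] [HasExt.{w} C]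
    {X X' Y Y' : C} (eX : X ≅ X') (eY : Y ≅ Y') {n : ℕ}
    (h : Subsingleton (Ext.{w} X Y n)) : Subsingleton (Ext.{w} X' Y' n) := by
  refine subsingleton_of_forall_eq 0 fun e => ?_
  have h1 : e = extPre eX.inv n (extPost eY.hom n (extPre eX.hom n (extPost eY.inv n e))) := by
    rw [extPre_extPost, ← extPre_comp, eX.inv_hom_id, extPre_id, ← extPost_comp,
      eY.inv_hom_id, extPost_id]
  rw [h1, Subsingleton.elim (extPre eX.hom n (extPost eY.inv n e)) 0, map_zero, map_zero]

lemma subsingleton_ext_iff.{w2} {C : Type u'} [Category.{v} C] [Abelian C] [hC : HasExt.{w} C]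
    [EnoughProjectives C] {D : Type u2} [Category.{u} D] [Abelian D] [hD : HasExt.{w2} D]
    (F : C ⥤ D) [F.Additive] [Limits.PreservesFiniteLimits F] [Limits.PreservesFiniteColimits F]
    [F.Full] [F.Faithful] [F.PreservesProjectiveObjects] {X Y : C} {X' Y' : D}
    (eX : F.obj X ≅ X') (eY : F.obj Y ≅ Y') (n : ℕ) :
    Subsingleton (Ext.{w2} X' Y' n) ↔ Subsingleton (Ext.{w} X Y n) :=
  let E := Equiv.ofBijective _
    (Functor.mapExt_bijective_of_preservesProjectiveObjects.{w, w2} F X Y n)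
  ⟨fun h => E.subsingleton_congr.2 (subsingleton_ext_congr eX.symm eY.symm h),
    fun h => subsingleton_ext_congr eX eY (E.subsingleton_congr.1 h)⟩

attribute [local instance] instHasExtModuleCatOfSmall

variable {A : Type u} [Ring A]

lemma subsingleton_extGroup_iff {M' : Type u} [AddCommGroup M'] [Module A M']
    {M : Type v} [AddCommGroup M] [Module A M] (e : M' ≃ₗ[A] M) (i : ℕ) :
    Subsingleton (ExtGroup A M A i) ↔ Subsingleton (ExtA A M' i) :=
  subsingleton_ext_iff (hC := instHasExtModuleCatOfSmall.{u, u} A)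
    (hD := hasExtModuleCat.{max v u} A) (ModuleCat.uliftFunctor.{max v u, u} A)
    (X := ModuleCat.of A M') (Y := ModuleCat.of A A)
    (((ULift.moduleEquiv.trans e).trans ULift.moduleEquiv.symm).toModuleIso) (Iso.refl _) i

/-- Comparison of the two models of `Ext^i (M, A)`, as right modules. -/
noncomputable def extAEquiv (M : Type u) [AddCommGroup M] [Module A M] (i : ℕ) :
    ExtA A M i ≃ₗ[Aᵐᵒᵖ] ExtGroup A M A i :=
  LinearEquiv.ofBijective (M := ExtA A M i) (M₂ := ExtGroup A M A i)
    { toFun := (Functor.mapExtAddHom.{u, u + 1} (ModuleCat.uliftFunctor.{u, u} A) (ModuleCat.of A M)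
        (ModuleCat.of A A) i : Ext.{u} (ModuleCat.of A M) (ModuleCat.of A A) i →+
          ExtGroup A M A i)
      map_add' := map_add _
      map_smul' := fun a e => by
        refine (Ext.mapExactFunctor_comp _ e _ (add_zero i)).trans ?_
        rw [Ext.mapExactFunctor_mk₀]
        rfl }
    (Functor.mapExt_bijective_of_preservesProjectiveObjects.{u, u + 1} _ (ModuleCat.of A M)
      (ModuleCat.of A A) i)

end ExtTransfer

section AntipodeTransfer

attribute [local instance] instHasExtModuleCatOfSmall

open Abelian

variable {k H : Type u} [Field k] [Ring H] [HopfAlgebra k H]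

lemma trivExtRank_op_iff (hS : Function.Bijective (HopfAlgebra.antipode k : H →ₗ[k] H)) (j : ℕ) :
    let _ : HopfAlgebra k Hᵐᵒᵖ := opHopf hS
    trivExtRank k Hᵐᵒᵖ j = 0 ↔ trivExtRank k H j = 0 := by
  intro _
  rw [trivExtRank_eq_zero, trivExtRank_eq_zero]
  let σ : H ≃+* Hᵐᵒᵖ := (antipodeEquiv hS).toRingEquiv
  let F := (ModuleCat.restrictScalarsEquivalenceOfRingEquiv.{u} σ).functor
  let _ : Module H (Triv k Hᵐᵒᵖ) := Module.compHom (Triv k Hᵐᵒᵖ) σ.toRingHom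
  let eX : F.obj (ModuleCat.of Hᵐᵒᵖ (Triv k Hᵐᵒᵖ)) ≅ ModuleCat.of H (Triv k H) :=
    LinearEquiv.toModuleIso (X₁ := Triv k Hᵐᵒᵖ) (X₂ := Triv k H)
      { toFun := fun x => x
        invFun := fun x => x
        left_inv := fun _ => rfl
        right_inv := fun _ => rfl
        map_add' := fun _ _ => rfl
        map_smul' := fun a x => by
          change Coalgebra.counit (R := k) (HopfAlgebra.antipode k a) • x =
            Coalgebra.counit (R := k) a • x
          rw [HopfAlgebra.counit_antipode] }
  exact (subsingleton_ext_iff (hC := instHasExtModuleCatOfSmall.{u, u} Hᵐᵒᵖ)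
    (hD := instHasExtModuleCatOfSmall.{u, u} H) F eX (ModuleCat.restrictScalarsIsoOfEquiv σ) j).symm

end AntipodeTransfer

section DualData

/-- The homological data of an algebra whose dual of the trivial module sits in degree `d`. -/
def IsDualizing (k A : Type u) [Field k] [Ring A] [Algebra k A] (d : ℕ) : Prop :=
  ∃ e, HasDualDim k A e d ∧ ∀ j, j ≠ d → e j = 0

variable {k H : Type u} [Field k] [Ring H] [HopfAlgebra k H]

theorem hasDualDim_trivExtRank [IsNoetherianRing H] [IsNoetherianRing Hᵐᵒᵖ]
    [Algebra.FiniteType k H]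
    (hS : Function.Bijective (HopfAlgebra.antipode k : H →ₗ[k] H)) {D : ℕ}
    (hD : MultilinearPI k H D) :
    ∃ d, HasDualDim k H (trivExtRank k H) d ∧ ∀ j, j ≠ d → trivExtRank k H j = 0 := by
  have : Algebra.FiniteType k Hᵐᵒᵖ := Algebra.FiniteType.equiv ‹_› (antipodeEquiv hS)
  have hD' : MultilinearPI k Hᵐᵒᵖ D :=
    hD.of_surjective (antipodeEquiv hS).toAlgHom (antipodeEquiv hS).surjective
  have : Nontrivial H := (Bialgebra.counitAlgHom k H).toRingHom.domain_nontrivial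
  obtain ⟨d, h, hd⟩ := exists_hasDualDim hD _ (rankFormula_mvPolynomial hD hD')
  refine ⟨d, h, fun j hj => ?_⟩
  rcases lt_or_gt_of_ne hj with hj | hj
  · exact hd j hj
  · exact (trivExtRank_op_iff hS j).1
      (trivExtRank_op_eq_zero hS hD' hd h.ne_zero h.ne_top j hj)

theorem exists_isDualizing [IsNoetherianRing H] [IsNoetherianRing Hᵐᵒᵖ]
    [Algebra.FiniteType k H]
    (hS : Function.Bijective (HopfAlgebra.antipode k : H →ₗ[k] H)) {D : ℕ}
    (hD : MultilinearPI k H D) :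
    ∃ d, IsDualizing k H d ∧ IsDualizing k Hᵐᵒᵖ d := by
  have : Algebra.FiniteType k Hᵐᵒᵖ := Algebra.FiniteType.equiv ‹_› (antipodeEquiv hS)
  have hD' : MultilinearPI k Hᵐᵒᵖ D :=
    hD.of_surjective (antipodeEquiv hS).toAlgHom (antipodeEquiv hS).surjective
  have : IsNoetherianRing Hᵐᵒᵖᵐᵒᵖ := isNoetherianRing_of_ringEquiv H (RingEquiv.opOp H)
  obtain ⟨d, h, hd⟩ := hasDualDim_trivExtRank hS hD
  let _ : HopfAlgebra k Hᵐᵒᵖ := opHopf hS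
  obtain ⟨d', h', hd'⟩ := hasDualDim_trivExtRank (k := k) (H := Hᵐᵒᵖ)
    (opAntipode_bijective hS) hD'
  have hdd : d' = d := by
    by_contra hne
    exact h'.ne_zero ((trivExtRank_op_iff hS d').2 (hd d' hne))
  subst hdd
  exact ⟨d', ⟨_, h, hd⟩, ⟨_, h', hd'⟩⟩

end DualData

section DualGrowth

open Cardinal

variable {k A : Type u} [Field k] [Ring A] [Algebra k A]

lemma GrowthLT.of_exact [IsNoetherianRing A] [Algebra.FiniteType k A] {D : ℕ}
    (hD : MultilinearPI k A D) {X Y W : Type u} [AddCommGroup X] [Module A X] [Module k X]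
    [IsScalarTower k A X] [AddCommGroup Y] [Module A Y] [Module k Y] [IsScalarTower k A Y]
    [AddCommGroup W] [Module A W] [Module k W] [IsScalarTower k A W] [Module.Finite A Y]
    (f : X →ₗ[A] Y) (g : Y →ₗ[A] W) (h : Function.Exact f g) {n : ℕ}
    (hX : GrowthLT k A X n) (hW : GrowthLT k A W n) : GrowthLT k A Y n := by
  refine GrowthLT.of_extension hD (LinearMap.range f).subtype g.rangeRestrict
    (LinearMap.range f).injective_subtype g.surjective_rangeRestrict (fun y => ?_)
    (hX.of_surjective f.rangeRestrict f.surjective_rangeRestrict)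
    (hW.of_injective (LinearMap.range g).subtype (LinearMap.range g).injective_subtype)
  rw [Submodule.coe_subtype, Subtype.range_coe]
  exact Subtype.ext_iff.trans (h y)

lemma subsingleton_of_exact {X Y W : Type u} [AddCommGroup X] [AddCommGroup Y] [AddCommGroup W]
    [Module A X] [Module A Y] [Module A W] {f : X →ₗ[A] Y} {g : Y →ₗ[A] W}
    (h : Function.Exact f g) [Subsingleton X] [Subsingleton W] : Subsingleton Y := by
  refine subsingleton_of_forall_eq 0 fun y => ?_
  obtain ⟨x, rfl⟩ := (h y).1 (Subsingleton.elim _ _)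
  rw [Subsingleton.elim x 0, map_zero]

lemma IsType.isSES_smul {Z N : Type u} [CommRing Z] [Algebra k Z] [AddCommGroup N]
    [Module k N] [Module A N] [Module Z N] [SMulCommClass A Z N] (h : IsType k A Z N) {z : Z} (hz : z ≠ 0) :
    IsSES (zEnd A N z) (LinearMap.range (zEnd A N z)).mkQ :=
  IsSES.of_range ((injective_iff_map_eq_zero _).2 fun n hn => (h.torsionFree z n hn).resolve_left hz)

variable [IsNoetherianRing A] [IsNoetherianRing Aᵐᵒᵖ]

theorem IsType.exists_dual_torsion {N : Type u} [AddCommGroup N] [Module A N] [Module k N]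
    [IsScalarTower k A N] [Module.Finite A N] [Nontrivial N] {s : ℕ} [Module (MvPolynomial (Fin s) k) N]
    [SMulCommClass A (MvPolynomial (Fin s) k) N]
    (hN : IsType k A (MvPolynomial (Fin s) k) N) {e : ℕ → ℕ∞} {d : ℕ} (hA : HasDualDim k A e d)
    {i : ℕ} (hi : i + s = d) :
    ∃ (T : Submodule Aᵐᵒᵖ (ExtA A N i)) (h : MvPolynomial (Fin s) k)
      (_ : Module (MvPolynomial (Fin s) k) (ExtA A N i ⧸ T)), h ≠ 0 ∧ (∀ x ∈ T, h • x = 0) ∧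
      IsType k Aᵐᵒᵖ (MvPolynomial (Fin s) k) (ExtA A N i ⧸ T) ∧ Nontrivial (ExtA A N i ⧸ T) := by
  have := hN.tower
  have : Module.Finite Aᵐᵒᵖ (ExtA A N i) := ExtA.finite N i
  have : IsNoetherian Aᵐᵒᵖ (ExtA A N i) := isNoetherian_of_isNoetherianRing_of_finite _ _
  have hr := (hA.rankFormula s N hN.rank_lt).1 i
  rw [hi] at hr
  have h0 : Module.rank (MvPolynomial (Fin s) k) (ExtA A N i) ≠ 0 := by
    rw [Ne, ← toENat_eq_zero, hr]
    exact mul_ne_zero (fun h => hN.rank_ne_zero (toENat_eq_zero.1 h)) hA.ne_zero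
  have ht : Module.rank (MvPolynomial (Fin s) k) (ExtA A N i) < ℵ₀ := by
    rw [← toENat_lt_top, hr]
    exact WithTop.mul_lt_top (toENat_lt_top.2 hN.rank_lt) (lt_top_iff_ne_top.2 hA.ne_top)
  obtain ⟨T, h, hh, hT, hT'⟩ := exists_torsion (Z := MvPolynomial (Fin s) k) (A := Aᵐᵒᵖ) (ExtA A N i)
  have hst : ∀ (z : MvPolynomial (Fin s) k) (x : ExtA A N i), x ∈ T → z • x ∈ T := fun z x hx =>
    hT' h _ hh (by rw [smul_comm, hT x hx, smul_zero]; exact T.zero_mem)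
  let _ : Module (MvPolynomial (Fin s) k) (ExtA A N i ⧸ T) := quotModule T hst
  have hq : ∀ (z : MvPolynomial (Fin s) k) (x : ExtA A N i),
    z • (Submodule.Quotient.mk x : ExtA A N i ⧸ T) = Submodule.Quotient.mk (z • x) := fun _ _ => rfl
  refine ⟨T, h, inferInstance, hh, hT, ⟨⟨?_⟩, ⟨?_⟩, ?_, ?_⟩, ?_⟩
  · rintro a z ⟨x⟩
    exact congrArg (Submodule.Quotient.mk (p := T)) (smul_comm a z x)
  · rintro c z ⟨x⟩
    exact congrArg (Submodule.Quotient.mk (p := T)) (smul_assoc c z x)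
  · rintro z ⟨x⟩ hx
    refine or_iff_not_imp_left.2 fun hz => (Submodule.Quotient.mk_eq_zero _).2 (hT' z x hz ?_)
    exact (Submodule.Quotient.mk_eq_zero _).1 hx
  · let φ : ExtA A N i →ₗ[MvPolynomial (Fin s) k] (ExtA A N i ⧸ T) :=
      { toFun := Submodule.Quotient.mk
        map_add' := fun _ _ => rfl
        map_smul' := fun _ _ => rfl }
    exact (LinearMap.rank_le_of_surjective φ (Submodule.mkQ_surjective T)).trans_lt ht
  · refine Submodule.Quotient.nontrivial_iff.2 fun htop => h0 (rank_eq_zero_of_killed h hh fun x => hT x ?_)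
    rw [htop]
    trivial

variable [Algebra.FiniteType k A] [Algebra.FiniteType k Aᵐᵒᵖ] {D D' : ℕ}

theorem growthLT_ext (hD : MultilinearPI k A D) (hD' : MultilinearPI k Aᵐᵒᵖ D') {d : ℕ}
    (hA : IsDualizing k A d) (n : ℕ) (M : Type u) [AddCommGroup M] [Module A M] [Module k M]
    [IsScalarTower k A M] [Module.Finite A M] (hM : GrowthLT k A M n) :
    (∀ i, GrowthLT k Aᵐᵒᵖ (ExtA A M i) (d + 1 - i)) ∧ ∀ i, i + n ≤ d → Subsingleton (ExtA A M i) := by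
  obtain ⟨e, he, hd⟩ := hA
  induction n generalizing M with
  | zero =>
    have := hM.subsingleton
    exact ⟨fun i => have := ExtA.subsingleton (A := A) (M := M) i
      growthLT_of_subsingleton _, fun i _ => ExtA.subsingleton i⟩
  | succ n ih =>
    refine devissage hD (fun M [AddCommGroup M] [Module A M] [Module k M] [IsScalarTower k A M] =>
      GrowthLT k A M (n + 1) → (∀ i, GrowthLT k Aᵐᵒᵖ (ExtA A M i) (d + 1 - i)) ∧
        ∀ i, i + (n + 1) ≤ d → Subsingleton (ExtA A M i)) (fun M _ _ _ _ _ _ => ?_)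
      (fun N _ _ _ _ _ _ s _ hN hg => ?_)
      (fun M' M M'' _ _ _ _ _ _ _ _ _ _ _ _ _ _ _ f g hf hg hfg h h' hM => ?_) M hM
    · exact ⟨fun i => have := ExtA.subsingleton (A := A) (M := M) i
        growthLT_of_subsingleton _, fun i _ => ExtA.subsingleton i⟩
    · have hs : s < n + 1 := hN.growthGE.le hg
      rcases Nat.lt_succ_iff_lt_or_eq.1 hs with hs | rfl
      · obtain ⟨h1, h2⟩ := ih N (hN.growthLT.mono hs)
        exact ⟨h1, fun i hi => h2 i (by lia)⟩
      have := hN.smulComm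
      have := hN.tower
      have hq := fun (z : MvPolynomial (Fin s) k) (hz : z ≠ 0) =>
        ih (N ⧸ LinearMap.range (zEnd A N z)) (hg.quotient_range _ (hN.isSES_smul hz).inj)
      have hinj : ∀ i, i + s ≠ d → ∃ (z : MvPolynomial (Fin s) k) (hz : z ≠ 0),
          Function.Injective ((hN.isSES_smul hz).δ i) := by
        intro i hi
        have : Module.Finite Aᵐᵒᵖ (ExtA A N i) := ExtA.finite N i
        have : IsNoetherian Aᵐᵒᵖ (ExtA A N i) := isNoetherian_of_isNoetherianRing_of_finite _ _
        have hr := (he.rankFormula s N hN.rank_lt).1 i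
        rw [hd _ hi, mul_zero, toENat_eq_zero] at hr
        obtain ⟨T, z, hz, hT, hT'⟩ := exists_torsion (Z := MvPolynomial (Fin s) k) (A := Aᵐᵒᵖ)
          (ExtA A N i)
        refine ⟨z, hz, (injective_iff_map_eq_zero _).2 fun x hx => ?_⟩
        obtain ⟨y, rfl⟩ := ((hN.isSES_smul hz).exact₁ i x).1 hx
        obtain ⟨c, hc, hcy⟩ := rank_eq_zero_iff.1 hr y
        exact hT y (hT' c y hc (by rw [hcy]; exact T.zero_mem))
      refine ⟨fun i => ?_, fun i hi => ?_⟩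
      · by_cases hi : i + s = d
        · obtain ⟨T, z, _, hz, hT, hty, _⟩ := hN.exists_dual_torsion he hi
          have : Module.Finite Aᵐᵒᵖ (ExtA A N i) := ExtA.finite N i
          refine GrowthLT.of_extension hD' T.subtype T.mkQ T.injective_subtype T.mkQ_surjective
            (LinearMap.exact_subtype_mkQ T) ?_ ?_
          · let φ := ExtA.map (LinearMap.range (zEnd A N z)).mkQ i
            have hle : T ≤ LinearMap.range φ := fun x hx =>
              ((hN.isSES_smul hz).exact₂ i x).1 (hT x hx)
            exact (((hq z hz).1 i).of_surjective φ.rangeRestrict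
              φ.surjective_rangeRestrict).of_injective (Submodule.inclusion hle)
              (Submodule.inclusion_injective hle)
          · rw [show d + 1 - i = s + 1 by lia]
            exact hty.growthLT
        · obtain ⟨z, hz, hinj⟩ := hinj i hi
          exact (((hq z hz).1 (i + 1)).mono (by lia)).of_injective _ hinj
      · obtain ⟨z, hz, hinj⟩ := hinj i (by lia)
        have := (hq z hz).2 (i + 1) (by lia)
        exact hinj.subsingleton
    · obtain ⟨h1, h2⟩ := h (hM.of_injective f hf)
      obtain ⟨h3, h4⟩ := h' (hM.of_surjective g hg)
      have hses : IsSES f g := ⟨hf, hg, hfg⟩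
      refine ⟨fun i => ?_, fun i hi => ?_⟩
      · have : Module.Finite Aᵐᵒᵖ (ExtA A M i) := ExtA.finite M i
        exact GrowthLT.of_exact hD' _ _ (hses.exact₂ i) (h3 i) (h1 i)
      · have := h2 i hi
        have := h4 i hi
        exact subsingleton_of_exact (hses.exact₂ i)

theorem growthLT_of_growthLT_ext (hD : MultilinearPI k A D) (hD' : MultilinearPI k Aᵐᵒᵖ D') {d : ℕ}
    (hA : IsDualizing k A d) {s : ℕ} (hs : s ≤ d) (M : Type u) [AddCommGroup M] [Module A M]
    [Module k M] [IsScalarTower k A M] [Module.Finite A M] (hM : GrowthLT k A M (s + 1))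
    (hE : GrowthLT k Aᵐᵒᵖ (ExtA A M (d - s)) s) : GrowthLT k A M s := by
  refine devissage hD (fun M [AddCommGroup M] [Module A M] [Module k M] [IsScalarTower k A M] =>
    GrowthLT k A M (s + 1) → GrowthLT k Aᵐᵒᵖ (ExtA A M (d - s)) s → GrowthLT k A M s)
    (fun M _ _ _ _ _ _ _ => growthLT_of_subsingleton _)
    (fun N _ _ _ _ _ _ t _ hN hg hE => ?_)
    (fun M' M M'' _ _ _ _ _ _ _ _ _ _ _ _ _ _ _ f g hf hg hfg h h' hM hE => ?_) M hM hE
  · have ht : t < s + 1 := hN.growthGE.le hg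
    rcases Nat.lt_succ_iff_lt_or_eq.1 ht with ht | rfl
    · exact hN.growthLT.mono ht
    have := hN.smulComm
    obtain ⟨e, he, hd⟩ := hA
    obtain ⟨T, z, _, hz, hT, hty, _⟩ := hN.exists_dual_torsion he (i := d - t) (by lia)
    have : Module.Finite Aᵐᵒᵖ (ExtA A N (d - t)) := ExtA.finite N _
    exact absurd (hty.growthGE.le (hE.of_surjective T.mkQ T.mkQ_surjective)) (lt_irrefl _)
  · have hses : IsSES f g := ⟨hf, hg, hfg⟩
    have hM' := hM.of_injective f hf
    have hM'' := hM.of_surjective g hg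
    refine GrowthLT.of_extension hD f g hf hg hfg (h hM' ?_) (h' hM'' ?_)
    · have : Module.Finite Aᵐᵒᵖ (ExtA A M' (d - s)) := ExtA.finite M' _
      exact GrowthLT.of_exact hD' _ _ (hses.exact₁ (d - s)) hE
        (((growthLT_ext hD hD' hA _ M'' hM'').1 (d - s + 1)).mono (by lia))
    · refine hE.of_injective (ExtA.map g (d - s)) ?_
      obtain h0 | ⟨j, hj⟩ : d - s = 0 ∨ ∃ j, d - s = j + 1 := by
        rcases d - s with _ | j
        exacts [Or.inl rfl, Or.inr ⟨j, rfl⟩]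
      · rw [h0]
        exact hses.map_zero_injective
      · rw [hj]
        have := (growthLT_ext hD hD' hA _ M' hM').2 j (by lia)
        refine (injective_iff_map_eq_zero _).2 fun x hx => ?_
        obtain ⟨y, rfl⟩ := (hses.exact₃ j x).1 hx
        rw [Subsingleton.elim y 0, map_zero]

end DualGrowth

section InjectiveDimension

open Abelian Module

attribute [local instance] instHasExtModuleCatOfSmall

variable {A : Type u} [Ring A]

lemma baer_of_subsingleton_ext (X : ModuleCat.{u} A)
    (h : ∀ I : Ideal A, Subsingleton (Ext.{u} (ModuleCat.of A (A ⧸ I)) X 1)) : Module.Baer A X := by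
  intro I g
  have hS := (IsSES.of_quotient (A := A) (M := A) I).shortExact
  obtain ⟨φ, hφ⟩ := Ext.contravariant_sequence_exact₁.{u} hS X (Ext.mk₀ (ModuleCat.ofHom g)) rfl
    ((h I).elim _ _)
  obtain ⟨f, rfl⟩ := Ext.homEquiv₀.symm.surjective φ
  have h1 := (Ext.mk₀_comp_mk₀ _ _).symm.trans hφ
  have h2 := Ext.homEquiv₀.symm.injective h1
  exact ⟨f.hom, fun x hx => congrArg (fun l => l.hom ⟨x, hx⟩) h2⟩

/-- Baer's criterion for the injective dimension. -/
lemma hasInjectiveDimensionLT_of_subsingleton_ext (n : ℕ) (X : ModuleCat.{u} A)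
    (h : ∀ I : Ideal A, Subsingleton (Ext.{u} (ModuleCat.of A (A ⧸ I)) X (n + 1))) :
    HasInjectiveDimensionLT X (n + 1) := by
  induction n generalizing X with
  | zero =>
    have := (Module.injective_iff_injective_object A X).1
      (Module.Baer.iff_injective.1 (baer_of_subsingleton_ext X h))
    infer_instance
  | succ n ih =>
    obtain ⟨J, _, f, _⟩ := EnoughInjectives.presentation X
    have hS : (ShortComplex.mk f (Limits.cokernel.π f) (Limits.cokernel.condition f)).ShortExact :=
      { exact := ShortComplex.exact_cokernel f }
    refine (hS.hasInjectiveDimensionLT_X₃_iff n ‹_›).1 (ih _ fun I => ?_)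
    refine subsingleton_of_forall_eq 0 fun x => ?_
    have := h I
    obtain ⟨y, rfl⟩ := Ext.covariant_sequence_exact₃.{u} _ hS x rfl (Subsingleton.elim _ _)
    rw [Ext.eq_zero_of_injective y, Ext.zero_comp]

lemma ExtA.subsingleton_of_forall_ideal {d : ℕ}
    (h : ∀ I : Ideal A, Subsingleton (ExtA A (A ⧸ I) (d + 1))) (M : Type u) [AddCommGroup M]
    [Module A M] (i : ℕ) (hi : d < i) : Subsingleton (ExtA A M i) :=
  have := hasInjectiveDimensionLT_of_subsingleton_ext d (ModuleCat.of A A) h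
  HasInjectiveDimensionLT.subsingleton.{u} (ModuleCat.of A A) (d + 1) i hi (ModuleCat.of A M)

end InjectiveDimension

section SelfInjectiveDimension

variable {k H : Type u} [Field k] [Ring H] [HopfAlgebra k H]

lemma growthLT_triv : GrowthLT k H (Triv k H) 1 := by
  intro V F _ _
  refine ⟨Module.finrank k (Triv k H), fun m _ => ?_⟩
  rw [pow_one, mul_comm]
  exact Nat.mul_le_mul_right _ (Submodule.finrank_le _)

variable [IsNoetherianRing H] [IsNoetherianRing Hᵐᵒᵖ] [Algebra.FiniteType k H] [Algebra.FiniteType k Hᵐᵒᵖ]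
  {D D' d : ℕ}

theorem selfInjectiveDimension_eq (hD : MultilinearPI k H D) (hD' : MultilinearPI k Hᵐᵒᵖ D')
    (hA : IsDualizing k H d) : selfInjectiveDimension H = d := by
  refine le_antisymm (sInf_le ⟨d, rfl, fun M _ _ i hi => ?_⟩) (le_sInf ?_)
  · refine (subsingleton_extGroup_iff (LinearEquiv.refl H M) i).2
      (ExtA.subsingleton_of_forall_ideal (fun I => ?_) M i hi)
    obtain ⟨e, he, -⟩ := id hA
    refine GrowthLT.subsingleton (k := k) (H := Hᵐᵒᵖ) ?_
    simpa using (growthLT_ext hD hD' hA (d + 1) (H ⧸ I) (he.growthLT _)).1 (d + 1)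
  · rintro _ ⟨n, rfl, hn⟩
    by_contra hlt
    have hlt : n < d := by simpa using hlt
    have h1 := (subsingleton_extGroup_iff (LinearEquiv.refl H (Triv k H)) d).1 (hn _ d hlt)
    have h2 := growthLT_of_growthLT_ext hD hD' hA (Nat.zero_le d) (Triv k H) growthLT_triv
      (growthLT_of_subsingleton 0)
    exact not_subsingleton k h2.subsingleton

end SelfInjectiveDimension

section AuslanderCohenMacaulay

variable {k A : Type u} [Field k] [Ring A] [Algebra k A] [IsNoetherianRing A]
  [IsNoetherianRing Aᵐᵒᵖ] [Algebra.FiniteType k A] [Algebra.FiniteType k Aᵐᵒᵖ] {D D' D'' d : ℕ}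

lemma le_moduleGrade {A : Type u} [Ring A] {M' : Type u} [AddCommGroup M'] [Module A M']
    {M : Type v} [AddCommGroup M] [Module A M] (e : M' ≃ₗ[A] M) {i : ℕ}
    (h : ∀ j < i, Subsingleton (ExtA A M' j)) : (i : ℕ∞) ≤ moduleGrade A M := by
  refine le_sInf ?_
  rintro _ ⟨j, rfl, hj⟩
  by_contra hlt
  exact not_subsingleton_iff_nontrivial.2 hj
    ((subsingleton_extGroup_iff e j).2 (h j (by simpa using hlt)))

theorem auslanderCondition_of_isDualizing [IsNoetherianRing Aᵐᵒᵖᵐᵒᵖ]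
    [Algebra.FiniteType k Aᵐᵒᵖᵐᵒᵖ] (hD : MultilinearPI k A D) (hD' : MultilinearPI k Aᵐᵒᵖ D')
    (hD'' : MultilinearPI k Aᵐᵒᵖᵐᵒᵖ D'') (hA : IsDualizing k A d) (hA' : IsDualizing k Aᵐᵒᵖ d) :
    AuslanderCondition A := by
  intro M _ _ hM i N
  let _ : Module k M := Module.compHom M (algebraMap k A)
  have : IsScalarTower k A M := ⟨fun c a m => by
    rw [Algebra.smul_def, mul_smul]
    rfl⟩
  let N' : Submodule Aᵐᵒᵖ (ExtA A M i) :=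
    N.comap (extAEquiv (A := A) M i).toLinearMap
  have hfin : Module.Finite Aᵐᵒᵖ (ExtA A M i) := ExtA.finite M i
  have : Module.Finite Aᵐᵒᵖ N' := Module.Finite.of_fg (IsNoetherian.noetherian N')
  obtain ⟨e, he, -⟩ := id hA
  have hN : GrowthLT k Aᵐᵒᵖ N' (d + 1 - i) :=
    ((growthLT_ext hD hD' hA (d + 1) M (he.growthLT M)).1 i).of_injective N'.subtype
      N'.injective_subtype
  exact le_moduleGrade ((extAEquiv (A := A) M i).ofSubmodule' N) fun j hj =>
    if hid : i ≤ d then (growthLT_ext hD' hD'' hA' _ N' hN).2 j (by omega)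
    else by
      have : Subsingleton N' := by
        rw [Nat.sub_eq_zero_of_le (by omega)] at hN
        exact hN.subsingleton
      exact ExtA.subsingleton j

open ENNReal in
theorem moduleGrade_add_gkDimModule (hD : MultilinearPI k A D) (hD' : MultilinearPI k Aᵐᵒᵖ D')
    (hA : IsDualizing k A d) (M : Type u) [AddCommGroup M] [Module A M] [Module k M]
    [IsScalarTower k A M] [Module.Finite A M] [Nontrivial M] :
    (moduleGrade A M : ℝ≥0∞) + gkDimModule k A M = gkDim k A := by
  obtain ⟨s, hs, hs'⟩ := exists_growth hD M
  obtain ⟨e, he, -⟩ := id hA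
  have hsd : s ≤ d := Nat.lt_succ_iff.1 (hs'.le (he.growthLT M))
  have hgrade : moduleGrade A M = (d - s : ℕ) := by
    refine le_antisymm (sInf_le ⟨_, rfl, not_subsingleton_iff_nontrivial.1 fun h => ?_⟩)
      (le_moduleGrade (LinearEquiv.refl A M) fun j hj =>
        (growthLT_ext hD hD' hA (s + 1) M hs).2 j (by omega))
    have := (subsingleton_extGroup_iff (LinearEquiv.refl A M) _).1 h
    exact lt_irrefl s
      (hs'.le (growthLT_of_growthLT_ext hD hD' hA hsd M hs (growthLT_of_subsingleton s)))
  rw [hgrade, gkDimModule_eq hs hs', gkDim_eq (he.growthLT A) he.growthGE, ENat.toENNReal_coe,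
    ← Nat.cast_add, Nat.sub_add_cancel hsd]

end AuslanderCohenMacaulay

open ENNReal in
theorem affine_noetherian_PI_hopf_is_AuslanderGorenstein_and_CohenMacaulay
    (k : Type u) [Field k] (H : Type u) [Ring H] [HopfAlgebra k H]
    (hS : Function.Bijective (HopfAlgebra.antipode k : H →ₗ[k] H))
    (haff : Algebra.FiniteType k H)
    (hnoeth : IsNoetherianRing H) (hnoeth' : IsNoetherianRing Hᵐᵒᵖ)
    (hPI : SatisfiesPolynomialIdentity k H) :
    -- `H` has finite, and equal, left and right injective dimensions:
    (selfInjectiveDimension H ≠ ⊤ ∧ selfInjectiveDimension Hᵐᵒᵖ ≠ ⊤ ∧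
      selfInjectiveDimension H = selfInjectiveDimension Hᵐᵒᵖ) ∧
    -- the Auslander condition, for noetherian left and right `H`-modules:
    (AuslanderCondition H ∧ AuslanderCondition Hᵐᵒᵖ) ∧
    -- the Cohen-Macaulay condition with respect to Gelfand-Kirillov dimension:
    (∀ (M : Type u) [AddCommGroup M] [Module H M] [Module k M] [IsScalarTower k H M],
      Nontrivial M → IsNoetherian H M →
        (moduleGrade H M : ℝ≥0∞) + gkDimModule k H M = gkDim k H) := by
  obtain ⟨D, hD⟩ := hPI.multilinear
  have : Algebra.FiniteType k Hᵐᵒᵖ := Algebra.FiniteType.equiv ‹_› (antipodeEquiv hS)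
  have : Algebra.FiniteType k Hᵐᵒᵖᵐᵒᵖ := Algebra.FiniteType.equiv haff (AlgEquiv.opOp k H)
  have : IsNoetherianRing Hᵐᵒᵖᵐᵒᵖ := isNoetherianRing_of_ringEquiv H (RingEquiv.opOp H)
  have hD' : MultilinearPI k Hᵐᵒᵖ D :=
    hD.of_surjective (antipodeEquiv hS).toAlgHom (antipodeEquiv hS).surjective
  have hD'' : MultilinearPI k Hᵐᵒᵖᵐᵒᵖ D :=
    hD.of_surjective (AlgEquiv.opOp k H).toAlgHom (AlgEquiv.opOp k H).surjective
  obtain ⟨d, hA, hA'⟩ := exists_isDualizing hS hD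
  have hi := selfInjectiveDimension_eq hD hD' hA
  let _ : HopfAlgebra k Hᵐᵒᵖ := opHopf hS
  have hS' := opAntipode_bijective hS
  have hi' : selfInjectiveDimension Hᵐᵒᵖ = d := selfInjectiveDimension_eq (k := k) hD' hD'' hA'
  obtain ⟨d', hB, hB'⟩ := exists_isDualizing (k := k) (H := Hᵐᵒᵖ) hS' hD'
  have hdd : d' = d := by
    obtain ⟨_, h, -⟩ := hA'
    obtain ⟨_, h', -⟩ := hB
    exact h'.unique h
  subst hdd
  have : IsNoetherianRing Hᵐᵒᵖᵐᵒᵖᵐᵒᵖ := isNoetherianRing_of_ringEquiv Hᵐᵒᵖ (RingEquiv.opOp Hᵐᵒᵖ)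
  have : Algebra.FiniteType k Hᵐᵒᵖᵐᵒᵖᵐᵒᵖ :=
    Algebra.FiniteType.equiv ‹Algebra.FiniteType k Hᵐᵒᵖ› (AlgEquiv.opOp k Hᵐᵒᵖ)
  have hD''' : MultilinearPI k Hᵐᵒᵖᵐᵒᵖᵐᵒᵖ D :=
    hD'.of_surjective (AlgEquiv.opOp k Hᵐᵒᵖ).toAlgHom (AlgEquiv.opOp k Hᵐᵒᵖ).surjective
  refine ⟨⟨hi ▸ ENat.natCast_ne_top d', hi' ▸ ENat.natCast_ne_top d', hi.trans hi'.symm⟩,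
    ⟨auslanderCondition_of_isDualizing hD hD' hD'' hA hA',
      auslanderCondition_of_isDualizing hD' hD'' hD''' hA' hB'⟩, fun M _ _ _ _ _ _ => ?_⟩
  exact moduleGrade_add_gkDimModule hD hD' hA M
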